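/- Let K be an algebraically closed field of characteristic zero, X an algebraic variety over K, Z an irreducible algebraic scheme over K, and φ₁, φ₂ : Z → X rational maps whose restrictions to the reduced scheme Z_red are dominant. Then the following are equivalent: (1) there exist nonempty Zariski open subsets V ⊆ Z and U ⊆ X such that the restrictions φ₁^V, φ₂^V : V → U are dominant regular morphisms and there exist infinitely many hypersurfaces H on U satisfying (φ₁^V)⁻¹(H) = (φ₂^V)⁻¹(H) as closed subschemes of V; (2) there exists a rational function g ∈ K(X) \ K such that g∘φ₁ = g∘φ₂. If moreover Z is reduced, these are also equivalent to: (3) there exist infinitely many hypersurfaces H on X satisfying φ₁*H = φ₂*H. -/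

import Mathlib

/-!
# Theorem 1.1 (main theorem of "Invariant hypersurfaces")

The algebraic variety `X` over the algebraically closed field `K` of characteristic zero is
modelled by an (affine model with) coordinate ring `R`: a finitely generated `K`-algebra
domain.  The irreducible algebraic scheme `Z` (possibly nonreduced) is modelled by a
finitely generated `K`-algebra `S` whose nilradical is prime (= irreducibility of `Spec S`);
`Z_red` has coordinate ring `S/nilradical S`.  The rational maps `φ₁, φ₂ : Z → X` are
modelled (after shrinking `Z`, which affects nothing) by `K`-algebra homomorphisms
`f₁, f₂ : R → S`; dominance of their restrictions to `Z_red` is injectivity of the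
compositions `R → S → S/nilradical S`.

Condition (1): on suitable basic open subsets `V = Spec S_s ⊆ Z` and `U = Spec R_r ⊆ X` to
which the `φᵢ` restrict (this restriction is encoded by ring maps `F₁, F₂` making the
evident squares commute), infinitely many hypersurfaces `H = V(I)` on `U` have equal
scheme-theoretic inverse images `(φᵢ^V)⁻¹(H)`, i.e. the extension ideals of `I` along
`F₁` and `F₂` agree.

Condition (2): a nonconstant `g = a/b ∈ K(X) \ K` with `g∘φ₁ = g∘φ₂` as rational maps on
the irreducible scheme `Z`, i.e. the cross-difference `f₁(a)f₂(b) − f₂(a)f₁(b)` is killed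
by some `u` outside the nilradical (equality on a dense open subscheme of `Z`).

Condition (3) (for reduced `Z`, i.e. `nilradical S = ⊥`): infinitely many hypersurfaces
`H = V(I)` on `X` have equal proper transforms `φ₁*H = φ₂*H`.
-/

/-- A prime ideal `P` of a commutative ring has height one. -/
def HeightOnePrime {R : Type*} [CommRing R] (P : Ideal R) : Prop :=
  P.IsPrime ∧ P ≠ ⊥ ∧ ∀ Q : Ideal R, Q.IsPrime → Q < P → Q = ⊥

/-- `I` is the radical vanishing ideal of a nonempty Zariski closed subset of pure
codimension one. -/
def IsHypersurfaceIdeal {R : Type*} [CommRing R] (I : Ideal R) : Prop :=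
  I.IsRadical ∧ I ≠ ⊤ ∧ ∀ P ∈ I.minimalPrimes, HeightOnePrime P

/-- The vanishing ideal of the proper transform of `V(I)` along the dominant map induced
by `f`. -/
def properTransform {R S : Type*} [CommRing R] [CommRing S] (f : R →+* S) (I : Ideal R) :
    Ideal S :=
  sInf {Q : Ideal S | Q ∈ (I.map f).minimalPrimes ∧ Q.comap f ∈ I.minimalPrimes}

namespace InvHyp

open MvPolynomial

section ValuationSubringBasics

variable {L : Type*} [Field L]

lemma _root_.ValuationSubring.mem_of_isIntegral' {D : Type*} [CommRing D] [Algebra D L]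
    (W : ValuationSubring L) (hD : ∀ d : D, algebraMap D L d ∈ W) {x : L}
    (hx : IsIntegral D x) : x ∈ W := by
  have h1 : IsIntegral W x := by
    obtain ⟨p, hp, h0⟩ := hx
    let f : D →+* W := (algebraMap D L).codRestrict W.toSubring hD
    refine ⟨p.map f, hp.map f, ?_⟩
    rw [Polynomial.eval₂_map]
    exact h0
  obtain ⟨y, hy⟩ := (IsIntegrallyClosed.isIntegral_iff (R := W) (K := L)).mp h1
  exact hy ▸ y.2

lemma valuation_eq_one_of_mem_of_inv_mem {W : ValuationSubring L} {x : L} (hx0 : x ≠ 0)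
    (h : x ∈ W) (h' : x⁻¹ ∈ W) : W.valuation x = 1 := by
  have h1 := (W.valuation_le_one_iff x).mpr h
  have h2 := (W.valuation_le_one_iff _).mpr h'
  rw [map_inv₀] at h2
  have h3 : W.valuation x ≠ 0 := by simpa using hx0
  exact le_antisymm h1 ((inv_le_one₀ (zero_lt_iff.mpr h3)).mp h2)

/-- If every valuation subring containing the image of `D` contains `x`, then `x` is integral. -/
lemma isIntegral_of_forall_valuationSubring {D : Type*} [CommRing D] [Algebra D L] {x : L}
    (h : ∀ W : ValuationSubring L, (∀ d : D, algebraMap D L d ∈ W) → x ∈ W) :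
    IsIntegral D x := by
  have h1 : x ∈ (integralClosure (Subring.closure (Set.range (algebraMap D L))) L).toSubring := by
    rw [← iInf_valuationSubring_superset, Subring.mem_iInf]
    rintro ⟨V, hV⟩
    exact h V fun d => hV ⟨d, rfl⟩
  have h2 : Subring.closure (Set.range (algebraMap D L)) = (algebraMap D L).range := by
    rw [← RingHom.coe_range, Subring.closure_eq]
  have h3 : IsIntegral (algebraMap D L).range x := by
    generalize Subring.closure (Set.range (algebraMap D L)) = T at h1 h2
    subst h2
    exact h1
  obtain ⟨p, hp, h0⟩ := h3
  have hl : p ∈ Polynomial.lifts (algebraMap D L).rangeRestrict := by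
    rw [Polynomial.lifts_iff_coeff_lifts]
    intro n
    exact (algebraMap D L).rangeRestrict_surjective _
  obtain ⟨q, hq, -, hqm⟩ := Polynomial.lifts_and_natDegree_eq_and_monic hl hp
  refine ⟨q, hqm, ?_⟩
  rw [← hq, Polynomial.eval₂_map] at h0
  exact h0

/-- The center of a valuation subring on a ring mapping to it. -/
def center {D : Type*} [CommRing D] [Algebra D L] (W : ValuationSubring L)
    (hD : ∀ d : D, algebraMap D L d ∈ W) : Ideal D :=
  (IsLocalRing.maximalIdeal W).comap ((algebraMap D L).codRestrict W.toSubring hD)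

instance center_isPrime {D : Type*} [CommRing D] [Algebra D L] (W : ValuationSubring L)
    (hD : ∀ d : D, algebraMap D L d ∈ W) : (center W hD).IsPrime := by
  unfold center; infer_instance

lemma mem_center {D : Type*} [CommRing D] [Algebra D L] (W : ValuationSubring L)
    (hD : ∀ d : D, algebraMap D L d ∈ W) (d : D) :
    d ∈ center W hD ↔ W.valuation (algebraMap D L d) < 1 := by
  unfold center
  rw [Ideal.mem_comap]
  exact W.valuation_lt_one_iff _

lemma valuation_eq_one_of_notMem_center {D : Type*} [CommRing D] [Algebra D L]
    (W : ValuationSubring L) (hD : ∀ d : D, algebraMap D L d ∈ W) {d : D}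
    (hd : d ∉ center W hD) : W.valuation (algebraMap D L d) = 1 := by
  rw [mem_center, not_lt] at hd
  exact le_antisymm ((W.valuation_le_one_iff _).mpr (hD d)) hd

lemma exists_eq_div_of_dedekind {B : Type*} [CommRing B] [Algebra B L] [IsFractionRing B L]
    [IsDedekindDomain B] {W₁ : ValuationSubring L} (h₁ : ∀ b : B, algebraMap B L b ∈ W₁)
    {x : L} (hx : x ∈ W₁) :
    ∃ c s : B, s ∉ center W₁ h₁ ∧ x = algebraMap B L c / algebraMap B L s := by
  obtain ⟨a, b, hb, rfl⟩ := IsFractionRing.div_surjective (A := B) x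
  have hb0 : algebraMap B L b ≠ 0 := by
    simpa using nonZeroDivisors.ne_zero hb
  by_cases ha0 : algebraMap B L a = 0
  · exact ⟨0, 1, (Ideal.ne_top_iff_one _).mp (Ideal.IsPrime.ne_top inferInstance), by simp [ha0]⟩
  set q := center W₁ h₁ with hq
  obtain ⟨c, hc⟩ := ValuationRing.cond (algebraMap B (Localization.AtPrime q) a)
    (algebraMap B (Localization.AtPrime q) b)
  obtain ⟨c, s, rfl⟩ := IsLocalization.exists_mk'_eq q.primeCompl c
  have hs0 : algebraMap B L s ≠ 0 := by
    have : (s : B) ≠ 0 := fun h0 => s.2 (h0 ▸ q.zero_mem)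
    simpa using this
  have red : ∀ u v : B, algebraMap B (Localization.AtPrime q) u *
      IsLocalization.mk' (Localization.AtPrime q) c s = algebraMap B _ v → u * c = v * s := by
    intro u v huv
    rw [← IsLocalization.mk'_one (M := q.primeCompl) (Localization.AtPrime q) u,
      ← IsLocalization.mk'_mul, ← IsLocalization.mk'_one (M := q.primeCompl)
      (Localization.AtPrime q) v, IsLocalization.mk'_eq_iff_eq] at huv
    have hinj := IsLocalization.injective (Localization.AtPrime q)
      (q.primeCompl_le_nonZeroDivisors)
    have := hinj huv
    simp only [Submonoid.coe_one, one_mul] at this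
    rw [this, mul_comm]
  rcases hc with hc | hc
  · have e := red _ _ hc
    have e' := congrArg (algebraMap B L) e
    simp only [map_mul] at e'
    by_cases hcq : c ∈ q
    · exfalso
      have hv := (W₁.valuation_le_one_iff _).mpr hx
      have hcv := (mem_center W₁ h₁ c).mp hcq
      have hsv := valuation_eq_one_of_notMem_center W₁ h₁ (d := (s : B)) s.2
      have e2 := congrArg W₁.valuation e'
      rw [map_mul, map_mul, hsv, mul_one] at e2
      rw [map_div₀] at hv
      have hbv : W₁.valuation (algebraMap B L b) ≠ 0 := by simpa using hb0
      have hav : W₁.valuation (algebraMap B L a) ≠ 0 := by simpa using ha0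
      rw [div_le_one₀ (zero_lt_iff.mpr hbv)] at hv
      have : W₁.valuation (algebraMap B L a) * W₁.valuation (algebraMap B L c) <
          W₁.valuation (algebraMap B L a) := by
        calc _ < W₁.valuation (algebraMap B L a) * 1 :=
              mul_lt_mul_of_pos_left hcv (zero_lt_iff.mpr hav)
          _ = _ := mul_one _
      rw [e2] at this
      exact absurd hv (not_le.mpr this)
    · have hc0 : algebraMap B L c ≠ 0 := by
        have : c ≠ 0 := fun h0 => hcq (h0 ▸ q.zero_mem)
        simpa using this
      have : algebraMap B L a / algebraMap B L b = algebraMap B L s / algebraMap B L c := by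
        field_simp
        rw [e']
      exact ⟨_, _, hcq, this⟩
  · have e := red _ _ hc
    have e' := congrArg (algebraMap B L) e
    simp only [map_mul] at e'
    have : algebraMap B L a / algebraMap B L b = algebraMap B L c / algebraMap B L s := by
      field_simp
      rw [← e', mul_comm]
    exact ⟨_, _, s.2, this⟩

lemma mem_of_center_eq {B : Type*} [CommRing B] [Algebra B L] [IsFractionRing B L]
    [IsDedekindDomain B] {W₁ W₂ : ValuationSubring L} (h₁ : ∀ b : B, algebraMap B L b ∈ W₁)
    (h₂ : ∀ b : B, algebraMap B L b ∈ W₂) (h : center W₁ h₁ = center W₂ h₂)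
    {x : L} (hx : x ∈ W₁) : x ∈ W₂ := by
  obtain ⟨c, s, hs, rfl⟩ := exists_eq_div_of_dedekind h₁ hx
  rw [h] at hs
  have := valuation_eq_one_of_notMem_center W₂ h₂ hs
  rw [← W₂.valuation_le_one_iff, map_div₀, this, div_one, W₂.valuation_le_one_iff]
  exact h₂ c

lemma finite_valuationSubring_of_dedekind (D k' : Type*) [CommRing D]
    [IsDedekindDomain D] [Field k'] [Algebra D k'] [IsFractionRing D k'] [Algebra D L]
    [Algebra k' L] [IsScalarTower D k' L] [FiniteDimensional k' L] [Algebra.IsSeparable k' L]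
    {e : L} (he : e ≠ 0) :
    {W : ValuationSubring L | (∀ d : D, algebraMap D L d ∈ W) ∧ W.valuation e ≠ 1}.Finite := by
  let B := integralClosure D L
  have : IsDedekindDomain B := integralClosure.isDedekindDomain D k' L
  have : IsFractionRing B L := integralClosure.isFractionRing_of_finite_extension k' L
  have hB : ∀ W : ValuationSubring L, (∀ d : D, algebraMap D L d ∈ W) →
      ∀ b : B, algebraMap B L b ∈ W := fun W hW b => W.mem_of_isIntegral' hW b.2
  obtain ⟨a, b, hb, rfl⟩ := IsFractionRing.div_surjective (A := B) e
  have hb0 : b ≠ 0 := nonZeroDivisors.ne_zero hb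
  have ha0 : a ≠ 0 := by rintro rfl; simp at he
  set Sset := {W : ValuationSubring L | (∀ d : D, algebraMap D L d ∈ W) ∧
    W.valuation (algebraMap B L a / algebraMap B L b) ≠ 1}
  classical
  let f : ValuationSubring L → Ideal B := fun W =>
    if h : ∀ d : D, algebraMap D L d ∈ W then center W (hB W h) else ⊥
  refine Set.Finite.of_finite_image (f := f) ?_ ?_
  · refine (Ideal.finite_minimalPrimes_of_isNoetherianRing B (Ideal.span {a * b})).subset ?_
    rintro _ ⟨W, ⟨hW, hWe⟩, rfl⟩
    simp only [f, dif_pos hW]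
    have hab : a * b ∈ center W (hB W hW) := by
      by_contra hab
      have ha : a ∉ center W (hB W hW) := fun h => hab (Ideal.mul_mem_right _ _ h)
      have hb : b ∉ center W (hB W hW) := fun h => hab (Ideal.mul_mem_left _ _ h)
      apply hWe
      rw [map_div₀, valuation_eq_one_of_notMem_center W _ ha,
        valuation_eq_one_of_notMem_center W _ hb, div_one]
    refine ⟨⟨inferInstance, by rwa [Ideal.span_singleton_le_iff_mem]⟩, ?_⟩
    rintro J ⟨hJ, hJ'⟩ hle
    rw [Ideal.span_singleton_le_iff_mem] at hJ'
    have hJ0 : J ≠ ⊥ := by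
      rintro rfl
      rw [Ideal.mem_bot] at hJ'
      exact mul_ne_zero ha0 hb0 hJ'
    have := (hJ.isMaximal hJ0).eq_of_le (Ideal.IsPrime.ne_top inferInstance) hle
    exact this.ge
  · rintro W₁ ⟨h₁, -⟩ W₂ ⟨h₂, -⟩ h
    simp only [f, dif_pos h₁, dif_pos h₂] at h
    ext x
    exact ⟨mem_of_center_eq _ _ h, mem_of_center_eq _ _ h.symm⟩

end ValuationSubringBasics

end InvHyp

namespace InvHyp

open MvPolynomial

section Charts

variable (K : Type*) [Field K] {L : Type*} [Field L] [Algebra K L] {ι : Type*}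

/-- The residues of the family `r` are algebraically independent over `K`. -/
def ResIndep (W : ValuationSubring L) (r : ι → L) : Prop :=
  ∀ p : MvPolynomial ι K, p ≠ 0 → W.valuation (aeval r p) = 1

/-- A valuation ring that contains the coordinates `τ` and all but one of them are residually
independent. -/
def ChartGood (τ : ι → L) (W : ValuationSubring L) : Prop :=
  (∀ i, τ i ∈ W) ∧ ∃ j : ι, ResIndep K W (fun l : {l // l ≠ j} => τ l)

variable {K}

lemma ResIndep.algebraMap_mem {W : ValuationSubring L} {r : ι → L} (h : ResIndep K W r) (a : K) :
    algebraMap K L a ∈ W := by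
  by_cases ha : a = 0
  · simp [ha]
  rw [← W.valuation_le_one_iff]
  have := h (C a) (by simpa using ha)
  simpa using this.le

lemma ChartGood.algebraMap_mem {W : ValuationSubring L} {τ : ι → L} (h : ChartGood K τ W)
    (a : K) : algebraMap K L a ∈ W := by
  obtain ⟨-, j, hj⟩ := h
  exact hj.algebraMap_mem a

lemma aeval_mem {W : ValuationSubring L} (hK : ∀ a : K, algebraMap K L a ∈ W) {τ : ι → L}
    (h : ∀ i, τ i ∈ W) (p : MvPolynomial ι K) : aeval τ p ∈ W := by
  induction p using MvPolynomial.induction_on with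
  | C a => simpa using hK a
  | add p q hp hq => rw [map_add]; exact W.add_mem _ _ hp hq
  | mul_X p i hp => rw [map_mul, aeval_X]; exact W.mul_mem _ _ hp (h i)

lemma ChartGood.aeval_mem {W : ValuationSubring L} {τ : ι → L} (h : ChartGood K τ W)
    (p : MvPolynomial ι K) : aeval τ p ∈ W := InvHyp.aeval_mem h.algebraMap_mem h.1 p

lemma ChartGood.mem_adjoin {W : ValuationSubring L} {τ : ι → L} (h : ChartGood K τ W)
    {x : L} (hx : x ∈ Algebra.adjoin K (Set.range τ)) : x ∈ W := by
  rw [Algebra.adjoin_range_eq_range_aeval] at hx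
  obtain ⟨p, rfl⟩ := hx
  exact h.aeval_mem p

/-- Finitely many elements have a common denominator. -/
lemma exists_common_denominator {τ : ι → L} (hτ : IsTranscendenceBasis K τ) (G : Finset L) :
    ∃ d ∈ Algebra.adjoin K (Set.range τ), d ≠ 0 ∧
      ∀ g ∈ G, IsIntegral (Algebra.adjoin K (Set.range τ)) (d * g) := by
  have := hτ.isAlgebraic
  obtain ⟨d, hd, h⟩ := Algebra.IsAlgebraic.exists_integral_multiples
    (Algebra.adjoin K (Set.range τ)) (A := L) G
  refine ⟨d, d.2, by simpa using hd, fun g hg => ?_⟩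
  have := h g hg
  rwa [Algebra.smul_def] at this

lemma exists_common_denominator_good {τ : ι → L} (hτ : IsTranscendenceBasis K τ) (G : Finset L) :
    ∃ d ∈ Algebra.adjoin K (Set.range τ), d ≠ 0 ∧
      ∀ g ∈ G, ∀ W : ValuationSubring L, ChartGood K τ W → d * g ∈ W := by
  obtain ⟨d, hd, hd0, h⟩ := exists_common_denominator hτ G
  exact ⟨d, hd, hd0, fun g hg W hW =>
    W.mem_of_isIntegral' (fun a => hW.mem_adjoin a.2) (h g hg)⟩

section Dedekind

variable [CharZero K] [Algebra.EssFiniteType K L] {τ : ι → L} 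

open IntermediateField in
lemma chart_dedekind_aux (hτ : IsTranscendenceBasis K τ) (j : ι) :
    (∀ e : L, e ≠ 0 → {W : ValuationSubring L | (τ j ∈ W ∧
      ResIndep K W (fun l : {l // l ≠ j} => τ l)) ∧ W.valuation e ≠ 1}.Finite) ∧
    (∃ G : Finset L, ∀ W : ValuationSubring L, τ j ∈ W →
      ResIndep K W (fun l : {l // l ≠ j} => τ l) → (∀ g ∈ G, g ∈ W) ∧
      ∀ T : Subring L, (∀ a : K, algebraMap K L a ∈ T) → (∀ g ∈ G, g ∈ T) → (∀ i, τ i ∈ T) →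
        (∀ s ∈ T, W.valuation s = 1 → s⁻¹ ∈ T) → ∀ x ∈ W, x ∈ T) ∧
    ∀ x : L, (∀ W : ValuationSubring L, τ j ∈ W →
      ResIndep K W (fun l : {l // l ≠ j} => τ l) → x ∈ W) →
      ∃ q : MvPolynomial {l // l ≠ j} K, q ≠ 0 ∧ ∃ p : MvPolynomial ι K,
        aeval (fun l : {l // l ≠ j} => τ l) q *
          (Algebra.trace (IntermediateField.adjoin K (Set.range τ)) L x : L) = aeval τ p := by
  classical
  set τ' : {l : ι // l ≠ j} → L := fun l => τ l with hτ'
  let k : IntermediateField K L := IntermediateField.adjoin K (Set.range τ')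
  let E : IntermediateField K L := IntermediateField.adjoin K (Set.range τ)
  have hkE : k ≤ E := IntermediateField.adjoin.mono _ _ _ (by rintro _ ⟨l, rfl⟩; exact ⟨l, rfl⟩)
  let : Algebra k E := (IntermediateField.inclusion hkE).toRingHom.toAlgebra
  have : IsScalarTower k E L := IsScalarTower.of_algebraMap_eq fun _ => rfl
  have hjE : τ j ∈ E := IntermediateField.subset_adjoin _ _ ⟨j, rfl⟩
  let : Algebra (Polynomial k) E :=
    (Polynomial.aeval (R := k) (⟨τ j, hjE⟩ : E)).toRingHom.toAlgebra
  let : Algebra (Polynomial k) L := (Polynomial.aeval (R := k) (τ j)).toRingHom.toAlgebra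
  have hDL : ∀ p : Polynomial k, algebraMap (Polynomial k) L p = Polynomial.aeval (τ j) p :=
    fun _ => rfl
  have hDE : ∀ p : Polynomial k, ((algebraMap (Polynomial k) E p : E) : L) =
      Polynomial.aeval (τ j) p := by
    intro p
    change algebraMap E L (Polynomial.aeval (⟨τ j, hjE⟩ : E) p) = _
    rw [← Polynomial.aeval_algebraMap_apply]
    rfl
  have : IsScalarTower (Polynomial k) E L := IsScalarTower.of_algebraMap_eq fun p => by
    rw [hDL, ← hDE]; rfl
  have htr : Transcendental k (τ j) := by
    have h1 := ((AlgebraicIndependent.iff_transcendental_adjoin_image j).mp hτ.1).2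
    have h2 : τ '' {j}ᶜ = Set.range τ' := by
      ext x; simp [hτ', Set.mem_image]
    rw [h2] at h1
    exact fun h3 => h1 (IntermediateField.isAlgebraic_adjoin_iff.mp h3)
  have hinj : Function.Injective (algebraMap (Polynomial k) E) := by
    rw [injective_iff_map_eq_zero]
    intro p hp
    have := hDE p
    rw [hp] at this
    by_contra hp0
    exact htr ⟨p, hp0, this.symm⟩
  -- polynomial expressions in `τ` come from `k[X]`
  have hpoly : ∀ r : MvPolynomial ι K, ∃ p : Polynomial k, aeval τ r = Polynomial.aeval (τ j) p := by
    intro r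
    induction r using MvPolynomial.induction_on with
    | C a => exact ⟨Polynomial.C (algebraMap K k a), by simp⟩
    | add p q hp hq =>
      obtain ⟨a, ha⟩ := hp
      obtain ⟨b, hb⟩ := hq
      exact ⟨a + b, by simp [ha, hb]⟩
    | mul_X p i hp =>
      obtain ⟨a, ha⟩ := hp
      by_cases hi : i = j
      · subst hi
        exact ⟨a * Polynomial.X, by simp [ha]⟩
      · exact ⟨a * Polynomial.C ⟨τ i, IntermediateField.subset_adjoin _ _ ⟨⟨i, hi⟩, rfl⟩⟩, by
          simp [ha]⟩
  have hFR : IsFractionRing (Polynomial k) E := by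
    have : FaithfulSMul (Polynomial k) E := (faithfulSMul_iff_algebraMap_injective _ _).mpr hinj
    refine IsFractionRing.of_field (Polynomial k) E ?_
    rintro ⟨z, hz⟩
    obtain ⟨r, s, rfl⟩ := (IntermediateField.mem_adjoin_range_iff _ _ _).mp hz
    obtain ⟨p, hp⟩ := hpoly r
    obtain ⟨q, hq⟩ := hpoly s
    refine ⟨p, q, Subtype.ext ?_⟩
    simp only [IntermediateField.coe_div, hDE, hp, hq]
  have : Algebra.IsAlgebraic E L := hτ.isAlgebraic_field
  have : Algebra.EssFiniteType E L := Algebra.EssFiniteType.of_comp K E L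
  have : FiniteDimensional E L := Algebra.finite_of_essFiniteType_of_isAlgebraic
  have hkW : ∀ W : ValuationSubring L, ResIndep K W τ' → ∀ a : k, (a : L) ∈ W := by
    rintro W hW ⟨a, ha⟩
    obtain ⟨r, s, rfl⟩ := (IntermediateField.mem_adjoin_range_iff _ _ _).mp ha
    have hr : aeval τ' r ∈ W := by
      by_cases hr : r = 0
      · simp [hr]
      · rw [← W.valuation_le_one_iff, hW r hr]
    by_cases hs : s = 0
    · simp [hs]
    rw [← W.valuation_le_one_iff, map_div₀, hW s hs, div_one, W.valuation_le_one_iff]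
    exact hr
  have hDW : ∀ W : ValuationSubring L, τ j ∈ W → ResIndep K W τ' →
      ∀ d : Polynomial k, algebraMap (Polynomial k) L d ∈ W := by
    intro W h1 h2 d
    rw [hDL]
    induction d using Polynomial.induction_on with
    | C a => simpa using hkW W h2 a
    | add p q hp hq => rw [map_add]; exact W.add_mem _ _ hp hq
    | monomial n a h =>
      rw [pow_succ, ← mul_assoc, map_mul, Polynomial.aeval_X]
      exact W.mul_mem _ _ h h1
  refine ⟨?_, ?_, ?_⟩
  · intro e he
    refine (finite_valuationSubring_of_dedekind (Polynomial k) E he).subset ?_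
    rintro W ⟨⟨h1, h2⟩, h3⟩
    exact ⟨hDW W h1 h2, h3⟩
  · let B := integralClosure (Polynomial k) L
    have : IsDedekindDomain B := integralClosure.isDedekindDomain _ E L
    have : IsFractionRing B L := integralClosure.isFractionRing_of_finite_extension E L
    have hfin : Module.Finite (Polynomial k) B := IsIntegralClosure.finite (Polynomial k) E L B
    obtain ⟨G, hG⟩ := hfin
    refine ⟨G.image (fun b : B => (b : L)), fun W h1 h2 => ?_⟩
    have hBW : ∀ b : B, algebraMap B L b ∈ W := fun b => W.mem_of_isIntegral' (hDW W h1 h2) b.2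
    refine ⟨?_, ?_⟩
    · intro g hg
      obtain ⟨b, -, rfl⟩ := Finset.mem_image.mp hg
      exact hBW b
    · intro T hTK hTG hTτ hTi x hx
      have hTr : ∀ r : MvPolynomial {l : ι // l ≠ j} K, aeval τ' r ∈ T := by
        intro r
        induction r using MvPolynomial.induction_on with
        | C a => simpa using hTK a
        | add p q hp hq => rw [map_add]; exact T.add_mem hp hq
        | mul_X p i hp => rw [map_mul, aeval_X]; exact T.mul_mem hp (hTτ _)
      have hTk : ∀ a : k, (a : L) ∈ T := by
        rintro ⟨a, ha⟩
        obtain ⟨r, s, rfl⟩ := (IntermediateField.mem_adjoin_range_iff _ _ _).mp ha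
        by_cases hs : s = 0
        · simp [hs]
        simp only [div_eq_mul_inv]
        exact T.mul_mem (hTr r) (hTi _ (hTr s) (h2 s hs))
      have hTD : ∀ d : Polynomial k, algebraMap (Polynomial k) L d ∈ T := by
        intro d
        rw [hDL]
        induction d using Polynomial.induction_on with
        | C a => simpa using hTk a
        | add p q hp hq => rw [map_add]; exact T.add_mem hp hq
        | monomial n a h =>
          rw [pow_succ, ← mul_assoc, map_mul, Polynomial.aeval_X]
          exact T.mul_mem h (hTτ _)
      have hTB : ∀ b : B, (b : L) ∈ T := by
        intro b
        have hb : b ∈ Submodule.span (Polynomial k) (G : Set B) := hG ▸ Submodule.mem_top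
        induction hb using Submodule.span_induction with
        | mem b hb => exact hTG _ (Finset.mem_image.mpr ⟨b, hb, rfl⟩)
        | zero => simp
        | add a b _ _ ha hb => exact T.add_mem ha hb
        | smul d b _ hb =>
          have : ((d • b : B) : L) = algebraMap (Polynomial k) L d * b := by
            rw [← Algebra.smul_def]; rfl
          rw [this]
          exact T.mul_mem (hTD d) hb
      obtain ⟨c, s, hs, rfl⟩ := exists_eq_div_of_dedekind hBW hx
      rw [div_eq_mul_inv]
      exact T.mul_mem (hTB c) (hTi _ (hTB s) (valuation_eq_one_of_notMem_center W hBW hs))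
  · intro x hx
    have hx' : IsIntegral (Polynomial k) x := by
      refine isIntegral_of_forall_valuationSubring fun W hW => hx W ?_ ?_
      · simpa [hDL] using hW Polynomial.X
      · have hk : ∀ a : k, (a : L) ∈ W := fun a => by simpa [hDL] using hW (Polynomial.C a)
        intro q hq
        have h0 : aeval τ' q ≠ 0 := fun h0 => hq <| by
          refine (hτ.1.comp _ Subtype.val_injective) (?_ : aeval τ' q = aeval τ' 0)
          rw [h0, map_zero]
        have h1 : aeval τ' q ∈ k := by
          have : aeval τ' q ∈ Algebra.adjoin K (Set.range τ') := by
            rw [Algebra.adjoin_range_eq_range_aeval]; exact ⟨q, rfl⟩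
          exact IntermediateField.algebra_adjoin_le_adjoin _ _ this
        exact valuation_eq_one_of_mem_of_inv_mem h0 (hk ⟨_, h1⟩) (hk ⟨_, k.inv_mem h1⟩)
    have hT : IsIntegral (Polynomial k) (Algebra.trace E L x) := Algebra.isIntegral_trace hx'
    obtain ⟨p, hp⟩ := IsIntegrallyClosed.isIntegral_iff.mp hT
    have hclear : ∀ p : Polynomial k, ∃ q : MvPolynomial {l // l ≠ j} K, q ≠ 0 ∧
        ∃ r : MvPolynomial ι K, aeval τ' q * Polynomial.aeval (τ j) p = aeval τ r := by
      have hre : ∀ q : MvPolynomial {l // l ≠ j} K,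
          aeval τ' q = aeval τ (rename Subtype.val q) := by
        intro q; rw [aeval_rename]; rfl
      have hkc : ∀ a : k, ∃ q : MvPolynomial {l // l ≠ j} K, q ≠ 0 ∧
        ∃ r : MvPolynomial ι K, aeval τ' q * (a : L) = aeval τ r := by
        rintro ⟨a, ha⟩
        obtain ⟨r, s, rfl⟩ := (IntermediateField.mem_adjoin_range_iff _ _ _).mp ha
        by_cases hs : aeval τ' s = 0
        · exact ⟨1, one_ne_zero, 0, by simp [hs]⟩
        · refine ⟨s, fun h => hs (by simp [h]), rename Subtype.val r, ?_⟩
          rw [← hre, mul_div_cancel₀ _ hs]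
      intro p
      induction p using Polynomial.induction_on' with
      | add p₁ p₂ h₁ h₂ =>
        obtain ⟨q₁, hq₁, r₁, h₁⟩ := h₁
        obtain ⟨q₂, hq₂, r₂, h₂⟩ := h₂
        refine ⟨q₁ * q₂, mul_ne_zero hq₁ hq₂,
          rename Subtype.val q₂ * r₁ + rename Subtype.val q₁ * r₂, ?_⟩
        simp only [map_mul, map_add, ← h₁, ← h₂, ← hre]
        ring
      | monomial i a =>
        obtain ⟨q, hq, r, h⟩ := hkc a
        refine ⟨q, hq, r * X j ^ i, ?_⟩
        simp only [map_mul, map_pow, aeval_X, ← h, Polynomial.aeval_monomial, mul_assoc]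
        rfl
    obtain ⟨q, hq, r, hr⟩ := hclear p
    refine ⟨q, hq, r, ?_⟩
    rw [← hr, ← hDE, hp]

lemma finite_chartGood [Finite ι] (hτ : IsTranscendenceBasis K τ) {e : L} (he : e ≠ 0) :
    {W : ValuationSubring L | ChartGood K τ W ∧ W.valuation e ≠ 1}.Finite := by
  refine (Set.finite_iUnion fun j => (chart_dedekind_aux hτ j).1 e he).subset ?_
  rintro W ⟨⟨h, j, hj⟩, hW⟩
  exact Set.mem_iUnion.mpr ⟨j, ⟨h j, hj⟩, hW⟩

/-- The chart-good valuation rings are uniformly generated, up to inverting units. -/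
lemma chart_generated [Finite ι] (hτ : IsTranscendenceBasis K τ) :
    ∃ G' : Finset L, ∀ W : ValuationSubring L, ChartGood K τ W → ∃ G ⊆ G', (∀ g ∈ G, g ∈ W) ∧
      ∀ T : Subring L, (∀ a : K, algebraMap K L a ∈ T) → (∀ g ∈ G, g ∈ T) →
        (∀ s ∈ T, W.valuation s = 1 → s⁻¹ ∈ T) → ∀ x ∈ W, x ∈ T := by
  classical
  have := Fintype.ofFinite ι
  choose G hG using fun j => (chart_dedekind_aux hτ j).2.1
  refine ⟨Finset.univ.biUnion G ∪ Finset.univ.image τ, ?_⟩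
  rintro W ⟨h, j, hj⟩
  obtain ⟨h1, h2⟩ := hG j W (h j) hj
  refine ⟨G j ∪ Finset.univ.image τ, Finset.union_subset_union
    (Finset.subset_biUnion_of_mem G (Finset.mem_univ j)) subset_rfl, ?_, ?_⟩
  · intro g hg
    rcases Finset.mem_union.mp hg with hg | hg
    · exact h1 g hg
    · obtain ⟨i, -, rfl⟩ := Finset.mem_image.mp hg
      exact h i
  · intro T hK hT hi
    exact h2 T hK (fun g hg => hT g (Finset.mem_union_left _ hg))
      (fun i => hT _ (Finset.mem_union_right _ (Finset.mem_image_of_mem _ (Finset.mem_univ i)))) hi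

/-- A derivation maps chart-good valuation rings into themselves up to a bounded denominator. -/
lemma exists_derivation_bound [Finite ι] (hτ : IsTranscendenceBasis K τ) (G₀ : Finset L)
    {κ : Type*} [Finite κ] (D : κ → Derivation K L L) :
    ∃ c : L, c ≠ 0 ∧ ∀ W : ValuationSubring L, ChartGood K τ W → c ∈ W ∧ (∀ g ∈ G₀, c * g ∈ W) ∧
      ∀ k, ∀ w ∈ W, c * D k w ∈ W := by
  classical
  have := Fintype.ofFinite κ
  obtain ⟨G', hG'⟩ := chart_generated (K := K) hτ
  obtain ⟨c, hc, hc0, h⟩ := exists_common_denominator_good hτ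
    ((G'.product Finset.univ).image (fun p : L × κ => D p.2 p.1) ∪ G₀)
  refine ⟨c, hc0, fun W hW => ⟨hW.mem_adjoin hc, fun g hg => h g
    (Finset.mem_union_right _ hg) W hW, fun k w hw => ?_⟩⟩
  obtain ⟨G, hGG, hG, hT⟩ := hG' W hW
  let T : Subring L :=
    { carrier := {b | b ∈ W ∧ c * D k b ∈ W}
      mul_mem' := by
        rintro a b ⟨ha, ha'⟩ ⟨hb, hb'⟩
        refine ⟨W.mul_mem _ _ ha hb, ?_⟩
        have : c * D k (a * b) = a * (c * D k b) + b * (c * D k a) := by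
          rw [Derivation.leibniz, smul_eq_mul, smul_eq_mul]; ring
        rw [this]
        exact W.add_mem _ _ (W.mul_mem _ _ ha hb') (W.mul_mem _ _ hb ha')
      one_mem' := ⟨W.one_mem, by simp⟩
      add_mem' := by
        rintro a b ⟨ha, ha'⟩ ⟨hb, hb'⟩
        refine ⟨W.add_mem _ _ ha hb, ?_⟩
        rw [map_add, mul_add]
        exact W.add_mem _ _ ha' hb'
      zero_mem' := ⟨W.zero_mem, by simp⟩
      neg_mem' := by
        rintro a ⟨ha, ha'⟩
        refine ⟨W.neg_mem _ ha, ?_⟩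
        rw [map_neg, mul_neg]
        exact W.neg_mem _ ha' }
  refine (hT T ?_ ?_ ?_ w hw).2
  · intro a
    exact ⟨hW.algebraMap_mem a, by simp⟩
  · intro g hg
    refine ⟨hG g hg, h _ (Finset.mem_union_left _ (Finset.mem_image.mpr
      ⟨(g, k), Finset.mem_product.mpr ⟨hGG hg, Finset.mem_univ _⟩, rfl⟩)) W hW⟩
  · rintro s ⟨hs, hs'⟩ h1
    have hi : s⁻¹ ∈ W := by rw [← W.valuation_le_one_iff, map_inv₀, h1, inv_one]
    refine ⟨hi, ?_⟩
    rw [Derivation.leibniz_inv]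
    have : c * ((-s⁻¹ ^ 2) • D k s) = (-s⁻¹ ^ 2) * (c * D k s) := by
      rw [smul_eq_mul]; ring
    rw [this]
    exact W.mul_mem _ _ (W.neg_mem _ (pow_mem hi 2)) hs'

end Dedekind
end Charts
end InvHyp

namespace InvHyp

open MvPolynomial

section ProjectiveCharts

variable {K : Type*} [Field K] {L : Type*} [Field L] [Algebra K L] {ι : Type*}

open IntermediateField in
/-- A finite family with the same size as a transcendence basis generating (algebraically) all of
its members is a transcendence basis. -/
lemma isTranscendenceBasis_of_adjoin_le [Finite ι] {t t' : ι → L} (ht : IsTranscendenceBasis K t)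
    (h : ∀ i, t i ∈ IntermediateField.adjoin K (Set.range t')) : IsTranscendenceBasis K t' := by
  have hle : IntermediateField.adjoin K (Set.range t) ≤
      IntermediateField.adjoin K (Set.range t') := by
    rw [IntermediateField.adjoin_le_iff]
    rintro _ ⟨i, rfl⟩
    exact h i
  have h1 : Algebra.IsAlgebraic (IntermediateField.adjoin K (Set.range t)) L :=
    ht.isAlgebraic_field
  have h2 : Algebra.IsAlgebraic (IntermediateField.adjoin K (Set.range t')) L := by
    constructor
    intro x
    let := (IntermediateField.inclusion hle).toRingHom.toAlgebra
    have : IsScalarTower (IntermediateField.adjoin K (Set.range t))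
      (IntermediateField.adjoin K (Set.range t')) L := IsScalarTower.of_algebraMap_eq fun _ => rfl
    exact (h1.isAlgebraic x).tower_top _
  have h3 : Algebra.IsAlgebraic (Algebra.adjoin K (Set.range t')) L := by
    constructor
    intro x
    exact IntermediateField.isAlgebraic_adjoin_iff.mp (h2.isAlgebraic x)
  refine Algebra.IsAlgebraic.isTranscendenceBasis_of_lift_le_trdeg_of_finite K t' ?_
  exact ht.lift_cardinalMk_eq_trdeg.le

/-- The affine coordinates `(t l)` (for `none`) or `1 / t i, t l / t i` (for `some i`). -/
def pchart [DecidableEq ι] (t : ι → L) : Option ι → ι → L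
  | none => t
  | some i => fun l => if l = i then (t i)⁻¹ else t l / t i

variable [DecidableEq ι]

@[simp] lemma pchart_none (t : ι → L) : pchart t none = t := rfl

@[simp] lemma pchart_some_self (t : ι → L) (i : ι) : pchart t (some i) i = (t i)⁻¹ := by
  simp [pchart]

lemma pchart_some_of_ne (t : ι → L) {i l : ι} (h : l ≠ i) :
    pchart t (some i) l = t l / t i := by
  simp [pchart, h]

lemma adjoin_pchart (t : ι → L) (ht : ∀ i, t i ≠ 0) (o : Option ι) :
    IntermediateField.adjoin K (Set.range (pchart t o)) =
      IntermediateField.adjoin K (Set.range t) := by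
  cases o with
  | none => rfl
  | some i =>
    have hm : ∀ l, t l ∈ IntermediateField.adjoin K (Set.range t) := fun l =>
      IntermediateField.subset_adjoin _ _ ⟨l, rfl⟩
    have hm' : ∀ l, pchart t (some i) l ∈
      IntermediateField.adjoin K (Set.range (pchart t (some i))) := fun l =>
      IntermediateField.subset_adjoin _ _ ⟨l, rfl⟩
    apply le_antisymm
    · rw [IntermediateField.adjoin_le_iff]
      rintro _ ⟨l, rfl⟩
      by_cases hl : l = i
      · subst hl
        simpa using hm l
      · rw [pchart_some_of_ne t hl]
        exact div_mem (hm l) (hm i)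
    · rw [IntermediateField.adjoin_le_iff]
      have hi : t i ∈ IntermediateField.adjoin K (Set.range (pchart t (some i))) := by
        have := inv_mem (hm' i)
        simpa using this
      rintro _ ⟨l, rfl⟩
      by_cases hl : l = i
      · subst hl; exact hi
      · have := mul_mem (hm' l) hi
        rwa [pchart_some_of_ne t hl, div_mul_cancel₀ _ (ht i)] at this

lemma isTranscendenceBasis_pchart [Finite ι] {t : ι → L} (ht : IsTranscendenceBasis K t)
    (o : Option ι) : IsTranscendenceBasis K (pchart t o) := by
  refine isTranscendenceBasis_of_adjoin_le ht fun i => ?_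
  rw [adjoin_pchart t (fun i => ht.1.ne_zero i) o]
  exact IntermediateField.subset_adjoin _ _ ⟨i, rfl⟩

lemma exists_homogenization {t : ι → L} (i : ι) (hti : t i ≠ 0) (p : MvPolynomial ι K) :
    ∃ (c : ℕ) (P : MvPolynomial ι K), P.totalDegree ≤ c ∧
      aeval (pchart t (some i)) p * t i ^ c = aeval t P := by
  induction p using MvPolynomial.induction_on with
  | C a => exact ⟨0, C a, by simp, by simp⟩
  | add p q hp hq =>
    obtain ⟨a, P, hP, hp⟩ := hp
    obtain ⟨b, Q, hQ, hq⟩ := hq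
    refine ⟨a + b, P * X i ^ b + Q * X i ^ a, ?_, ?_⟩
    · refine (totalDegree_add _ _).trans (max_le ?_ ?_)
      · refine (totalDegree_mul _ _).trans (add_le_add hP (by simp))
      · refine (totalDegree_mul _ _).trans ((add_le_add hQ (by simp)).trans (add_comm _ _).le)
    · simp only [map_add, map_mul, map_pow, aeval_X, ← hp, ← hq]
      ring
  | mul_X p l hp =>
    obtain ⟨a, P, hP, hp⟩ := hp
    by_cases hl : l = i
    · subst hl
      refine ⟨a + 1, P, hP.trans (Nat.le_succ _), ?_⟩
      simp only [map_mul, aeval_X, ← hp, pchart_some_self]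
      field_simp
      ring
    · refine ⟨a + 1, P * X l, (totalDegree_mul _ _).trans (add_le_add hP (by simp)), ?_⟩
      simp only [map_mul, aeval_X, ← hp, pchart_some_of_ne t hl]
      field_simp
      ring

lemma exists_homogenization_isHomogeneous {t : ι → L} (i : ι) (hti : t i ≠ 0)
    (p : MvPolynomial {l // l ≠ i} K) :
    ∃ (c : ℕ) (P : MvPolynomial ι K), P.IsHomogeneous c ∧
      aeval (fun l : {l // l ≠ i} => pchart t (some i) l) p * t i ^ c = aeval t P := by
  induction p using MvPolynomial.induction_on with
  | C a => exact ⟨0, C a, isHomogeneous_C _ _, by simp⟩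
  | add p q hp hq =>
    obtain ⟨a, P, hP, hp⟩ := hp
    obtain ⟨b, Q, hQ, hq⟩ := hq
    refine ⟨a + b, P * X i ^ b + Q * X i ^ a, ?_, ?_⟩
    · refine (hP.mul (isHomogeneous_X_pow _ _)).add ?_
      rw [add_comm a b]
      exact hQ.mul (isHomogeneous_X_pow _ _)
    · simp only [map_add, map_mul, map_pow, aeval_X, ← hp, ← hq]
      ring
  | mul_X p l hp =>
    obtain ⟨a, P, hP, hp⟩ := hp
    refine ⟨a + 1, P * X l.1, hP.mul (isHomogeneous_X _ _), ?_⟩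
    simp only [map_mul, aeval_X, ← hp, pchart_some_of_ne t l.2]
    field_simp
    ring

/-- An element of `K(t)` that becomes a polynomial after multiplication by, for each `j`, some
nonzero polynomial not involving `t j`, is a polynomial. -/
lemma mem_range_aeval_of_forall_mul {t : ι → L} (ht : AlgebraicIndependent K t) {a : L}
    (ha : a ∈ IntermediateField.adjoin K (Set.range t))
    (h : ∀ j, ∃ q : MvPolynomial {l // l ≠ j} K, q ≠ 0 ∧ ∃ p : MvPolynomial ι K,
      aeval (fun l : {l // l ≠ j} => t l.1) q * a = aeval t p) :
    ∃ A : MvPolynomial ι K, a = aeval t A := by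
  obtain ⟨u, v, rfl⟩ := (IntermediateField.mem_adjoin_range_iff _ _ _).mp ha
  by_cases hv : v = 0
  · exact ⟨0, by simp [hv]⟩
  obtain ⟨v', u', c', hrel, rfl, rfl⟩ :=
    UniqueFactorizationMonoid.exists_reduced_factors v hv u
  have hv' : v' ≠ 0 := right_ne_zero_of_mul hv
  have hc' : c' ≠ 0 := left_ne_zero_of_mul hv
  have hinj : ∀ p : MvPolynomial ι K, p ≠ 0 → aeval t p ≠ 0 := fun p hp h0 =>
    hp (ht (by simpa using h0 : aeval t p = aeval t 0))
  have hvt := hinj _ hv'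
  have hct := hinj _ hc'
  have key : ∀ j, v'.degreeOf j = 0 := by
    intro j
    obtain ⟨q, hq, p, hp⟩ := h j
    have e1 : aeval (fun l : {l // l ≠ j} => t l.1) q = aeval t (rename Subtype.val q) := by
      rw [aeval_rename]; rfl
    have hq' : rename Subtype.val q ≠ 0 := fun h0 =>
      hq (rename_injective _ Subtype.val_injective (by simpa using h0))
    rw [e1, map_mul, map_mul, mul_div_mul_left _ _ hct, mul_div_assoc', div_eq_iff hvt, ← map_mul,
      ← map_mul] at hp
    have hdvd : v' ∣ rename Subtype.val q * u' := ⟨p, by rw [ht hp, mul_comm]⟩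
    obtain ⟨w, hw⟩ := hrel.dvd_of_dvd_mul_right hdvd
    have hw0 : w ≠ 0 := by rintro rfl; simp [hq'] at hw
    have h1 : (rename Subtype.val q : MvPolynomial ι K).degreeOf j = 0 := by
      by_contra hmj
      obtain ⟨l, -, hl⟩ := Finset.mem_image.mp
        (vars_rename Subtype.val q (mem_vars_iff_degreeOf_ne_zero.mpr hmj))
      exact l.2 hl
    rw [hw, degreeOf_mul_eq hv' hw0] at h1
    omega
  have hvars : v'.vars = ∅ := by
    ext j
    simp [mem_vars_iff_degreeOf_ne_zero, key j]
  obtain ⟨b, hb⟩ : ∃ b, v' = C b := ⟨_, vars_eq_empty_iff_eq_C.mp hvars⟩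
  subst hb
  refine ⟨C b⁻¹ * u', ?_⟩
  rw [map_mul, map_mul, mul_div_mul_left _ _ hct, map_mul, div_eq_iff hvt]
  have hb : b ≠ 0 := by rintro rfl; simp at hv'
  rw [mul_comm, ← mul_assoc, ← map_mul, ← C_mul, mul_inv_cancel₀ hb]
  simp

/-- Elements with poles bounded on every chart form a finite-dimensional space. -/
lemma exists_finiteDimensional_of_bounded [Finite ι] [Nonempty ι] [CharZero K]
    [Algebra.EssFiniteType K L] {t : ι → L} (ht : IsTranscendenceBasis K t)
    (c : Option ι → L) (hc : ∀ o, c o ≠ 0) :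
    ∃ N : Submodule K L, FiniteDimensional K N ∧ ∀ s : L,
      (∀ o W, ChartGood K (pchart t o) W → c o * s ∈ W) → s ∈ N := by
  classical
  let E : IntermediateField K L := IntermediateField.adjoin K (Set.range t)
  have : Algebra.IsAlgebraic E L := ht.isAlgebraic_field
  have : Algebra.EssFiniteType E L := Algebra.EssFiniteType.of_comp K E L
  have : FiniteDimensional E L := Algebra.finite_of_essFiniteType_of_isAlgebraic
  have ht0 : ∀ i, t i ≠ 0 := fun i => ht.1.ne_zero i
  have hinj : ∀ {o} (p : MvPolynomial ι K), p ≠ 0 → aeval (pchart t o) p ≠ 0 := fun {o} p hp h0 =>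
    hp ((isTranscendenceBasis_pchart ht o).1 (by simpa using h0))
  let b := Module.finBasis E L
  let τ : L → Fin (Module.finrank E L) → L := fun s k => (Algebra.trace E L (s * b k) : E)
  -- denominators
  have hden : ∀ o, ∃ D : MvPolynomial ι K, D ≠ 0 ∧ ∀ k, ∀ s : L, (∀ W, ChartGood K (pchart t o) W →
      c o * s ∈ W) → ∀ j, ∃ q : MvPolynomial {l // l ≠ j} K, q ≠ 0 ∧ ∃ p : MvPolynomial ι K,
        aeval (fun l : {l // l ≠ j} => pchart t o l.1) q * (aeval (pchart t o) D * τ s k) =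
          aeval (pchart t o) p := by
    intro o
    have hto := isTranscendenceBasis_pchart ht o
    obtain ⟨d, hd, hd0, h⟩ := exists_common_denominator_good hto
      (Finset.univ.image (fun k => (c o)⁻¹ * b k))
    rw [Algebra.adjoin_range_eq_range_aeval] at hd
    obtain ⟨D, rfl⟩ := hd
    refine ⟨D, fun h0 => hd0 (by simp [h0]), fun k s hs j => ?_⟩
    obtain ⟨q, hq, p, hp⟩ := (chart_dedekind_aux hto j).2.2 (aeval (pchart t o) D * (s * b k)) (by
      intro W h1 h2
      have hW : ChartGood K (pchart t o) W := by
        refine ⟨fun i => ?_, j, h2⟩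
        by_cases hi : i = j
        · subst hi; exact h1
        · have := h2 (X ⟨i, hi⟩) (X_ne_zero _)
          rw [aeval_X] at this
          rw [← W.valuation_le_one_iff, this]
      have e : aeval (pchart t o) D * (s * b k) =
          (aeval (pchart t o) D * ((c o)⁻¹ * b k)) * (c o * s) := by
        have := hc o
        field_simp
      rw [e]
      exact W.mul_mem _ _ (h _ (Finset.mem_image_of_mem _ (Finset.mem_univ k)) W hW) (hs W hW))
    refine ⟨q, hq, p, ?_⟩
    rw [← hp]
    congr 1
    have hE : ∀ E' : IntermediateField K L, E' = E →
        ((Algebra.trace E' L (aeval (pchart t o) D * (s * b k)) : E') : L) =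
          aeval (pchart t o) D * τ s k := by
      rintro _ rfl
      have hDE : aeval (pchart t o) D ∈ E := by
        change _ ∈ IntermediateField.adjoin K (Set.range t)
        rw [← adjoin_pchart t ht0 o]
        refine IntermediateField.algebra_adjoin_le_adjoin _ _ ?_
        rw [Algebra.adjoin_range_eq_range_aeval]; exact ⟨D, rfl⟩
      have := map_smul (Algebra.trace E L) (⟨_, hDE⟩ : E) (s * b k)
      rw [Algebra.smul_def] at this
      change ((Algebra.trace E L (algebraMap E L ⟨_, hDE⟩ * (s * b k)) : E) : L) = _
      rw [this]
      rfl
    exact (hE _ (adjoin_pchart t ht0 o)).symm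
  choose D hD0 hD using hden
  obtain ⟨i⟩ := ‹Nonempty ι›
  obtain ⟨β, D', hD'β, hD'⟩ := exists_homogenization i (ht0 i) (D (some i))
  let M := (D none).totalDegree + β
  have hbound : ∀ s : L, (∀ o W, ChartGood K (pchart t o) W → c o * s ∈ W) → ∀ k,
      ∃ A ∈ restrictTotalDegree ι K M, aeval t (D none) * τ s k = aeval t A := by
    intro s hs k
    obtain ⟨A, hA⟩ := mem_range_aeval_of_forall_mul ht.1 (a := aeval t (D none) * τ s k) (by
      refine mul_mem ?_ (Subtype.mem _)
      refine IntermediateField.algebra_adjoin_le_adjoin _ _ ?_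
      rw [Algebra.adjoin_range_eq_range_aeval]; exact ⟨_, rfl⟩) (hD none k s (hs none))
    refine ⟨A, ?_, hA⟩
    rw [mem_restrictTotalDegree]
    by_cases hA0 : A = 0
    · simp [hA0]
    obtain ⟨q, hq, p, hp⟩ := hD (some i) k s (hs _) i
    obtain ⟨a, Q, hQ, hQe⟩ := exists_homogenization_isHomogeneous i (ht0 i) q
    obtain ⟨γ, P, hP, hPe⟩ := exists_homogenization i (ht0 i) p
    have e : Q * D' * A * X i ^ γ = D none * P * X i ^ (a + β) := by
      apply ht.1
      change aeval t _ = aeval t _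
      simp only [map_mul, map_pow, aeval_X, ← hQe, ← hD', ← hPe, ← hA, ← hp]
      ring
    have hQ0 : Q ≠ 0 := by
      rintro rfl
      rw [map_zero] at hQe
      have h1 : aeval (fun l : {l // l ≠ i} => pchart t (some i) l.1) q = 0 :=
        (mul_eq_zero.mp hQe).resolve_right (pow_ne_zero _ (ht0 i))
      refine hq (((isTranscendenceBasis_pchart ht (some i)).1.comp _ Subtype.val_injective)
        (?_ : aeval _ q = aeval _ 0))
      rw [map_zero]
      exact h1
    have hD'0 : D' ≠ 0 := by
      rintro rfl
      rw [map_zero] at hD'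
      exact mul_ne_zero (hinj _ (hD0 (some i))) (pow_ne_zero _ (ht0 i)) hD'
    have hL : (Q * D' * A * X i ^ γ).totalDegree = a + D'.totalDegree + A.totalDegree + γ := by
      have hX : (X i ^ γ : MvPolynomial ι K) ≠ 0 := pow_ne_zero _ (X_ne_zero _)
      rw [totalDegree_mul_of_isDomain (mul_ne_zero (mul_ne_zero hQ0 hD'0) hA0) hX,
        totalDegree_mul_of_isDomain (mul_ne_zero hQ0 hD'0) hA0,
        totalDegree_mul_of_isDomain hQ0 hD'0, hQ.totalDegree hQ0, totalDegree_X_pow]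
    have hR : (D none * P * X i ^ (a + β)).totalDegree ≤ (D none).totalDegree + γ + (a + β) := by
      refine (totalDegree_mul _ _).trans (add_le_add ((totalDegree_mul _ _).trans
        (add_le_add le_rfl hP)) (by simp))
    rw [e] at hL
    omega
  -- the finite-dimensional space
  let Φ : L →ₗ[K] (Fin (Module.finrank E L) → L) :=
    { toFun := fun s k => aeval t (D none) * τ s k
      map_add' := by intro s s'; ext k; simp [τ, add_mul, mul_add]
      map_smul' := by
        intro r s; ext k
        have : Algebra.trace E L (r • s * b k) = r • Algebra.trace E L (s * b k) := by
          rw [smul_mul_assoc, ← algebraMap_smul E r, map_smul, algebraMap_smul]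
        simp only [τ, this, RingHom.id_apply, Pi.smul_apply, IntermediateField.coe_smul,
          mul_smul_comm] }
  have hΦ : Function.Injective Φ := by
    rw [← LinearMap.ker_eq_bot, LinearMap.ker_eq_bot']
    intro s hs
    have h1 : ∀ k, Algebra.trace E L (s * b k) = 0 := by
      intro k
      have := congrFun hs k
      change aeval t (D none) * ((Algebra.trace E L (s * b k) : E) : L) = 0 at this
      exact_mod_cast (mul_eq_zero.mp this).resolve_left (hinj (o := none) _ (hD0 none))
    refine (traceForm_nondegenerate E L).1 s fun y => ?_
    have : Algebra.traceForm E L s = 0 := b.ext fun k => by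
      simpa [Algebra.traceForm_apply] using h1 k
    rw [this]; rfl
  let N₀ : Submodule K L := (restrictTotalDegree ι K M).map (aeval t).toLinearMap
  have : FiniteDimensional K (restrictTotalDegree ι K M) := by infer_instance
  have : FiniteDimensional K N₀ := Module.Finite.map _ _
  let N₁ : Submodule K (Fin (Module.finrank E L) → L) := Submodule.pi Set.univ fun _ => N₀
  have : FiniteDimensional K N₁ := by
    let ψ : N₁ →ₗ[K] (Fin (Module.finrank E L) → N₀) :=
      { toFun := fun f k => ⟨f.1 k, f.2 k trivial⟩
        map_add' := fun _ _ => rfl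
        map_smul' := fun _ _ => rfl }
    refine Module.Finite.of_injective ψ fun f g hfg => ?_
    ext k
    exact congrArg Subtype.val (congrFun hfg k)
  refine ⟨N₁.comap Φ, ?_, fun s hs k _ => ?_⟩
  · let ψ : N₁.comap Φ →ₗ[K] N₁ := Φ.restrict fun _ h => h
    refine Module.Finite.of_injective ψ fun f g hfg => ?_
    exact Subtype.ext (hΦ (congrArg Subtype.val hfg))
  · obtain ⟨A, hA, h⟩ := hbound s hs k
    exact ⟨A, hA, h.symm⟩

end ProjectiveCharts
end InvHyp

namespace InvHyp

open MvPolynomial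

section Derivations

variable {K : Type*} [Field K] [CharZero K] {L : Type*} [Field L] [Algebra K L] {ι : Type*}

/-- The differentials of a transcendence basis form a basis of the Kähler differentials. -/
lemma exists_basis_kaehler {t : ι → L} (ht : IsTranscendenceBasis K t) :
    ∃ b : Module.Basis ι L (Ω[L⁄K]), ∀ i, b i = KaehlerDifferential.D K L (t i) := by
  let E : IntermediateField K L := IntermediateField.adjoin K (Set.range t)
  have : Algebra.IsAlgebraic E L := ht.isAlgebraic_field
  let : Algebra (MvPolynomial ι K) L := (aeval t).toAlgebra
  have hE : ∀ p : MvPolynomial ι K, aeval t p ∈ E := fun p =>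
    IntermediateField.algebra_adjoin_le_adjoin _ _ (by
      rw [Algebra.adjoin_range_eq_range_aeval]; exact ⟨p, rfl⟩)
  let : Algebra (MvPolynomial ι K) E := ((aeval t).codRestrict E.toSubalgebra hE).toAlgebra
  have : IsScalarTower K (MvPolynomial ι K) L := IsScalarTower.of_algebraMap_eq fun a => by
    change _ = aeval t (C a); simp
  have : IsScalarTower (MvPolynomial ι K) E L := IsScalarTower.of_algebraMap_eq fun _ => rfl
  have hinj : Function.Injective (algebraMap (MvPolynomial ι K) E) := by
    intro p q h
    exact ht.1 (congrArg Subtype.val h)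
  have : FaithfulSMul (MvPolynomial ι K) E := (faithfulSMul_iff_algebraMap_injective _ _).mpr hinj
  have : IsFractionRing (MvPolynomial ι K) E := by
    refine IsFractionRing.of_field (MvPolynomial ι K) E ?_
    rintro ⟨z, hz⟩
    obtain ⟨r, s, rfl⟩ := (IntermediateField.mem_adjoin_range_iff _ _ _).mp hz
    exact ⟨r, s, Subtype.ext rfl⟩
  have h1 : Algebra.FormallyEtale (MvPolynomial ι K) E :=
    Algebra.FormallyEtale.of_isLocalization (nonZeroDivisors (MvPolynomial ι K))
  have h2 : Algebra.FormallyEtale E L := Algebra.FormallyEtale.of_isSeparable E L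
  have h3 : Algebra.FormallyEtale (MvPolynomial ι K) L := Algebra.FormallyEtale.comp _ E L
  let e := KaehlerDifferential.tensorKaehlerEquivOfFormallyEtale K (MvPolynomial ι K) L
  refine ⟨((KaehlerDifferential.mvPolynomialBasis K ι).baseChange L).map e, fun i => ?_⟩
  rw [Module.Basis.map_apply, Module.Basis.baseChange_apply,
    KaehlerDifferential.mvPolynomialBasis_apply]
  simp only [KaehlerDifferential.tensorKaehlerEquivOfFormallyEtale_apply,
    KaehlerDifferential.mapBaseChange_tmul, KaehlerDifferential.map_D, one_smul, e]
  change KaehlerDifferential.D K L (aeval t (X i)) = _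
  rw [aeval_X]

variable {M : Type*} [AddCommGroup M] [Module K M] [Module L M] [IsScalarTower K L M]

lemma exists_derivation {t : ι → L} (ht : IsTranscendenceBasis K t) (m : ι → M) :
    ∃ D : Derivation K L M, ∀ i, D (t i) = m i := by
  obtain ⟨b, hb⟩ := exists_basis_kaehler ht
  refine ⟨(b.constr L m).compDer (KaehlerDifferential.D K L), fun i => ?_⟩
  have := b.constr_basis L m i
  rw [hb] at this
  exact this

lemma derivation_ext {t : ι → L} (ht : IsTranscendenceBasis K t) {D D' : Derivation K L M}
    (h : ∀ i, D (t i) = D' (t i)) : D = D' := by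
  obtain ⟨b, hb⟩ := exists_basis_kaehler ht
  have : D.liftKaehlerDifferential = D'.liftKaehlerDifferential := b.ext fun i => by
    simp [hb, h]
  rw [← D.liftKaehlerDifferential_comp, this, D'.liftKaehlerDifferential_comp]

/-- Two derivations along a ring homomorphism that agree on a transcendence basis agree. -/
lemma derivation_along_ext {x : ι → L} (hx : IsTranscendenceBasis K x) {Q : Type*} [CommRing Q] [Algebra K Q] (Φ : L →ₐ[K] Q)
    {δ δ' : L →ₗ[K] Q} (h : ∀ a b, δ (a * b) = Φ a * δ b + Φ b * δ a)
    (h' : ∀ a b, δ' (a * b) = Φ a * δ' b + Φ b * δ' a) (hδ : ∀ i, δ (x i) = δ' (x i)) (g : L) :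
    δ g = δ' g := by
  let : Module L Q := Module.compHom Q (Φ : L →+* Q)
  have hsmul : ∀ (a : L) (q : Q), a • q = Φ a * q := fun _ _ => rfl
  have : IsScalarTower K L Q := ⟨fun k a q => by
    rw [hsmul, hsmul, map_smul, smul_mul_assoc]⟩
  let D : Derivation K L Q := Derivation.mk' δ fun a b => by rw [h, hsmul, hsmul]
  let D' : Derivation K L Q := Derivation.mk' δ' fun a b => by rw [h', hsmul, hsmul]
  have : D = D' := derivation_ext hx hδ
  exact congrArg (fun D : Derivation K L Q => D g) this

/-- The partial derivative with respect to a coordinate of a transcendence basis. -/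
noncomputable def pd [DecidableEq ι] {x : ι → L} (hx : IsTranscendenceBasis K x) (i : ι) :
    Derivation K L L :=
  (exists_derivation hx (fun j => if i = j then (1 : L) else 0)).choose

section Pd

variable [DecidableEq ι] {x : ι → L} (hx : IsTranscendenceBasis K x)

lemma pd_apply (i j : ι) : pd hx i (x j) = if i = j then 1 else 0 :=
  (exists_derivation hx (fun j => if i = j then (1 : L) else 0)).choose_spec j

lemma pd_comm (i j : ι) (g : L) : pd hx i (pd hx j g) = pd hx j (pd hx i g) := by
  have : ⁅pd hx i, pd hx j⁆ = 0 := derivation_ext hx fun l => by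
    rw [Derivation.commutator_apply, pd_apply, pd_apply]
    split_ifs <;> simp
  have := congrArg (fun D : Derivation K L L => D g) this
  simpa [Derivation.commutator_apply, sub_eq_zero] using this

lemma derivation_chain_rule [Fintype ι] {Q : Type*} [CommRing Q] [Algebra K Q] (Φ : L →ₐ[K] Q)
    (D : Derivation K Q Q) (g : L) : D (Φ g) = ∑ i, Φ (pd hx i g) * D (Φ (x i)) := by
  let δ : L →ₗ[K] Q := (D : Q →ₗ[K] Q) ∘ₗ Φ.toLinearMap
  let δ' : L →ₗ[K] Q := ∑ i, (LinearMap.mulRight K (D (Φ (x i)))) ∘ₗ Φ.toLinearMap ∘ₗ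
    (pd hx i : L →ₗ[K] L)
  have h1 : ∀ g, δ g = D (Φ g) := fun _ => rfl
  have h2 : ∀ g, δ' g = ∑ i, Φ (pd hx i g) * D (Φ (x i)) := fun g => by
    simp only [δ', LinearMap.sum_apply]; rfl
  have := derivation_along_ext hx Φ (δ := δ) (δ' := δ') (fun a b => by
      simp only [h1, map_mul, Derivation.leibniz, smul_eq_mul])
    (fun a b => by
      simp only [h2, map_mul, Derivation.leibniz, smul_eq_mul, map_add, add_mul,
        Finset.sum_add_distrib, Finset.mul_sum, mul_assoc])
    (fun j => by
      simp only [h1, h2, pd_apply, apply_ite Φ, map_one, map_zero, ite_mul, one_mul, zero_mul,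
        Finset.sum_ite_eq', Finset.mem_univ, if_true]) g
  rwa [h1, h2] at this

lemma derivation_eq_sum [Fintype ι] (D : Derivation K L L) (g : L) :
    D g = ∑ i, pd hx i g * D (x i) :=
  derivation_chain_rule hx (AlgHom.id K L) D g

/-- Partial derivatives extend along field extensions. -/
lemma exists_pd_extension {F : Type*} [Field F] [Algebra K F] {x : ι → F}
    (hx : IsTranscendenceBasis K x) (φ : F →ₐ[K] L) (i : ι) :
    ∃ D : Derivation K L L, ∀ g, D (φ g) = φ (pd hx i g) := by
  have hind : AlgebraicIndependent K (φ ∘ x) := hx.1.map' φ.toRingHom.injective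
  obtain ⟨s, hs, hsb⟩ := exists_isTranscendenceBasis_superset hind.coe_range
  classical
  obtain ⟨D, hD⟩ := exists_derivation hsb (fun a : s => if (a : L) = φ (x i) then (1 : L) else 0)
  refine ⟨D, fun g => ?_⟩
  let δ : F →ₗ[K] L := (D : L →ₗ[K] L) ∘ₗ φ.toLinearMap
  let δ' : F →ₗ[K] L := φ.toLinearMap ∘ₗ (pd hx i : F →ₗ[K] F)
  refine derivation_along_ext hx φ (δ := δ) (δ' := δ') (fun a b => ?_) (fun a b => ?_) (fun j => ?_) g
  · change D (φ (a * b)) = φ a * D (φ b) + φ b * D (φ a)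
    simp only [map_mul, Derivation.leibniz, smul_eq_mul]
  · change φ (pd hx i (a * b)) = φ a * φ (pd hx i b) + φ b * φ (pd hx i a)
    simp only [map_mul, Derivation.leibniz, smul_eq_mul, map_add]
  · change D (φ (x j)) = φ (pd hx i (x j))
    have := hD ⟨φ (x j), hs ⟨j, rfl⟩⟩
    rw [this, pd_apply]
    have hinj : Function.Injective x := hx.1.injective
    by_cases hij : i = j
    · subst hij; simp
    · rw [if_neg hij, if_neg, map_zero]
      exact fun h => hij (hinj (φ.toRingHom.injective h)).symm

lemma mem_range_of_pd_eq_zero [IsAlgClosed K] [Finite ι] {g : L} (h : ∀ i, pd hx i g = 0) :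
    g ∈ Set.range (algebraMap K L) := by
  have := Fintype.ofFinite ι
  by_cases hg : IsAlgebraic K g
  · exact minpoly.mem_range_of_degree_eq_one K g
      (IsAlgClosed.degree_eq_one_of_irreducible K (minpoly.irreducible hg.isIntegral))
  · have h1 : AlgebraicIndependent K (fun a : ({g} : Set L) => (a : L)) :=
      (algebraicIndependent_unique_type_iff).mpr hg
    obtain ⟨s, hs, hsb⟩ := exists_isTranscendenceBasis_superset h1
    obtain ⟨D, hD⟩ := exists_derivation hsb (fun a : s => (1 : L))
    have := derivation_eq_sum hx D g
    rw [hD ⟨g, hs rfl⟩] at this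
    simp [h] at this

end Pd

end Derivations
end InvHyp

namespace InvHyp

section Taylor

variable {K : Type*} [Field K] {Q : Type*} [CommRing Q] [Algebra K Q]

/-- The terms of the Taylor expansion of `B` along the displacement `lam`. -/
noncomputable def taylorTerm (K : Type*) [Field K] {Q : Type*} [CommRing Q] [Algebra K Q]
    {G Λ : Type*} [Fintype Λ] (d : Λ → G → G) (B : G → Q) (lam : Λ → Q) :
    ℕ → G → Q
  | 0 => B
  | s + 1 => fun g => ((s + 1 : K)⁻¹) • ∑ l, lam l * taylorTerm K d B lam s (d l g)

variable {G Λ : Type*} [Fintype Λ] {d : Λ → G → G} {A B : G → Q} {a b lam : Λ → Q}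

lemma taylorTerm_zero (g : G) : taylorTerm K d B lam 0 g = B g := by rw [taylorTerm]

variable [CharZero K]

lemma succ_smul_taylorTerm (s : ℕ) (g : G) :
    (s + 1 : K) • taylorTerm K d B lam (s + 1) g =
      ∑ l, lam l * taylorTerm K d B lam s (d l g) := by
  rw [taylorTerm, smul_smul, mul_inv_cancel₀ (by exact_mod_cast Nat.succ_ne_zero s), one_smul]

lemma derivation_taylorTerm_succ (hd : ∀ k l g, d k (d l g) = d l (d k g)) (E : Derivation K Q Q)
    (hB : ∀ g, E (B g) = ∑ l, B (d l g) * b l) (s : ℕ) (g : G) :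
    E (taylorTerm K d B lam (s + 1) g) =
      ∑ l, E (lam l) * taylorTerm K d B lam s (d l g) +
        ∑ l, b l * taylorTerm K d B lam (s + 1) (d l g) := by
  have hs : ∀ s : ℕ, (s + 1 : K) ≠ 0 := fun s => by exact_mod_cast Nat.succ_ne_zero s
  have inj : ∀ (s : ℕ) (u v : Q), (s + 1 : K) • u = (s + 1 : K) • v → u = v := by
    intro s u v h
    have := congrArg (fun w => (s + 1 : K)⁻¹ • w) h
    simpa only [smul_smul, inv_mul_cancel₀ (hs s), one_smul] using this
  have hR : ∀ (s : ℕ) (g : G), (s + 1 : K) • ∑ l, b l * taylorTerm K d B lam (s + 1) (d l g) =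
      ∑ l, ∑ k, lam l * (b k * taylorTerm K d B lam s (d k (d l g))) := by
    intro s g
    rw [Finset.smul_sum, Finset.sum_comm]
    refine Finset.sum_congr rfl fun k _ => ?_
    rw [← mul_smul_comm, succ_smul_taylorTerm, Finset.mul_sum]
    refine Finset.sum_congr rfl fun l _ => ?_
    rw [hd k l]; ring
  induction s generalizing g with
  | zero =>
    apply inj 0
    rw [← Derivation.map_smul, succ_smul_taylorTerm, smul_add, hR]
    simp only [taylorTerm_zero, map_sum, Derivation.leibniz, hB, smul_eq_mul,
      Finset.sum_add_distrib, Finset.mul_sum]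
    rw [add_comm]
    congr 1
    · simp only [Nat.cast_zero, zero_add, one_smul]
      exact Finset.sum_congr rfl fun _ _ => mul_comm _ _
    · exact Finset.sum_congr rfl fun _ _ => Finset.sum_congr rfl fun _ _ => by ring
  | succ s ih =>
    apply inj (s + 1)
    rw [← Derivation.map_smul, succ_smul_taylorTerm, smul_add, hR]
    simp only [map_sum, Derivation.leibniz, smul_eq_mul, ih, Finset.sum_add_distrib, mul_add,
      Finset.mul_sum]
    rw [add_right_comm]
    congr 1
    have : ∑ l, ∑ k, lam l * (E (lam k) * taylorTerm K d B lam s (d k (d l g))) =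
        (s + 1 : K) • ∑ k, E (lam k) * taylorTerm K d B lam (s + 1) (d k g) := by
      rw [Finset.smul_sum, Finset.sum_comm]
      refine Finset.sum_congr rfl fun k _ => ?_
      rw [← mul_smul_comm, succ_smul_taylorTerm, Finset.mul_sum]
      refine Finset.sum_congr rfl fun l _ => ?_
      rw [hd k l]; ring
    rw [this]
    push_cast
    simp only [mul_comm, add_smul, one_smul]

/-- If `A` and `B` agree to first order and the displacement lies in `J`, then `A` and `B` agree
modulo `J`. -/
lemma sub_mem_of_taylor (hd : ∀ k l g, d k (d l g) = d l (d k g)) (E : Derivation K Q Q)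
    {𝔪 J : Ideal Q} {M : ℕ} (hM : 𝔪 ^ M = ⊥) (hJ : J ≤ 𝔪) (hE : ∀ q, E q ∈ 𝔪)
    (hEk : ∀ k u, u ∈ 𝔪 → E u ∈ 𝔪 ^ k → u ∈ 𝔪 ^ k)
    (hA : ∀ g, E (A g) = ∑ l, A (d l g) * a l) (hB : ∀ g, E (B g) = ∑ l, B (d l g) * b l)
    (hb : ∀ l, b l ∈ 𝔪) (hlam : ∀ l, lam l ∈ J) (hElam : ∀ l, E (lam l) = a l - b l)
    (hAB : ∀ g, A g - B g ∈ 𝔪) (g : G) : A g - B g ∈ J := by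
  set T := taylorTerm K d B lam with hT
  have hTJ : ∀ s g, T (s + 1) g ∈ J := by
    intro s g
    rw [hT, taylorTerm]
    exact Submodule.smul_of_tower_mem _ _ (sum_mem fun l _ => J.mul_mem_right _ (hlam l))
  have hTB : ∀ s g, ∑ i ∈ Finset.range (s + 1), T i g - B g ∈ J := by
    intro s g
    rw [Finset.sum_range_succ', hT, taylorTerm_zero, add_sub_cancel_right]
    exact sum_mem fun i _ => hTJ i g
  have key : ∀ k, 1 ≤ k → ∀ s g, k ≤ s + 1 → A g - ∑ i ∈ Finset.range (s + 1), T i g ∈ 𝔪 ^ k := by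
    intro k hk
    induction k, hk using Nat.le_induction with
    | base =>
      intro s g _
      rw [pow_one]
      have := 𝔪.sub_mem (hAB g) (hJ (hTB s g))
      simpa using this
    | succ k hk ih =>
      intro s g hs
      obtain ⟨s, rfl⟩ : ∃ s', s = s' + 1 := ⟨s - 1, by omega⟩
      have h1 : A g - ∑ i ∈ Finset.range (s + 1 + 1), T i g ∈ 𝔪 := by
        have := 𝔪.sub_mem (hAB g) (hJ (hTB (s + 1) g))
        simpa using this
      refine hEk _ _ h1 ?_
      have e : E (A g - ∑ i ∈ Finset.range (s + 1 + 1), T i g) =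
          ∑ l, b l * (A (d l g) - ∑ i ∈ Finset.range (s + 1 + 1), T i (d l g)) +
          ∑ l, E (lam l) * (A (d l g) - ∑ i ∈ Finset.range (s + 1), T i (d l g)) := by
        have h2 : E (∑ i ∈ Finset.range (s + 1 + 1), T i g) =
            ∑ l, b l * (∑ i ∈ Finset.range (s + 1 + 1), T i (d l g)) +
            ∑ l, E (lam l) * (∑ i ∈ Finset.range (s + 1), T i (d l g)) := by
          rw [Finset.sum_range_succ', map_add, map_sum]
          simp only [Finset.sum_range_succ' _ (s + 1), mul_add, Finset.mul_sum,
            Finset.sum_add_distrib, hT, derivation_taylorTerm_succ hd E hB, taylorTerm_zero, hB]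
          rw [Finset.sum_comm (s := Finset.range (s + 1)),
            Finset.sum_comm (s := Finset.range (s + 1))]
          simp only [mul_comm]
          ring
        rw [map_sub, h2, hA]
        simp only [mul_sub, Finset.sum_sub_distrib, hElam]
        have h3 : ∑ l, A (d l g) * a l = ∑ l, b l * A (d l g) + ∑ l, (a l - b l) * A (d l g) := by
          rw [← Finset.sum_add_distrib]
          exact Finset.sum_congr rfl fun _ _ => by ring
        rw [h3]
        ring
      rw [e, pow_succ']
      exact Ideal.add_mem _ (sum_mem fun l _ => Ideal.mul_mem_mul (hb l)
        (ih _ _ (by omega))) (sum_mem fun l _ => Ideal.mul_mem_mul (hE _) (ih _ _ (by omega)))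
  have h1 := key (M + 1) (by omega) M g le_rfl
  rw [pow_succ, hM, Ideal.bot_mul, Ideal.mem_bot, sub_eq_zero] at h1
  rw [h1]
  exact hTB M g

end Taylor

section Invariant

variable {K : Type*} [Field K] [CharZero K] {F L Q : Type*} [Field F] [Algebra K F] [Field L]
  [Algebra K L] [CommRing Q] [Algebra K Q] {ι : Type*} [Fintype ι] [DecidableEq ι] {x : ι → F}

/-- An infinite-dimensional space of closed forms on which the two pullbacks agree yields an
invariant function. -/
theorem exists_invariant_of_forms (hx : IsTranscendenceBasis K x) (V : Submodule K (ι → F))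
    (hVinf : ¬ FiniteDimensional K V) (hV0 : ∀ z ∈ V, ∀ i j, pd hx i (z j) = pd hx j (z i))
    (φ₁ φ₂ : F →ₐ[K] L) (Dt : ι → Derivation K L L)
    (hDt : ∀ i g, Dt i (φ₁ g) = φ₁ (pd hx i g))
    (hV1 : ∀ z ∈ V, ∀ i, φ₁ (z i) = ∑ j, φ₂ (z j) * Dt i (φ₂ (x j)))
    (ρ : Q →ₐ[K] L) (A B : F →ₐ[K] Q) (hρA : ∀ g, ρ (A g) = φ₁ g) (hρB : ∀ g, ρ (B g) = φ₂ g)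
    (E : Derivation K Q Q) (Iv : Q → Q) {J : Ideal Q} {M : ℕ}
    (hM : RingHom.ker ρ ^ M = ⊥) (hJ : J ≤ RingHom.ker ρ) (hE : ∀ q, E q ∈ RingHom.ker ρ)
    (hEk : ∀ k u, u ∈ RingHom.ker ρ → E u ∈ RingHom.ker ρ ^ k → u ∈ RingHom.ker ρ ^ k)
    (hIv : ∀ u ∈ RingHom.ker ρ, E (Iv u) = u)
    (hV2 : ∀ z ∈ V, Iv (∑ i, A (z i) * E (A (x i)) - ∑ i, B (z i) * E (B (x i))) ∈ J) :
    ∃ g : F, g ∉ Set.range (algebraMap K F) ∧ A g - B g ∈ J := by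
  classical
  obtain ⟨b, hbV, hspan, hli⟩ := exists_linearIndependent F (V : Set (ι → F))
  have : Finite b := hli.finite
  have : Fintype b := Fintype.ofFinite b
  obtain ⟨ω, hωV, hω⟩ : ∃ ω ∈ V, ω ∉ Submodule.span K b := by
    by_contra! h
    apply hVinf
    have : FiniteDimensional K (Submodule.span K b) :=
      FiniteDimensional.span_of_finite K (Set.toFinite b)
    exact Submodule.finiteDimensional_of_le (S₂ := Submodule.span K b) h
  have hωs : ω ∈ Submodule.span F b := hspan ▸ Submodule.subset_span hωV
  obtain ⟨u, hu⟩ : ∃ u : b → F, ∑ k, u k • (k : ι → F) = ω := by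
    have := (Submodule.mem_span_range_iff_exists_fun F (v := ((↑) : b → ι → F))).1
      (by simpa using hωs)
    exact this
  obtain ⟨k₀, hk₀⟩ : ∃ k, u k ∉ Set.range (algebraMap K F) := by
    by_contra! h
    choose r hr using h
    apply hω
    rw [← hu]
    refine sum_mem fun k _ => ?_
    rw [← hr k, algebraMap_smul]
    exact Submodule.smul_mem _ _ (Submodule.subset_span k.2)
  -- a dual family
  obtain ⟨c, hc⟩ : ∃ c : b → ι → F, ∀ k l : b, ∑ i, c l i * (k : ι → F) i = if k = l then 1 else 0 := by
    obtain ⟨r, hr⟩ := LinearMap.exists_leftInverse_of_injective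
      (Fintype.linearCombination F ((↑) : b → ι → F))
      (LinearMap.ker_eq_bot.2 (hli.fintypeLinearCombination_injective))
    refine ⟨fun l i => r (Pi.single i 1) l, fun k l => ?_⟩
    have h1 := congrFun (LinearMap.congr_fun hr (Pi.single k 1)) l
    simp only [LinearMap.comp_apply, Fintype.linearCombination_apply_single, one_smul,
      LinearMap.id_apply] at h1
    have h2 : (k : ι → F) = ∑ i, (k : ι → F) i • Pi.single i (1 : F) :=
      pi_eq_sum_univ' _ 
    rw [h2, map_sum, Finset.sum_apply] at h1
    simp only [map_smul, Pi.smul_apply, smul_eq_mul] at h1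
    simp only [mul_comm (r _ _), h1, Pi.single_apply, eq_comm]
  let δ : b → F → F := fun l g => ∑ i, c l i * pd hx i g
  have closed : ∀ h : b → F, (∀ i j, ∑ k, pd hx i (h k) * (k : ι → F) j =
      ∑ k, pd hx j (h k) * (k : ι → F) i) →
      (∀ l j, pd hx j (h l) = ∑ k, δ l (h k) * (k : ι → F) j) ∧
      ∀ l m, δ l (h m) = δ m (h l) := by
    intro h hh
    have h1 : ∀ l j, pd hx j (h l) = ∑ k, δ l (h k) * (k : ι → F) j := by
      intro l j
      calc pd hx j (h l) = ∑ k, pd hx j (h k) * ∑ i, c l i * (k : ι → F) i := by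
            simp [hc]
        _ = ∑ i, c l i * ∑ k, pd hx j (h k) * (k : ι → F) i := by
            simp only [Finset.mul_sum]
            rw [Finset.sum_comm]
            exact Finset.sum_congr rfl fun _ _ => Finset.sum_congr rfl fun _ _ => by ring
        _ = ∑ i, c l i * ∑ k, pd hx i (h k) * (k : ι → F) j := by
            simp only [fun i => hh i j]
        _ = ∑ k, δ l (h k) * (k : ι → F) j := by
            simp only [δ, Finset.mul_sum, Finset.sum_mul]
            rw [Finset.sum_comm]
            exact Finset.sum_congr rfl fun _ _ => Finset.sum_congr rfl fun _ _ => by ring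
    refine ⟨h1, fun l m => ?_⟩
    calc δ l (h m) = ∑ k, δ m (h k) * ∑ j, c l j * (k : ι → F) j := by
          simp only [δ, fun j => h1 m j, Finset.mul_sum]
          rw [Finset.sum_comm]
          exact Finset.sum_congr rfl fun _ _ => Finset.sum_congr rfl fun _ _ => by ring
      _ = δ m (h l) := by simp [hc]
  have cancel : ∀ u w : b → L, (∀ i, ∑ k, u k * φ₁ ((k : ι → F) i) =
      ∑ k, w k * φ₁ ((k : ι → F) i)) → u = w := by
    intro u w h
    have h1 : ∀ (u : b → L) l, u l = ∑ i, φ₁ (c l i) * ∑ k, u k * φ₁ ((k : ι → F) i) := by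
      intro u l
      calc u l = ∑ k, u k * φ₁ (∑ i, c l i * (k : ι → F) i) := by simp [hc, apply_ite φ₁]
        _ = _ := by
          simp only [map_sum, map_mul, Finset.mul_sum]
          rw [Finset.sum_comm]
          exact Finset.sum_congr rfl fun _ _ => Finset.sum_congr rfl fun _ _ => by ring
    funext l
    rw [h1 u, h1 w]
    simp only [h]
  have agree : ∀ (h : b → F) i, ∑ k, φ₂ (h k) * φ₁ ((k : ι → F) i) =
      ∑ j, φ₂ (∑ k, h k * (k : ι → F) j) * Dt i (φ₂ (x j)) := by
    intro h i
    simp only [map_sum, map_mul, Finset.sum_mul, fun k : b => hV1 k (hbV k.2) i, Finset.mul_sum]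
    rw [Finset.sum_comm]
    exact Finset.sum_congr rfl fun _ _ => Finset.sum_congr rfl fun _ _ => by ring
  let 𝒢 : Type _ := {g : F // φ₁ g = φ₂ g ∧ ∀ i, pd hx i g = ∑ k, δ k g * (k : ι → F) i}
  have hcl : ∀ g : 𝒢, (∀ l j, pd hx j (δ l g.1) = ∑ k, δ l (δ k g.1) * (k : ι → F) j) ∧
      ∀ l m, δ l (δ m g.1) = δ m (δ l g.1) := by
    intro g
    refine closed (fun k => δ k g.1) fun i j => ?_
    have h1 := pd_comm hx i j g.1
    rw [g.2.2 j, g.2.2 i] at h1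
    simp only [map_sum, Derivation.leibniz, smul_eq_mul, Finset.sum_add_distrib] at h1
    simp only [fun k : b => hV0 k (hbV k.2) i j, add_right_inj] at h1
    simpa only [mul_comm] using h1
  have hφ : ∀ g : 𝒢, ∀ l, φ₁ (δ l g.1) = φ₂ (δ l g.1) := by
    intro g
    refine congrFun (cancel (fun l => φ₁ (δ l g.1)) (fun l => φ₂ (δ l g.1)) fun i => ?_)
    rw [agree]
    simp only [← g.2.2, ← map_mul, ← map_sum]
    rw [← hDt, g.2.1, derivation_chain_rule hx φ₂ (Dt i)]
  let d : b → 𝒢 → 𝒢 := fun l g => ⟨δ l g.1, hφ g l, fun i => by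
    rw [(hcl g).1 l i]
    simp only [(hcl g).2 l]⟩
  have hφu : ∀ l, φ₁ (u l) = φ₂ (u l) := by
    refine congrFun (cancel (fun l => φ₁ (u l)) (fun l => φ₂ (u l)) fun i => ?_)
    rw [agree]
    have h3 : ∀ j, ∑ k, u k * (k : ι → F) j = ω j := fun j => by
      rw [← hu, Finset.sum_apply]; rfl
    simp only [h3, ← map_mul, ← map_sum]
    exact hV1 ω hωV i
  have hclu := closed u fun i j => by
    have h1 := hV0 ω hωV i j
    rw [← hu] at h1
    simp only [Finset.sum_apply, Pi.smul_apply, smul_eq_mul, map_sum, Derivation.leibniz,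
      Finset.sum_add_distrib] at h1
    simp only [fun k : b => hV0 k (hbV k.2) i j, add_right_inj] at h1
    simpa only [mul_comm] using h1
  let g₀ : 𝒢 := ⟨u k₀, hφu k₀, fun i => by
    rw [hclu.1 k₀ i]
    simp only [hclu.2 k₀]⟩
  have hEx : ∀ (Φ : F →ₐ[K] Q) (g : 𝒢), E (Φ g.1) =
      ∑ l, Φ (d l g).1 * ∑ i, Φ ((l : ι → F) i) * E (Φ (x i)) := by
    intro Φ g
    rw [derivation_chain_rule hx Φ E]
    simp only [fun i => g.2.2 i, map_sum, map_mul, Finset.mul_sum, Finset.sum_mul]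
    rw [Finset.sum_comm]
    exact Finset.sum_congr rfl fun _ _ => Finset.sum_congr rfl fun _ _ => by ring
  have hab : ∀ (Φ : F →ₐ[K] Q) (l : b), ∑ i, Φ ((l : ι → F) i) * E (Φ (x i)) ∈ RingHom.ker ρ :=
    fun Φ l => sum_mem fun i _ => Ideal.mul_mem_left _ _ (hE _)
  refine ⟨u k₀, hk₀, ?_⟩
  exact sub_mem_of_taylor (K := K) (G := 𝒢) (d := d) (A := fun g => A g.1) (B := fun g => B g.1)
    (a := fun l => ∑ i, A ((l : ι → F) i) * E (A (x i)))
    (b := fun l => ∑ i, B ((l : ι → F) i) * E (B (x i)))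
    (lam := fun l => Iv (∑ i, A ((l : ι → F) i) * E (A (x i)) -
      ∑ i, B ((l : ι → F) i) * E (B (x i))))
    (fun k l g => Subtype.ext ((hcl g).2 k l)) E hM hJ hE hEk (hEx A) (hEx B) (hab B)
    (fun l => hV2 l (hbV l.2)) (fun l => hIv _ (Ideal.sub_mem _ (hab A l) (hab B l)))
    (fun g => by rw [RingHom.mem_ker, map_sub, hρA, hρB, g.2.1, sub_self]) g₀

end Invariant

end InvHyp

namespace InvHyp

open Polynomial in
/-- `p` is a polynomial of degree at most `k` whose coefficients, scaled by powers of `t`, lie in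
the valuation ring `W`. -/
def ScaledIn {T : Type*} [Field T] (W : ValuationSubring T) (t : T) (k : ℕ) (p : T[X]) : Prop :=
  p.natDegree ≤ k ∧ ∀ b, p.coeff b * t ^ (k - b) ∈ W

section Scaled

open Polynomial

variable {T : Type*} [Field T] {W : ValuationSubring T} {t : T}

lemma ScaledIn.add {k : ℕ} {p q : T[X]} (hp : ScaledIn W t k p) (hq : ScaledIn W t k q) :
    ScaledIn W t k (p + q) :=
  ⟨natDegree_add_le_of_degree_le hp.1 hq.1, fun b => by
    rw [coeff_add, add_mul]; exact add_mem (hp.2 b) (hq.2 b)⟩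

lemma ScaledIn.mul {k l : ℕ} {p q : T[X]} (hp : ScaledIn W t k p) (hq : ScaledIn W t l q) :
    ScaledIn W t (k + l) (p * q) := by
  refine ⟨natDegree_mul_le_of_le hp.1 hq.1, fun b => ?_⟩
  rw [coeff_mul, Finset.sum_mul]
  refine sum_mem fun ⟨i, j⟩ hij => ?_
  have hb : i + j = b := by simpa using hij
  by_cases hi : k < i
  · simp [coeff_eq_zero_of_natDegree_lt (hp.1.trans_lt hi), W.zero_mem]
  by_cases hj : l < j
  · simp [coeff_eq_zero_of_natDegree_lt (hq.1.trans_lt hj), W.zero_mem]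
  have : k + l - b = (k - i) + (l - j) := by omega
  rw [this, pow_add]
  convert mul_mem (hp.2 i) (hq.2 j) using 1
  ring

lemma ScaledIn.mono (ht : t ∈ W) {k l : ℕ} (hkl : k ≤ l) {p : T[X]} (hp : ScaledIn W t k p) :
    ScaledIn W t l p := by
  refine ⟨hp.1.trans hkl, fun b => ?_⟩
  by_cases hb : k < b
  · simp [coeff_eq_zero_of_natDegree_lt (hp.1.trans_lt hb), W.zero_mem]
  have : l - b = (k - b) + (l - k) := by omega
  rw [this, pow_add, ← mul_assoc]
  exact mul_mem (hp.2 b) (pow_mem ht _)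

lemma scaledIn_C {a : T} (ha : a ∈ W) : ScaledIn W t 0 (C a) :=
  ⟨by simp, fun b => by
    rw [coeff_C]; split_ifs
    · simpa using ha
    · simp [W.zero_mem]⟩

lemma ScaledIn.pow {k : ℕ} {p : T[X]} (hp : ScaledIn W t k p) (m : ℕ) :
    ScaledIn W t (m * k) (p ^ m) := by
  induction m with
  | zero => simpa using scaledIn_C W.one_mem
  | succ m ih => rw [pow_succ, add_mul, one_mul]; exact ih.mul hp

/-- Dividing off a linear factor preserves the bounds on the values. -/
lemma ScaledIn.eval_divByMonic_mem {e : ℕ} {p : T[X]} (hp : ScaledIn W t e p) {r s : T}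
    (hr : r * t ∈ W) (hs : s * t ∈ W) : (p /ₘ (X - C r)).eval s * t ^ (e - 1) ∈ W := by
  rw [eval_eq_sum_range, Finset.sum_mul]
  refine sum_mem fun n _ => ?_
  rw [coeff_divByMonic_X_sub_C, Finset.sum_mul, Finset.sum_mul]
  refine sum_mem fun i hi => ?_
  rw [Finset.mem_Icc] at hi
  have : e - 1 = (i - (n + 1)) + (e - i) + n := by have := hp.1; omega
  rw [this, pow_add, pow_add]
  convert mul_mem (mul_mem (pow_mem hr (i - (n + 1))) (hp.2 i)) (pow_mem hs n) using 1
  rw [mul_pow, mul_pow]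
  ring

lemma ScaledIn.mul_mem_of_isRoot {e : ℕ} {p : T[X]} (hp : ScaledIn W t e p)
    (hlead : W.valuation (p.coeff e) = 1) {r : T} (hr : p.eval r = 0) : r * t ∈ W := by
  by_contra h
  have h0 : r * t ≠ 0 := fun h' => h (h' ▸ W.zero_mem)
  have hlt : W.valuation (r * t)⁻¹ < 1 := by
    rw [map_inv₀]
    exact inv_lt_one_of_one_lt₀ (not_le.1 (mt (W.valuation_le_one_iff _).1 h))
  have h1 : ∑ b ∈ Finset.range (e + 1), p.coeff b * t ^ (e - b) * ((r * t)⁻¹) ^ (e - b) = 0 := by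
    have h2 := eval_eq_sum_range' (Nat.lt_succ_of_le hp.1) r
    rw [hr] at h2
    have h3 := congrArg (fun q => q * t ^ e * ((r * t)⁻¹) ^ e) h2
    simp only [zero_mul, Finset.sum_mul] at h3
    rw [h3]
    refine Finset.sum_congr rfl fun b hb => ?_
    have hb' : e = b + (e - b) := by have := Finset.mem_range.1 hb; omega
    have h4 : (r * t) ^ b * ((r * t)⁻¹) ^ b = 1 := by
      rw [← mul_pow, mul_inv_cancel₀ h0, one_pow]
    calc _ = p.coeff b * t ^ (e - b) * ((r * t)⁻¹) ^ (e - b) * ((r * t) ^ b * ((r * t)⁻¹) ^ b) := by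
          rw [h4, mul_one]
      _ = p.coeff b * r ^ b * (t ^ b * t ^ (e - b)) *
          (((r * t)⁻¹) ^ b * ((r * t)⁻¹) ^ (e - b)) := by rw [mul_pow r t]; ring
      _ = _ := by rw [← pow_add, ← pow_add, ← hb']
  rw [Finset.sum_range_succ, Nat.sub_self, pow_zero, pow_zero, mul_one, mul_one,
    add_comm, add_eq_zero_iff_eq_neg] at h1
  have h2 : W.valuation (p.coeff e) < 1 := by
    rw [h1, Valuation.map_neg]
    refine Valuation.map_sum_lt _ one_ne_zero fun b hb => ?_
    rw [map_mul, map_pow]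
    have h5 : e - b ≠ 0 := by have := Finset.mem_range.1 hb; omega
    exact (mul_le_of_le_one_left' ((W.valuation_le_one_iff _).2 (hp.2 b))).trans_lt
      (pow_lt_one₀ zero_le hlt h5)
  exact h2.ne hlead

lemma eval_divByMonic_of_isRoot [DecidableEq T] {p : T[X]} {r s : T} (hr : p.eval r = 0) (hs : p.eval s = 0) :
    (p /ₘ (X - C r)).eval s = if r = s then p.derivative.eval s else 0 := by
  have h := mul_divByMonic_eq_iff_isRoot.2 hr
  split_ifs with hrs
  · subst hrs
    conv_rhs => rw [← h]
    simp
  · have h1 := congrArg (eval s) h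
    rw [hs, eval_mul, eval_sub, eval_X, eval_C] at h1
    exact (mul_eq_zero.1 h1).resolve_left (sub_ne_zero.2 (Ne.symm hrs))

end Scaled

section Line

open Polynomial

variable {K : Type*} [Field K] {ι : Type*} {T : Type*} [Field T] [Algebra K T]

/-- The restriction of `h` to the line through `χ` in direction `w`. -/
noncomputable def linePoly (w : ι → K) (h : MvPolynomial ι K) (χ : ι → T) : T[X] :=
  MvPolynomial.aeval (fun l => C (χ l) + C (algebraMap K T (w l)) * X) h

variable (w : ι → K) (h : MvPolynomial ι K) (χ : ι → T)

lemma eval_linePoly (r : T) : (linePoly w h χ).eval r =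
    MvPolynomial.aeval (fun l => χ l + algebraMap K T (w l) * r) h := by
  have : (linePoly w h χ).eval r = ((Polynomial.aeval r).restrictScalars K) (linePoly w h χ) := by
    simp [Polynomial.coe_aeval_eq_eval]
  rw [this, linePoly, ← AlgHom.comp_apply, MvPolynomial.comp_aeval]
  simp

lemma map_linePoly {T' : Type*} [Field T'] [Algebra K T'] (σ : T →ₐ[K] T') :
    (linePoly w h χ).map (σ : T →+* T') = linePoly w h (fun l => σ (χ l)) := by
  have : (linePoly w h χ).map (σ : T →+* T') = Polynomial.mapAlgHom σ (linePoly w h χ) := rfl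
  rw [this, linePoly, ← AlgHom.comp_apply, MvPolynomial.comp_aeval, linePoly]
  congr 2
  funext l
  simp

lemma derivative_linePoly [Fintype ι] : derivative (linePoly w h χ) =
    ∑ l, C (algebraMap K T (w l)) * linePoly w (MvPolynomial.pderiv l h) χ := by
  classical
  induction h using MvPolynomial.induction_on with
  | C a => simp [linePoly, algebraMap_eq, IsScalarTower.algebraMap_apply K T T[X]]
  | add p q hp hq =>
    simp only [linePoly, map_add, mul_add, Finset.sum_add_distrib] at hp hq ⊢
    rw [hp, hq]
  | mul_X p i hp =>
    simp only [linePoly, map_mul, MvPolynomial.aeval_X, Derivation.leibniz, derivative_mul,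
      MvPolynomial.pderiv_X, smul_eq_mul, map_add, mul_add, Finset.sum_add_distrib] at hp ⊢
    rw [hp]
    simp only [derivative_C, derivative_X, zero_add, zero_mul, mul_one, Pi.single_apply,
      apply_ite (MvPolynomial.aeval _), map_one, map_zero, mul_ite, mul_zero,
      Finset.sum_ite_eq, Finset.mem_univ, if_true]
    rw [Finset.sum_congr rfl fun l _ => mul_left_comm (C (algebraMap K T (w l))) _ _,
      ← Finset.mul_sum]
    generalize (MvPolynomial.aeval fun l => C (χ l) + C (algebraMap K T (w l)) * X) p = q
    generalize ∑ l, C (algebraMap K T (w l)) * _ = r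
    ring

lemma scaledIn_linePoly {W : ValuationSubring T} (hK : ∀ a : K, algebraMap K T a ∈ W) {t : T}
    (ht : t ∈ W) (hχ : ∀ l, χ l * t ∈ W) {k : ℕ} (hk : h.totalDegree ≤ k) :
    ScaledIn W t k (linePoly w h χ) := by
  classical
  have hl : ∀ l, ScaledIn W t 1 (C (χ l) + C (algebraMap K T (w l)) * X) := fun l => by
    refine ⟨by compute_degree, fun b => ?_⟩
    rcases b with _ | _ | b
    · simpa using hχ l
    · simpa [coeff_C] using hK _
    · simp [W.zero_mem]
  have hm : ∀ (m : ι →₀ ℕ), ScaledIn W t m.degree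
      (m.prod fun l j => (C (χ l) + C (algebraMap K T (w l)) * X) ^ j) := by
    intro m
    induction m using Finsupp.induction with
    | zero => simpa using scaledIn_C W.one_mem
    | single_add l j m hlm hj ih =>
      rw [Finsupp.prod_add_index' (by simp) (by simp [pow_add]), Finsupp.prod_single_index (by simp),
        map_add, Finsupp.degree_single]
      simpa using ((hl l).pow j).mul ih
  rw [linePoly, MvPolynomial.aeval_def, MvPolynomial.eval₂_eq]
  refine Finset.sum_induction _ (ScaledIn W t k) (fun _ _ => ScaledIn.add)
    (map_zero (C : T →+* T[X]) ▸ (scaledIn_C W.zero_mem).mono ht (Nat.zero_le _)) fun m hm' => ?_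
  rw [IsScalarTower.algebraMap_apply K T T[X], algebraMap_eq]
  have := ((scaledIn_C (t := t) (hK (MvPolynomial.coeff m h))).mul (hm m)).mono ht (l := k) (by
    rw [zero_add]; exact (MvPolynomial.le_totalDegree hm').trans hk)
  exact this

lemma natDegree_linePoly_le {k : ℕ} (hk : h.totalDegree ≤ k) : (linePoly w h χ).natDegree ≤ k :=
  (scaledIn_linePoly (W := ⊤) (t := 1) w h χ (fun _ => trivial) trivial (fun _ => trivial) hk).1

lemma coeff_linePoly {k : ℕ} (hk : h.totalDegree ≤ k) : (linePoly w h χ).coeff k =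
    algebraMap K T (MvPolynomial.eval w (MvPolynomial.homogeneousComponent k h)) := by
  classical
  have hl : ∀ (l : ι) j, (((C (χ l) + C (algebraMap K T (w l)) * X) ^ j).natDegree ≤ j) := by
    intro l j
    compute_degree
  have hl' : ∀ (l : ι) j, ((C (χ l) + C (algebraMap K T (w l)) * X) ^ j).coeff j =
      algebraMap K T (w l) ^ j := by
    intro l j
    have := coeff_pow_of_natDegree_le (p := C (χ l) + C (algebraMap K T (w l)) * X) (n := 1)
      (by compute_degree) (m := j)
    simpa using this
  have hm : ∀ (m : ι →₀ ℕ),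
      (m.prod fun l j => (C (χ l) + C (algebraMap K T (w l)) * X) ^ j).natDegree ≤ m.degree ∧
      (m.prod fun l j => (C (χ l) + C (algebraMap K T (w l)) * X) ^ j).coeff m.degree =
        algebraMap K T (m.prod fun l j => w l ^ j) := by
    intro m
    induction m using Finsupp.induction with
    | zero => simp
    | single_add l j m hlm hj ih =>
      rw [Finsupp.prod_add_index' (by simp) (by simp [pow_add]), Finsupp.prod_single_index (by simp),
        Finsupp.prod_add_index' (by simp) (by simp [pow_add]), Finsupp.prod_single_index (by simp),
        map_add, Finsupp.degree_single]
      refine ⟨natDegree_mul_le_of_le (hl l j) ih.1, ?_⟩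
      rw [coeff_mul_add_eq_of_natDegree_le (hl l j) ih.1, ih.2, hl', map_mul, map_pow]
  rw [linePoly, MvPolynomial.aeval_def, MvPolynomial.eval₂_eq, finsetSum_coeff,
    MvPolynomial.homogeneousComponent_apply, map_sum, map_sum, Finset.sum_filter]
  refine Finset.sum_congr rfl fun m hm' => ?_
  rw [IsScalarTower.algebraMap_apply K T T[X], algebraMap_eq, coeff_C_mul,
    MvPolynomial.eval_monomial, map_mul]
  have hle := (MvPolynomial.le_totalDegree hm').trans hk
  split_ifs with hmk
  · rw [← hmk]
    congr 1
    exact (hm m).2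
  · refine mul_eq_zero_of_right _ ?_
    exact coeff_eq_zero_of_natDegree_lt ((hm m).1.trans_lt (lt_of_le_of_ne hle hmk))

lemma linePoly_zero : linePoly (0 : ι → K) h χ = C (MvPolynomial.aeval χ h) := by
  have : (C (MvPolynomial.aeval χ h) : T[X]) =
      (CAlgHom (R := K) (A := T)) (MvPolynomial.aeval χ h) := rfl
  rw [this, ← AlgHom.comp_apply, MvPolynomial.comp_aeval, linePoly]
  congr 2
  funext l
  simp [CAlgHom]

lemma aeval_mul_pow_mem {W : ValuationSubring T} (hK : ∀ a : K, algebraMap K T a ∈ W) {t : T}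
    (ht : t ∈ W) (hχ : ∀ l, χ l * t ∈ W) {k : ℕ} (hk : h.totalDegree ≤ k) :
    MvPolynomial.aeval χ h * t ^ k ∈ W := by
  have := (scaledIn_linePoly 0 h χ hK ht hχ hk).2 0
  rwa [linePoly_zero, coeff_C_zero, Nat.sub_zero] at this

end Line

end InvHyp

namespace InvHyp

set_option linter.unusedSectionVars false

section TraceSum

open Polynomial

variable {k κ : Type*} [Field k] [Field κ] [Algebra k κ]

/-- The trace of `N(s) g(r)`, where the trace is applied to the coefficients. -/
noncomputable def traceSum (k : Type*) [Field k] [Algebra k κ] {T : Type*} [CommRing T]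
    [Algebra k T] (N g : κ[X]) (s r : T) : T :=
  ∑ a ∈ Finset.range (N.natDegree + 1), ∑ b ∈ Finset.range (g.natDegree + 1),
    algebraMap k T (Algebra.trace k κ (N.coeff a * g.coeff b)) * (s ^ a * r ^ b)

lemma map_traceSum {T T' : Type*} [CommRing T] [Algebra k T] [CommRing T'] [Algebra k T']
    (ψ : T →ₐ[k] T') (N g : κ[X]) (s r : T) :
    ψ (traceSum k N g s r) = traceSum k N g (ψ s) (ψ r) := by
  simp [traceSum]

lemma traceSum_eq_sum [CharZero k] [FiniteDimensional k κ] {T : Type*} [Field T] [Algebra k T]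
    [IsAlgClosed T] (N g : κ[X]) (s r : T) :
    traceSum k N g s r = ∑ σ : κ →ₐ[k] T,
      (N.map (σ : κ →+* T)).eval s * (g.map (σ : κ →+* T)).eval r := by
  simp only [traceSum, trace_eq_sum_embeddings T, Finset.sum_mul]
  have : ∀ σ : κ →ₐ[k] T, (N.map (σ : κ →+* T)).eval s * (g.map (σ : κ →+* T)).eval r =
      ∑ a ∈ Finset.range (N.natDegree + 1), ∑ b ∈ Finset.range (g.natDegree + 1),
        σ (N.coeff a * g.coeff b) * (s ^ a * r ^ b) := by
    intro σ
    rw [eval_map, eval_map, eval₂_eq_sum_range, eval₂_eq_sum_range, Finset.sum_mul_sum]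
    refine Finset.sum_congr rfl fun a _ => Finset.sum_congr rfl fun b _ => ?_
    simp only [map_mul, RingHom.coe_coe]
    ring
  simp_rw [this]
  exact (Finset.sum_comm.trans (Finset.sum_congr rfl fun a _ => Finset.sum_comm)).symm

end TraceSum

section Fiber

open Polynomial

variable {K : Type*} [Field K] {ι : Type*}

/-- The polynomial obtained from `f` by specializing the coordinates of the base to `ξ`. -/
noncomputable def fiberPoly (f : (MvPolynomial ι K)[X]) {T : Type*} [CommRing T] [Algebra K T]
    (ξ : ι → T) : T[X] := f.map (MvPolynomial.aeval ξ : MvPolynomial ι K →ₐ[K] T)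

variable (f : (MvPolynomial ι K)[X])

lemma map_fiberPoly {T T' : Type*} [CommRing T] [Algebra K T] [CommRing T'] [Algebra K T']
    (σ : T →ₐ[K] T') (ξ : ι → T) :
    (fiberPoly f ξ).map (σ : T →+* T') = fiberPoly f (fun l => σ (ξ l)) := by
  rw [fiberPoly, fiberPoly, map_map]
  congr 1
  refine MvPolynomial.ringHom_ext ?_ ?_
  · intro r; simp
  · intro i; simp

lemma scaledIn_fiberPoly {T : Type*} [Field T] [Algebra K T] {W : ValuationSubring T}
    (hK : ∀ a : K, algebraMap K T a ∈ W) {t : T} (ht : t ∈ W) {ξ : ι → T}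
    (hξ : ∀ l, ξ l * t ∈ W) {D d : ℕ} (hf : f.natDegree ≤ d)
    (hD : ∀ j, (f.coeff j).totalDegree ≤ D * (d - j)) :
    ScaledIn W (t ^ D) d (fiberPoly f ξ) := by
  refine ⟨natDegree_map_le.trans hf, fun b => ?_⟩
  rw [fiberPoly, coeff_map, ← pow_mul]
  exact aeval_mul_pow_mem (f.coeff b) ξ hK ht hξ (hD b)

end Fiber

section Core

open Polynomial

variable {K : Type*} [Field K] {ι : Type*} [Fintype ι]
  {k κ F : Type*} [Field k] [Field κ] [Field F] [Algebra K k] [Algebra K κ] [Algebra K F]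
  [Algebra k κ] [Algebra k F] [IsScalarTower K k κ] [IsScalarTower K k F]
  [CharZero k] [FiniteDimensional k κ]
  (w : ι → K) (h : MvPolynomial ι K) (f : (MvPolynomial ι K)[X]) (χ : ι → k) (u η : κ)

/-- The numerator of the trace of the logarithmic kernel. -/
noncomputable def logTrace {T : Type*} [CommRing T] [Algebra k T] (s r : T) : T :=
  traceSum k (linePoly w h (fun l => algebraMap k κ (χ l)) /ₘ (X - C u))
    (fiberPoly f (fun l => algebraMap k κ (χ l) + algebraMap K κ (w l) * u) /ₘ (X - C η)) s r

lemma map_logTrace {T T' : Type*} [CommRing T] [Algebra k T] [CommRing T'] [Algebra k T']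
    (ψ : T →ₐ[k] T') (s r : T) :
    ψ (logTrace w h f χ u η s r) = logTrace w h f χ u η (ψ s) (ψ r) :=
  map_traceSum ψ _ _ s r

lemma logTrace_eq_sum {T : Type*} [Field T] [Algebra k T] [Algebra K T] [IsScalarTower K k T]
    [IsAlgClosed T] (s r : T) : logTrace w h f χ u η s r = ∑ σ : κ →ₐ[k] T,
      (linePoly w h (fun l => algebraMap k T (χ l)) /ₘ (X - C (σ u))).eval s *
      (fiberPoly f (fun l => algebraMap k T (χ l) + algebraMap K T (w l) * σ u) /ₘ
        (X - C (σ η))).eval r := by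
  rw [logTrace, traceSum_eq_sum]
  refine Finset.sum_congr rfl fun σ _ => ?_
  have hm : ∀ (p : κ[X]) (a : κ), (p /ₘ (X - C a)).map (σ : κ →+* T) =
      p.map (σ : κ →+* T) /ₘ (X - C (σ a)) := by
    intro p a
    rw [map_divByMonic _ (monic_X_sub_C a)]
    simp
  have h1 := map_linePoly w h (fun l => algebraMap k κ (χ l)) (σ.restrictScalars K)
  have h2 := map_fiberPoly f (σ.restrictScalars K)
    (fun l => algebraMap k κ (χ l) + algebraMap K κ (w l) * u)
  simp only [AlgHom.coe_restrictScalars', AlgHom.commutes, map_add, map_mul] at h1 h2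
  rw [hm, hm]
  congr 3

variable {w h f χ u η}
  (hw : MvPolynomial.eval w (MvPolynomial.homogeneousComponent h.totalDegree h) ≠ 0)
  (hf : f.Monic) 
  (hu : (linePoly w h (fun l => algebraMap k κ (χ l))).eval u = 0)
  (hη : (fiberPoly f (fun l => algebraMap k κ (χ l) + algebraMap K κ (w l) * u)).eval η = 0)

include hu in
lemma eval_linePoly_emb {T : Type*} [Field T] [Algebra k T] [Algebra K T] [IsScalarTower K k T]
    (σ : κ →ₐ[k] T) : (linePoly w h (fun l => algebraMap k T (χ l))).eval (σ u) = 0 := by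
  have h1 := map_linePoly w h (fun l => algebraMap k κ (χ l)) (σ.restrictScalars K)
  simp only [AlgHom.coe_restrictScalars', AlgHom.commutes] at h1
  rw [← h1]
  have h2 := eval_map_apply (f := ((σ.restrictScalars K : κ →ₐ[K] T) : κ →+* T))
    (p := linePoly w h (fun l => algebraMap k κ (χ l))) u
  simp only [RingHom.coe_coe, AlgHom.coe_restrictScalars'] at h2
  rw [h2, hu, map_zero]

include hη in
lemma eval_fiberPoly_emb {T : Type*} [Field T] [Algebra k T] [Algebra K T] [IsScalarTower K k T]
    (σ : κ →ₐ[k] T) : (fiberPoly f (fun l => algebraMap k T (χ l) + algebraMap K T (w l) * σ u)).eval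
      (σ η) = 0 := by
  have h1 := map_fiberPoly f (σ.restrictScalars K)
    (fun l => algebraMap k κ (χ l) + algebraMap K κ (w l) * u)
  simp only [AlgHom.coe_restrictScalars', AlgHom.commutes, map_add, map_mul] at h1
  rw [← h1]
  have h2 := eval_map_apply (f := ((σ.restrictScalars K : κ →ₐ[K] T) : κ →+* T))
    (p := fiberPoly f (fun l => algebraMap k κ (χ l) + algebraMap K κ (w l) * u)) η
  simp only [RingHom.coe_coe, AlgHom.coe_restrictScalars'] at h2
  rw [h2, hη, map_zero]

include hw hf hu hη in
lemma logTrace_mul_mem {D : ℕ} (hD : ∀ j, (f.coeff j).totalDegree ≤ D * (f.natDegree - j))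
    {s y : F} (hy : (fiberPoly f (fun l => algebraMap k F (χ l) + algebraMap K F (w l) * s)).eval y = 0)
    {v : ValuationSubring F} (hK : ∀ a : K, algebraMap K F a ∈ v) {t : F} (ht : t ∈ v)
    (hx : ∀ l, algebraMap k F (χ l) * t ∈ v) (hs : s * t ∈ v) :
    logTrace w h f χ u η s y *
      t ^ (h.totalDegree - 1 + D * (f.natDegree - 1)) ∈ v := by
  classical
  refine v.mem_of_isIntegral' (D := v) (fun d => d.2) ?_
  let T := AlgebraicClosure F
  rw [← isIntegral_algebraMap_iff (algebraMap F T).injective]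
  refine isIntegral_of_forall_valuationSubring fun V hV => ?_
  have hV' : ∀ z ∈ v, algebraMap F T z ∈ V := fun z hz => hV ⟨z, hz⟩
  have hKT : ∀ a : K, algebraMap K T a ∈ V := fun a => by
    rw [IsScalarTower.algebraMap_apply K F T]; exact hV' _ (hK a)
  set τ : T := algebraMap F T t with hτ
  have hkT : ∀ l, algebraMap k T (χ l) * τ ∈ V := fun l => by
    rw [IsScalarTower.algebraMap_apply k F T, ← map_mul]; exact hV' _ (hx l)
  have hsT : algebraMap F T s * τ ∈ V := by rw [← map_mul]; exact hV' _ hs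
  have hτV : τ ∈ V := hV' _ ht
  rw [map_mul, map_pow]
  have h1 := map_logTrace w h f χ u η (IsScalarTower.toAlgHom k F T) s y
  simp only [IsScalarTower.coe_toAlgHom'] at h1
  rw [h1, logTrace_eq_sum, Finset.sum_mul]
  refine sum_mem fun σ _ => ?_
  have hl : ScaledIn V τ h.totalDegree (linePoly w h (fun l => algebraMap k T (χ l))) :=
    scaledIn_linePoly w h _ hKT hτV hkT le_rfl
  have hσu : σ u * τ ∈ V := by
    refine hl.mul_mem_of_isRoot ?_ (eval_linePoly_emb hu σ)
    rw [coeff_linePoly w h _ le_rfl]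
    refine valuation_eq_one_of_mem_of_inv_mem ?_ (hKT _) ?_
    · simpa using hw
    · rw [← map_inv₀]; exact hKT _
  have hwσ : ∀ l, (algebraMap k T (χ l) + algebraMap K T (w l) * σ u) * τ ∈ V := fun l => by
    rw [add_mul, mul_assoc]
    exact add_mem (hkT l) (mul_mem (hKT _) hσu)
  have hws : ∀ l, (algebraMap k T (χ l) + algebraMap K T (w l) * algebraMap F T s) * τ ∈ V :=
    fun l => by
      rw [add_mul, mul_assoc]
      exact add_mem (hkT l) (mul_mem (hKT _) hsT)
  have hlead : ∀ ξ : ι → T, V.valuation ((fiberPoly f ξ).coeff f.natDegree) = 1 := fun ξ => by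
    rw [fiberPoly, coeff_map, hf.coeff_natDegree]; simp
  have hg := scaledIn_fiberPoly f hKT hτV hwσ le_rfl hD
  have hση : σ η * τ ^ D ∈ V :=
    hg.mul_mem_of_isRoot (hlead _) (eval_fiberPoly_emb hη σ)
  have hyT : algebraMap F T y * τ ^ D ∈ V := by
    refine (scaledIn_fiberPoly f hKT hτV hws le_rfl hD).mul_mem_of_isRoot (hlead _) ?_
    have h2 := map_fiberPoly f (IsScalarTower.toAlgHom K F T)
      (fun l => algebraMap k F (χ l) + algebraMap K F (w l) * s)
    simp only [IsScalarTower.coe_toAlgHom', map_add, map_mul,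
      ← IsScalarTower.algebraMap_apply] at h2
    rw [← h2]
    have h3 := eval_map_apply (f := ((IsScalarTower.toAlgHom K F T : F →ₐ[K] T) : F →+* T))
      (p := fiberPoly f (fun l => algebraMap k F (χ l) + algebraMap K F (w l) * s)) y
    simp only [RingHom.coe_coe, IsScalarTower.coe_toAlgHom'] at h3
    rw [h3, hy, map_zero]
  have := mul_mem (hl.eval_divByMonic_mem hσu hsT) (hg.eval_divByMonic_mem hση hyT)
  rw [pow_add, pow_mul]
  convert this using 1
  ring

include hu hη in
open Classical in
/-- The value of the trace at a zero of both polynomials counts the embeddings that map the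
point `(u, η)` to the given one. -/
lemma logTrace_eq_card {T : Type*} [Field T] [Algebra k T] [Algebra K T] [IsScalarTower K k T]
    [IsAlgClosed T] {s r : T}
    (hs : (linePoly w h (fun l => algebraMap k T (χ l))).eval s = 0)
    (hr : (fiberPoly f (fun l => algebraMap k T (χ l) + algebraMap K T (w l) * s)).eval r = 0) :
    logTrace w h f χ u η s r = (Finset.univ.filter fun σ : κ →ₐ[k] T => σ u = s ∧ σ η = r).card *
      ((derivative (linePoly w h (fun l => algebraMap k T (χ l)))).eval s *
      (derivative (fiberPoly f
        (fun l => algebraMap k T (χ l) + algebraMap K T (w l) * s))).eval r) := by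
  rw [logTrace_eq_sum, ← nsmul_eq_mul, ← Finset.sum_const, Finset.sum_filter]
  refine Finset.sum_congr rfl fun σ _ => ?_
  rw [eval_divByMonic_of_isRoot (eval_linePoly_emb hu σ) hs]
  by_cases h1 : σ u = s
  · have h2 := eval_fiberPoly_emb hη σ
    rw [h1] at h2 ⊢
    rw [if_pos rfl, eval_divByMonic_of_isRoot h2 hr]
    by_cases h3 : σ η = r
    · simp [h3]
    · simp [h3]
  · simp [h1]

end Core

end InvHyp

namespace InvHyp

section PointEval

open Polynomial

variable {K : Type*} [Field K] {ι : Type*}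

/-- Evaluation of polynomials in the coordinates and one further variable. -/
noncomputable def pev {T : Type*} [CommRing T] [Algebra K T] (ξ : ι → T) (r : T) :
    (MvPolynomial ι K)[X] →+* T :=
  eval₂RingHom (MvPolynomial.aeval ξ : MvPolynomial ι K →ₐ[K] T) r

lemma pev_apply {T : Type*} [CommRing T] [Algebra K T] (ξ : ι → T) (r : T)
    (q : (MvPolynomial ι K)[X]) : pev ξ r q = (fiberPoly q ξ).eval r := by
  rw [fiberPoly, eval_map]; rfl

@[simp] lemma pev_C {T : Type*} [CommRing T] [Algebra K T] (ξ : ι → T) (r : T)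
    (p : MvPolynomial ι K) : pev ξ r (C p) = MvPolynomial.aeval ξ p := by
  simp [pev]

@[simp] lemma pev_X {T : Type*} [CommRing T] [Algebra K T] (ξ : ι → T) (r : T) :
    pev ξ r (X : (MvPolynomial ι K)[X]) = r := by
  simp [pev]

lemma pev_ext {T : Type*} [CommRing T] {φ ψ : (MvPolynomial ι K)[X] →+* T}
    (hK : ∀ a, φ (C (MvPolynomial.C a)) = ψ (C (MvPolynomial.C a)))
    (hι : ∀ l, φ (C (MvPolynomial.X l)) = ψ (C (MvPolynomial.X l))) (hX : φ X = ψ X) : φ = ψ := by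
  refine Polynomial.ringHom_ext (fun p => ?_) hX
  exact congrFun (congrArg DFunLike.coe (MvPolynomial.ringHom_ext (f := φ.comp C) (g := ψ.comp C)
    hK hι)) p

end PointEval

section Slope

open Polynomial

variable {K : Type*} [Field K] {ι : Type*} {h : MvPolynomial ι K} {w : ι → K} {i₀ : ι}

lemma linePoly_mul {T : Type*} [Field T] [Algebra K T] (w : ι → K) (p q : MvPolynomial ι K)
    (χ : ι → T) : linePoly w (p * q) χ = linePoly w p χ * linePoly w q χ := by
  simp [linePoly]

lemma exists_ne_zero_of_direction (hh : Irreducible h)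
    (hw : MvPolynomial.eval w (MvPolynomial.homogeneousComponent h.totalDegree h) ≠ 0) :
    ∃ i, w i ≠ 0 := by
  by_contra! hw0
  have h1 : w = 0 := funext hw0
  have h2 : h.totalDegree ≠ 0 := by
    intro h3
    rw [MvPolynomial.totalDegree_eq_zero_iff_eq_C] at h3
    have h4 : MvPolynomial.coeff 0 h ≠ 0 := fun h5 => hh.ne_zero (by rw [h3, h5, map_zero])
    exact hh.not_isUnit (by rw [h3]; exact (IsUnit.mk0 _ h4).map MvPolynomial.C)
  apply hw
  rw [h1, MvPolynomial.homogeneousComponent_apply, map_sum]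
  refine Finset.sum_eq_zero fun m hm => ?_
  rw [MvPolynomial.eval_monomial]
  have hm0 : m ≠ 0 := by
    rintro rfl
    exact h2 (by simpa using (Finset.mem_filter.1 hm).2.symm)
  obtain ⟨i, hi⟩ := Finsupp.ne_iff.1 hm0
  rw [Finsupp.prod, Finset.prod_eq_zero (Finsupp.mem_support_iff.2 hi), mul_zero]
  simpa using hi

open Classical in
/-- The coordinates on the space of lines in direction `w`. -/
noncomputable def slopeCoord (K : Type*) [Field K] (i₀ : ι) :
    ι → FractionRing (MvPolynomial {l : ι // l ≠ i₀} K) :=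
  fun l => if hl : l = i₀ then 0 else algebraMap (MvPolynomial {l : ι // l ≠ i₀} K) _ (MvPolynomial.X ⟨l, hl⟩)

lemma slope_injective (hh : Irreducible h)
    (hw : MvPolynomial.eval w (MvPolynomial.homogeneousComponent h.totalDegree h) ≠ 0)
    (hi : w i₀ ≠ 0) {T : Type*} [Field T] [Algebra K T] (ξ : ι → T)
    (hξ : ∀ p, MvPolynomial.aeval ξ p = 0 → h ∣ p) :
    Function.Injective (MvPolynomial.aeval (R := K) (fun l : {l : ι // l ≠ i₀} =>
      ξ l - algebraMap K T (w l) * (ξ i₀ / algebraMap K T (w i₀)))) := by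
  classical
  rw [injective_iff_map_eq_zero]
  intro q hq
  let θ : MvPolynomial {l : ι // l ≠ i₀} K →ₐ[K] MvPolynomial ι K := MvPolynomial.aeval
    (fun l => MvPolynomial.X (l : ι) - MvPolynomial.C (w l / w i₀) * MvPolynomial.X i₀)
  have h1 : MvPolynomial.aeval ξ (θ q) = 0 := by
    rw [← hq, ← AlgHom.comp_apply, MvPolynomial.comp_aeval]
    congr 2
    funext l
    simp only [map_sub, map_mul, MvPolynomial.aeval_X, MvPolynomial.aeval_C, map_div₀]
    ring
  obtain ⟨g, hg⟩ := hξ _ h1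
  set χ := slopeCoord K i₀ with hχ
  have h2 : linePoly w (θ q) χ = C (algebraMap _ _ q) := by
    have : (C (algebraMap _ (FractionRing (MvPolynomial {l : ι // l ≠ i₀} K)) q)) =
      ((CAlgHom (R := K) (A := FractionRing (MvPolynomial {l : ι // l ≠ i₀} K))).comp
        (IsScalarTower.toAlgHom K (MvPolynomial {l : ι // l ≠ i₀} K) _)) q := rfl
    rw [this, linePoly, ← AlgHom.comp_apply, MvPolynomial.comp_aeval]
    congr 1
    refine MvPolynomial.algHom_ext fun l => ?_
    have e1 : ∀ a : K, algebraMap K (FractionRing (MvPolynomial {l : ι // l ≠ i₀} K))[X] a =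
        C (algebraMap K (FractionRing (MvPolynomial {l : ι // l ≠ i₀} K)) a) := fun _ => rfl
    have e2 : algebraMap K (FractionRing (MvPolynomial {l : ι // l ≠ i₀} K)) (w l) =
        algebraMap K _ (w l / w i₀) * algebraMap K _ (w i₀) := by
      rw [← map_mul, div_mul_cancel₀ _ hi]
    have e3 : χ i₀ = 0 := by simp [hχ, slopeCoord]
    have e4 : χ l = algebraMap (MvPolynomial {l : ι // l ≠ i₀} K) _ (MvPolynomial.X l) := by
      simp [hχ, slopeCoord, l.2]
    simp only [MvPolynomial.aeval_X, map_sub, map_mul, MvPolynomial.aeval_C, AlgHom.comp_apply,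
      IsScalarTower.coe_toAlgHom', CAlgHom_apply]
    change C (χ l) + C (algebraMap K _ (w l)) * X - algebraMap K _ (w l / w i₀) * (C (χ i₀) + C (algebraMap K _ (w i₀)) * X) = _
    rw [e1, e3, e4, e2, map_mul, map_zero]
    ring
  rw [hg, linePoly_mul] at h2
  have he : h.totalDegree ≠ 0 := by
    intro h3
    rw [MvPolynomial.totalDegree_eq_zero_iff_eq_C] at h3
    have h4 : MvPolynomial.coeff 0 h ≠ 0 := fun h5 => hh.ne_zero (by rw [h3, h5, map_zero])
    exact hh.not_isUnit (by rw [h3]; exact (IsUnit.mk0 _ h4).map MvPolynomial.C)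
  have h3 : (linePoly w h χ).coeff h.totalDegree ≠ 0 := by
    rw [coeff_linePoly w h χ le_rfl]; simpa using hw
  have h4 : linePoly w g χ = 0 := by
    by_contra h5
    have h6 := congrArg natDegree h2
    rw [natDegree_C, natDegree_mul (fun h7 => h3 (by rw [h7, coeff_zero])) h5] at h6
    have := le_natDegree_of_ne_zero h3
    omega
  rw [h4, mul_zero, eq_comm, C_eq_zero] at h2
  exact (IsFractionRing.injective _ _) (by rw [h2, map_zero])

end Slope

end InvHyp

namespace InvHyp

universe uB uT in
lemma exists_residue_field_of_prime {B : Type uB} [CommRing B] (P : Ideal B) [P.IsPrime] :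
    ∃ (κ : Type uB) (_ : Field κ) (ev : B →+* κ), (∀ q, ev q = 0 ↔ q ∈ P) ∧
      (∀ z, ∃ a b, z = ev a / ev b) ∧
      ∀ (T : Type uT) [Field T] (ψ : B →+* T), (∀ q, ψ q = 0 ↔ q ∈ P) →
        ∃ σ : κ →+* T, ∀ q, σ (ev q) = ψ q := by
  refine ⟨FractionRing (B ⧸ P), inferInstance,
    (algebraMap (B ⧸ P) (FractionRing (B ⧸ P))).comp (Ideal.Quotient.mk P),
    fun q => ?_, fun z => ?_, fun T _ ψ hψ => ?_⟩
  · rw [← Ideal.Quotient.eq_zero_iff_mem]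
    exact map_eq_zero_iff _ (IsFractionRing.injective (B ⧸ P) (FractionRing (B ⧸ P)))
  · obtain ⟨a, b, -, rfl⟩ := IsFractionRing.div_surjective (A := B ⧸ P) z
    obtain ⟨a, rfl⟩ := Ideal.Quotient.mk_surjective a
    obtain ⟨b, rfl⟩ := Ideal.Quotient.mk_surjective b
    exact ⟨a, b, rfl⟩
  · have hinj : Function.Injective (Ideal.Quotient.lift P ψ fun q hq => (hψ q).2 hq) := by
      rw [injective_iff_map_eq_zero]
      intro z hz
      obtain ⟨a, rfl⟩ := Ideal.Quotient.mk_surjective z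
      rw [Ideal.Quotient.lift_mk] at hz
      exact Ideal.Quotient.eq_zero_iff_mem.2 ((hψ a).1 hz)
    refine ⟨IsFractionRing.lift hinj, fun q => ?_⟩
    change IsFractionRing.lift hinj (algebraMap (B ⧸ P) _ (Ideal.Quotient.mk P q)) = _
    rw [IsFractionRing.lift_algebraMap, Ideal.Quotient.lift_mk]

section Slope

universe uK uI uF

open Polynomial

variable {K : Type uK} [Field K] {ι : Type uI} {h : MvPolynomial ι K} {w : ι → K} {i₀ : ι}

lemma exists_slope_algHom (hh : Irreducible h)
    (hw : MvPolynomial.eval w (MvPolynomial.homogeneousComponent h.totalDegree h) ≠ 0)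
    (hi : w i₀ ≠ 0) {T : Type*} [Field T] [Algebra K T] (ξ : ι → T)
    (hξ : ∀ p, MvPolynomial.aeval ξ p = 0 → h ∣ p) :
    ∃ θ : FractionRing (MvPolynomial {l : ι // l ≠ i₀} K) →ₐ[K] T, ∀ l,
      ξ l = θ (slopeCoord K i₀ l) + algebraMap K T (w l) * (ξ i₀ / algebraMap K T (w i₀)) := by
  refine ⟨IsFractionRing.liftAlgHom (slope_injective hh hw hi ξ hξ), fun l => ?_⟩
  have hw0 : algebraMap K T (w i₀) ≠ 0 := by simpa using hi
  by_cases hl : l = i₀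
  · subst hl
    simp only [slopeCoord, dif_pos, map_zero, zero_add]
    field_simp
  · simp only [slopeCoord, dif_neg hl]
    rw [IsFractionRing.liftAlgHom_apply, IsFractionRing.lift_algebraMap]
    simp

lemma finiteDimensional_of_point {k κ : Type*} [Field k] [Field κ] [Algebra K k] [Algebra K κ]
    [Algebra k κ] [IsScalarTower K k κ] {f : (MvPolynomial ι K)[X]} (hf : f.Monic)
    {χ : ι → k} {u η : κ} (hl : linePoly w h χ ≠ 0)
    (hu : (linePoly w h (fun l => algebraMap k κ (χ l))).eval u = 0)
    (hη : (fiberPoly f (fun l => algebraMap k κ (χ l) + algebraMap K κ (w l) * u)).eval η = 0)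
    (hgen : ∀ z : κ, ∃ a b : (MvPolynomial ι K)[X], z = pev (fun l => algebraMap k κ (χ l) + algebraMap K κ (w l) * u) η a /
      pev (fun l => algebraMap k κ (χ l) + algebraMap K κ (w l) * u) η b) :
    FiniteDimensional k κ := by
  have hui : IsIntegral k u := by
    rw [← isAlgebraic_iff_isIntegral]
    refine ⟨linePoly w h χ, hl, ?_⟩
    have := map_linePoly w h χ (IsScalarTower.toAlgHom K k κ)
    simp only [IsScalarTower.coe_toAlgHom'] at this
    rw [← this] at hu
    rw [aeval_def, ← eval_map]
    exact hu
  set ξ : ι → κ := fun l => algebraMap k κ (χ l) + algebraMap K κ (w l) * u with hξ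
  have hξi : ∀ l, IsIntegral k (ξ l) := fun l => by
    refine isIntegral_algebraMap.add (IsIntegral.mul ?_ hui)
    rw [IsScalarTower.algebraMap_apply K k κ]
    exact isIntegral_algebraMap
  have hηi : IsIntegral k η := by
    let A := integralClosure k κ
    have hA : IsIntegral A η := by
      refine ⟨f.map (MvPolynomial.aeval (fun l => (⟨ξ l, hξi l⟩ : A)) : MvPolynomial ι K →ₐ[K] A),
        hf.map _, ?_⟩
      have e : (algebraMap A κ).comp
          (MvPolynomial.aeval (fun l => (⟨ξ l, hξi l⟩ : A)) : MvPolynomial ι K →ₐ[K] A) =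
          ((MvPolynomial.aeval ξ : MvPolynomial ι K →ₐ[K] κ) : MvPolynomial ι K →+* κ) := by
        refine MvPolynomial.ringHom_ext (fun a => ?_) fun i => ?_
        · simp [← IsScalarTower.algebraMap_apply]
        · simp only [RingHom.comp_apply, RingHom.coe_coe, MvPolynomial.aeval_X]; rfl
      rw [← eval_map, map_map, e]
      exact hη
    exact isIntegral_trans (R := k) (A := A) η hA
  have htop : IntermediateField.adjoin k {u, η} = ⊤ := by
    refine eq_top_iff.2 fun z _ => ?_
    have hpe : ∀ a : (MvPolynomial ι K)[X], pev ξ η a ∈ IntermediateField.adjoin k {u, η} := by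
      have hum : u ∈ IntermediateField.adjoin k {u, η} :=
        IntermediateField.subset_adjoin _ _ (by simp)
      have hηm : η ∈ IntermediateField.adjoin k {u, η} :=
        IntermediateField.subset_adjoin _ _ (by simp)
      have hK : ∀ a : K, algebraMap K κ a ∈ IntermediateField.adjoin k {u, η} := fun a => by
        rw [IsScalarTower.algebraMap_apply K k κ]; exact IntermediateField.algebraMap_mem _ _
      have hp : ∀ p : MvPolynomial ι K,
          MvPolynomial.aeval ξ p ∈ IntermediateField.adjoin k {u, η} := fun p => by
        induction p using MvPolynomial.induction_on with
        | C a => simpa using hK a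
        | add p q hp hq => rw [map_add]; exact add_mem hp hq
        | mul_X p i hp =>
          rw [map_mul, MvPolynomial.aeval_X]
          exact mul_mem hp (add_mem (IntermediateField.algebraMap_mem _ _) (mul_mem (hK _) hum))
      intro a
      induction a using Polynomial.induction_on' with
      | add p q hp hq => rw [map_add]; exact add_mem hp hq
      | monomial n p =>
        rw [← C_mul_X_pow_eq_monomial, map_mul, map_pow, pev_C, pev_X]
        exact mul_mem (hp p) (pow_mem hηm n)
    obtain ⟨a, b, rfl⟩ := hgen z
    exact div_mem (hpe a) (hpe b)
  have h1 : FiniteDimensional k (IntermediateField.adjoin k {u, η}) :=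
    IntermediateField.finiteDimensional_adjoin_pair hui hηi
  rw [htop] at h1
  exact Module.Finite.equiv (IntermediateField.topEquiv (F := k) (E := κ)).toLinearEquiv

/-- There is a function with bounded poles whose residue along the divisors over `h` picks out the
divisor with center `P`. -/
theorem exists_log_numerator [Fintype ι] [CharZero K] (hh : Irreducible h)
    (hw : MvPolynomial.eval w (MvPolynomial.homogeneousComponent h.totalDegree h) ≠ 0)
    {f : (MvPolynomial ι K)[X]} (hf : f.Monic) {D : ℕ}
    (hD : ∀ j, (f.coeff j).totalDegree ≤ D * (f.natDegree - j))
    {P : Ideal (MvPolynomial ι K)[X]} [P.IsPrime] (hfP : f ∈ P) (hP : ∀ p, C p ∈ P ↔ h ∣ p)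
    {F : Type uF} [Field F] [Algebra K F] {x : ι → F} (hx : AlgebraicIndependent K x) {y : F}
    (hy : pev x y f = 0) :
    ∃ c : F, (∀ (v : ValuationSubring F) (t : F), (∀ a : K, algebraMap K F a ∈ v) → t ∈ v →
        (∀ l, x l * t ∈ v) → c * t ^ (h.totalDegree - 1 + D * (f.natDegree - 1)) ∈ v) ∧
      ∀ v : ValuationSubring F, (∀ a : K, algebraMap K F a ∈ v) → (∀ l, x l ∈ v) → y ∈ v →
        (∀ p, v.valuation (MvPolynomial.aeval x p) < 1 ↔ h ∣ p) →
        ((∀ q, v.valuation (pev x y q) < 1 ↔ q ∈ P) → v.valuation (c - pev x y (derivative f) *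
          ∑ l, algebraMap K F (w l) * MvPolynomial.aeval x (MvPolynomial.pderiv l h)) < 1) ∧
        ((¬ ∀ q, v.valuation (pev x y q) < 1 ↔ q ∈ P) → v.valuation c < 1) := by
  classical
  obtain ⟨i₀, hi⟩ := exists_ne_zero_of_direction hh hw
  let k := FractionRing (MvPolynomial {l : ι // l ≠ i₀} K)
  have : CharZero k := charZero_of_injective_algebraMap (algebraMap K k).injective
  set χ : ι → k := slopeCoord K i₀
  obtain ⟨κ, _, ev, hev, hgen, hlift⟩ := exists_residue_field_of_prime.{_, uF} P
  let _ : Algebra K κ := (ev.comp (C.comp MvPolynomial.C)).toAlgebra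
  have hevK : ∀ a, ev (C (MvPolynomial.C a)) = algebraMap K κ a := fun _ => rfl
  -- the coordinates of the point of `P` and of `F`
  set ξ : ι → κ := fun l => ev (C (MvPolynomial.X l)) with hξ
  have hev' : ev = pev ξ (ev X) := pev_ext (by simp [hevK]) (by simp [hξ]) (by simp)
  have hξh : ∀ p, MvPolynomial.aeval ξ p = 0 → h ∣ p := fun p hp => by
    rw [← hP, ← hev, hev', pev_C, hp]
  have hxh : ∀ p, MvPolynomial.aeval x p = 0 → h ∣ p := fun p hp => by
    rw [(injective_iff_map_eq_zero _).1 hx p hp]; exact dvd_zero h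
  obtain ⟨θκ, hθκ⟩ := exists_slope_algHom hh hw hi ξ hξh
  obtain ⟨θF, hθF⟩ := exists_slope_algHom hh hw hi x hxh
  let _ : Algebra k κ := θκ.toRingHom.toAlgebra
  let _ : Algebra k F := θF.toRingHom.toAlgebra
  have : IsScalarTower K k κ := IsScalarTower.of_algebraMap_eq fun a => (θκ.commutes a).symm
  have : IsScalarTower K k F := IsScalarTower.of_algebraMap_eq fun a => (θF.commutes a).symm
  set u : κ := ξ i₀ / algebraMap K κ (w i₀) with hu
  set s : F := x i₀ / algebraMap K F (w i₀) with hs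
  have hξe : ξ = fun l => algebraMap k κ (χ l) + algebraMap K κ (w l) * u := funext hθκ
  have hxe : x = fun l => algebraMap k F (χ l) + algebraMap K F (w l) * s := funext hθF
  have hu0 : (linePoly w h (fun l => algebraMap k κ (χ l))).eval u = 0 := by
    rw [eval_linePoly, ← hξe, ← pev_C ξ (ev X), ← hev', hev, hP]
  have hη0 : (fiberPoly f (fun l => algebraMap k κ (χ l) + algebraMap K κ (w l) * u)).eval
      (ev X) = 0 := by
    rw [← hξe, ← pev_apply, ← hev', hev]; exact hfP
  have hl0 : linePoly w h χ ≠ 0 := fun h0 => by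
    have := coeff_linePoly w h χ le_rfl
    rw [h0, coeff_zero, eq_comm, map_eq_zero] at this
    exact hw this
  have : FiniteDimensional k κ := by
    refine finiteDimensional_of_point hf hl0 hu0 hη0 fun z => ?_
    rw [← hξe, ← hev']
    exact hgen z
  have hsv : ∀ v : ValuationSubring F, (∀ a : K, algebraMap K F a ∈ v) → ∀ t, x i₀ * t ∈ v →
      s * t ∈ v := fun v hK t ht => by
    rw [hs, div_eq_mul_inv, mul_right_comm, ← map_inv₀]
    exact mul_mem ht (hK _)
  refine ⟨logTrace w h f χ u (ev X) s y, fun v t hK ht hxt => ?_, fun v hK hxv hyv hv => ?_⟩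
  · refine logTrace_mul_mem hw hf hu0 hη0 hD ?_ hK ht (fun l => ?_) (hsv v hK t (hxt i₀))
    · rw [← hxe, ← pev_apply, hy]
    · have : algebraMap k F (χ l) = x l - algebraMap K F (w l) * s :=
        eq_sub_of_add_eq (congrFun hxe l).symm
      rw [this, sub_mul, mul_assoc]
      exact sub_mem (hxt l) (mul_mem (hK _) (hsv v hK t (hxt i₀)))
  -- reduction to an algebraically closed residue field
  obtain ⟨T, _, _, ρ, hρ⟩ : ∃ (T : Type uF) (_ : Field T) (_ : IsAlgClosed T) (ρ : v →+* T),
      ∀ z, ρ z = 0 ↔ v.valuation z < 1 := by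
    refine ⟨AlgebraicClosure (IsLocalRing.ResidueField v), inferInstance, inferInstance,
      (algebraMap _ _).comp (IsLocalRing.residue v), fun z => ?_⟩
    rw [RingHom.comp_apply, map_eq_zero, IsLocalRing.residue_eq_zero_iff,
      ValuationSubring.valuation_lt_one_iff]
  have hθF' : ∀ b : MvPolynomial {l : ι // l ≠ i₀} K, algebraMap k F (algebraMap _ k b) =
      MvPolynomial.aeval (fun l : {l : ι // l ≠ i₀} => algebraMap k F (χ l)) b := by
    intro b
    have : (θF.comp (IsScalarTower.toAlgHom K (MvPolynomial {l : ι // l ≠ i₀} K) k)) =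
        MvPolynomial.aeval (fun l : {l : ι // l ≠ i₀} => algebraMap k F (χ l)) := by
      refine MvPolynomial.algHom_ext fun l => ?_
      rw [MvPolynomial.aeval_X]
      change θF _ = θF _
      simp [χ, slopeCoord, l.2]
      rfl
    exact DFunLike.congr_fun this b
  have hsv' : s ∈ v := by simpa using hsv v hK 1 (by simpa using hxv i₀)
  have hχv : ∀ l, algebraMap k F (χ l) ∈ v := fun l => by
    rw [eq_sub_of_add_eq (congrFun hxe l).symm]
    exact sub_mem (hxv l) (mul_mem (hK _) hsv')
  let _ : Algebra K v := ((algebraMap K F).codRestrict v.toSubring hK).toAlgebra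
  have : IsScalarTower K v F := IsScalarTower.of_algebraMap_eq fun _ => rfl
  let _ : Algebra K T := (ρ.comp (algebraMap K v)).toAlgebra
  let ρ' : v →ₐ[K] T := { ρ with commutes' := fun _ => rfl }
  have hval : ∀ p, MvPolynomial.aeval (fun l => ρ ⟨x l, hxv l⟩) p =
      ρ ⟨MvPolynomial.aeval x p, aeval_mem hK hxv p⟩ := by
    intro p
    have h1 : MvPolynomial.aeval (fun l => ρ ⟨x l, hxv l⟩) p =
        ρ' (MvPolynomial.aeval (fun l => (⟨x l, hxv l⟩ : v)) p) := by
      rw [← AlgHom.comp_apply, MvPolynomial.comp_aeval]; rfl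
    rw [h1]
    refine congrArg ρ (Subtype.ext ?_)
    have : ((IsScalarTower.toAlgHom K v F) (MvPolynomial.aeval (fun l => (⟨x l, hxv l⟩ : v)) p)) =
        MvPolynomial.aeval x p := by
      rw [← AlgHom.comp_apply, MvPolynomial.comp_aeval]; rfl
    exact this
  have hkv : ∀ z : k, algebraMap k F z ∈ v := by
    intro z
    obtain ⟨a, b, hb, rfl⟩ := IsFractionRing.div_surjective
      (A := MvPolynomial {l : ι // l ≠ i₀} K) z
    have hb0 : b ≠ 0 := nonZeroDivisors.ne_zero hb
    have hmem : ∀ q, algebraMap k F (algebraMap (MvPolynomial {l : ι // l ≠ i₀} K) k q) ∈ v :=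
      fun q => by rw [hθF']; exact aeval_mem hK (fun l : {l : ι // l ≠ i₀} => hχv l) q
    have hb1 : v.valuation (algebraMap k F (algebraMap _ k b)) = 1 := by
      refine le_antisymm ((v.valuation_le_one_iff _).2 (hmem b)) (not_lt.1 fun hlt => hb0 ?_)
      refine (injective_iff_map_eq_zero _).1 (slope_injective hh hw hi
        (fun l => ρ ⟨x l, hxv l⟩) fun p hp => ?_) b ?_
      · rw [hval, hρ] at hp
        exact (hv p).1 hp
      · have h1 := (hρ ⟨_, hmem b⟩).2 hlt
        rw [← h1]
        have h2 : (⟨algebraMap k F (algebraMap _ k b), hmem b⟩ : v) =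
            MvPolynomial.aeval (fun l : {l : ι // l ≠ i₀} => (⟨algebraMap k F (χ l), hχv l⟩ : v)) b := by
          refine Subtype.ext ?_
          have : ((IsScalarTower.toAlgHom K v F) (MvPolynomial.aeval
              (fun l : {l : ι // l ≠ i₀} => (⟨algebraMap k F (χ l), hχv l⟩ : v)) b)) =
              MvPolynomial.aeval (fun l : {l : ι // l ≠ i₀} => algebraMap k F (χ l)) b := by
            rw [← AlgHom.comp_apply, MvPolynomial.comp_aeval]; rfl
          exact (hθF' b).trans this.symm
        rw [h2]
        change _ = ρ' _
        rw [← AlgHom.comp_apply, MvPolynomial.comp_aeval]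
        congr 2
        funext l
        have h3 : (⟨algebraMap k F (χ l), hχv l⟩ : v) =
            ⟨x l, hxv l⟩ - algebraMap K v (w l) * (algebraMap K v (w i₀)⁻¹ * ⟨x i₀, hxv i₀⟩) := by
          refine Subtype.ext ?_
          change algebraMap k F (χ l) = x l - algebraMap K F (w l) * (algebraMap K F (w i₀)⁻¹ * x i₀)
          rw [eq_sub_of_add_eq (congrFun hxe l).symm, hs, map_inv₀, div_eq_inv_mul]
        rw [h3, map_sub, map_mul, map_mul, AlgHom.commutes, AlgHom.commutes, map_inv₀,
          ← div_eq_inv_mul]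
        rfl
    rw [map_div₀]
    rw [← v.valuation_le_one_iff, map_div₀, hb1, div_one, v.valuation_le_one_iff]
    exact hmem a
  let _ : Algebra k v := ((algebraMap k F).codRestrict v.toSubring hkv).toAlgebra
  have : IsScalarTower k v F := IsScalarTower.of_algebraMap_eq fun _ => rfl
  let _ : Algebra k T := (ρ.comp (algebraMap k v)).toAlgebra
  have : IsScalarTower K k T := IsScalarTower.of_algebraMap_eq fun a => by
    change ρ _ = ρ _
    refine congrArg ρ (Subtype.ext ?_)
    exact IsScalarTower.algebraMap_apply K k F a
  let ρk : v →ₐ[k] T := { ρ with commutes' := fun _ => rfl }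
  set sT : T := ρ ⟨s, hsv'⟩ with hsT
  set yT : T := ρ ⟨y, hyv⟩ with hyT
  have hxT : (fun l => ρ ⟨x l, hxv l⟩) = fun l => algebraMap k T (χ l) + algebraMap K T (w l) * sT := by
    funext l
    change _ = ρ _ + ρ _ * ρ _
    rw [← map_mul, ← map_add]
    exact congrArg ρ (Subtype.ext (congrFun hxe l))
  have hpev : ∀ q : (MvPolynomial ι K)[X], ∃ hq : pev x y q ∈ v,
      pev (fun l => algebraMap k T (χ l) + algebraMap K T (w l) * sT) yT q = ρ ⟨pev x y q, hq⟩ := by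
    intro q
    have h1 : (algebraMap v F).comp (pev (K := K) (fun l => (⟨x l, hxv l⟩ : v)) ⟨y, hyv⟩) = pev x y :=
      pev_ext (fun a => by simp; rfl) (fun l => by simp) (by simp)
    have h2 : ρ.comp (pev (K := K) (fun l => (⟨x l, hxv l⟩ : v)) ⟨y, hyv⟩) =
        pev (fun l => algebraMap k T (χ l) + algebraMap K T (w l) * sT) yT := by
      rw [← hxT]
      exact pev_ext (fun a => by simp; rfl) (by simp) (by simp [hyT])
    rw [← h1, ← h2]
    exact ⟨Subtype.property _, rfl⟩
  have hlog : ∃ hc : logTrace w h f χ u (ev X) s y ∈ v,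
      ρ ⟨_, hc⟩ = logTrace w h f χ u (ev X) sT yT := by
    have h1 := map_logTrace w h f χ u (ev X) (IsScalarTower.toAlgHom k v F) ⟨s, hsv'⟩ ⟨y, hyv⟩
    have h2 := map_logTrace w h f χ u (ev X) ρk ⟨s, hsv'⟩ ⟨y, hyv⟩
    simp only [IsScalarTower.coe_toAlgHom'] at h1
    change _ = logTrace w h f χ u (ev X) s y at h1
    change _ = logTrace w h f χ u (ev X) sT yT at h2
    rw [← h1, ← h2]
    exact ⟨Subtype.property _, rfl⟩
  obtain ⟨hc, hc'⟩ := hlog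
  have hsT0 : (linePoly w h (fun l => algebraMap k T (χ l))).eval sT = 0 := by
    rw [eval_linePoly, ← hxT, hval, hρ, hv]
  have hyT0 : (fiberPoly f (fun l => algebraMap k T (χ l) + algebraMap K T (w l) * sT)).eval yT = 0 := by
    rw [← pev_apply]
    obtain ⟨hq, hq'⟩ := hpev f
    rw [hq', hρ]
    simp [hy]
  rw [logTrace_eq_card hu0 hη0 hsT0 hyT0] at hc'
  -- embeddings over the point given by `v`
  have hσ : ∀ σ : κ →ₐ[k] T, σ u = sT → σ (ev X) = yT →
      ∀ q, σ (ev q) = pev (fun l => algebraMap k T (χ l) + algebraMap K T (w l) * sT) yT q := by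
    intro σ h1 h2 q
    have : (σ : κ →+* T).comp ev = pev (fun l => algebraMap k T (χ l) + algebraMap K T (w l) * sT) yT := by
      refine pev_ext (fun a => ?_) (fun l => ?_) ?_
      · simp only [RingHom.comp_apply, hevK, pev_C, MvPolynomial.algHom_C]
        exact (σ.restrictScalars K).commutes a
      · simp only [RingHom.comp_apply, pev_C, MvPolynomial.aeval_X]
        change σ (ξ l) = _
        rw [hξe]
        simp only [map_add, map_mul, AlgHom.commutes, h1]
        congr 2
        exact (σ.restrictScalars K).commutes _
      · simpa using h2
    exact DFunLike.congr_fun this q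
  have hcrit : (∃ σ : κ →ₐ[k] T, σ u = sT ∧ σ (ev X) = yT) →
      ∀ q, v.valuation (pev x y q) < 1 ↔ q ∈ P := by
    rintro ⟨σ, h1, h2⟩ q
    obtain ⟨hq, hq'⟩ := hpev q
    rw [← hρ ⟨_, hq⟩, ← hq', ← hσ σ h1 h2, map_eq_zero, hev]
  refine ⟨fun hq => ?_, fun hq => ?_⟩
  · have hcard : (Finset.univ.filter fun σ : κ →ₐ[k] T => σ u = sT ∧ σ (ev X) = yT).card = 1 := by
      rw [Finset.card_eq_one]
      obtain ⟨σ₀, hσ₀⟩ := hlift T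
        (pev (fun l => algebraMap k T (χ l) + algebraMap K T (w l) * sT) yT) fun q => by
          obtain ⟨hq1, hq2⟩ := hpev q
          rw [hq2, hρ, ← hq q]
      have hσ₀K : ∀ a : K, σ₀ (algebraMap K κ a) = algebraMap K T a := fun a => by
        rw [← hevK, hσ₀, pev_C, MvPolynomial.algHom_C]
      have hσ₀ξ : ∀ l, σ₀ (ξ l) = algebraMap k T (χ l) + algebraMap K T (w l) * sT := fun l => by
        rw [hξ, hσ₀, pev_C, MvPolynomial.aeval_X]
      have hw0 : algebraMap K T (w i₀) ≠ 0 := by simpa using hi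
      have hχ0 : χ i₀ = 0 := by simp [χ, slopeCoord]
      have hσ₀u : σ₀ u = sT := by
        rw [hu, map_div₀, hσ₀K, hσ₀ξ, hχ0, map_zero, zero_add, mul_div_cancel_left₀ _ hw0]
      have hσ₀k : ∀ l, σ₀ (algebraMap k κ (χ l)) = algebraMap k T (χ l) := fun l => by
        have := hσ₀ξ l
        rw [hξe] at this
        simp only [map_add, map_mul, hσ₀K, hσ₀u] at this
        exact add_right_cancel this
      have hσ₀c : ∀ z, σ₀ (algebraMap k κ z) = algebraMap k T z := by
        have : σ₀.comp (algebraMap k κ) = algebraMap k T := by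
          refine IsFractionRing.ringHom_ext (A := MvPolynomial {l : ι // l ≠ i₀} K) fun b => ?_
          have : (σ₀.comp (algebraMap k κ)).comp (algebraMap (MvPolynomial {l : ι // l ≠ i₀} K) k) =
              (algebraMap k T).comp (algebraMap (MvPolynomial {l : ι // l ≠ i₀} K) k) := by
            refine MvPolynomial.ringHom_ext (fun a => ?_) fun l => ?_
            · simp only [RingHom.comp_apply]
              rw [← MvPolynomial.algebraMap_eq, ← IsScalarTower.algebraMap_apply K _ k,
                ← IsScalarTower.algebraMap_apply K k κ, hσ₀K, ← IsScalarTower.algebraMap_apply K k T]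
            · have := hσ₀k l
              simpa [χ, slopeCoord, l.2] using this
          exact DFunLike.congr_fun this b
        exact DFunLike.congr_fun this
      refine ⟨{ σ₀ with commutes' := hσ₀c }, ?_⟩
      ext σ
      simp only [Finset.mem_filter, Finset.mem_univ, true_and, Finset.mem_singleton]
      constructor
      · rintro ⟨h1, h2⟩
        refine AlgHom.ext fun z => ?_
        obtain ⟨a, b, rfl⟩ := hgen z
        rw [map_div₀, hσ σ h1 h2, hσ σ h1 h2]
        change _ = σ₀ _
        rw [map_div₀, hσ₀, hσ₀]
      · rintro rfl
        refine ⟨hσ₀u, ?_⟩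
        change σ₀ _ = _
        rw [hσ₀, pev_X]
    rw [hcard, Nat.cast_one, one_mul] at hc'
    obtain ⟨hm1, hm2⟩ := hpev (derivative f)
    have hm3 : ∑ l, algebraMap K F (w l) * MvPolynomial.aeval x (MvPolynomial.pderiv l h) ∈ v :=
      sum_mem fun l _ => mul_mem (hK _) (aeval_mem hK hxv _)
    have h4 : (⟨_, hm3⟩ : v) = ∑ l, algebraMap K v (w l) *
        ⟨MvPolynomial.aeval x (MvPolynomial.pderiv l h), aeval_mem hK hxv _⟩ := by
      refine Subtype.ext ?_
      change ∑ l, algebraMap K F (w l) * MvPolynomial.aeval x (MvPolynomial.pderiv l h) =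
        (algebraMap v F) _
      rw [map_sum]
      rfl
    have h5 := (hρ (⟨_, hc⟩ - ⟨_, hm1⟩ * ⟨_, hm3⟩)).1 ?_
    · exact h5
    rw [map_sub, hc', map_mul, ← hm2, h4, map_sum, sub_eq_zero, mul_comm, pev_apply]
    congr 1
    · rw [fiberPoly, fiberPoly, derivative_map]
    · rw [derivative_linePoly, eval_finsetSum]
      refine Finset.sum_congr rfl fun l _ => ?_
      rw [eval_mul, eval_C, eval_linePoly, ← hxT, hval, map_mul]
      rfl
  · have hcard : (Finset.univ.filter fun σ : κ →ₐ[k] T => σ u = sT ∧ σ (ev X) = yT).card = 0 := by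
      rw [Finset.card_eq_zero, Finset.filter_eq_empty_iff]
      exact fun σ _ hσ' => hq (hcrit ⟨σ, hσ'⟩)
    rw [hcard, Nat.cast_zero, zero_mul, hρ] at hc'
    exact hc'

end Slope

end InvHyp

namespace InvHyp

section LogForm

open Polynomial

universe uK uI uF

variable {K : Type uK} [Field K] {ι : Type uI} {h : MvPolynomial ι K}

lemma homogeneousComponent_totalDegree_ne_zero (hh : h ≠ 0) :
    MvPolynomial.homogeneousComponent h.totalDegree h ≠ 0 := by
  obtain ⟨m, hm, hm'⟩ := Finset.exists_mem_eq_sup h.support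
    (MvPolynomial.support_nonempty.2 hh) (fun s => s.sum fun _ e => e)
  intro h0
  have h1 := MvPolynomial.coeff_homogeneousComponent h.totalDegree h m
  rw [h0, MvPolynomial.coeff_zero, if_pos] at h1
  · exact (MvPolynomial.mem_support_iff.1 hm) h1.symm
  · exact hm'.symm

/-- The logarithmic form whose residue picks out the divisor with center `P`. -/
theorem exists_log_form [Fintype ι] [CharZero K] (hh : Irreducible h)
    {f : (MvPolynomial ι K)[X]} (hf : f.Monic) {D : ℕ}
    (hD : ∀ j, (f.coeff j).totalDegree ≤ D * (f.natDegree - j))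
    {P : Ideal (MvPolynomial ι K)[X]} [P.IsPrime] (hfP : f ∈ P) (hP : ∀ p, C p ∈ P ↔ h ∣ p)
    {F : Type uF} [Field F] [Algebra K F] {x : ι → F} (hx : AlgebraicIndependent K x) {y : F}
    (hy : pev x y f = 0) :
    ∃ c : ι → F, (∀ (v : ValuationSubring F) (t : F), (∀ a : K, algebraMap K F a ∈ v) → t ∈ v →
        (∀ l, x l * t ∈ v) →
          ∀ j, c j * t ^ (h.totalDegree - 1 + D * (f.natDegree - 1)) ∈ v) ∧
      ∀ v : ValuationSubring F, (∀ a : K, algebraMap K F a ∈ v) → (∀ l, x l ∈ v) → y ∈ v →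
        (∀ p, v.valuation (MvPolynomial.aeval x p) < 1 ↔ h ∣ p) →
        ((∀ q, v.valuation (pev x y q) < 1 ↔ q ∈ P) → ∀ j, v.valuation (c j -
          pev x y (derivative f) * MvPolynomial.aeval x (MvPolynomial.pderiv j h)) < 1) ∧
        ((¬ ∀ q, v.valuation (pev x y q) < 1 ↔ q ∈ P) → ∀ j, v.valuation (c j) < 1) := by
  classical
  let Good : Submodule K (ι → K) :=
    { carrier := {w | ∃ c : F, (∀ (v : ValuationSubring F) (t : F), (∀ a : K, algebraMap K F a ∈ v) →
          t ∈ v → (∀ l, x l * t ∈ v) →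
            c * t ^ (h.totalDegree - 1 + D * (f.natDegree - 1)) ∈ v) ∧
        ∀ v : ValuationSubring F, (∀ a : K, algebraMap K F a ∈ v) → (∀ l, x l ∈ v) → y ∈ v →
        (∀ p, v.valuation (MvPolynomial.aeval x p) < 1 ↔ h ∣ p) →
        ((∀ q, v.valuation (pev x y q) < 1 ↔ q ∈ P) → v.valuation (c - pev x y (derivative f) *
          ∑ l, algebraMap K F (w l) * MvPolynomial.aeval x (MvPolynomial.pderiv l h)) < 1) ∧
        ((¬ ∀ q, v.valuation (pev x y q) < 1 ↔ q ∈ P) → v.valuation c < 1)}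
      zero_mem' := ⟨0, fun v t _ _ _ => by simp [v.zero_mem], fun v _ _ _ _ =>
        ⟨fun _ => by simp, fun _ => by simp⟩⟩
      add_mem' := by
        rintro w w' ⟨c, h1, h2⟩ ⟨c', h1', h2'⟩
        refine ⟨c + c', fun v t hK ht hx' => ?_, fun v hK hxv hyv hv => ⟨fun hq => ?_, fun hq => ?_⟩⟩
        · rw [add_mul]; exact add_mem (h1 v t hK ht hx') (h1' v t hK ht hx')
        · convert v.valuation.map_add_lt ((h2 v hK hxv hyv hv).1 hq) ((h2' v hK hxv hyv hv).1 hq)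
            using 2
          simp only [Pi.add_apply, map_add, add_mul, Finset.sum_add_distrib]
          ring
        · exact v.valuation.map_add_lt ((h2 v hK hxv hyv hv).2 hq) ((h2' v hK hxv hyv hv).2 hq)
      smul_mem' := by
        rintro a w ⟨c, h1, h2⟩
        refine ⟨algebraMap K F a * c, fun v t hK ht hx' => ?_,
          fun v hK hxv hyv hv => ⟨fun hq => ?_, fun hq => ?_⟩⟩
        · rw [mul_assoc]; exact mul_mem (hK a) (h1 v t hK ht hx')
        · have : algebraMap K F a * c - pev x y (derivative f) *
              ∑ l, algebraMap K F ((a • w) l) * MvPolynomial.aeval x (MvPolynomial.pderiv l h) =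
              algebraMap K F a * (c - pev x y (derivative f) *
              ∑ l, algebraMap K F (w l) * MvPolynomial.aeval x (MvPolynomial.pderiv l h)) := by
            simp only [Pi.smul_apply, smul_eq_mul, map_mul, mul_assoc, ← Finset.mul_sum]
            ring
          rw [this, map_mul]
          exact (mul_le_of_le_one_left' ((v.valuation_le_one_iff _).2 (hK a))).trans_lt
            ((h2 v hK hxv hyv hv).1 hq)
        · rw [map_mul]
          exact (mul_le_of_le_one_left' ((v.valuation_le_one_iff _).2 (hK a))).trans_lt
            ((h2 v hK hxv hyv hv).2 hq) }
  have : Infinite K := Infinite.of_injective ((↑) : ℕ → K) Nat.cast_injective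
  set H := MvPolynomial.homogeneousComponent h.totalDegree h with hH
  have hgood : ∀ w, MvPolynomial.eval w H ≠ 0 → w ∈ Good := fun w hw =>
    exists_log_numerator hh hw hf hD hfP hP hx hy
  obtain ⟨w₀, hw₀⟩ : ∃ w, MvPolynomial.eval w H ≠ 0 := by
    by_contra! h0
    exact homogeneousComponent_totalDegree_ne_zero hh.ne_zero
      (MvPolynomial.funext (by simpa using h0))
  have hall : ∀ w, w ∈ Good := by
    intro w
    let p : K[X] := MvPolynomial.aeval (fun l => C (w₀ l) + C (w l) * X) H
    have hp : ∀ t, p.eval t = MvPolynomial.eval (w₀ + t • w) H := fun t => by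
      have := eval_linePoly w H w₀ t
      rw [← MvPolynomial.coe_aeval_eq_eval] 
      refine this.trans ?_
      simp only [Algebra.algebraMap_self, RingHom.id_apply, RingHom.coe_coe]
      congr 2
      funext l
      simp [mul_comm]
    have hp0 : X * p ≠ 0 := mul_ne_zero X_ne_zero fun h0 => hw₀ (by
      have := hp 0
      rwa [h0, eval_zero, zero_smul, add_zero, eq_comm] at this)
    obtain ⟨t, ht⟩ : ∃ t, (X * p).eval t ≠ 0 := by
      by_contra! h0
      exact hp0 (Polynomial.funext (by simpa using h0))
    rw [eval_mul, eval_X, hp, mul_ne_zero_iff] at ht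
    have h1 := Good.smul_mem t⁻¹ (Good.sub_mem (hgood _ ht.2) (hgood _ hw₀))
    rwa [add_sub_cancel_left, smul_smul, inv_mul_cancel₀ ht.1, one_smul] at h1
  choose c hc hc' using fun j => hall (Pi.single j 1)
  refine ⟨c, fun v t hK ht hxt j => hc j v t hK ht hxt, fun v hK hxv hyv hv =>
    ⟨fun hq j => ?_, fun hq j => (hc' j v hK hxv hyv hv).2 hq⟩⟩
  have := (hc' j v hK hxv hyv hv).1 hq
  simpa [Pi.single_apply, apply_ite (algebraMap K F)] using this

end LogForm

end InvHyp

namespace InvHyp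

section Primitive

open Polynomial

variable {K : Type*} [Field K] [CharZero K] {ι : Type*} {F : Type*} [Field F]
  [Algebra K F] {x : ι → F}

lemma exists_primitive_data [Finite ι] [Algebra.EssFiniteType K F] (hx : IsTranscendenceBasis K x) :
    ∃ (y : F) (f : (MvPolynomial ι K)[X]), f.Monic ∧ pev x y f = 0 ∧
      pev x y (derivative f) ≠ 0 ∧ ∀ g, ∃ (a : (MvPolynomial ι K)[X]) (d : MvPolynomial ι K),
        d ≠ 0 ∧ g * MvPolynomial.aeval x d = pev x y a := by
  classical
  let E := IntermediateField.adjoin K (Set.range x)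
  have : Algebra.EssFiniteType E F := Algebra.EssFiniteType.of_comp K E F
  have : Algebra.IsAlgebraic E F := hx.isAlgebraic_field
  have : FiniteDimensional E F := Algebra.finite_of_essFiniteType_of_isAlgebraic
  have : CharZero E := charZero_of_injective_algebraMap (algebraMap K E).injective
  let A := MvPolynomial ι K
  let _ : Algebra A F := (MvPolynomial.aeval x : A →ₐ[K] F).toRingHom.toAlgebra
  have hA : ∀ p : A, algebraMap A F p = MvPolynomial.aeval x p := fun _ => rfl
  have hinj : Function.Injective (algebraMap A F) := hx.1
  have : FaithfulSMul A F := (faithfulSMul_iff_algebraMap_injective A F).2 hinj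
  have hE : ∀ e : E, ∃ p d : A, d ≠ 0 ∧ (e : F) = algebraMap A F p / algebraMap A F d := by
    intro e
    obtain ⟨r, s, he⟩ := (IntermediateField.mem_adjoin_range_iff K x (e : F)).1 e.2
    by_cases hs : s = 0
    · exact ⟨0, 1, one_ne_zero, by rw [he, hs]; simp⟩
    · exact ⟨r, s, hs, he⟩
  obtain ⟨y₀, hy₀⟩ := Field.exists_primitive_element E F
  -- clear the denominators
  obtain ⟨b, hb, hby⟩ : ∃ b : A, b ≠ 0 ∧ IsIntegral A (algebraMap A F b * y₀) := by
    obtain ⟨b, hb, hb'⟩ := exists_common_denominator hx {y₀}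
    rw [Algebra.adjoin_range_eq_range_aeval] at hb
    obtain ⟨b, rfl⟩ := hb
    refine ⟨b, fun h0 => hb'.1 (by rw [h0, map_zero]), ?_⟩
    have h1 := hb'.2 y₀ (by simp)
    obtain ⟨p, hp, hp'⟩ := h1
    let θ : A →+* Algebra.adjoin K (Set.range x) :=
      (MvPolynomial.aeval (R := K) (fun l => (⟨x l, Algebra.subset_adjoin ⟨l, rfl⟩⟩ :
        Algebra.adjoin K (Set.range x)))).toRingHom
    have hθ : ∀ p, ((θ p : Algebra.adjoin K (Set.range x)) : F) = MvPolynomial.aeval x p := by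
      intro p
      change (Algebra.adjoin K (Set.range x)).val (MvPolynomial.aeval _ p) = _
      rw [← AlgHom.comp_apply, MvPolynomial.comp_aeval]; rfl
    have hsurj : Function.Surjective θ := by
      rintro ⟨z, hz⟩
      have hz' := hz
      rw [Algebra.adjoin_range_eq_range_aeval] at hz'
      obtain ⟨p, hp⟩ := hz'
      exact ⟨p, Subtype.ext ((hθ p).trans hp)⟩
    obtain ⟨p', hp1, -, hp2⟩ := Polynomial.lifts_and_natDegree_eq_and_monic
      ((Polynomial.lifts_iff_coeff_lifts p).2 fun n => hsurj _) hp
    refine ⟨p', hp2, ?_⟩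
    rw [← hp1, eval₂_map] at hp'
    have h3 : algebraMap A F = (algebraMap (Algebra.adjoin K (Set.range x)) F).comp θ :=
      RingHom.ext fun p => (hθ p).symm
    rwa [← h3] at hp'
  set y : F := algebraMap A F b * y₀ with hy
  have hbF : algebraMap A F b ≠ 0 := by rwa [Ne, map_eq_zero_iff _ hinj]
  have hpev : ∀ q : A[X], pev x y q = aeval y q := fun q => rfl
  refine ⟨y, minpoly A y, minpoly.monic hby, ?_, fun h0 => ?_, fun g => ?_⟩
  · rw [hpev, minpoly.aeval]
  · rw [hpev] at h0
    have h1 := minpoly.isIntegrallyClosed_dvd hby h0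
    have h2 : (minpoly A y).natDegree ≠ 0 := (minpoly.natDegree_pos hby).ne'
    by_cases h3 : derivative (minpoly A y) = 0
    · exact h2 (derivative_eq_zero.1 h3)
    · exact absurd (natDegree_le_of_dvd h1 h3) (not_le.2 (natDegree_derivative_lt h2))
  · have hg : g ∈ Algebra.adjoin E {y₀} := by
      have h1 := IntermediateField.adjoin_simple_toSubalgebra_of_isAlgebraic
        (Algebra.IsAlgebraic.isAlgebraic (R := E) y₀)
      rw [← h1, hy₀]
      trivial
    induction hg using Algebra.adjoin_induction with
    | mem z hz =>
      rw [Set.mem_singleton_iff] at hz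
      subst hz
      exact ⟨X, b, hb, by rw [pev_X, hy, hA, mul_comm]⟩
    | algebraMap e =>
      obtain ⟨p, d, hd, he⟩ := hE e
      have hdF : algebraMap A F d ≠ 0 := by rwa [Ne, map_eq_zero_iff _ hinj]
      refine ⟨C p, d, hd, ?_⟩
      rw [pev_C, ← hA, ← hA]
      change (e : F) * _ = _
      rw [he, div_mul_cancel₀ _ hdF]
    | add g g' _ _ h1 h2 =>
      obtain ⟨a, d, hd, h1⟩ := h1
      obtain ⟨a', d', hd', h2⟩ := h2
      refine ⟨a * C d' + a' * C d, d * d', mul_ne_zero hd hd', ?_⟩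
      simp only [map_add, map_mul, pev_C]
      rw [← h1, ← h2]
      ring
    | mul g g' _ _ h1 h2 =>
      obtain ⟨a, d, hd, h1⟩ := h1
      obtain ⟨a', d', hd', h2⟩ := h2
      refine ⟨a * a', d * d', mul_ne_zero hd hd', ?_⟩
      simp only [map_mul]
      rw [← h1, ← h2]
      ring

end Primitive

end InvHyp

namespace InvHyp

universe uL

section Exchange

/-- If `r` is algebraically independent and algebraic over `τ`, some subfamily of `τ` of the size
of `r` is algebraically independent. -/
lemma _root_.AlgebraicIndependent.exists_comp_of_isAlgebraic {K κ ι α : Type*} [Field K] [Field κ]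
    [Algebra K κ] [Finite ι] [Finite α] {τ : ι → κ} {r : α → κ} (hr : AlgebraicIndependent K r)
    (halg : ∀ a, IsAlgebraic (Algebra.adjoin K (Set.range τ)) (r a)) :
    ∃ s : α → ι, Function.Injective s ∧ AlgebraicIndependent K (τ ∘ s) := by
  classical
  let M := AlgebraicIndependent.matroid K κ
  obtain ⟨I, hI⟩ := M.exists_isBasis (Set.range τ)
  have h1 : (Set.range r).encard ≤ I.encard := by
    have hri : M.Indep (Set.range r) := by
      rw [AlgebraicIndependent.matroid_indep_iff]
      exact hr.coe_range
    rw [hI.encard_eq_eRk, ← hri.eRk_eq_encard, ← M.eRk_closure_eq (Set.range τ)]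
    apply M.eRk_mono
    rintro _ ⟨a, rfl⟩
    rw [AlgebraicIndependent.matroid_closure_eq]
    exact halg a
  have hIτ : I ⊆ Set.range τ := hI.subset
  have hIf : I.Finite := (Set.finite_range τ).subset hIτ
  have := hIf.to_subtype
  have := Fintype.ofFinite α
  have := Fintype.ofFinite I
  replace h1 := hr.injective.encard_range.trans h1
  rw [ENat.card_eq_coe_fintype_card, Set.encard, ENat.card_eq_coe_fintype_card, Nat.cast_le] at h1
  obtain ⟨e⟩ := Function.Embedding.nonempty_of_card_le h1
  choose s hs using fun i : I => hIτ i.2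
  have hse : Function.Injective (s ∘ e) := by
    intro a b hab
    apply e.injective
    apply Subtype.ext
    rw [← hs, ← hs]
    exact congrArg τ hab
  refine ⟨s ∘ e, hse, ?_⟩
  have h2 : AlgebraicIndependent K ((↑) : I → κ) :=
    (AlgebraicIndependent.matroid_indep_iff.1 hI.indep)
  have h3 : τ ∘ s ∘ e = ((↑) : I → κ) ∘ e := funext fun a => hs (e a)
  rw [h3]
  exact h2.comp e e.injective

variable {K : Type*} [Field K] {L : Type uL} [Field L] [Algebra K L] {ι : Type*}

lemma exists_residue_algebra {W : ValuationSubring L} (hK : ∀ a : K, algebraMap K L a ∈ W) :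
    ∃ (κ : Type uL) (_ : Field κ) (_ : Algebra K κ) (res : W →+* κ),
      (∀ w : W, res w = 0 ↔ W.valuation w < 1) ∧
      ∀ a : K, res ⟨algebraMap K L a, hK a⟩ = algebraMap K κ a := by
  let θ : K →+* W := (algebraMap K L).codRestrict W.toSubring hK
  refine ⟨IsLocalRing.ResidueField W, inferInstance,
    ((IsLocalRing.residue W).comp θ).toAlgebra, IsLocalRing.residue W, fun w => ?_, fun a => rfl⟩
  rw [IsLocalRing.residue_eq_zero_iff, ← ValuationSubring.valuation_lt_one_iff]

lemma residue_aeval {W : ValuationSubring L} (hK : ∀ a : K, algebraMap K L a ∈ W) {κ : Type*}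
    [Field κ] [Algebra K κ] {res : W →+* κ}
    (hres : ∀ a : K, res ⟨algebraMap K L a, hK a⟩ = algebraMap K κ a) {r : ι → L}
    (hr : ∀ i, r i ∈ W) (p : MvPolynomial ι K) :
    res ⟨MvPolynomial.aeval r p, aeval_mem hK hr p⟩ =
      MvPolynomial.aeval (fun i => res ⟨r i, hr i⟩) p := by
  let θ : K →+* W := (algebraMap K L).codRestrict W.toSubring hK
  have h1 : (⟨MvPolynomial.aeval r p, aeval_mem hK hr p⟩ : W) =
      MvPolynomial.eval₂Hom θ (fun i => (⟨r i, hr i⟩ : W)) p := by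
    apply Subtype.ext
    change MvPolynomial.aeval r p = W.subtype _
    rw [MvPolynomial.map_eval₂Hom, MvPolynomial.aeval_def]
    rfl
  have h2 : res.comp θ = algebraMap K κ := RingHom.ext hres
  rw [h1, MvPolynomial.map_eval₂Hom, MvPolynomial.aeval_def, h2]
  rfl

lemma resIndep_iff {W : ValuationSubring L} (hK : ∀ a : K, algebraMap K L a ∈ W) {κ : Type*}
    [Field κ] [Algebra K κ] {res : W →+* κ} (hres0 : ∀ w : W, res w = 0 ↔ W.valuation w < 1)
    (hres : ∀ a : K, res ⟨algebraMap K L a, hK a⟩ = algebraMap K κ a) {r : ι → L}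
    (hr : ∀ i, r i ∈ W) :
    ResIndep K W r ↔ AlgebraicIndependent K (fun i => res ⟨r i, hr i⟩) := by
  rw [algebraicIndependent_iff]
  refine forall_congr' fun p => ?_
  rw [← residue_aeval hK hres hr p, hres0]
  have := W.valuation_le_one ⟨_, aeval_mem hK hr p⟩
  constructor
  · intro h1 h2
    by_contra h3
    exact absurd (h1 h3) h2.ne
  · intro h1 h2
    by_contra h3
    exact h2 (h1 (lt_of_le_of_ne this h3))

lemma resIndep_comp {W : ValuationSubring L} {r : ι → L} (h : ResIndep K W r) {α : Type*}
    {s : α → ι} (hs : Function.Injective s) : ResIndep K W (r ∘ s) := by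
  intro p hp
  rw [← MvPolynomial.aeval_rename]
  exact h _ fun h0 => hp (MvPolynomial.rename_injective s hs (by rw [h0, map_zero]))

/-- A residually independent family that is residually algebraic over `τ` can be exchanged for a
subfamily of `τ`. -/
lemma ResIndep.exchange [Finite ι] {W : ValuationSubring L} (hK : ∀ a : K, algebraMap K L a ∈ W)
    {τ : ι → L} (hτ : ∀ i, τ i ∈ W) {α : Type*} [Finite α] {r : α → L} (hr : ResIndep K W r)
    (halg : ∀ a, ∃ s ∈ Algebra.adjoin K (Set.range τ), W.valuation s = 1 ∧
      IsIntegral (Algebra.adjoin K (Set.range τ)) (s * r a)) :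
    ∃ s : α → ι, Function.Injective s ∧ ResIndep K W (τ ∘ s) := by
  obtain ⟨κ, _, _, res, hres, hresK⟩ := exists_residue_algebra hK
  have hW : ∀ {x : L}, x ∈ Algebra.adjoin K (Set.range τ) → x ∈ W := by
    intro x hx
    rw [Algebra.adjoin_range_eq_range_aeval] at hx
    obtain ⟨p, rfl⟩ := hx
    exact aeval_mem hK hτ p
  have hrW : ∀ a, r a ∈ W := fun a => by
    rw [← W.valuation_le_one_iff]
    simpa using (hr (MvPolynomial.X a) (MvPolynomial.X_ne_zero a)).le
  have hmem : ∀ z : Algebra.adjoin K (Set.range τ), res ⟨z, hW z.2⟩ ∈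
      Algebra.adjoin K (Set.range fun i => res ⟨τ i, hτ i⟩) := by
    rintro ⟨z, hz⟩
    have hz' := hz
    rw [Algebra.adjoin_range_eq_range_aeval] at hz'
    obtain ⟨p, rfl⟩ := hz'
    change res ⟨MvPolynomial.aeval τ p, _⟩ ∈ _
    rw [residue_aeval hK hresK hτ, Algebra.adjoin_range_eq_range_aeval]
    exact ⟨p, rfl⟩
  let θ : Algebra.adjoin K (Set.range τ) →+*
      Algebra.adjoin K (Set.range fun i => res ⟨τ i, hτ i⟩) :=
    RingHom.codRestrict (res.comp ((algebraMap (Algebra.adjoin K (Set.range τ)) L).codRestrict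
      W.toSubring fun z => hW z.2)) (Algebra.adjoin K (Set.range fun i => res ⟨τ i, hτ i⟩)) hmem
  obtain ⟨s, hs, hs'⟩ := ((resIndep_iff hK hres hresK hrW).1 hr).exists_comp_of_isAlgebraic
    (τ := fun i => res ⟨τ i, hτ i⟩) (by
      intro a
      obtain ⟨s, hs, hs1, p, hp, hp0⟩ := halg a
      have hsr : s * r a ∈ W := W.mul_mem _ _ (hW hs) (hrW a)
      have h1 : IsIntegral (Algebra.adjoin K (Set.range fun i => res ⟨τ i, hτ i⟩))
          (res ⟨s * r a, hsr⟩) := by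
        refine ⟨p.map θ, hp.map θ, ?_⟩
        rw [Polynomial.eval₂_map]
        let θ' : Algebra.adjoin K (Set.range τ) →+* W :=
          (algebraMap (Algebra.adjoin K (Set.range τ)) L).codRestrict W.toSubring fun z => hW z.2
        have h2 : (algebraMap (Algebra.adjoin K (Set.range fun i => res ⟨τ i, hτ i⟩)) κ).comp θ =
            res.comp θ' := rfl
        rw [h2, ← Polynomial.hom_eval₂]
        have h3 : Polynomial.eval₂ θ' ⟨s * r a, hsr⟩ p = 0 := by
          apply Subtype.ext
          change W.subtype _ = 0
          rw [Polynomial.hom_eval₂]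
          exact hp0
        rw [h3, map_zero]
      have h4 : res ⟨s * r a, hsr⟩ = res ⟨s, hW hs⟩ * res ⟨r a, hrW a⟩ := by
        rw [← map_mul]; rfl
      have h5 : res ⟨s, hW hs⟩ ≠ 0 := by
        rw [Ne, hres]
        exact hs1.not_lt
      have h6 : res ⟨r a, hrW a⟩ = (res ⟨s, hW hs⟩)⁻¹ * res ⟨s * r a, hsr⟩ := by
        rw [h4, inv_mul_cancel_left₀ h5]
      rw [h6]
      refine IsAlgebraic.mul (IsAlgebraic.inv ?_) h1.isAlgebraic
      exact isAlgebraic_algebraMap (⟨_, hmem ⟨s, hs⟩⟩ :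
        Algebra.adjoin K (Set.range fun i => res ⟨τ i, hτ i⟩)))
  exact ⟨s, hs, (resIndep_iff hK hres hresK fun a => hτ (s a)).2 hs'⟩

lemma chartGood_of_injective [Finite ι] {W : ValuationSubring L} {τ : ι → L} (hτ : ∀ i, τ i ∈ W)
    {α : Type*} (hα : Nat.card α + 1 = Nat.card ι) {s : α → ι} (hs : Function.Injective s)
    (h : ResIndep K W (τ ∘ s)) : ChartGood K τ W := by
  have : Finite α := Finite.of_injective s hs
  obtain ⟨j, hj⟩ : ∃ j, j ∉ Set.range s := by
    by_contra! h1
    have := Nat.card_eq_of_bijective s ⟨hs, h1⟩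
    omega
  have h2 : ∀ l : {l // l ≠ j}, ∃ a, s a = l := by
    let s' : α → {l // l ≠ j} := fun a => ⟨s a, fun h => hj ⟨a, h⟩⟩
    have hs' : Function.Injective s' := fun a b hab => hs (congrArg Subtype.val hab)
    have hc : Nat.card {l // l ≠ j} + 1 = Nat.card ι := by
      have := Fintype.ofFinite ι
      classical
      rw [Nat.card_eq_fintype_card, Nat.card_eq_fintype_card, Fintype.card_subtype_compl]
      have : 0 < Fintype.card ι := Fintype.card_pos_iff.2 ⟨j⟩
      simp
      omega
    have hb : Function.Bijective s' := (Nat.bijective_iff_injective_and_card s').2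
      ⟨hs', by omega⟩
    intro l
    obtain ⟨a, ha⟩ := hb.2 l
    exact ⟨a, congrArg Subtype.val ha⟩
  choose g hg using h2
  have hgi : Function.Injective g := fun a b hab => Subtype.ext (by rw [← hg, ← hg, hab])
  refine ⟨hτ, j, ?_⟩
  have h3 : (fun l : {l // l ≠ j} => τ l) = (τ ∘ s) ∘ g := funext fun l => by
    simp [hg]
  rw [h3]
  exact resIndep_comp h hgi

/-- The centre of a chart-good valuation ring on the coordinate ring is principal as soon as it is
nonzero. -/
lemma ChartGood.valuation_lt_one_iff_dvd {W : ValuationSubring L} {τ : ι → L}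
    (hW : ChartGood K τ W) {h : MvPolynomial ι K} (hh : Irreducible h)
    (hh1 : W.valuation (MvPolynomial.aeval τ h) < 1) (p : MvPolynomial ι K) :
    W.valuation (MvPolynomial.aeval τ p) < 1 ↔ h ∣ p := by
  classical
  refine ⟨fun hp => ?_, fun ⟨q, hq⟩ => ?_⟩
  swap
  · rw [hq, map_mul, map_mul]
    exact mul_lt_one_of_lt_of_le hh1 ((W.valuation_le_one_iff _).2 (hW.aeval_mem q))
  obtain ⟨-, j, hj⟩ := id hW
  by_contra hhp
  have : (Ideal.span {h}).IsPrime := (Ideal.span_singleton_prime hh.ne_zero).2 hh.prime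
  let A' := MvPolynomial {l // l ≠ j} K
  let C := MvPolynomial ι K ⧸ Ideal.span {h}
  let ρ : A' →ₐ[K] MvPolynomial ι K := MvPolynomial.rename (↑)
  let _ : Algebra A' C := ((Ideal.Quotient.mkₐ K (Ideal.span {h})).comp ρ).toRingHom.toAlgebra
  have halgA : ∀ q : A', algebraMap A' C q = Ideal.Quotient.mk _ (ρ q) := fun _ => rfl
  have hρ : ∀ q : A', MvPolynomial.aeval τ (ρ q) = MvPolynomial.aeval (fun l => τ l.1) q :=
    fun q => MvPolynomial.aeval_rename _ _ _
  have key : ∀ q : A', h ∣ ρ q → q = 0 := by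
    rintro q ⟨q', hq'⟩
    by_contra h0
    have h1 := hj q h0
    rw [← hρ, hq', map_mul, map_mul] at h1
    exact (mul_lt_one_of_lt_of_le hh1 ((W.valuation_le_one_iff _).2 (hW.aeval_mem q'))).ne h1
  have hxj : IsAlgebraic A' (Ideal.Quotient.mk (Ideal.span {h}) (MvPolynomial.X j) : C) := by
    let Φ : MvPolynomial ι K →ₐ[K] Polynomial A' := MvPolynomial.aeval fun l =>
      if hl : l = j then Polynomial.X else Polynomial.C (MvPolynomial.X ⟨l, hl⟩)
    let Ψ : Polynomial A' →+* MvPolynomial ι K := Polynomial.eval₂RingHom ρ.toRingHom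
      (MvPolynomial.X j)
    have hΨ : ∀ q, Ψ (Φ q) = q := by
      intro q
      have : Ψ.comp Φ.toRingHom = RingHom.id _ := by
        refine MvPolynomial.ringHom_ext (fun a => ?_) fun l => ?_
        · change Ψ (Φ (algebraMap K _ a)) = algebraMap K _ a
          rw [AlgHom.commutes]
          change Polynomial.eval₂ _ _ (Polynomial.C (algebraMap K A' a)) = _
          rw [Polynomial.eval₂_C]
          exact ρ.commutes a
        · change Ψ (Φ (MvPolynomial.X l)) = MvPolynomial.X l
          rw [MvPolynomial.aeval_X]
          split_ifs with hl
          · rw [hl]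
            exact Polynomial.eval₂_X _ _
          · refine (Polynomial.eval₂_C _ _).trans ?_
            exact MvPolynomial.rename_X _ _
      exact RingHom.congr_fun this q
    refine ⟨Φ h, fun h0 => hh.ne_zero (by rw [← hΨ h, h0, map_zero]), ?_⟩
    have : ∀ q, Polynomial.aeval (Ideal.Quotient.mk (Ideal.span {h}) (MvPolynomial.X j) : C) q =
        Ideal.Quotient.mk (Ideal.span {h}) (Ψ q) := by
      intro q
      change _ = Ideal.Quotient.mk (Ideal.span {h}) (Polynomial.eval₂ _ _ q)
      rw [Polynomial.hom_eval₂]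
      rfl
    rw [this, hΨ, Ideal.Quotient.eq_zero_iff_mem]
    exact Ideal.mem_span_singleton_self h
  have hall : ∀ q : MvPolynomial ι K, IsAlgebraic A' (Ideal.Quotient.mk (Ideal.span {h}) q : C) := by
    have : Nontrivial A' := inferInstance
    have hinj : Function.Injective (algebraMap A' C) := by
      rw [injective_iff_map_eq_zero]
      intro q hq
      rw [halgA, Ideal.Quotient.eq_zero_iff_mem, Ideal.mem_span_singleton] at hq
      exact key q hq
    intro q
    induction q using MvPolynomial.induction_on with
    | C a =>
      have := isAlgebraic_algebraMap (R := A') (A := C) (MvPolynomial.C a)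
      rwa [halgA, show ρ (MvPolynomial.C a) = MvPolynomial.C a from ρ.commutes a] at this
    | add p q hp hq => rw [map_add]; exact hp.add hq
    | mul_X p l hp =>
      rw [map_mul]
      refine hp.mul ?_
      by_cases hl : l = j
      · rw [hl]; exact hxj
      · have := isAlgebraic_algebraMap (R := A') (A := C) (MvPolynomial.X ⟨l, hl⟩)
        rwa [halgA, show ρ (MvPolynomial.X ⟨l, hl⟩) = MvPolynomial.X l from
          MvPolynomial.rename_X _ _] at this
  have hp0 : (Ideal.Quotient.mk (Ideal.span {h}) p : C) ≠ 0 := by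
    rwa [Ne, Ideal.Quotient.eq_zero_iff_mem, Ideal.mem_span_singleton]
  obtain ⟨r, hr, c, hc⟩ := (hall p).exists_nonzero_dvd (mem_nonZeroDivisors_of_ne_zero hp0)
  obtain ⟨c, rfl⟩ := Ideal.Quotient.mk_surjective c
  rw [halgA, ← map_mul, Ideal.Quotient.eq, Ideal.mem_span_singleton] at hc
  obtain ⟨e, he⟩ := hc
  have h1 := hj r hr
  rw [← hρ, sub_eq_iff_eq_add.1 he, map_add, map_mul, map_mul] at h1
  refine (lt_of_le_of_lt (W.valuation.map_add _ _) (max_lt ?_ ?_)).ne h1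
  · rw [map_mul]
    exact mul_lt_one_of_lt_of_le hh1 ((W.valuation_le_one_iff _).2 (hW.aeval_mem e))
  · rw [map_mul]
    exact mul_lt_one_of_lt_of_le hp ((W.valuation_le_one_iff _).2 (hW.aeval_mem c))

end Exchange

end InvHyp

namespace InvHyp

section

variable {K : Type*} [Field K] {F : Type*} [Field F] [Algebra K F]

/-- A valuation ring that is generated by fractions, up to inverting units, consists of
fractions. -/
lemma exists_frac_of_generated {R₀ : Type*} [CommRing R₀] (θ : R₀ →+* F) {v : ValuationSubring F}
    (hK : ∀ a : K, algebraMap K F a ∈ θ.range) {G : Finset F}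
    (hgen : ∀ T : Subring F, (∀ a : K, algebraMap K F a ∈ T) → (∀ g ∈ G, g ∈ T) →
        (∀ s ∈ T, v.valuation s = 1 → s⁻¹ ∈ T) → ∀ x ∈ v, x ∈ T)
    (hG : ∀ g ∈ G, ∃ a s, v.valuation (θ s) = 1 ∧ g * θ s = θ a) {x : F} (hx : x ∈ v) :
    ∃ a s, v.valuation (θ s) = 1 ∧ x * θ s = θ a := by
  have hne : ∀ {s}, v.valuation (θ s) = 1 → θ s ≠ 0 := fun {s} hs h0 => by simp [h0] at hs
  let T : Subring F :=
    { carrier := {x | ∃ a s, v.valuation (θ s) = 1 ∧ x * θ s = θ a}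
      mul_mem' := by
        rintro x y ⟨a, s, hs, h⟩ ⟨a', s', hs', h'⟩
        exact ⟨a * a', s * s', by rw [map_mul, map_mul, hs, hs', one_mul], by
          rw [map_mul, map_mul, ← h, ← h']; ring⟩
      one_mem' := ⟨1, 1, by simp, by simp⟩
      add_mem' := by
        rintro x y ⟨a, s, hs, h⟩ ⟨a', s', hs', h'⟩
        exact ⟨a * s' + a' * s, s * s', by rw [map_mul, map_mul, hs, hs', one_mul], by
          rw [map_mul, map_add, map_mul, map_mul, ← h, ← h']; ring⟩
      zero_mem' := ⟨0, 1, by simp, by simp⟩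
      neg_mem' := by
        rintro x ⟨a, s, hs, h⟩
        exact ⟨-a, s, hs, by rw [map_neg, ← h]; ring⟩ }
  refine hgen T (fun a => ?_) hG ?_ x hx
  · obtain ⟨r, hr⟩ := hK a
    exact ⟨r, 1, by simp, by rw [map_one, mul_one, hr]⟩
  · rintro x ⟨a, s, hs, h⟩ hx1
    have ha : v.valuation (θ a) = 1 := by rw [← h, map_mul, hx1, hs, one_mul]
    have hx0 : x ≠ 0 := fun h0 => by simp [h0] at hx1
    exact ⟨s, a, ha, by rw [← h]; field_simp⟩

lemma le_of_frac {R₀ : Type*} [CommRing R₀] (θ : R₀ →+* F) {v v' : ValuationSubring F}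
    (hv' : ∀ r, θ r ∈ v') (hfrac : ∀ x ∈ v, ∃ a s, v.valuation (θ s) = 1 ∧ x * θ s = θ a)
    (h : ∀ r, v'.valuation (θ r) < 1 → v.valuation (θ r) < 1) : v ≤ v' := by
  intro x hx
  obtain ⟨a, s, hs, ha⟩ := hfrac x hx
  have h1 : v'.valuation (θ s) = 1 := by
    by_contra h2
    exact (h s (lt_of_le_of_ne ((v'.valuation_le_one_iff _).2 (hv' s)) h2)).ne hs
  rw [← v'.valuation_le_one_iff]
  have h3 := (v'.valuation_le_one_iff _).2 (hv' a)
  rwa [← ha, map_mul, h1, mul_one] at h3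

variable {ι : Type*} {x : ι → F}

/-- A nonzero polynomial whose nonvanishing forces given elements to be units. -/
lemma exists_unit_polynomial (hx : IsTranscendenceBasis K x) (G : Finset F)
    (hG : ∀ g ∈ G, g ≠ 0) :
    ∃ d : MvPolynomial ι K, d ≠ 0 ∧ ∀ v : ValuationSubring F, ChartGood K x v →
      v.valuation (MvPolynomial.aeval x d) = 1 → ∀ g ∈ G, v.valuation g = 1 := by
  classical
  obtain ⟨d, hd, hd0, h⟩ := exists_common_denominator_good hx (G ∪ G.image (·⁻¹))
  rw [Algebra.adjoin_range_eq_range_aeval] at hd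
  obtain ⟨d, rfl⟩ := hd
  refine ⟨d, fun h0 => hd0 (by rw [h0, map_zero]), fun v hv hd1 g hg => ?_⟩
  change v.valuation (MvPolynomial.aeval x d) = 1 at hd1
  have h1 : ∀ z, (MvPolynomial.aeval x d) * z ∈ v → z ∈ v := by
    intro z hz
    rwa [← v.valuation_le_one_iff, map_mul, hd1, one_mul, v.valuation_le_one_iff] at hz
  exact valuation_eq_one_of_mem_of_inv_mem (hG g hg)
    (h1 _ (h g (Finset.mem_union_left _ hg) v hv))
    (h1 _ (h _ (Finset.mem_union_right _ (Finset.mem_image_of_mem _ hg)) v hv))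

lemma _root_.MvPolynomial.IsHomogeneous.aeval_mul {p : MvPolynomial ι K} {k : ℕ}
    (hp : p.IsHomogeneous k) (x : ι → F) (t : F) :
    MvPolynomial.aeval (fun l => x l * t) p = MvPolynomial.aeval x p * t ^ k := by
  rw [MvPolynomial.aeval_def, MvPolynomial.aeval_def, MvPolynomial.eval₂_eq, MvPolynomial.eval₂_eq,
    Finset.sum_mul]
  refine Finset.sum_congr rfl fun d hd => ?_
  have h1 := hp (MvPolynomial.mem_support_iff.1 hd)
  rw [Finsupp.weight_apply, Finsupp.sum] at h1
  simp only [mul_pow, Finset.prod_mul_distrib, Finset.prod_pow_eq_pow_sum]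
  simp only [Pi.one_apply, smul_eq_mul, mul_one] at h1
  rw [h1]
  ring

variable [DecidableEq ι]

/-- A valuation ring that is good for a chart at infinity is either good for the finite chart, or
has its centre at infinity and every nonzero polynomial has the expected pole order. -/
lemma chart_dichotomy [Finite ι] (hx : AlgebraicIndependent K x) {i : ι}
    {v : ValuationSubring F} (hv : ChartGood K (pchart x (some i)) v) :
    ChartGood K x v ∨ (v.valuation (x i)⁻¹ < 1 ∧ (∀ l, x l * (x i)⁻¹ ∈ v) ∧
      ∀ h : MvPolynomial ι K, h ≠ 0 →
      v.valuation (MvPolynomial.aeval x h * (x i)⁻¹ ^ h.totalDegree) = 1) := by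
  have hxi : x i ≠ 0 := hx.ne_zero i
  have hK := hv.algebraMap_mem
  have hinv : (x i)⁻¹ ∈ v := by simpa using hv.1 i
  have hdiv : ∀ l, x l * (x i)⁻¹ ∈ v := by
    intro l
    by_cases hl : l = i
    · rw [hl, mul_inv_cancel₀ hxi]; exact v.one_mem
    · have := hv.1 l
      rwa [pchart_some_of_ne x hl, div_eq_mul_inv] at this
  rcases eq_or_lt_of_le ((v.valuation_le_one_iff _).2 hinv) with h1 | h1
  · left
    have hxiv : x i ∈ v := by
      rw [← v.valuation_le_one_iff, ← inv_inv (x i), map_inv₀, h1, inv_one]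
    have hxv : ∀ l, x l ∈ v := fun l => by
      have := v.mul_mem _ _ (hdiv l) hxiv
      rwa [inv_mul_cancel_right₀ hxi] at this
    obtain ⟨-, j, hj⟩ := hv
    have hvi : v.valuation (x i) = 1 := by rw [map_inv₀] at h1; exact inv_eq_one.1 h1
    obtain ⟨s, hs, hs'⟩ := hj.exchange hK hxv (fun a => by
      refine ⟨x i, Algebra.subset_adjoin ⟨i, rfl⟩, hvi, ?_⟩
      by_cases ha : a.1 = i
      · have : x i * pchart x (some i) a.1 = 1 := by
          rw [ha, pchart_some_self, mul_inv_cancel₀ hxi]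
        rw [this]
        exact isIntegral_one
      · have : x i * pchart x (some i) a.1 = x a.1 := by
          rw [pchart_some_of_ne x ha, mul_div_cancel₀ _ hxi]
        rw [this]
        exact isIntegral_algebraMap (x := (⟨x a.1, Algebra.subset_adjoin ⟨a.1, rfl⟩⟩ :
          Algebra.adjoin K (Set.range x))))
    refine chartGood_of_injective hxv ?_ hs hs'
    have := Fintype.ofFinite ι
    rw [Nat.card_eq_fintype_card, Nat.card_eq_fintype_card, Fintype.card_subtype_compl]
    have : 0 < Fintype.card ι := Fintype.card_pos_iff.2 ⟨j⟩
    simp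
    omega
  · right
    refine ⟨h1, hdiv, fun h hh => ?_⟩
    obtain ⟨-, j, hj⟩ := hv
    have hji : j = i := by
      by_contra hne
      have := hj (MvPolynomial.X ⟨i, Ne.symm hne⟩) (MvPolynomial.X_ne_zero _)
      rw [MvPolynomial.aeval_X] at this
      simp only [pchart_some_self] at this
      exact h1.ne this
    subst hji
    set t := (x j)⁻¹ with ht
    have hexp : MvPolynomial.aeval x h * t ^ h.totalDegree =
        ∑ k ∈ Finset.range (h.totalDegree + 1),
          MvPolynomial.aeval (fun l => x l * t) (MvPolynomial.homogeneousComponent k h) *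
            t ^ (h.totalDegree - k) := by
      have h2 : MvPolynomial.aeval x h = ∑ k ∈ Finset.range (h.totalDegree + 1),
          MvPolynomial.aeval x (MvPolynomial.homogeneousComponent k h) := by
        rw [← map_sum, MvPolynomial.sum_homogeneousComponent]
      rw [h2, Finset.sum_mul]
      refine Finset.sum_congr rfl fun k hk => ?_
      rw [(MvPolynomial.homogeneousComponent_isHomogeneous k h).aeval_mul x t, mul_assoc,
        ← pow_add, Nat.add_sub_cancel' (Nat.lt_succ_iff.1 (Finset.mem_range.1 hk))]
    let φ : MvPolynomial ι K →ₐ[K] MvPolynomial {l // l ≠ j} K := MvPolynomial.aeval fun l =>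
      if hl : l = j then 1 else MvPolynomial.X ⟨l, hl⟩
    have hφ : ∀ q, MvPolynomial.aeval (fun l => x l * t) q =
        MvPolynomial.aeval (fun l : {l // l ≠ j} => pchart x (some j) l) (φ q) := by
      intro q
      rw [← AlgHom.comp_apply, MvPolynomial.comp_aeval]
      congr 2
      funext l
      split_ifs with hl
      · rw [hl, map_one, ht, mul_inv_cancel₀ hxi]
      · rw [MvPolynomial.aeval_X, pchart_some_of_ne x hl, div_eq_mul_inv]
    have htop : v.valuation (MvPolynomial.aeval (fun l => x l * t)
        (MvPolynomial.homogeneousComponent h.totalDegree h)) = 1 := by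
      rw [hφ]
      refine hj _ fun h0 => ?_
      have h2 := hφ (MvPolynomial.homogeneousComponent h.totalDegree h)
      rw [h0, map_zero,
        (MvPolynomial.homogeneousComponent_isHomogeneous _ h).aeval_mul x t, mul_eq_zero] at h2
      refine h2.elim (fun h3 => homogeneousComponent_totalDegree_ne_zero hh ?_)
        (pow_ne_zero _ (inv_ne_zero hxi))
      exact (map_eq_zero_iff _ hx).1 h3
    rw [hexp, Finset.sum_range_succ, Nat.sub_self, pow_zero, mul_one]
    rw [Valuation.map_add_eq_of_lt_right, htop]
    rw [htop]
    refine Valuation.map_sum_lt _ one_ne_zero fun k hk => ?_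
    rw [map_mul, map_pow]
    have hk' := Finset.mem_range.1 hk
    rw [mul_comm]
    exact mul_lt_one_of_lt_of_le (pow_lt_one₀ zero_le h1 (by omega))
      ((v.valuation_le_one_iff _).2 (aeval_mem hK hdiv _))

end

end InvHyp

namespace InvHyp

section

variable {K : Type*} [Field K] {ι : Type*}

lemma totalDegree_pderiv_lt {h : MvPolynomial ι K} {j : ι} (hj : MvPolynomial.pderiv j h ≠ 0) :
    (MvPolynomial.pderiv j h).totalDegree < h.totalDegree := by
  have key : ∀ m ∈ (MvPolynomial.pderiv j h).support, (m.sum fun _ e => e) + 1 ≤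
      h.totalDegree := fun m hm => by
    rw [MvPolynomial.mem_support_iff, MvPolynomial.coeff_pderiv] at hm
    have h1 : m + Finsupp.single j 1 ∈ h.support :=
      MvPolynomial.mem_support_iff.2 (left_ne_zero_of_mul hm)
    have h2 := MvPolynomial.le_totalDegree h1
    rwa [Finsupp.sum_add_index' (fun _ => rfl) (fun _ _ _ => rfl),
      Finsupp.sum_single_index rfl] at h2
  obtain ⟨m, hm⟩ := MvPolynomial.support_nonempty.2 hj
  refine (Finset.sup_lt_iff ?_).2 fun m hm => Nat.lt_of_succ_le (key m hm)
  exact (Nat.zero_lt_succ _).trans_le (key m hm)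

lemma exists_pderiv_not_dvd [CharZero K] {h : MvPolynomial ι K} (hh : Irreducible h) :
    ∃ j, ¬ h ∣ MvPolynomial.pderiv j h := by
  classical
  have h1 : ∃ m ∈ h.support, m ≠ 0 := by
    by_contra! hc
    have h2 : h = MvPolynomial.C (h.coeff 0) := by
      ext m
      rw [MvPolynomial.coeff_C]
      split_ifs with hm
      · rw [hm]
      · exact MvPolynomial.notMem_support_iff.1 fun hm' => hm (hc m hm').symm
    refine hh.not_isUnit (h2 ▸ (IsUnit.mk0 _ fun h0 => hh.ne_zero ?_).map MvPolynomial.C)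
    rw [h2, h0, map_zero]
  obtain ⟨m, hm, hm0⟩ := h1
  obtain ⟨j, hj⟩ := Finsupp.ne_iff.1 hm0
  have hne : MvPolynomial.pderiv j h ≠ 0 := fun h0 => by
    have h3 := congrArg (MvPolynomial.coeff (m - Finsupp.single j 1)) h0
    have h4 : m - Finsupp.single j 1 + Finsupp.single j 1 = m :=
      tsub_add_cancel_of_le (by
        rw [Finsupp.single_le_iff]; exact Nat.one_le_iff_ne_zero.2 hj)
    rw [MvPolynomial.coeff_pderiv, h4, MvPolynomial.coeff_zero] at h3
    refine (mul_ne_zero (MvPolynomial.mem_support_iff.1 hm) ?_) h3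
    exact Nat.cast_add_one_ne_zero _
  refine ⟨j, fun ⟨q, hq⟩ => ?_⟩
  have hq0 : q ≠ 0 := fun h0 => hne (by rw [hq, h0, mul_zero])
  have := totalDegree_pderiv_lt hne
  rw [hq, MvPolynomial.totalDegree_mul_of_isDomain hh.ne_zero hq0] at this
  omega

lemma totalDegree_pos_of_irreducible {h : MvPolynomial ι K} (hh : Irreducible h) :
    0 < h.totalDegree := by
  rw [Nat.pos_iff_ne_zero, ne_eq, MvPolynomial.totalDegree_eq_zero_iff_eq_C]
  intro h2
  refine hh.not_isUnit (h2 ▸ (IsUnit.mk0 _ fun h0 => hh.ne_zero ?_).map MvPolynomial.C)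
  rw [h2, h0, map_zero]

end

section

variable {K : Type*} [Field K] {F : Type*} [Field F] [Algebra K F]
  {ι : Type*} {x : ι → F}

lemma exists_irreducible_of_ne_top [Finite ι] [CharZero K] [Algebra.EssFiniteType K F]
    (hx : IsTranscendenceBasis K x)
    {v : ValuationSubring F} (hv : ChartGood K x v) (hv1 : v ≠ ⊤) :
    ∃ h : MvPolynomial ι K, Irreducible h ∧
      ∀ p, v.valuation (MvPolynomial.aeval x p) < 1 ↔ h ∣ p := by
  obtain ⟨g, hg⟩ : ∃ g, g ∉ v := by
    by_contra! hc
    exact hv1 (eq_top_iff.2 fun g _ => hc g)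
  have hg0 : g ≠ 0 := fun h0 => hg (h0 ▸ zero_mem _)
  obtain ⟨d, hd0, hd⟩ := exists_unit_polynomial hx {g} (by simpa using hg0)
  let P : Ideal (MvPolynomial ι K) := (IsLocalRing.maximalIdeal v).comap
    ((MvPolynomial.aeval x : MvPolynomial ι K →ₐ[K] F).toRingHom.codRestrict v.toSubring
      hv.aeval_mem)
  have hP : ∀ p, p ∈ P ↔ v.valuation (MvPolynomial.aeval x p) < 1 := fun p =>
    v.valuation_lt_one_iff _
  have hPp : P.IsPrime := by infer_instance
  have hdP : d ∈ P := by
    by_contra hc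
    rw [hP, not_lt] at hc
    have := hd v hv (le_antisymm ((v.valuation_le_one_iff _).2 (hv.aeval_mem d)) hc) g (by simp)
    exact hg ((v.valuation_le_one_iff _).1 this.le)
  obtain ⟨h, hhP, hh⟩ := hPp.exists_mem_prime_of_ne_bot fun h0 => hd0 (by simpa [h0] using hdP)
  exact ⟨h, hh.irreducible, hv.valuation_lt_one_iff_dvd hh.irreducible ((hP _).1 hhP)⟩

end

section

variable {K : Type*} [Field K] [CharZero K] {F : Type*} [Field F] [Algebra K F]
  {ι : Type*} [DecidableEq ι] {x : ι → F} (hx : IsTranscendenceBasis K x)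
include hx

lemma pd_aeval (j : ι) (p : MvPolynomial ι K) :
    pd hx j (MvPolynomial.aeval x p) = MvPolynomial.aeval x (MvPolynomial.pderiv j p) := by
  induction p using MvPolynomial.induction_on with
  | C a => simp
  | add p q hp hq => simp only [map_add, hp, hq]
  | mul_X p i hp =>
    rw [MvPolynomial.pderiv_mul, map_mul, Derivation.leibniz, hp, MvPolynomial.aeval_X, pd_apply,
      MvPolynomial.pderiv_X]
    simp only [map_add, map_mul, MvPolynomial.aeval_X, smul_eq_mul, Pi.single_apply]
    rcases eq_or_ne i j with rfl | hij
    · simp only [if_true, mul_one, map_one]; ring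
    · simp [hij, hij.symm, mul_comm]

/-- An irreducible polynomial generates the maximal ideal of a valuation ring that is stable under
the partial derivatives. -/
lemma div_mem_of_derivation_mem {v : ValuationSubring F}
    (hD : ∀ j, ∀ w ∈ v, pd hx j w ∈ v) {h : MvPolynomial ι K} (hh : Irreducible h)
    (hv : ∀ p, v.valuation (MvPolynomial.aeval x p) < 1 ↔ h ∣ p) {b : F} (hb : v.valuation b < 1) :
    b / MvPolynomial.aeval x h ∈ v := by
  by_contra hc
  obtain ⟨j, hj⟩ := exists_pderiv_not_dvd hh
  refine hj ((hv _).1 ?_)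
  rw [← pd_aeval hx]
  have hH0 : MvPolynomial.aeval x h ≠ 0 := fun h0 =>
    hh.ne_zero (hx.1 (h0.trans (map_zero _).symm))
  have hb0 : b ≠ 0 := fun h0 => hc (by simp [h0])
  obtain ⟨g, hg⟩ : ∃ g, g = MvPolynomial.aeval x h / b := ⟨_, rfl⟩
  have hg1 : v.valuation g < 1 := by
    rw [hg, ← inv_div, map_inv₀]
    refine inv_lt_one_of_one_lt₀ ?_
    rw [← not_le, v.valuation_le_one_iff]
    exact hc
  have hgb : MvPolynomial.aeval x h = b * g := by rw [hg]; field_simp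
  rw [hgb, Derivation.leibniz, smul_eq_mul, smul_eq_mul]
  refine Valuation.map_add_lt _ ?_ ?_ <;> rw [map_mul]
  · exact mul_lt_one_of_lt_of_le hb ((v.valuation_le_one_iff _).2
      (hD j g ((v.valuation_le_one_iff _).1 hg1.le)))
  · exact mul_lt_one_of_lt_of_le hg1 ((v.valuation_le_one_iff _).2
      (hD j b ((v.valuation_le_one_iff _).1 hb.le)))

end

end InvHyp

namespace InvHyp

open Polynomial

variable {K : Type*} [Field K] [CharZero K] {F : Type*} [Field F] [Algebra K F]
  [Algebra.EssFiniteType K F] {ι : Type*} [Fintype ι] [DecidableEq ι] {x : ι → F}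

/-- Almost all good valuation rings carry a differential form with logarithmic pole exactly
there, with uniformly bounded poles elsewhere. -/
theorem exists_log_forms (hx : IsTranscendenceBasis K x) (G₁ : Finset F) :
    ∃ (q : Option ι → F) (N : Set (ValuationSubring F)) (H : ValuationSubring F → F)
      (ω : ValuationSubring F → ι → F), (∀ o, q o ≠ 0) ∧
      {v | (∃ o, ChartGood K (pchart x o) v) ∧ v ≠ ⊤ ∧ v ∉ N}.Finite ∧
      (∀ o v, ChartGood K (pchart x o) v → q o ∈ v ∧ (∀ g ∈ G₁, q o * g ∈ v) ∧
        (∀ j, x j * q o ∈ v) ∧ ∀ j, ∀ w ∈ v, q o * pd hx j w ∈ v) ∧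
      ∀ v ∈ N, ChartGood K x v ∧ v.valuation (H v) < 1 ∧ H v ≠ 0 ∧
        (∀ b, v.valuation b < 1 → b / H v ∈ v) ∧
        (∃ j, q none * (pd hx j (H v) / H v) ∉ v) ∧
        (∀ o, ChartGood K (pchart x o) v → ∀ j, q o * (ω v j - pd hx j (H v) / H v) ∈ v) ∧
        ∀ o v', ChartGood K (pchart x o) v' → v' ≠ v → ∀ j, q o * ω v j ∈ v' := by
  classical
  obtain ⟨y, f, hf, hy, hfy, hprim⟩ := exists_primitive_data hx
  obtain ⟨fy, hfy'⟩ : ∃ fy, fy = pev x y (derivative f) := ⟨_, rfl⟩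
  rw [← hfy'] at hfy
  obtain ⟨D, hD⟩ : ∃ D : ℕ, ∀ j, (f.coeff j).totalDegree ≤ D * (f.natDegree - j) := by
    refine ⟨f.support.sup fun j => (f.coeff j).totalDegree, fun j => ?_⟩
    rcases lt_trichotomy j f.natDegree with hj | rfl | hj
    · by_cases hj0 : f.coeff j = 0
      · simp [hj0]
      · exact (Finset.le_sup (f := fun j => (f.coeff j).totalDegree)
          (mem_support_iff.2 hj0)).trans (Nat.le_mul_of_pos_right _ (by omega))
    · simp [hf.coeff_natDegree]
    · simp [coeff_eq_zero_of_natDegree_lt hj]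
  let G₀ : Finset F := G₁ ∪ ({fy⁻¹} ∪ (Finset.univ.image x ∪
    Finset.univ.image fun i => x i ^ (D * (f.natDegree - 1)) * fy⁻¹))
  choose q hq0 hq using fun o => exists_derivation_bound (isTranscendenceBasis_pchart hx o) G₀
    (fun j => pd hx j)
  have hq1 : ∀ o v, ChartGood K (pchart x o) v → q o * fy⁻¹ ∈ v := fun o v hv =>
    (hq o v hv).2.1 _ (by simp [G₀])
  have hq2 : ∀ o v, ChartGood K (pchart x o) v → ∀ i,
      q o * (x i ^ (D * (f.natDegree - 1)) * fy⁻¹) ∈ v := fun o v hv i =>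
    (hq o v hv).2.1 _ (Finset.mem_union_right _ (Finset.mem_union_right _
      (Finset.mem_union_right _ (Finset.mem_image_of_mem _ (Finset.mem_univ i)))))
  obtain ⟨G', hG'⟩ := chart_generated hx
  choose pa pd' hpd0 hpd using hprim
  obtain ⟨d₁, hd₁0, hd₁⟩ := exists_unit_polynomial hx {q none, fy} (by
    simp only [Finset.mem_insert, Finset.mem_singleton]
    rintro g (rfl | rfl)
    exacts [hq0 none, hfy])
  let bad : MvPolynomial ι K := d₁ * ∏ g ∈ G', pd' g
  have hbad0 : bad ≠ 0 := mul_ne_zero hd₁0 (Finset.prod_ne_zero_iff.2 fun g _ => hpd0 g)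
  let N : Set (ValuationSubring F) :=
    {v | ChartGood K x v ∧ v ≠ ⊤ ∧ v.valuation (MvPolynomial.aeval x bad) = 1}
  have hbadE : ∀ v ∈ N, v.valuation (MvPolynomial.aeval x d₁) = 1 ∧
      ∀ g ∈ G', v.valuation (MvPolynomial.aeval x (pd' g)) = 1 := by
    rintro v ⟨hv, -, hv1⟩
    have hle : ∀ p, v.valuation (MvPolynomial.aeval x p) ≤ 1 := fun p =>
      (v.valuation_le_one_iff _).2 (hv.aeval_mem p)
    have hd : ∀ p, p ∣ bad → v.valuation (MvPolynomial.aeval x p) = 1 := by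
      rintro p ⟨p', hp⟩
      by_contra hc
      have := mul_lt_one_of_lt_of_le (lt_of_le_of_ne (hle p) hc) (hle p')
      rw [← map_mul, ← map_mul, ← hp, hv1] at this
      exact this.false
    exact ⟨hd _ (dvd_mul_right _ _),
      fun g hg => hd _ ((Finset.dvd_prod_of_mem _ hg).mul_left _)⟩
  have hunit : ∀ v ∈ N, v.valuation (q none) = 1 ∧ v.valuation fy = 1 := fun v hv =>
    have h := hd₁ v hv.1 (hbadE v hv).1
    ⟨h _ (by simp), h _ (by simp)⟩
  have hmem : ∀ v ∈ N, ∀ l, x l ∈ v := fun v hv => hv.1.1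
  have hDv : ∀ v ∈ N, ∀ j, ∀ w ∈ v, pd hx j w ∈ v := fun v hv j w hw => by
    have h1 := (hq none v (by simpa [pchart_none] using hv.1)).2.2 j w hw
    rw [← v.valuation_le_one_iff, map_mul, (hunit v hv).1, one_mul] at h1
    exact (v.valuation_le_one_iff _).1 h1
  have hymem : ∀ v : ValuationSubring F, ChartGood K x v → y ∈ v := fun v hv => by
    let _ : Algebra (MvPolynomial ι K) F := (MvPolynomial.aeval x).toRingHom.toAlgebra
    refine v.mem_of_isIntegral' (D := MvPolynomial ι K) hv.aeval_mem ⟨f, hf, ?_⟩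
    exact hy
  have hpev : ∀ v : ValuationSubring F, ChartGood K x v → ∀ p : (MvPolynomial ι K)[X],
      pev x y p ∈ v := fun v hv p => by
    induction p using Polynomial.induction_on' with
    | add p p' hp hp' => rw [map_add]; exact add_mem hp hp'
    | monomial k a =>
      rw [← C_mul_X_pow_eq_monomial, map_mul, map_pow, pev_C, pev_X]
      exact mul_mem (hv.aeval_mem a) (pow_mem (hymem v hv) k)
  have hfrac : ∀ v ∈ N, ∀ z ∈ v, ∃ a s, v.valuation (pev x y s) = 1 ∧
      z * pev x y s = pev x y a := fun v hv z hz => by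
    obtain ⟨G, hGG, -, hgen⟩ := hG' v hv.1
    refine exists_frac_of_generated (pev x y) (fun a => ⟨C (MvPolynomial.C a), by simp⟩) hgen
      (fun g hg => ⟨pa g, C (pd' g), ?_, ?_⟩) hz
    · rw [pev_C]
      exact (hbadE v hv).2 g (hGG hg)
    · rw [pev_C]
      exact hpd g
  have hex : ∀ v : ValuationSubring F, ∃ (h : MvPolynomial ι K) (c : ι → F), v ∈ N →
      Irreducible h ∧ (∀ p, v.valuation (MvPolynomial.aeval x p) < 1 ↔ h ∣ p) ∧
      (∀ (v' : ValuationSubring F) (t : F), (∀ a : K, algebraMap K F a ∈ v') → t ∈ v' →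
        (∀ l, x l * t ∈ v') →
          ∀ j, c j * t ^ (h.totalDegree - 1 + D * (f.natDegree - 1)) ∈ v') ∧
      (∀ j, v.valuation (c j - fy * pd hx j (MvPolynomial.aeval x h)) < 1) ∧
      ∀ v' ∈ N, v' ≠ v → (∀ p, v'.valuation (MvPolynomial.aeval x p) < 1 ↔ h ∣ p) →
        ∀ j, v'.valuation (c j) < 1 := fun v => by
    by_cases hv : v ∈ N
    swap
    · exact ⟨0, 0, fun h => (hv h).elim⟩
    obtain ⟨h, hh, hhv⟩ := exists_irreducible_of_ne_top hx hv.1 hv.2.1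
    let P : Ideal (MvPolynomial ι K)[X] := (IsLocalRing.maximalIdeal v).comap
      ((pev x y).codRestrict v.toSubring (hpev v hv.1))
    have hP : ∀ p, p ∈ P ↔ v.valuation (pev x y p) < 1 := fun p => v.valuation_lt_one_iff _
    have hPp : P.IsPrime := by infer_instance
    obtain ⟨c, hc1, hc2⟩ := exists_log_form hh hf hD (P := P) (by rw [hP, hy]; simp)
      (fun p => by rw [hP, pev_C, hhv]) hx.1 hy
    refine ⟨h, c, fun _ => ⟨hh, hhv, hc1, fun j => ?_, fun v' hv' hne hhv' => ?_⟩⟩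
    · rw [pd_aeval, hfy']
      exact (hc2 v hv.1.algebraMap_mem (hmem v hv) (hymem v hv.1) hhv).1 (fun p => (hP p).symm) j
    · refine (hc2 v' hv'.1.algebraMap_mem (hmem v' hv') (hymem v' hv'.1) hhv').2 fun hcc => hne ?_
      refine le_antisymm ?_ ?_
      · exact le_of_frac (pev x y) (hpev v hv.1) (hfrac v' hv') fun r hr => by
          rwa [hcc, hP]
      · exact le_of_frac (pev x y) (hpev v' hv'.1) (hfrac v hv) fun r hr => by
          rwa [hcc, hP] at hr
  choose h c hhc using hex
  have hdiv : ∀ v ∈ N, ∀ h', Irreducible h' →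
      (∀ p, v.valuation (MvPolynomial.aeval x p) < 1 ↔ h' ∣ p) →
      ∀ b, v.valuation b < 1 → b / MvPolynomial.aeval x h' ∈ v := fun v hv h' hh' hv' b hb =>
    div_mem_of_derivation_mem hx (hDv v hv) hh' hv' hb
  have hne0 : ∀ v ∈ N, MvPolynomial.aeval x (h v) ≠ 0 := fun v hv h0 =>
    (hhc v hv).1.ne_zero (hx.1 (h0.trans (map_zero _).symm))
  refine ⟨q, N, fun v => MvPolynomial.aeval x (h v),
    fun v j => c v j / (MvPolynomial.aeval x (h v) * fy), hq0, ?_, fun o v hv => ?_, fun v hv => ?_⟩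
  · refine ((finite_chartGood hx (e := MvPolynomial.aeval x bad)
      (fun h0 => hbad0 (hx.1 (h0.trans (map_zero _).symm)))).union
      (Set.finite_iUnion fun i => finite_chartGood (isTranscendenceBasis_pchart hx (some i))
        (e := (x i)⁻¹) (inv_ne_zero (hx.1.ne_zero i)))).subset ?_
    rintro v ⟨⟨o, hv⟩, hv1, hvN⟩
    by_cases hvx : ChartGood K x v
    · exact Or.inl ⟨hvx, fun h1 => hvN ⟨hvx, hv1, h1⟩⟩
    · rcases o with _ | i
      · exact absurd (by simpa [pchart_none] using hv) hvx
      · exact Or.inr (Set.mem_iUnion.2 ⟨i, hv,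
          (((chart_dichotomy hx.1 hv).resolve_left hvx).1).ne⟩)
  · refine ⟨(hq o v hv).1, fun g hg => (hq o v hv).2.1 g (by simp [G₀, hg]), fun j => ?_,
      (hq o v hv).2.2⟩
    rw [mul_comm]
    exact (hq o v hv).2.1 _ (by simp [G₀])
  obtain ⟨hh, hhv, hc1, hc2, hc3⟩ := hhc v hv
  refine ⟨hv.1, (hhv _).2 dvd_rfl, hne0 v hv, hdiv v hv _ hh hhv, ?_, fun o ho j => ?_,
    fun o v' ho hne j => ?_⟩
  · obtain ⟨j, hj⟩ := exists_pderiv_not_dvd hh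
    refine ⟨j, fun hcc => hj ((hhv _).1 ?_)⟩
    rw [← v.valuation_le_one_iff, map_mul, (hunit v hv).1, one_mul, map_div₀, pd_aeval hx,
      div_le_one₀ (zero_lt_iff.2 ((Valuation.ne_zero_iff _).2 (hne0 v hv)))] at hcc
    exact hcc.trans_lt ((hhv _).2 dvd_rfl)
  · have h1 := mul_mem (hq1 o v ho) (hdiv v hv _ hh hhv _ (hc2 j))
    convert h1 using 1
    have h4 := hne0 v hv
    field_simp
  · have h0 := hne0 v hv
    have key : ChartGood K x v' → q o * (c v j / (MvPolynomial.aeval x (h v) * fy)) ∈ v' := by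
      intro hvx
      have hcj : c v j ∈ v' := by
        simpa using hc1 v' 1 hvx.algebraMap_mem (one_mem _) (by simpa using hvx.1) j
      by_cases h1 : v'.valuation (MvPolynomial.aeval x (h v)) < 1
      · have hd := hvx.valuation_lt_one_iff_dvd hh h1
        have hvN : v' ∈ N := by
          refine ⟨hvx, ?_, ?_⟩
          · rintro rfl
            have h3 : (MvPolynomial.aeval x (h v))⁻¹ ∈ (⊤ : ValuationSubring F) := trivial
            exact h1.ne (valuation_eq_one_of_mem_of_inv_mem h0 trivial h3)
          · by_contra hc
            have := (hd bad).1 (lt_of_le_of_ne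
              ((v'.valuation_le_one_iff _).2 (hvx.aeval_mem bad)) hc)
            rw [← hhv, hv.2.2] at this
            exact this.false
        have h2 := mul_mem (hq1 o v' ho) (hdiv v' hvN _ hh hd _ (hc3 v' hvN hne hd j))
        convert h2 using 1
        field_simp
      · have h2 : (MvPolynomial.aeval x (h v))⁻¹ ∈ v' := by
          rw [← v'.valuation_le_one_iff, map_inv₀]
          exact inv_le_one_of_one_le₀ (not_lt.1 h1)
        have h3 := mul_mem (mul_mem (hq1 o v' ho) hcj) h2
        convert h3 using 1
        field_simp
    rcases o with _ | i
    · exact key (by simpa [pchart_none] using ho)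
    rcases chart_dichotomy hx.1 ho with hvx | ⟨ht, hxt, hunit'⟩
    · exact key hvx
    have ht' : (x i)⁻¹ ∈ v' := (v'.valuation_le_one_iff _).1 ht.le
    have h1 := hc1 v' _ ho.algebraMap_mem ht' hxt j
    have h2 : (MvPolynomial.aeval x (h v) * (x i)⁻¹ ^ (h v).totalDegree)⁻¹ ∈ v' := by
      rw [← v'.valuation_le_one_iff, map_inv₀, hunit' _ hh.ne_zero, inv_one]
    have h3 := mul_mem (mul_mem (mul_mem h1 h2) ht') (hq2 _ v' ho i)
    convert h3 using 1
    have hxi := hx.1.ne_zero i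
    obtain ⟨e, he⟩ : ∃ e, (h v).totalDegree = e + 1 :=
      ⟨_, (Nat.succ_pred_eq_of_pos (totalDegree_pos_of_irreducible hh)).symm⟩
    rw [he, Nat.add_sub_cancel]
    simp only [inv_pow, pow_add, pow_one]
    field_simp

end InvHyp

namespace InvHyp

lemma not_finiteDimensional_inf_ker {K E E' : Type*} [Field K] [AddCommGroup E] [Module K E]
    [AddCommGroup E'] [Module K E'] {V : Submodule K E} (hV : ¬ FiniteDimensional K V)
    (T : E →ₗ[K] E') (hT : FiniteDimensional K (V.map T)) :
    ¬ FiniteDimensional K (V ⊓ LinearMap.ker T : Submodule K E) := fun h =>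
  hV ((Submodule.fg_iff_finiteDimensional _).1 (Submodule.fg_of_fg_map_of_fg_inf_ker T
    ((Submodule.fg_iff_finiteDimensional _).2 hT) ((Submodule.fg_iff_finiteDimensional _).2 h)))

section Log

variable {K : Type*} [Field K] [CharZero K] {Q : Type*} [CommRing Q] [Algebra K Q]

/-- The logarithmic derivative of `1 + j`, for `j` nilpotent in an ideal, is the derivative of an
element of the ideal. -/
lemma exists_log {J : Ideal Q} (E : Derivation K Q Q) {j u : Q} (hj : j ∈ J) {M : ℕ}
    (hM : j ^ M = 0) (hu : (1 + j) * u = 1) : ∃ l ∈ J, E l = E (1 + j) * u := by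
  refine ⟨∑ k ∈ Finset.range M, ((-1) ^ k * ((k : K) + 1)⁻¹) • j ^ (k + 1), ?_, ?_⟩
  · refine sum_mem fun k _ => ?_
    rw [Algebra.smul_def]
    exact J.mul_mem_left _ (Ideal.pow_mem_of_mem _ hj _ (Nat.succ_pos k))
  · have h1 : ∀ k : ℕ, E (((-1) ^ k * ((k : K) + 1)⁻¹) • j ^ (k + 1)) = (-j) ^ k * E j := by
      intro k
      have hk : (k : K) + 1 ≠ 0 := Nat.cast_add_one_ne_zero k
      rw [Derivation.map_smul, Derivation.leibniz_pow, Nat.add_sub_cancel, neg_pow j k,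
        ← Nat.cast_smul_eq_nsmul K, smul_smul, Nat.cast_add, Nat.cast_one, mul_assoc,
        inv_mul_cancel₀ hk, mul_one, Algebra.smul_def]
      simp [mul_assoc]
    rw [map_sum, Finset.sum_congr rfl fun k _ => h1 k, ← Finset.sum_mul]
    have h2 : (∑ k ∈ Finset.range M, (-j) ^ k) * (1 + j) = 1 := by
      have h3 := geom_sum_mul_neg (-j) M
      rw [neg_pow j M, hM, mul_zero, sub_zero, sub_neg_eq_add] at h3
      exact h3
    have h4 : ∑ k ∈ Finset.range M, (-j) ^ k = u := by
      calc _ = (∑ k ∈ Finset.range M, (-j) ^ k) * ((1 + j) * u) := by rw [hu, mul_one]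
        _ = _ := by rw [← mul_assoc, h2, one_mul]
    rw [h4, map_add, Derivation.map_one_eq_zero, zero_add, mul_comm]

end Log

section Pairing

set_option linter.unusedSectionVars false

variable {K : Type*} [Field K] [CharZero K] {F : Type*} [Field F] [Algebra K F]
  {ι : Type*} [Fintype ι] [DecidableEq ι] {x : ι → F}
  {Q : Type*} [CommRing Q] [Algebra K Q]

lemma pairing_mem (Φ : F →ₐ[K] Q) (D : Derivation K Q Q) {Λ : Subring Q}
    {ε : Q} (hε : ∀ y ∈ Λ, ε * D y ∈ Λ) {v : ValuationSubring F} (hΦ : ∀ w ∈ v, Φ w ∈ Λ) {q : F}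
    (hq : q ∈ v) (hqx : ∀ j, x j * q ∈ v) {b : ι → F} (hb : ∀ j, q * b j ∈ v) :
    Φ q ^ 3 * (ε * ∑ j, Φ (b j) * D (Φ (x j))) ∈ Λ := by
  rw [Finset.mul_sum, Finset.mul_sum]
  refine sum_mem fun j _ => ?_
  have h1 : Φ q * D (Φ (x j)) = D (Φ (x j * q)) - Φ (x j) * D (Φ q) := by
    rw [map_mul, Derivation.leibniz, smul_eq_mul, smul_eq_mul]; ring
  have h2 : Φ q ^ 3 * (ε * (Φ (b j) * D (Φ (x j)))) = Φ (q * b j) *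
      (Φ q * (ε * D (Φ (x j * q))) - Φ (x j * q) * (ε * D (Φ q))) := by
    rw [map_mul Φ q (b j)]
    linear_combination Φ q ^ 2 * ε * Φ (b j) * h1 +
      Φ q * Φ (b j) * ε * D (Φ q) * map_mul Φ (x j) q
  rw [h2]
  exact mul_mem (hΦ _ (hb j)) (sub_mem (mul_mem (hΦ _ hq) (hε _ (hΦ _ (hqx j))))
    (mul_mem (hΦ _ (hqx j)) (hε _ (hΦ _ hq))))

lemma pairing_eq (hx : IsTranscendenceBasis K x) (Φ : F →ₐ[K] Q) (D : Derivation K Q Q)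
    (z : ι → F) (k : ℤ) (h : F) : ∑ j, Φ (z j) * D (Φ (x j)) = k * (D (Φ h) * Φ h⁻¹) +
      ∑ j, Φ (z j - k * (pd hx j h / h)) * D (Φ (x j)) := by
  rw [derivation_chain_rule hx Φ D h, Finset.sum_mul, Finset.mul_sum, ← Finset.sum_add_distrib]
  refine Finset.sum_congr rfl fun j _ => ?_
  rw [div_eq_mul_inv, map_sub, map_mul, map_mul, map_intCast]
  ring

/-- Compatibility of local equations of divisors. -/
def LogCompat (A B : F →ₐ[K] Q) (J : Ideal Q) (Λ : Subring Q) (h₁ h₂ : F)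
    (v₁ v₂ : ValuationSubring F) : Prop :=
  ∃ e₁ e₂ : F, e₁ ≠ 0 ∧ e₂ ≠ 0 ∧ e₁ / h₁ ∈ v₁ ∧ h₁ / e₁ ∈ v₁ ∧ e₂ / h₂ ∈ v₂ ∧ h₂ / e₂ ∈ v₂ ∧
    ∃ σ₁ ∈ Λ, ∃ σ₂ ∈ Λ, ∃ τ₁ ∈ Λ, ∃ τ₂ ∈ Λ, σ₁ * τ₁ = 1 ∧ σ₂ * τ₂ = 1 ∧
      σ₂ * A e₁ - σ₁ * B e₂ ∈ J

lemma logDeriv_mul (D : Derivation K Q Q) {a a' b b' : Q} (ha : a * a' = 1) (hb : b * b' = 1) :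
    D (a * b) * (a' * b') = D a * a' + D b * b' := by
  rw [Derivation.leibniz, smul_eq_mul, smul_eq_mul]
  linear_combination D b * b' * ha + D a * a' * hb

lemma logDeriv_div_mem (D : Derivation K Q Q) {Λ : Subring Q} {ε : Q}
    (hε : ∀ y ∈ Λ, ε * D y ∈ Λ) {Φ : F →ₐ[K] Q} {v : ValuationSubring F}
    (hΦ : ∀ w ∈ v, Φ w ∈ Λ) {e h : F} (he : e ≠ 0) (hh : h ≠ 0) (h₁ : e / h ∈ v)
    (h₂ : h / e ∈ v) : ε * (D (Φ h) * Φ h⁻¹ - D (Φ e) * Φ e⁻¹) ∈ Λ := by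
  have h3 := logDeriv_mul D (a := Φ e) (a' := Φ e⁻¹) (b := Φ (h / e)) (b' := Φ (e / h))
    (by rw [← map_mul, mul_inv_cancel₀ he, map_one])
    (by rw [← map_mul, div_mul_div_cancel₀ he, div_self hh, map_one])
  rw [← map_mul, ← map_mul, mul_div_cancel₀ _ he] at h3
  have h4 : e⁻¹ * (e / h) = h⁻¹ := by field_simp
  rw [h4] at h3
  rw [h3, add_sub_cancel_left, ← mul_assoc]
  exact mul_mem (hε _ (hΦ _ h₂)) (hΦ _ h₁)

lemma pairing_diff (hx : IsTranscendenceBasis K x) (A B : F →ₐ[K] Q) (D : Derivation K Q Q)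
    {J : Ideal Q} {Λ : Subring Q} {ε : Q} (hε : ∀ y ∈ Λ, ε * D y ∈ Λ)
    {v₁ v₂ : ValuationSubring F} (hA : ∀ w ∈ v₁, A w ∈ Λ) (hB : ∀ w ∈ v₂, B w ∈ Λ)
    {q₁ q₂ : F} (hq₁ : q₁ ∈ v₁) (hq₂ : q₂ ∈ v₂) (hqx₁ : ∀ j, x j * q₁ ∈ v₁)
    (hqx₂ : ∀ j, x j * q₂ ∈ v₂) {z : ι → F} {k : ℤ} {h₁ h₂ : F} (hh₁ : h₁ ≠ 0) (hh₂ : h₂ ≠ 0)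
    (hz₁ : ∀ j, q₁ * (z j - k * (pd hx j h₁ / h₁)) ∈ v₁)
    (hz₂ : ∀ j, q₂ * (z j - k * (pd hx j h₂ / h₂)) ∈ v₂)
    (hc : k ≠ 0 → LogCompat A B J Λ h₁ h₂ v₁ v₂) :
    ∃ u u' β : Q, u * u' = 1 ∧ u - 1 ∈ J ∧ A q₁ ^ 3 * B q₂ ^ 3 * (ε * β) ∈ Λ ∧
      ∑ j, A (z j) * D (A (x j)) - ∑ j, B (z j) * D (B (x j)) = k * (D u * u') + β := by
  have m₁ := pairing_mem A D hε hA hq₁ hqx₁ hz₁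
  have m₂ := pairing_mem B D hε hB hq₂ hqx₂ hz₂
  have e₁ := pairing_eq hx A D z k h₁
  have e₂ := pairing_eq hx B D z k h₂
  set β₁ := ∑ j, A (z j - k * (pd hx j h₁ / h₁)) * D (A (x j))
  set β₂ := ∑ j, B (z j - k * (pd hx j h₂ / h₂)) * D (B (x j))
  have hA3 : A q₁ ^ 3 ∈ Λ := pow_mem (hA _ hq₁) 3
  have hB3 : B q₂ ^ 3 ∈ Λ := pow_mem (hB _ hq₂) 3
  have hkΛ : (k : Q) ∈ Λ := intCast_mem Λ k
  by_cases hk : k = 0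
  · refine ⟨1, 1, β₁ - β₂, one_mul 1, by simp, ?_, ?_⟩
    · have : A q₁ ^ 3 * B q₂ ^ 3 * (ε * (β₁ - β₂)) =
        B q₂ ^ 3 * (A q₁ ^ 3 * (ε * β₁)) - A q₁ ^ 3 * (B q₂ ^ 3 * (ε * β₂)) := by ring
      rw [this]
      exact sub_mem (mul_mem hB3 m₁) (mul_mem hA3 m₂)
    · rw [e₁, e₂, hk]; simp
  obtain ⟨f₁, f₂, hf₁, hf₂, n₁, n₂, n₃, n₄, σ₁, s₁, σ₂, s₂, τ₁, t₁, τ₂, t₂, st₁, st₂, hJ⟩ := hc hk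
  have l₁ := logDeriv_div_mem D hε hA hf₁ hh₁ n₁ n₂
  have l₂ := logDeriv_div_mem D hε hB hf₂ hh₂ n₃ n₄
  have ia : A f₁ * A f₁⁻¹ = 1 := by rw [← map_mul, mul_inv_cancel₀ hf₁, map_one]
  have ib : B f₂ * B f₂⁻¹ = 1 := by rw [← map_mul, mul_inv_cancel₀ hf₂, map_one]
  have L₁ := logDeriv_mul D ia st₂
  have L₂ := logDeriv_mul D ib st₁
  have hP : A f₁ * σ₂ * (A f₁⁻¹ * τ₂) = 1 := by linear_combination σ₂ * τ₂ * ia + st₂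
  have hR : B f₂ * σ₁ * (B f₂⁻¹ * τ₁) = 1 := by linear_combination σ₁ * τ₁ * ib + st₁
  have L₃ := logDeriv_mul D hP ((mul_comm _ _).trans hR)
  have L₄ := logDeriv_mul D hR ((mul_comm _ _).trans hR)
  rw [mul_comm (B f₂ * σ₁) (B f₂⁻¹ * τ₁), (mul_comm (B f₂⁻¹ * τ₁) _).trans hR,
    Derivation.map_one_eq_zero, zero_mul] at L₄
  obtain ⟨w₁, hw₁⟩ : ∃ w, w = D (A h₁) * A h₁⁻¹ - D (A f₁) * A f₁⁻¹ := ⟨_, rfl⟩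
  obtain ⟨w₂, hw₂⟩ : ∃ w, w = D (B h₂) * B h₂⁻¹ - D (B f₂) * B f₂⁻¹ := ⟨_, rfl⟩
  rw [← hw₁] at l₁
  rw [← hw₂] at l₂
  refine ⟨A f₁ * σ₂ * (B f₂⁻¹ * τ₁), A f₁⁻¹ * τ₂ * (B f₂ * σ₁),
    k * (w₁ - w₂ - D σ₂ * τ₂ + D σ₁ * τ₁) + (β₁ - β₂), ?_, ?_, ?_, ?_⟩
  · linear_combination B f₂ * σ₁ * (B f₂⁻¹ * τ₁) * hP + hR
  · have : A f₁ * σ₂ * (B f₂⁻¹ * τ₁) - 1 =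
        (B f₂⁻¹ * τ₁) * (σ₂ * A f₁ - σ₁ * B f₂) := by linear_combination hR
    rw [this]
    exact J.mul_mem_left _ hJ
  · have : A q₁ ^ 3 * B q₂ ^ 3 * (ε * (k * (w₁ - w₂ - D σ₂ * τ₂ + D σ₁ * τ₁) + (β₁ - β₂))) =
        A q₁ ^ 3 * B q₂ ^ 3 * (k * (ε * w₁ - ε * w₂ - ε * D σ₂ * τ₂ + ε * D σ₁ * τ₁)) +
        (B q₂ ^ 3 * (A q₁ ^ 3 * (ε * β₁)) - A q₁ ^ 3 * (B q₂ ^ 3 * (ε * β₂))) := by ring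
    rw [this]
    exact add_mem (mul_mem (mul_mem hA3 hB3) (mul_mem hkΛ (add_mem (sub_mem (sub_mem l₁ l₂)
      (mul_mem (hε _ s₂) t₂)) (mul_mem (hε _ s₁) t₁))))
      (sub_mem (mul_mem hB3 m₁) (mul_mem hA3 m₂))
  · rw [e₁, e₂]
    linear_combination (-(k : Q)) * L₃ - (k : Q) * L₁ + (k : Q) * L₄ + (k : Q) * L₂ -
      (k : Q) * hw₁ + (k : Q) * hw₂

end Pairing

end InvHyp

namespace InvHyp

lemma finiteDimensional_map_span_pi {K E E' κ : Type*} [Field K] [AddCommGroup E] [Module K E]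
    [AddCommGroup E'] [Module K E'] [Finite κ] {G : Set E} {T : E →ₗ[K] κ → E'}
    {N : Submodule K E'} [FiniteDimensional K N] (h : ∀ g ∈ G, ∀ k, T g k ∈ N) :
    FiniteDimensional K ((Submodule.span K G).map T) := by
  have hle : (Submodule.span K G).map T ≤ LinearMap.range (N.subtype.compLeft κ) := by
    rw [Submodule.map_span, Submodule.span_le]
    rintro _ ⟨g, hg, rfl⟩
    exact ⟨fun k => ⟨T g k, h g hg k⟩, rfl⟩
  exact Submodule.finiteDimensional_of_le hle

section

variable {K : Type*} [Field K] {F L Q : Type*} [Field F] [Algebra K F]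
  [Field L] [Algebra K L] [CommRing Q] [Algebra K Q]

lemma LogCompat.map {A B : F →ₐ[K] Q} {J : Ideal Q} {Λ : Subring Q} {h₁ h₂ : F}
    {v₁ v₂ : ValuationSubring F} (h : LogCompat A B J Λ h₁ h₂ v₁ v₂) {ρ : Q →ₐ[K] L}
    {φ₁ φ₂ : F →ₐ[K] L} (hρA : ∀ g, ρ (A g) = φ₁ g) (hρB : ∀ g, ρ (B g) = φ₂ g)
    (hJ : J ≤ RingHom.ker ρ) {Λ' : Subring L} (hΛ : ∀ y ∈ Λ, ρ y ∈ Λ') :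
    LogCompat φ₁ φ₂ ⊥ Λ' h₁ h₂ v₁ v₂ := by
  obtain ⟨e₁, e₂, a, b, c, d, e, f, σ₁, s₁, σ₂, s₂, τ₁, t₁, τ₂, t₂, st₁, st₂, hh⟩ := h
  refine ⟨e₁, e₂, a, b, c, d, e, f, ρ σ₁, hΛ _ s₁, ρ σ₂, hΛ _ s₂, ρ τ₁, hΛ _ t₁, ρ τ₂, hΛ _ t₂,
    by rw [← map_mul, st₁, map_one], by rw [← map_mul, st₂, map_one], ?_⟩
  have := hJ hh
  rw [RingHom.mem_ker, map_sub, map_mul, map_mul, hρA, hρB] at this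
  simpa using this

end

section

variable {K : Type*} [Field K] [CharZero K] {F : Type*} [Field F] [Algebra K F]
  {ι : Type*} {x : ι → F}

/-- The combination of logarithmic forms attached to a divisor. -/
def divisorForm (ω : ValuationSubring F → ι → F) (m : ValuationSubring F →₀ ℤ) : ι → F :=
  m.sum fun v k => k • ω v

variable {ω : ValuationSubring F → ι → F} {m : ValuationSubring F →₀ ℤ}

lemma divisorForm_apply (j : ι) : divisorForm ω m j = m.sum fun v k => (k : F) * ω v j := by
  rw [divisorForm, Finsupp.sum, Finset.sum_apply, Finsupp.sum]
  simp

lemma divisorForm_mem {v : ValuationSubring F} {q : F} {a : F} {j : ι}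
    (h : ∀ v' ∈ m.support, v ≠ v' → q * ω v' j ∈ v)
    (hv : v ∈ m.support → q * (ω v j - a) ∈ v) : q * (divisorForm ω m j - m v * a) ∈ v := by
  classical
  rw [divisorForm_apply, Finsupp.sum]
  by_cases hvm : v ∈ m.support
  · rw [← Finset.add_sum_erase _ _ hvm]
    have : q * (m v * ω v j + ∑ v' ∈ m.support.erase v, (m v' : F) * ω v' j - m v * a) =
        m v * (q * (ω v j - a)) + ∑ v' ∈ m.support.erase v, (m v' : F) * (q * ω v' j) := by
      rw [mul_sub, mul_add, Finset.mul_sum, Finset.sum_congr rfl fun v' _ =>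
        mul_left_comm q (m v' : F) (ω v' j)]
      ring
    rw [this]
    refine add_mem (mul_mem (intCast_mem v _) (hv hvm)) (sum_mem fun v' hv' => ?_)
    rw [Finset.mem_erase] at hv'
    exact mul_mem (intCast_mem v _) (h v' hv'.2 hv'.1.symm)
  · have h0 : m v = 0 := by simpa using hvm
    rw [h0, Int.cast_zero, zero_mul, sub_zero, Finset.mul_sum]
    refine sum_mem fun v' hv' => ?_
    rw [mul_left_comm]
    exact mul_mem (intCast_mem v _) (h v' hv' fun h1 => hvm (h1 ▸ hv'))

/-- The exterior derivative of a form with logarithmic poles has bounded poles. -/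
lemma curl_mem [DecidableEq ι] (hx : IsTranscendenceBasis K x) {v : ValuationSubring F} {q : F} (hq : q ∈ v)
    (hD : ∀ j, ∀ w ∈ v, q * pd hx j w ∈ v) {z : ι → F} {k : ℤ} {h : F} (hh : h ≠ 0)
    (hz : ∀ j, q * (z j - k * (pd hx j h / h)) ∈ v) (i j : ι) :
    q ^ 3 * (pd hx i (z j) - pd hx j (z i)) ∈ v := by
  have key : ∀ b : F, q * b ∈ v → ∀ i, q ^ 3 * pd hx i b ∈ v := fun b hb i => by
    have h1 := Derivation.leibniz (pd hx i) q b
    simp only [smul_eq_mul] at h1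
    have h2 : q ^ 3 * pd hx i b = q * (q * pd hx i (q * b)) - (q * b) * (q * pd hx i q) := by
      rw [h1]; ring
    rw [h2]
    exact sub_mem (mul_mem hq (hD i _ hb)) (mul_mem hb (hD i _ hq))
  have h1 : ∀ i j, pd hx i (pd hx j h / h) = pd hx i (pd hx j h) / h -
      pd hx j h * pd hx i h / h ^ 2 := fun i j => by
    rw [Derivation.leibniz_div]
    simp only [smul_eq_mul]
    field_simp
  have h2 : ∀ i j, pd hx i ((k : F) * (pd hx j h / h)) = k * pd hx i (pd hx j h / h) :=
    fun i j => by
      rw [← zsmul_eq_mul, map_zsmul, zsmul_eq_mul]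
  have h3 : pd hx i (z j) - pd hx j (z i) = pd hx i (z j - k * (pd hx j h / h)) -
      pd hx j (z i - k * (pd hx i h / h)) := by
    rw [map_sub, map_sub, h2, h2, h1, h1, pd_comm hx i j h]
    ring
  rw [h3, mul_sub]
  exact sub_mem (key _ (hz j) i) (key _ (hz i) j)

end

end InvHyp

namespace InvHyp

variable {K : Type*} [Field K] [CharZero K] {F L Q : Type*} [Field F] [Algebra K F]
  [Algebra.EssFiniteType K F] [Field L] [Algebra K L] [Algebra.EssFiniteType K L] [CommRing Q]
  [Algebra K Q] {ι ι' : Type*} [Fintype ι] [DecidableEq ι] [Nonempty ι] {x : ι → F}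
  [Finite ι'] [DecidableEq ι'] [Nonempty ι'] {t : ι' → L}

/-- The difference of the pairings of a form, pulled back in two ways, with a derivation. -/
def pairingDiff {R : Type*} [CommRing R] [Algebra K R] (x : ι → F) (a b : F →ₐ[K] R)
    (D : Derivation K R R) : (ι → F) →ₗ[K] R where
  toFun z := ∑ j, a (z j) * D (a (x j)) - ∑ j, b (z j) * D (b (x j))
  map_add' z z' := by
    simp only [Pi.add_apply, map_add, add_mul, Finset.sum_add_distrib]; ring
  map_smul' r z := by
    simp only [Pi.smul_apply, map_smul, smul_mul_assoc, ← Finset.smul_sum, RingHom.id_apply,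
      smul_sub]

omit [CharZero K] [Algebra.EssFiniteType K F] [DecidableEq ι] [Nonempty ι] in
lemma pairingDiff_apply {R : Type*} [CommRing R] [Algebra K R] (a b : F →ₐ[K] R)
    (D : Derivation K R R) (z : ι → F) : pairingDiff x a b D z =
      ∑ j, a (z j) * D (a (x j)) - ∑ j, b (z j) * D (b (x j)) := rfl

/-- Divisors with the same pullbacks under two dominant maps yield an invariant function. -/
theorem exists_invariant_of_divisors (hx : IsTranscendenceBasis K x)
    (ht : IsTranscendenceBasis K t) {q : Option ι → F} {N : Set (ValuationSubring F)}
    {H : ValuationSubring F → F} {ω : ValuationSubring F → ι → F} (hq0 : ∀ o, q o ≠ 0)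
    (hq : ∀ o v, ChartGood K (pchart x o) v → q o ∈ v ∧
      (∀ j, x j * q o ∈ v) ∧ ∀ j, ∀ w ∈ v, q o * pd hx j w ∈ v)
    (hN : ∀ v ∈ N, ChartGood K x v ∧ H v ≠ 0 ∧ (∃ j, q none * (pd hx j (H v) / H v) ∉ v) ∧
        (∀ o, ChartGood K (pchart x o) v → ∀ j, q o * (ω v j - pd hx j (H v) / H v) ∈ v) ∧
        ∀ o v', ChartGood K (pchart x o) v' → v' ≠ v → ∀ j, q o * ω v j ∈ v')
    (φ₁ φ₂ : F →ₐ[K] L) (Dt : ι → Derivation K L L)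
    (hDt : ∀ i g, Dt i (φ₁ g) = φ₁ (pd hx i g))
    (hgood : ∀ o W, ChartGood K (pchart t o) W →
      (∃ o₁, ChartGood K (pchart x o₁) (W.comap (φ₁ : F →+* L))) ∧
      ∃ o₂, ChartGood K (pchart x o₂) (W.comap (φ₂ : F →+* L)))
    {c : Option ι' → L} (hc0 : ∀ o, c o ≠ 0)
    (hc : ∀ o W, ChartGood K (pchart t o) W → c o ∈ W ∧
      (∀ o₁ o₂, c o * (φ₁ (q o₁) ^ 3 * φ₂ (q o₂) ^ 3)⁻¹ ∈ W) ∧ ∀ i, ∀ w ∈ W, c o * Dt i w ∈ W)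
    (ρ : Q →ₐ[K] L) (A B : F →ₐ[K] Q) (hρA : ∀ g, ρ (A g) = φ₁ g) (hρB : ∀ g, ρ (B g) = φ₂ g)
    (E : Derivation K Q Q) (Iv : Q →ₗ[K] Q) {J : Ideal Q} {M : ℕ}
    (hM : RingHom.ker ρ ^ M = ⊥) (hJ : J ≤ RingHom.ker ρ) (hE : ∀ q, E q ∈ RingHom.ker ρ)
    (hEk : ∀ k u, u ∈ RingHom.ker ρ → E u ∈ RingHom.ker ρ ^ k → u ∈ RingHom.ker ρ ^ k)
    (hIv : ∀ u ∈ RingHom.ker ρ, E (Iv u) = u) (hIvE : ∀ u ∈ RingHom.ker ρ, Iv (E u) = u)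
    {Λ : Option ι' → ValuationSubring L → Subring Q}
    (hΛ : ∀ o W, ChartGood K (pchart t o) W → (∀ w ∈ W.comap (φ₁ : F →+* L), A w ∈ Λ o W) ∧
      (∀ w ∈ W.comap (φ₂ : F →+* L), B w ∈ Λ o W) ∧ (∀ y ∈ Λ o W, E y ∈ Λ o W) ∧
      ∀ y ∈ Λ o W, ρ y ∈ W)
    {P : Submodule K (Q ⧸ J)} [FiniteDimensional K P]
    (hP : ∀ w : Q, (∀ o W, ChartGood K (pchart t o) W → ∃ o₁ o₂ β,
      A (q o₁) ^ 3 * B (q o₂) ^ 3 * β ∈ Λ o W ∧ Iv (w - β) ∈ J) → Ideal.Quotient.mk J (Iv w) ∈ P)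
    {G : Set (ValuationSubring F →₀ ℤ)} (hGN : ∀ m ∈ G, ∀ v ∈ m.support, v ∈ N)
    (hGinf : (⋃ m ∈ G, (m.support : Set (ValuationSubring F))).Infinite)
    (hG : ∀ m ∈ G, ∀ o W, ChartGood K (pchart t o) W →
      m (W.comap (φ₁ : F →+* L)) = m (W.comap (φ₂ : F →+* L)) ∧
      (m (W.comap (φ₁ : F →+* L)) ≠ 0 → LogCompat A B J (Λ o W) (H (W.comap (φ₁ : F →+* L)))
        (H (W.comap (φ₂ : F →+* L))) (W.comap (φ₁ : F →+* L)) (W.comap (φ₂ : F →+* L)))) :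
    ∃ g : F, g ∉ Set.range (algebraMap K F) ∧ A g - B g ∈ J := by
  classical
  let S : Set (ι → F) := divisorForm ω '' G
  -- local structure
  let H' : (ValuationSubring F →₀ ℤ) → ValuationSubring F → F := fun m v =>
    if m v = 0 then 1 else H v
  have hH0 : ∀ m ∈ G, ∀ v, H' m v ≠ 0 := fun m hm v => by
    simp only [H']
    split_ifs with h
    · exact one_ne_zero
    · exact (hN v (hGN m hm v (Finsupp.mem_support_iff.2 h))).2.1
  have hloc : ∀ m ∈ G, ∀ o v, ChartGood K (pchart x o) v → ∀ j,
      q o * (divisorForm ω m j - m v * (pd hx j (H' m v) / H' m v)) ∈ v := fun m hm o v hv j => by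
    refine divisorForm_mem (fun v' hv' hne => (hN v' (hGN m hm v' hv')).2.2.2.2 o v hv hne j)
      fun hvm => ?_
    simp only [H', if_neg (Finsupp.mem_support_iff.1 hvm)]
    exact (hN v (hGN m hm v hvm)).2.2.2.1 o hv j
  -- infinite dimensionality
  have hV₀ : ¬ FiniteDimensional K (Submodule.span K S) := by
    intro hfd
    obtain ⟨S', hS', hspan⟩ := Submodule.fg_span_iff_fg_span_finset_subset S |>.1
      ((Submodule.fg_iff_finiteDimensional _).2 hfd)
    choose! g hgG hg using fun z (hz : z ∈ S') => hS' hz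
    obtain ⟨v, hv, hvn⟩ := hGinf.exists_notMem_finset (S'.biUnion fun z => (g z).support)
    simp only [Set.mem_iUnion, Finset.mem_coe] at hv
    obtain ⟨m, hm, hvm⟩ := hv
    have hvN := hGN m hm v hvm
    have hvc : ChartGood K (pchart x none) v := by simpa [pchart_none] using (hN v hvN).1
    obtain ⟨j, hj⟩ := (hN v hvN).2.2.1
    have h1 : ∀ z ∈ Submodule.span K S, q none * z j ∈ v := by
      intro z hz
      rw [hspan] at hz
      induction hz using Submodule.span_induction with
      | mem z hz =>
        have h2 := hloc (g z) (hgG z hz) none v hvc j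
        have h3 : g z v = 0 := by
          by_contra h4
          exact hvn (Finset.mem_biUnion.2 ⟨z, hz, Finsupp.mem_support_iff.2 h4⟩)
        rwa [h3, Int.cast_zero, zero_mul, sub_zero, hg z hz] at h2
      | zero => simp
      | add z z' _ _ h h' => rw [Pi.add_apply, mul_add]; exact add_mem h h'
      | smul a z _ h =>
        rw [Pi.smul_apply, mul_smul_comm, Algebra.smul_def]
        exact mul_mem (hvc.algebraMap_mem a) h
    have h2 := sub_mem (h1 _ (Submodule.subset_span ⟨m, hm, rfl⟩)) (hloc m hm none v hvc j)
    have hm0 := Finsupp.mem_support_iff.1 hvm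
    rw [← mul_sub, sub_sub_cancel, mul_left_comm] at h2
    simp only [H', if_neg hm0] at h2
    have h3 := mul_mem (hvc.algebraMap_mem (m v : K)⁻¹) h2
    rw [map_inv₀, map_intCast, inv_mul_cancel_left₀ (by
      rw [← map_intCast (algebraMap K F), ne_eq, map_eq_zero]; exact_mod_cast hm0)] at h3
    exact hj h3
  -- closedness
  let T₀ : (ι → F) →ₗ[K] (ι × ι → F) :=
    { toFun := fun z p => pd hx p.1 (z p.2) - pd hx p.2 (z p.1)
      map_add' := fun z z' => by ext p; simp; ring
      map_smul' := fun a z => by ext p; simp [smul_sub] }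
  obtain ⟨N₀, hN₀, hN₀'⟩ := exists_finiteDimensional_of_bounded hx (fun o => q o ^ 3)
    fun o => pow_ne_zero 3 (hq0 o)
  have hT₀ : FiniteDimensional K ((Submodule.span K S).map T₀) := by
    refine finiteDimensional_map_span_pi (N := N₀) ?_
    rintro _ ⟨m, hm, rfl⟩ p
    exact hN₀' _ fun o v hv => curl_mem hx (hq o v hv).1 (hq o v hv).2.2 (hH0 m hm v)
      (hloc m hm o v hv) p.1 p.2
  have hV₁ := not_finiteDimensional_inf_ker hV₀ T₀ hT₀
  -- the two pullbacks
  let T₁ : (ι → F) →ₗ[K] (ι → L) := LinearMap.pi fun i => pairingDiff x φ₁ φ₂ (Dt i)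
  obtain ⟨N₁, hN₁, hN₁'⟩ := exists_finiteDimensional_of_bounded ht (fun o => c o ^ 2)
    fun o => pow_ne_zero 2 (hc0 o)
  have hT₁ : FiniteDimensional K ((Submodule.span K S ⊓ LinearMap.ker T₀).map T₁) := by
    have : FiniteDimensional K ((Submodule.span K S).map T₁) := by
      refine finiteDimensional_map_span_pi (N := N₁) ?_
      rintro _ ⟨m, hm, rfl⟩ i
      refine hN₁' _ fun o W hW => ?_
      obtain ⟨⟨o₁, ho₁⟩, o₂, ho₂⟩ := hgood o W hW
      obtain ⟨hcW, hcq, hcD⟩ := hc o W hW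
      obtain ⟨hm12, hlc⟩ := hG m hm o W hW
      obtain ⟨u, u', β, huu, hu, hβ, heq⟩ := pairing_diff hx φ₁ φ₂ (Dt i) (J := ⊥)
        (Λ := W.toSubring) (ε := c o) (hcD i) (fun w hw => hw) (fun w hw => hw)
        (hq o₁ _ ho₁).1 (hq o₂ _ ho₂).1 (hq o₁ _ ho₁).2.1 (hq o₂ _ ho₂).2.1
        (hH0 m hm _) (hH0 m hm _) (hloc m hm o₁ _ ho₁) (hm12 ▸ hloc m hm o₂ _ ho₂) fun hk => by
          simp only [H', if_neg hk, if_neg (hm12 ▸ hk)]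
          exact (hlc hk).map hρA hρB hJ (hΛ o W hW).2.2.2
      have hu1 : u = 1 := sub_eq_zero.1 hu
      rw [hu1, Derivation.map_one_eq_zero, zero_mul, mul_zero, zero_add] at heq
      have h0 : φ₁ (q o₁) ^ 3 * φ₂ (q o₂) ^ 3 ≠ 0 :=
        mul_ne_zero (pow_ne_zero 3 ((map_ne_zero φ₁).2 (hq0 _)))
          (pow_ne_zero 3 ((map_ne_zero φ₂).2 (hq0 _)))
      have h1 := mul_mem (hcq o₁ o₂) (show _ ∈ W from hβ)
      have h2 : T₁ (divisorForm ω m) i = β := heq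
      rw [h2]
      convert h1 using 1
      rw [mul_comm (c o), mul_assoc, mul_comm (c o), mul_assoc, inv_mul_cancel_left₀ h0]
      ring
    exact Submodule.finiteDimensional_of_le (Submodule.map_mono (inf_le_left))
  have hV₂ := not_finiteDimensional_inf_ker hV₁ T₁ hT₁
  let T₂ : (ι → F) →ₗ[K] Q ⧸ J :=
    (Ideal.Quotient.mkₐ K J).toLinearMap ∘ₗ Iv ∘ₗ pairingDiff x A B E
  have hT₂ : FiniteDimensional K
      ((Submodule.span K S ⊓ LinearMap.ker T₀ ⊓ LinearMap.ker T₁).map T₂) := by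
    have : (Submodule.span K S ⊓ LinearMap.ker T₀ ⊓ LinearMap.ker T₁).map T₂ ≤ P := by
      refine (Submodule.map_mono (inf_le_left.trans inf_le_left)).trans ?_
      rw [Submodule.map_span, Submodule.span_le]
      rintro _ ⟨_, ⟨m, hm, rfl⟩, rfl⟩
      refine hP _ fun o W hW => ?_
      obtain ⟨⟨o₁, ho₁⟩, o₂, ho₂⟩ := hgood o W hW
      obtain ⟨hm12, hlc⟩ := hG m hm o W hW
      obtain ⟨hA, hB, hEΛ, -⟩ := hΛ o W hW
      obtain ⟨u, u', β, huu, hu, hβ, heq⟩ := pairing_diff hx A B E (J := J)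
        (Λ := Λ o W) (ε := 1) (fun y hy => by simpa using hEΛ y hy) hA hB
        (hq o₁ _ ho₁).1 (hq o₂ _ ho₂).1 (hq o₁ _ ho₁).2.1 (hq o₂ _ ho₂).2.1
        (hH0 m hm _) (hH0 m hm _) (hloc m hm o₁ _ ho₁) (hm12 ▸ hloc m hm o₂ _ ho₂) fun hk => by
          simp only [H', if_neg hk, if_neg (hm12 ▸ hk)]
          exact hlc hk
      refine ⟨o₁, o₂, β, by simpa using hβ, ?_⟩
      have hjM : (u - 1) ^ M = 0 := by
        have := Ideal.pow_mem_pow (hJ hu) M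
        rwa [hM] at this
      obtain ⟨l, hl, hEl⟩ := exists_log E hu hjM (u := u') (by rw [add_sub_cancel]; exact huu)
      rw [add_sub_cancel] at hEl
      rw [pairingDiff_apply, heq, add_sub_cancel_right, ← hEl, ← zsmul_eq_mul, map_zsmul,
        hIvE l (hJ hl)]
      exact zsmul_mem hl _
    exact Submodule.finiteDimensional_of_le this
  have hV₃ := not_finiteDimensional_inf_ker hV₂ T₂ hT₂
  refine exists_invariant_of_forms hx _ hV₃ (fun z hz i j => ?_) φ₁ φ₂ Dt hDt (fun z hz i => ?_)
    ρ A B hρA hρB E Iv hM hJ hE hEk hIv fun z hz => ?_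
  · have h := congr_fun (LinearMap.mem_ker.1 hz.1.1.2) (i, j)
    exact sub_eq_zero.1 h
  · have h : ∑ j, φ₁ (z j) * Dt i (φ₁ (x j)) - ∑ j, φ₂ (z j) * Dt i (φ₂ (x j)) = 0 :=
      congr_fun (LinearMap.mem_ker.1 hz.1.2) i
    rw [← sub_eq_zero.1 h]
    simp [hDt, pd_apply]
  · exact Ideal.Quotient.eq_zero_iff_mem.1 (LinearMap.mem_ker.1 hz.2)

end InvHyp

namespace InvHyp

section

variable {L : Type*} [Field L] {σ : Type*} {M : ℕ}

variable (L σ M) in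
/-- Polynomials truncated in degrees larger than `M`. -/
abbrev TruncPoly : Type _ :=
  MvPolynomial σ L ⧸ (MvPolynomial.idealOfVars σ L) ^ (M + 1)

variable (L σ M) in
/-- The class of a polynomial. -/
noncomputable abbrev truncMk : MvPolynomial σ L →ₐ[L] TruncPoly L σ M :=
  Ideal.Quotient.mkₐ L _

lemma truncMk_surjective : Function.Surjective (truncMk L σ M) := Ideal.Quotient.mk_surjective

/-- Multiplication of the homogeneous part of degree `n` by `s n`. -/
noncomputable def polyScale (s : ℕ → L) : MvPolynomial σ L →ₗ[L] MvPolynomial σ L :=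
  (MvPolynomial.basisMonomials σ L).constr L fun β => MvPolynomial.monomial β (s β.degree)

lemma polyScale_monomial (s : ℕ → L) (β : σ →₀ ℕ) (a : L) :
    polyScale s (MvPolynomial.monomial β a) = MvPolynomial.monomial β (s β.degree * a) := by
  have h : MvPolynomial.monomial β a = a • MvPolynomial.basisMonomials σ L β := by
    simp [MvPolynomial.smul_monomial]
  rw [h, map_smul, polyScale, Module.Basis.constr_basis, MvPolynomial.smul_monomial, smul_eq_mul,
    mul_comm]

lemma coeff_polyScale (s : ℕ → L) (β : σ →₀ ℕ) (p : MvPolynomial σ L) :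
    (polyScale s p).coeff β = s β.degree * p.coeff β := by
  classical
  induction p using MvPolynomial.induction_on' with
  | monomial γ a =>
    rw [polyScale_monomial, MvPolynomial.coeff_monomial, MvPolynomial.coeff_monomial]
    split_ifs with h
    · rw [h]
    · rw [mul_zero]
  | add p q hp hq => rw [map_add, MvPolynomial.coeff_add, MvPolynomial.coeff_add, hp, hq, mul_add]

lemma polyScale_mem {s : ℕ → L} {p : MvPolynomial σ L} {k : ℕ}
    (hp : p ∈ MvPolynomial.idealOfVars σ L ^ k) :
    polyScale s p ∈ MvPolynomial.idealOfVars σ L ^ k := by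
  rw [MvPolynomial.mem_pow_idealOfVars_iff'] at hp ⊢
  intro β hβ
  rw [coeff_polyScale, hp β hβ, mul_zero]

/-- Multiplication of the homogeneous part of degree `n` by `s n`. -/
noncomputable def truncScale (s : ℕ → L) : TruncPoly L σ M →ₗ[L] TruncPoly L σ M :=
  Submodule.mapQ (((MvPolynomial.idealOfVars σ L) ^ (M + 1)).restrictScalars L)
    (((MvPolynomial.idealOfVars σ L) ^ (M + 1)).restrictScalars L) (polyScale s)
    fun _ hp => polyScale_mem hp

lemma truncScale_mk (s : ℕ → L) (p : MvPolynomial σ L) :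
    truncScale s (truncMk L σ M p) = truncMk L σ M (polyScale s p) := rfl

lemma truncScale_truncScale (s s' : ℕ → L) (q : TruncPoly L σ M) :
    truncScale s (truncScale s' q) = truncScale (fun n => s n * s' n) q := by
  obtain ⟨p, rfl⟩ := truncMk_surjective q
  rw [truncScale_mk, truncScale_mk, truncScale_mk]
  congr 1
  ext β
  simp only [coeff_polyScale, mul_assoc]

variable (L σ M) in
/-- The constant term. -/
noncomputable def truncConst : TruncPoly L σ M →ₐ[L] L :=
  Ideal.Quotient.liftₐ _ (MvPolynomial.aeval fun _ => (0 : L)) fun p hp => by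
    have h1 : p ∈ MvPolynomial.idealOfVars σ L := Ideal.pow_le_self (by omega) hp
    have h2 : MvPolynomial.idealOfVars σ L ≤
        RingHom.ker (MvPolynomial.aeval (R := L) fun _ : σ => (0 : L)) := by
      rw [Ideal.span_le]
      rintro _ ⟨i, rfl⟩
      simp
    exact h2 h1

lemma truncConst_mk (p : MvPolynomial σ L) :
    truncConst L σ M (truncMk L σ M p) = p.coeff 0 := by
  have : truncConst L σ M (truncMk L σ M p) = MvPolynomial.aeval (fun _ => (0 : L)) p := rfl
  rw [this, MvPolynomial.aeval_zero', MvPolynomial.constantCoeff_eq]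
  rfl

lemma truncMk_mem_ker_pow {k : ℕ} {q : TruncPoly L σ M} :
    q ∈ RingHom.ker (truncConst L σ M) ^ k ↔
      ∃ p ∈ MvPolynomial.idealOfVars σ L ^ k, truncMk L σ M p = q := by
  have h1 : RingHom.ker (truncConst L σ M) =
      (MvPolynomial.idealOfVars σ L).map (truncMk L σ M) := by
    ext q
    obtain ⟨p, rfl⟩ := truncMk_surjective q
    rw [RingHom.mem_ker, truncConst_mk, Ideal.mem_map_iff_of_surjective _ truncMk_surjective]
    constructor
    · intro h
      refine ⟨p, ?_, rfl⟩
      rw [← pow_one (MvPolynomial.idealOfVars σ L), MvPolynomial.mem_pow_idealOfVars_iff']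
      intro β hβ
      rw [Nat.lt_one_iff, Finsupp.degree_eq_zero_iff] at hβ
      rw [hβ, h]
    · rintro ⟨p', hp', h⟩
      rw [← truncConst_mk (M := M), ← h, truncConst_mk]
      rw [← pow_one (MvPolynomial.idealOfVars σ L), MvPolynomial.mem_pow_idealOfVars_iff'] at hp'
      exact hp' 0 (by simp)
  rw [h1, ← Ideal.map_pow, Ideal.mem_map_iff_of_surjective _ truncMk_surjective]

lemma ker_truncConst_pow : RingHom.ker (truncConst L σ M) ^ (M + 1) = ⊥ := by
  rw [eq_bot_iff]
  intro q hq
  obtain ⟨p, hp, rfl⟩ := truncMk_mem_ker_pow.1 hq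
  exact Ideal.Quotient.eq_zero_iff_mem.2 hp

lemma truncScale_mem_ker_pow {s : ℕ → L} {k : ℕ} {q : TruncPoly L σ M}
    (hq : q ∈ RingHom.ker (truncConst L σ M) ^ k) :
    truncScale s q ∈ RingHom.ker (truncConst L σ M) ^ k := by
  obtain ⟨p, hp, rfl⟩ := truncMk_mem_ker_pow.1 hq
  exact truncMk_mem_ker_pow.2 ⟨_, polyScale_mem hp, rfl⟩

lemma truncScale_eq_self {s : ℕ → L} (hs : ∀ n, n ≠ 0 → s n = 1) {q : TruncPoly L σ M}
    (hq : q ∈ RingHom.ker (truncConst L σ M)) : truncScale s q = q := by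
  rw [← pow_one (RingHom.ker (truncConst L σ M))] at hq
  obtain ⟨p, hp, rfl⟩ := truncMk_mem_ker_pow.1 hq
  rw [truncScale_mk]
  congr 1
  ext β
  rw [coeff_polyScale]
  by_cases h : β.degree = 0
  · rw [(MvPolynomial.mem_pow_idealOfVars_iff' _ _).1 hp β (by omega), mul_zero]
  · rw [hs _ h, one_mul]

lemma TruncPoly.induction_on {p : TruncPoly L σ M → Prop} (q : TruncPoly L σ M)
    (hm : ∀ β a, p (truncMk L σ M (MvPolynomial.monomial β a)))
    (ha : ∀ q q', p q → p q' → p (q + q')) : p q := by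
  obtain ⟨f, rfl⟩ := truncMk_surjective q
  induction f using MvPolynomial.induction_on' with
  | monomial γ a => exact hm γ a
  | add f g hf hg => rw [map_add]; exact ha _ _ hf hg

variable (K : Type*) [Field K] [Algebra K L]

/-- The Euler derivation. -/
noncomputable def truncEuler : Derivation K (TruncPoly L σ M) (TruncPoly L σ M) :=
  Derivation.mk' ((truncScale fun n => (n : L)).restrictScalars K) fun a b => by
    simp only [LinearMap.coe_restrictScalars, smul_eq_mul]
    induction a using TruncPoly.induction_on with
    | hm β r =>
      induction b using TruncPoly.induction_on with
      | hm γ t =>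
        simp only [← map_mul, truncScale_mk, MvPolynomial.monomial_mul, polyScale_monomial,
          ← map_add]
        congr 1
        rw [add_comm γ β, ← map_add]
        congr 1
        rw [map_add, Nat.cast_add]
        ring
      | ha q q' h h' => simp only [mul_add, map_add, add_mul, h, h']; ring
    | ha q q' h h' => simp only [mul_add, map_add, add_mul, h, h']; ring

lemma truncEuler_apply (q : TruncPoly L σ M) :
    truncEuler K q = truncScale (fun n => (n : L)) q := rfl

end

end InvHyp

namespace InvHyp

section

variable {L : Type*} [Field L] {σ : Type*} {M : ℕ} {W : ValuationSubring L} {c : L}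

variable (σ M W c) in
/-- Truncated polynomials with integral coefficients in the variables divided by `c`. -/
noncomputable def truncLattice : Subring (TruncPoly L σ M) :=
  (MvPolynomial.eval₂Hom ((algebraMap L (TruncPoly L σ M)).comp W.subtype)
    fun i => truncMk L σ M (MvPolynomial.monomial (Finsupp.single i 1) c⁻¹)).range

lemma truncLattice_eval_monomial (β : σ →₀ ℕ) (w : W) :
    MvPolynomial.eval₂Hom ((algebraMap L (TruncPoly L σ M)).comp W.subtype)
      (fun i => truncMk L σ M (MvPolynomial.monomial (Finsupp.single i 1) c⁻¹))
      (MvPolynomial.monomial β w) =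
      truncMk L σ M (MvPolynomial.monomial β ((w : L) * c⁻¹ ^ β.degree)) := by
  have h1 : ∀ w : L, algebraMap L (TruncPoly L σ M) w = truncMk L σ M (MvPolynomial.C w) :=
    fun w => rfl
  rw [MvPolynomial.coe_eval₂Hom, MvPolynomial.eval₂_monomial, RingHom.comp_apply, h1]
  have h2 : MvPolynomial.monomial β ((W.subtype w : L) * c⁻¹ ^ β.degree) = MvPolynomial.C (W.subtype w) *
      β.prod fun i k => (MvPolynomial.monomial (Finsupp.single i 1) c⁻¹) ^ k := by
    rw [← MvPolynomial.C_mul_monomial]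
    congr 1
    rw [MvPolynomial.monomial_eq, Finsupp.degree_apply, ← Finset.prod_pow_eq_pow_sum, map_prod,
      Finsupp.prod, Finsupp.prod, ← Finset.prod_mul_distrib]
    refine Finset.prod_congr rfl fun i _ => ?_
    rw [MvPolynomial.monomial_pow, map_pow, ← mul_pow, ← MvPolynomial.monomial_pow]
    congr 1
    rw [MvPolynomial.X, MvPolynomial.C_mul_monomial, mul_one]
  rw [show (w : L) = W.subtype w from rfl, h2, map_mul, map_finsuppProd]
  simp only [map_pow]

lemma mk_monomial_mem_truncLattice (hc : c ≠ 0) {β : σ →₀ ℕ} {a : L}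
    (h : c ^ β.degree * a ∈ W) :
    truncMk L σ M (MvPolynomial.monomial β a) ∈ truncLattice σ M W c := by
  refine ⟨MvPolynomial.monomial β ⟨_, h⟩, ?_⟩
  rw [truncLattice_eval_monomial]
  congr 2
  simp only [inv_pow]
  field_simp

lemma mk_mem_truncLattice (hc : c ≠ 0) {p : MvPolynomial σ L}
    (h : ∀ β ∈ p.support, c ^ β.degree * p.coeff β ∈ W) :
    truncMk L σ M p ∈ truncLattice σ M W c := by
  rw [← MvPolynomial.support_sum_monomial_coeff p, map_sum]
  exact sum_mem fun β hβ => mk_monomial_mem_truncLattice hc (h β hβ)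

lemma mk_mem_truncLattice' (hc : c ≠ 0) (hcW : c ∈ W) {p : MvPolynomial σ L}
    (h : ∀ β ∈ p.support, c * p.coeff β ∈ W) (h0 : p.coeff 0 ∈ W) :
    truncMk L σ M p ∈ truncLattice σ M W c := by
  refine mk_mem_truncLattice hc fun β hβ => ?_
  by_cases hd : β = 0
  · simpa [hd] using h0
  · have h1 : β.degree ≠ 0 := fun h => hd ((Finsupp.degree_eq_zero_iff β).1 h)
    obtain ⟨k, hk⟩ := Nat.exists_eq_succ_of_ne_zero h1
    rw [hk, pow_succ, mul_assoc]
    exact mul_mem (pow_mem hcW k) (h β hβ)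

lemma truncLattice_induction {P : TruncPoly L σ M → Prop}
    (hm : ∀ β : σ →₀ ℕ, ∀ w ∈ W, P (truncMk L σ M (MvPolynomial.monomial β (w * c⁻¹ ^ β.degree))))
    (ha : ∀ q q', P q → P q' → P (q + q')) {q : TruncPoly L σ M}
    (hq : q ∈ truncLattice σ M W c) : P q := by
  obtain ⟨p, rfl⟩ := hq
  induction p using MvPolynomial.induction_on' with
  | monomial γ a => rw [truncLattice_eval_monomial]; exact hm γ a a.2
  | add f g hf hg => rw [map_add]; exact ha _ _ hf hg

lemma truncScale_mem_truncLattice (hc : c ≠ 0) {s : ℕ → L} (hs : ∀ n, s n ∈ W)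
    {q : TruncPoly L σ M} (hq : q ∈ truncLattice σ M W c) :
    truncScale s q ∈ truncLattice σ M W c := by
  refine truncLattice_induction (P := fun q => truncScale s q ∈ truncLattice σ M W c)
    (fun β w hw => ?_) (fun q q' h h' => ?_) hq
  · rw [truncScale_mk, polyScale_monomial]
    refine mk_monomial_mem_truncLattice hc ?_
    have : c ^ β.degree * (s β.degree * (w * c⁻¹ ^ β.degree)) = s β.degree * w := by
      rw [inv_pow]; field_simp
    rw [this]
    exact mul_mem (hs _) hw
  · rw [map_add]; exact add_mem h h'

lemma truncConst_mem {q : TruncPoly L σ M} (hq : q ∈ truncLattice σ M W c) :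
    truncConst L σ M q ∈ W := by
  refine truncLattice_induction (P := fun q => truncConst L σ M q ∈ W)
    (fun β w hw => ?_) (fun q q' h h' => ?_) hq
  · classical
    rw [truncConst_mk, MvPolynomial.coeff_monomial]
    split_ifs with h
    · simpa [h] using hw
    · exact W.zero_mem
  · rw [map_add]; exact add_mem h h'

lemma algebraMap_mem_truncLattice (hc : c ≠ 0) {w : L} (hw : w ∈ W) :
    algebraMap L (TruncPoly L σ M) w ∈ truncLattice σ M W c := by
  have : algebraMap L (TruncPoly L σ M) w = truncMk L σ M (MvPolynomial.monomial 0 w) := rfl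
  rw [this]
  exact mk_monomial_mem_truncLattice hc (by simpa using hw)

lemma exists_inv_truncLattice (hc : c ≠ 0) {q : TruncPoly L σ M}
    (hq : q ∈ truncLattice σ M W c) (h : W.valuation (truncConst L σ M q) = 1) :
    ∃ q' ∈ truncLattice σ M W c, q * q' = 1 := by
  have h0 : truncConst L σ M q ≠ 0 := by
    rintro h0; rw [h0, map_zero] at h; exact zero_ne_one h
  have hw := algebraMap_mem_truncLattice (σ := σ) (M := M) hc (truncConst_mem hq)
  have hw' : algebraMap L (TruncPoly L σ M) (truncConst L σ M q)⁻¹ ∈ truncLattice σ M W c :=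
    algebraMap_mem_truncLattice hc ((W.valuation_le_one_iff _).1 (by rw [map_inv₀, h, inv_one]))
  have hu : IsUnit (⟨_, hw⟩ : truncLattice σ M W c) := by
    refine IsUnit.of_mul_eq_one ⟨_, hw'⟩ (Subtype.ext ?_)
    change algebraMap L (TruncPoly L σ M) _ * algebraMap L (TruncPoly L σ M) _ = 1
    rw [← map_mul, mul_inv_cancel₀ h0, map_one]
  have hn : IsNilpotent ((⟨q, hq⟩ : truncLattice σ M W c) - ⟨_, hw⟩) := by
    refine ⟨M + 1, Subtype.ext ?_⟩
    have h1 : q - algebraMap L (TruncPoly L σ M) (truncConst L σ M q) ∈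
        RingHom.ker (truncConst L σ M) := by
      rw [RingHom.mem_ker, map_sub, AlgHom.commutes, Algebra.algebraMap_self_apply, sub_self]
    have h2 := Ideal.pow_mem_pow h1 (M + 1)
    rw [ker_truncConst_pow] at h2
    exact h2
  have := IsNilpotent.isUnit_add_left_of_commute hn hu (Commute.all _ _)
  rw [add_sub_cancel] at this
  obtain ⟨y, hy⟩ := this.exists_right_inv
  exact ⟨y, y.2, congr_arg Subtype.val hy⟩

/-- Coordinate functionals are bounded on the lattice. -/
lemma linear_mem_of_truncLattice (hc : c ≠ 0) (hcW : c ∈ W) (ℓ : TruncPoly L σ M →ₗ[L] L)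
    (hℓ : ∀ β : σ →₀ ℕ, β.degree ≤ M → c * ℓ (truncMk L σ M (MvPolynomial.monomial β 1)) ∈ W)
    {q : TruncPoly L σ M} (hq : q ∈ truncLattice σ M W c) : c ^ (M + 1) * ℓ q ∈ W := by
  refine truncLattice_induction (P := fun q => c ^ (M + 1) * ℓ q ∈ W)
    (fun β w hw => ?_) (fun q q' h h' => ?_) hq
  · by_cases h : β.degree ≤ M
    · have h1 : truncMk L σ M (MvPolynomial.monomial β (w * c⁻¹ ^ β.degree)) =
          (w * c⁻¹ ^ β.degree) • truncMk L σ M (MvPolynomial.monomial β 1) := by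
        rw [← map_smul, MvPolynomial.smul_monomial, smul_eq_mul, mul_one]
      obtain ⟨k, hk⟩ := Nat.exists_eq_add_of_le h
      rw [h1, map_smul, smul_eq_mul]
      have h2 : c ^ (M + 1) * (w * c⁻¹ ^ β.degree * ℓ (truncMk L σ M (MvPolynomial.monomial β 1)))
          = c ^ k * w * (c * ℓ (truncMk L σ M (MvPolynomial.monomial β 1))) := by
        have : c ^ (M + 1) * c⁻¹ ^ β.degree = c ^ k * c := by
          rw [hk, inv_pow]; field_simp; ring
        calc _ = (c ^ (M + 1) * c⁻¹ ^ β.degree) *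
              (w * ℓ (truncMk L σ M (MvPolynomial.monomial β 1))) := by ring
          _ = _ := by rw [this]; ring
      rw [h2]
      exact mul_mem (mul_mem (pow_mem hcW k) hw) (hℓ β h)
    · have h1 : truncMk L σ M (MvPolynomial.monomial β (w * c⁻¹ ^ β.degree)) = 0 := by
        refine Ideal.Quotient.eq_zero_iff_mem.2 ?_
        rw [MvPolynomial.mem_pow_idealOfVars_iff']
        intro γ hγ
        classical
        rw [MvPolynomial.coeff_monomial, if_neg (by rintro rfl; omega)]
      rw [h1, map_zero, mul_zero]
      exact W.zero_mem
  · rw [map_add, mul_add]; exact add_mem h h'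

instance [Finite σ] : Module.Finite L (TruncPoly L σ M) := by
  classical
  have hfin : {β : σ →₀ ℕ | β.degree ≤ M}.Finite := by
    have := Fintype.ofFinite σ
    exact (Finsupp.finite_of_degree_le M)
  refine ⟨⟨hfin.toFinset.image fun β => truncMk L σ M (MvPolynomial.monomial β 1), ?_⟩⟩
  rw [eq_top_iff]
  intro q _
  induction q using TruncPoly.induction_on with
  | hm β a =>
    by_cases h : β.degree ≤ M
    · have : truncMk L σ M (MvPolynomial.monomial β a) =
          a • truncMk L σ M (MvPolynomial.monomial β 1) := by
        rw [← map_smul, MvPolynomial.smul_monomial, smul_eq_mul, mul_one]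
      rw [this]
      refine Submodule.smul_mem _ _ (Submodule.subset_span ?_)
      simpa using ⟨β, h, rfl⟩
    · have h1 : truncMk L σ M (MvPolynomial.monomial β a) = 0 := by
        refine Ideal.Quotient.eq_zero_iff_mem.2 ?_
        rw [MvPolynomial.mem_pow_idealOfVars_iff']
        intro γ hγ
        rw [MvPolynomial.coeff_monomial, if_neg (by rintro rfl; omega)]
      rw [h1]
      exact zero_mem _
  | ha q q' h h' => exact add_mem (h trivial) (h' trivial)

end

end InvHyp

namespace InvHyp

section

variable {L : Type*} [Field L] {σ : Type*} {M : ℕ} {W : ValuationSubring L} {c : L}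

/-- The coefficients of a representing polynomial. -/
noncomputable def truncCoeffs (q : TruncPoly L σ M) : Finset L :=
  letI := Classical.decEq L
  (Function.surjInv truncMk_surjective q).support.image
    fun β => (Function.surjInv truncMk_surjective q).coeff β

lemma coeff_mem_truncCoeffs {q : TruncPoly L σ M} {β : σ →₀ ℕ}
    (hβ : β ∈ (Function.surjInv truncMk_surjective q).support) :
    (Function.surjInv truncMk_surjective q).coeff β ∈ truncCoeffs q :=
  letI := Classical.decEq L
  Finset.mem_image_of_mem _ hβ

lemma mem_truncLattice_of_coeffs (hc : c ≠ 0) (hcW : c ∈ W) {q : TruncPoly L σ M}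
    (h : ∀ l ∈ truncCoeffs q, c * l ∈ W) (h0 : truncConst L σ M q ∈ W) :
    q ∈ truncLattice σ M W c := by
  have hq := Function.surjInv_eq (truncMk_surjective (L := L) (σ := σ) (M := M)) q
  rw [← hq]
  refine mk_mem_truncLattice' hc hcW (fun β hβ => h _ (coeff_mem_truncCoeffs hβ)) ?_
  rw [← truncConst_mk (M := M), hq]
  exact h0

lemma smul_mem_truncLattice_of_coeffs (hc : c ≠ 0) (hcW : c ∈ W) {q : TruncPoly L σ M}
    (h : ∀ l ∈ truncCoeffs q, c * l ∈ W) : c • q ∈ truncLattice σ M W c := by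
  have hq := Function.surjInv_eq (truncMk_surjective (L := L) (σ := σ) (M := M)) q
  rw [← hq, ← map_smul]
  refine mk_mem_truncLattice hc fun β hβ => ?_
  rw [MvPolynomial.coeff_smul]
  exact mul_mem (pow_mem hcW _) (h _ (coeff_mem_truncCoeffs (MvPolynomial.support_smul hβ)))

variable {K F : Type*} [Field K] [Algebra K L] [Field F] [Algebra K F]

lemma lift_mem_truncLattice (hc : c ≠ 0) (hcW : c ∈ W) (hK : ∀ a : K, algebraMap K L a ∈ W)
    (a : F →ₐ[K] TruncPoly L σ M) (φ : F →ₐ[K] L) (hφ : ∀ g, truncConst L σ M (a g) = φ g)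
    {G : Finset F} (hGv : ∀ g ∈ G, g ∈ W.comap (φ : F →+* L))
    (hgen : ∀ T : Subring F, (∀ a : K, algebraMap K F a ∈ T) → (∀ g ∈ G, g ∈ T) →
      (∀ s ∈ T, (W.comap (φ : F →+* L)).valuation s = 1 → s⁻¹ ∈ T) →
        ∀ x ∈ W.comap (φ : F →+* L), x ∈ T)
    (hcoef : ∀ g ∈ G, ∀ l ∈ truncCoeffs (a g), c * l ∈ W) :
    ∀ x ∈ W.comap (φ : F →+* L), a x ∈ truncLattice σ M W c := by
  refine hgen ((truncLattice σ M W c).comap (a : F →+* TruncPoly L σ M)) (fun k => ?_)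
    (fun g hg => mem_truncLattice_of_coeffs hc hcW (hcoef g hg)
      (show truncConst L σ M (a g) ∈ W by rw [hφ]; exact hGv g hg))
    fun s hs hs1 => ?_
  · change a (algebraMap K F k) ∈ truncLattice σ M W c
    rw [AlgHom.commutes, IsScalarTower.algebraMap_apply K L (TruncPoly L σ M)]
    exact algebraMap_mem_truncLattice hc (hK k)
  · have hs0 : s ≠ 0 := by
      rintro rfl; rw [map_zero] at hs1; exact zero_ne_one hs1
    have h1 : s⁻¹ ∈ W.comap (φ : F →+* L) :=
      (ValuationSubring.valuation_le_one_iff _ _).1 (by rw [map_inv₀, hs1, inv_one])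
    have h2 : s ∈ W.comap (φ : F →+* L) :=
      (ValuationSubring.valuation_le_one_iff _ _).1 hs1.le
    have h3 : W.valuation (truncConst L σ M (a s)) = 1 := by
      rw [hφ]
      exact valuation_eq_one_of_mem_of_inv_mem ((map_ne_zero φ).2 hs0) h2
        (by rw [← map_inv₀]; exact h1)
    obtain ⟨q', hq', h4⟩ := exists_inv_truncLattice hc hs h3
    have h5 : a s⁻¹ = q' := by
      have : a s⁻¹ * a s = 1 := by rw [← map_mul, inv_mul_cancel₀ hs0, map_one]
      calc a s⁻¹ = a s⁻¹ * (a s * q') := by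
            rw [show a s * q' = 1 from h4, mul_one]
        _ = q' := by rw [← mul_assoc, this, one_mul]
    change a s⁻¹ ∈ truncLattice σ M W c
    rw [h5]
    exact hq'

end

lemma exists_truncated_presentation {K L S : Type*} [Field K] [CharZero K] [Field L] [Algebra K L]
    [Algebra.EssFiniteType K L] [CommRing S] [Algebra K S] (π : S →ₐ[K] L) (hπ : Function.Surjective π)
    (hfg : (RingHom.ker π).FG) {M : ℕ} (hM : RingHom.ker π ^ (M + 1) = ⊥) :
    ∃ (r : ℕ) (ψ : TruncPoly L (Fin r) M →ₐ[K] S), Function.Surjective ψ ∧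
      ∀ q, π (ψ q) = truncConst L (Fin r) M q := by
  have : Algebra.FormallySmooth K L := Algebra.FormallySmooth.of_perfectField
  let s : L →ₐ[K] S := Algebra.FormallySmooth.liftOfSurjective (AlgHom.id K L) π hπ ⟨_, hM⟩
  have hs : ∀ l, π (s l) = l := fun l =>
    Algebra.FormallySmooth.liftOfSurjective_apply (AlgHom.id K L) π hπ ⟨_, hM⟩ l
  obtain ⟨r, n, hn⟩ := Submodule.fg_iff_exists_fin_generating_family.1 hfg
  have hnk : ∀ i, n i ∈ RingHom.ker π := fun i => by
    rw [← hn]; exact Submodule.subset_span ⟨i, rfl⟩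
  let ψ₀ : MvPolynomial (Fin r) L →ₐ[K] S :=
    { MvPolynomial.eval₂Hom (s : L →+* S) n with
      commutes' := fun k => by
        change MvPolynomial.eval₂Hom (s : L →+* S) n (algebraMap K _ k) = _
        rw [MvPolynomial.algebraMap_apply]
        simp }
  have hC : ∀ l, ψ₀ (MvPolynomial.C l) = s l := fun l => MvPolynomial.eval₂Hom_C _ _ _
  have hX : ∀ i, ψ₀ (MvPolynomial.X i) = n i := fun i => MvPolynomial.eval₂Hom_X' _ _ _
  have hI : (MvPolynomial.idealOfVars (Fin r) L) ≤ (RingHom.ker π).comap ψ₀ := by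
    rw [Ideal.span_le]
    rintro _ ⟨i, rfl⟩
    change ψ₀ (MvPolynomial.X i) ∈ RingHom.ker π
    rw [hX]
    exact hnk i
  have hker : ∀ p ∈ (MvPolynomial.idealOfVars (Fin r) L) ^ (M + 1), ψ₀ p = 0 := fun p hp => by
    have h1 := (Ideal.pow_right_mono hI (M + 1)).trans (Ideal.le_comap_pow ψ₀ (M + 1)) hp
    rw [hM] at h1
    exact h1
  have hsurj : ∀ k, ∀ y, ∃ p, y - ψ₀ p ∈ RingHom.ker π ^ k := by
    intro k
    induction k with
    | zero => intro y; exact ⟨0, by simp⟩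
    | succ k ih =>
      intro y
      have h1 : y - s (π y) ∈ RingHom.ker π := by rw [RingHom.mem_ker, map_sub, hs, sub_self]
      rw [← hn] at h1
      obtain ⟨a, ha⟩ := (Submodule.mem_span_range_iff_exists_fun S).1 h1
      choose p hp using ih
      refine ⟨MvPolynomial.C (π y) + ∑ i, p (a i) * MvPolynomial.X i, ?_⟩
      rw [map_add, hC, ← sub_sub, ← ha, map_sum, ← Finset.sum_sub_distrib]
      refine sum_mem fun i _ => ?_
      rw [map_mul, hX, smul_eq_mul, ← sub_mul, pow_succ]
      exact Ideal.mul_mem_mul (hp _) (hnk i)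
  refine ⟨r, Ideal.Quotient.liftₐ _ ψ₀ hker, fun y => ?_, fun q => ?_⟩
  · obtain ⟨p, hp⟩ := hsurj (M + 1) y
    rw [hM] at hp
    exact ⟨Ideal.Quotient.mk _ p, (sub_eq_zero.1 hp).symm⟩
  · obtain ⟨p, rfl⟩ := truncMk_surjective q
    have h1 : Ideal.Quotient.liftₐ _ ψ₀ hker (truncMk L (Fin r) M p) = ψ₀ p := rfl
    rw [h1, truncConst_mk]
    induction p using MvPolynomial.induction_on with
    | C a => rw [hC, hs]; simp
    | add p q hp hq => rw [map_add, map_add, hp rfl, hq rfl, MvPolynomial.coeff_add]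
    | mul_X p i hp =>
      rw [map_mul, hX, map_mul, (RingHom.mem_ker).1 (hnk i), mul_zero]
      rw [← MvPolynomial.constantCoeff_eq, map_mul, MvPolynomial.constantCoeff_X, mul_zero]

end InvHyp

namespace InvHyp

section

variable {K : Type*} [Field K] [CharZero K] {F L S : Type*} [Field F] [Algebra K F]
  [Algebra.EssFiniteType K F] [Field L] [Algebra K L] [Algebra.EssFiniteType K L] [CommRing S]
  [Algebra K S] {ι ι' : Type*} [Fintype ι] [DecidableEq ι] [Nonempty ι] {x : ι → F}
  [Finite ι'] [DecidableEq ι'] [Nonempty ι'] {t : ι' → L}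

/-- Divisors with the same pullbacks to an infinitesimal thickening of a variety yield an
invariant function. -/
theorem exists_invariant_of_thickening (hx : IsTranscendenceBasis K x)
    (ht : IsTranscendenceBasis K t) {q : Option ι → F} {N : Set (ValuationSubring F)}
    {H : ValuationSubring F → F} {ω : ValuationSubring F → ι → F} (hq0 : ∀ o, q o ≠ 0)
    (hq : ∀ o v, ChartGood K (pchart x o) v → q o ∈ v ∧
      (∀ j, x j * q o ∈ v) ∧ ∀ j, ∀ w ∈ v, q o * pd hx j w ∈ v)
    (hN : ∀ v ∈ N, ChartGood K x v ∧ H v ≠ 0 ∧ (∃ j, q none * (pd hx j (H v) / H v) ∉ v) ∧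
        (∀ o, ChartGood K (pchart x o) v → ∀ j, q o * (ω v j - pd hx j (H v) / H v) ∈ v) ∧
        ∀ o v', ChartGood K (pchart x o) v' → v' ≠ v → ∀ j, q o * ω v j ∈ v')
    (π : S →ₐ[K] L) (hπ : Function.Surjective π) (hfg : (RingHom.ker π).FG) {M : ℕ}
    (hM : RingHom.ker π ^ (M + 1) = ⊥) (Φ₁ Φ₂ : F →ₐ[K] S) (Y : Finset S)
    (hgood : ∀ o W, ChartGood K (pchart t o) W →
      (∃ o₁, ChartGood K (pchart x o₁) (W.comap (π.comp Φ₁ : F →+* L))) ∧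
      ∃ o₂, ChartGood K (pchart x o₂) (W.comap (π.comp Φ₂ : F →+* L)))
    {G : Set (ValuationSubring F →₀ ℤ)} (hGN : ∀ m ∈ G, ∀ v ∈ m.support, v ∈ N)
    (hGinf : (⋃ m ∈ G, (m.support : Set (ValuationSubring F))).Infinite)
    (hG : ∀ m ∈ G, ∀ o W, ChartGood K (pchart t o) W → ∀ v₁ v₂,
      v₁ = W.comap (π.comp Φ₁ : F →+* L) → v₂ = W.comap (π.comp Φ₂ : F →+* L) → m v₁ = m v₂ ∧
      (m v₁ ≠ 0 → (∀ y ∈ Y, π y ∈ W) ∧ ∃ e₁ e₂ : F, e₁ ≠ 0 ∧ e₂ ≠ 0 ∧ e₁ / H v₁ ∈ v₁ ∧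
        H v₁ / e₁ ∈ v₁ ∧ e₂ / H v₂ ∈ v₂ ∧ H v₂ / e₂ ∈ v₂ ∧ ∃ s₁ ∈ Algebra.adjoin K (Y : Set S),
          ∃ s₂ ∈ Algebra.adjoin K (Y : Set S), W.valuation (π s₁) = 1 ∧ W.valuation (π s₂) = 1 ∧
            s₂ * Φ₁ e₁ = s₁ * Φ₂ e₂)) :
    ∃ g : F, g ∉ Set.range (algebraMap K F) ∧ Φ₁ g = Φ₂ g := by
  classical
  have : CharZero L := charZero_of_injective_algebraMap (algebraMap K L).injective
  have : Algebra.FormallySmooth K F := Algebra.FormallySmooth.of_perfectField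
  obtain ⟨r, ψ, hψ, hψπ⟩ := exists_truncated_presentation π hπ hfg hM
  have hJ : RingHom.ker ψ ≤ RingHom.ker (truncConst L (Fin r) M) := fun y hy => by
    rw [RingHom.mem_ker] at hy ⊢
    rw [← hψπ, hy, map_zero]
  have hnil : IsNilpotent (RingHom.ker ψ) := ⟨M + 1, by
    have := Ideal.pow_right_mono hJ (M + 1)
    rw [ker_truncConst_pow] at this
    exact le_bot_iff.1 this⟩
  let A : F →ₐ[K] TruncPoly L (Fin r) M := Algebra.FormallySmooth.liftOfSurjective Φ₁ ψ hψ hnil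
  let B : F →ₐ[K] TruncPoly L (Fin r) M := Algebra.FormallySmooth.liftOfSurjective Φ₂ ψ hψ hnil
  have hψA : ∀ g, ψ (A g) = Φ₁ g :=
    fun g => Algebra.FormallySmooth.liftOfSurjective_apply Φ₁ ψ hψ hnil g
  have hψB : ∀ g, ψ (B g) = Φ₂ g :=
    fun g => Algebra.FormallySmooth.liftOfSurjective_apply Φ₂ ψ hψ hnil g
  have hρA : ∀ g, truncConst L (Fin r) M (A g) = π.comp Φ₁ g := fun g => by
    rw [← hψπ, hψA]; rfl
  have hρB : ∀ g, truncConst L (Fin r) M (B g) = π.comp Φ₂ g := fun g => by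
    rw [← hψπ, hψB]; rfl
  choose Dt hDt using exists_pd_extension hx (π.comp Φ₁)
  choose G' hG' using fun o => chart_generated (isTranscendenceBasis_pchart hx o)
  let d := Module.finrank L (TruncPoly L (Fin r) M ⧸ RingHom.ker ψ)
  let b := Module.finBasis L (TruncPoly L (Fin r) M ⧸ RingHom.ker ψ)
  let ℓ : Fin d → TruncPoly L (Fin r) M →ₗ[L] L := fun k =>
    b.coord k ∘ₗ (Ideal.Quotient.mkₐ L (RingHom.ker ψ)).toLinearMap
  have hdeg : {β : Fin r →₀ ℕ | β.degree ≤ M}.Finite := Finsupp.finite_of_degree_le M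
  let yl : S → TruncPoly L (Fin r) M := Function.surjInv hψ
  let dinv : Option ι → Option ι → TruncPoly L (Fin r) M := fun o₁ o₂ =>
    A (q o₁)⁻¹ ^ 3 * B (q o₂)⁻¹ ^ 3
  let G₀ : Finset L :=
    (Finset.univ.image fun o : Option ι × Option ι =>
      (π.comp Φ₁ (q o.1) ^ 3 * π.comp Φ₂ (q o.2) ^ 3)⁻¹) ∪
    (Finset.univ.biUnion fun o => (G' o).biUnion fun g => truncCoeffs (A g) ∪ truncCoeffs (B g)) ∪
    (Y.biUnion fun y => truncCoeffs (yl y)) ∪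
    (Finset.univ.biUnion fun o : Option ι × Option ι => truncCoeffs (dinv o.1 o.2)) ∪
    (Finset.univ.biUnion fun k => hdeg.toFinset.image fun β =>
      ℓ k (truncMk L (Fin r) M (MvPolynomial.monomial β 1)))
  choose c hc0 hc using fun o =>
    exists_derivation_bound (isTranscendenceBasis_pchart ht o) G₀ Dt
  have hcW : ∀ o W, ChartGood K (pchart t o) W → c o ∈ W := fun o W hW => (hc o W hW).1
  have hcg : ∀ o W, ChartGood K (pchart t o) W → ∀ g ∈ G₀, c o * g ∈ W :=
    fun o W hW => (hc o W hW).2.1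
  obtain ⟨N₂, hN₂, hN₂'⟩ := exists_finiteDimensional_of_bounded ht (fun o => c o ^ (M + 2))
    fun o => pow_ne_zero _ (hc0 o)
  have hcoefA : ∀ o W, ChartGood K (pchart t o) W → ∀ o', ∀ g ∈ G' o', ∀ l ∈ truncCoeffs (A g),
      c o * l ∈ W := fun o W hW o' g hg l hl => hcg o W hW l (by
    simp only [G₀, Finset.mem_union, Finset.mem_biUnion]
    exact Or.inl (Or.inl (Or.inl (Or.inr ⟨o', Finset.mem_univ _, g, hg, Or.inl hl⟩))))
  have hcoefB : ∀ o W, ChartGood K (pchart t o) W → ∀ o', ∀ g ∈ G' o', ∀ l ∈ truncCoeffs (B g),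
      c o * l ∈ W := fun o W hW o' g hg l hl => hcg o W hW l (by
    simp only [G₀, Finset.mem_union, Finset.mem_biUnion]
    exact Or.inl (Or.inl (Or.inl (Or.inr ⟨o', Finset.mem_univ _, g, hg, Or.inr hl⟩))))
  let Λ : Option ι' → ValuationSubring L → Subring (TruncPoly L (Fin r) M) := fun o W =>
    truncLattice (Fin r) M W (c o)
  let P : Submodule K (TruncPoly L (Fin r) M ⧸ RingHom.ker ψ) :=
    (LinearMap.range (N₂.subtype.compLeft (Fin d))).map
      (b.equivFun.symm.toLinearMap.restrictScalars K)
  have hres := exists_invariant_of_divisors hx ht hq0 hq hN (π.comp Φ₁) (π.comp Φ₂) Dt hDt hgood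
    hc0 (fun o W hW => ⟨hcW o W hW, fun o₁ o₂ => hcg o W hW _ ?_, (hc o W hW).2.2⟩)
    ((truncConst L (Fin r) M).restrictScalars K) A B hρA hρB (truncEuler K)
    ((truncScale fun n => (n : L)⁻¹).restrictScalars K) (J := RingHom.ker ψ) (M := M + 1)
    ker_truncConst_pow hJ (fun y => ?_) (fun k u hu hEu => ?_) (fun u hu => ?_) (fun u hu => ?_)
    (Λ := Λ) (fun o W hW => ⟨?_, ?_, fun y hy => ?_, fun y hy => truncConst_mem hy⟩) (P := P)
    (fun w hw => ?_) hGN hGinf fun m hm o W hW => ⟨(hG m hm o W hW _ _ rfl rfl).1, fun hmv => ?_⟩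
  · obtain ⟨g, hg, hgJ⟩ := hres
    refine ⟨g, hg, ?_⟩
    rw [RingHom.mem_ker, map_sub, hψA, hψB] at hgJ
    exact sub_eq_zero.1 hgJ
  · simp only [G₀, Finset.mem_union, Finset.mem_image]
    exact Or.inl (Or.inl (Or.inl (Or.inl ⟨(o₁, o₂), Finset.mem_univ _, rfl⟩)))
  · obtain ⟨p, rfl⟩ := truncMk_surjective y
    change truncConst L (Fin r) M _ = 0
    rw [truncEuler_apply, truncScale_mk, truncConst_mk, coeff_polyScale]
    simp
  · have h1 : u = truncScale (fun n => (n : L)⁻¹) (truncEuler K u) := by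
      rw [truncEuler_apply, truncScale_truncScale, truncScale_eq_self (fun n hn => ?_) hu]
      exact inv_mul_cancel₀ (Nat.cast_ne_zero.2 hn)
    rw [h1]
    exact truncScale_mem_ker_pow hEu
  · change truncEuler K (truncScale (fun n => (n : L)⁻¹) u) = u
    rw [truncEuler_apply, truncScale_truncScale, truncScale_eq_self (fun n hn => ?_) hu]
    exact mul_inv_cancel₀ (Nat.cast_ne_zero.2 hn)
  · change truncScale (fun n => (n : L)⁻¹) (truncEuler K u) = u
    rw [truncEuler_apply, truncScale_truncScale, truncScale_eq_self (fun n hn => ?_) hu]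
    exact inv_mul_cancel₀ (Nat.cast_ne_zero.2 hn)
  · obtain ⟨o₁, ho₁⟩ := (hgood o W hW).1
    obtain ⟨Gs, hGs, hGv, hgen⟩ := hG' o₁ _ ho₁
    exact lift_mem_truncLattice (hc0 o) (hcW o W hW) hW.algebraMap_mem A _ hρA hGv hgen
      fun g hg => hcoefA o W hW o₁ g (hGs hg)
  · obtain ⟨o₂, ho₂⟩ := (hgood o W hW).2
    obtain ⟨Gs, hGs, hGv, hgen⟩ := hG' o₂ _ ho₂
    exact lift_mem_truncLattice (hc0 o) (hcW o W hW) hW.algebraMap_mem B _ hρB hGv hgen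
      fun g hg => hcoefB o W hW o₂ g (hGs hg)
  · rw [truncEuler_apply]
    exact truncScale_mem_truncLattice (hc0 o) (fun n => natCast_mem W n) hy
  · refine ⟨fun k => b.equivFun (Ideal.Quotient.mk _ (truncScale (fun n => (n : L)⁻¹) w)) k, ?_,
      b.equivFun.symm_apply_apply _⟩
    have hk : ∀ k, ℓ k (truncScale (fun n => (n : L)⁻¹) w) ∈ N₂ := fun k => by
      refine hN₂' _ fun o W hW => ?_
      obtain ⟨o₁, o₂, β, hβ, hβw⟩ := hw o W hW
      have h1 : ℓ k (truncScale (fun n => (n : L)⁻¹) w) =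
          ℓ k (truncScale (fun n => (n : L)⁻¹) β) := by
        rw [← sub_eq_zero, ← map_sub, ← map_sub]
        change b.coord k (Ideal.Quotient.mk _ _) = 0
        exact (congr_arg (b.coord k) (Ideal.Quotient.eq_zero_iff_mem.2 hβw)).trans (map_zero _)
      have h2 : c o • dinv o₁ o₂ ∈ truncLattice (Fin r) M W (c o) :=
        smul_mem_truncLattice_of_coeffs (hc0 o) (hcW o W hW) fun l hl => hcg o W hW l (by
          simp only [G₀, Finset.mem_union, Finset.mem_biUnion]
          exact Or.inl (Or.inr ⟨(o₁, o₂), Finset.mem_univ _, hl⟩))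
      have h3 : c o • β ∈ truncLattice (Fin r) M W (c o) := by
        have h4 := mul_mem h2 hβ
        have hA1 : A (q o₁)⁻¹ * A (q o₁) = 1 := by
          rw [← map_mul, inv_mul_cancel₀ (hq0 _), map_one]
        have hB1 : B (q o₂)⁻¹ * B (q o₂) = 1 := by
          rw [← map_mul, inv_mul_cancel₀ (hq0 _), map_one]
        have h5 : dinv o₁ o₂ * (A (q o₁) ^ 3 * B (q o₂) ^ 3 * β) = β := by
          calc dinv o₁ o₂ * (A (q o₁) ^ 3 * B (q o₂) ^ 3 * β)
              = (A (q o₁)⁻¹ * A (q o₁)) ^ 3 * (B (q o₂)⁻¹ * B (q o₂)) ^ 3 * β := by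
                simp only [dinv]; ring
            _ = β := by rw [hA1, hB1, one_pow, one_mul, one_mul]
        rwa [smul_mul_assoc, h5] at h4
      have h6 := linear_mem_of_truncLattice (hc0 o) (hcW o W hW) (ℓ k) (fun β hβ =>
        hcg o W hW _ (by
          simp only [G₀, Finset.mem_union, Finset.mem_biUnion, Finset.mem_image]
          exact Or.inr ⟨k, Finset.mem_univ _, β, by simpa using hβ, rfl⟩))
        (truncScale_mem_truncLattice (hc0 o) (s := fun n => (n : L)⁻¹) (fun n => by
          have := hW.algebraMap_mem ((n : K)⁻¹)
          rwa [map_inv₀, map_natCast] at this) h3)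
      rw [map_smul, map_smul, smul_eq_mul, ← mul_assoc, ← pow_succ] at h6
      rw [h1]
      exact h6
    exact ⟨fun k => ⟨_, hk k⟩, rfl⟩
  · obtain ⟨hY, e₁, e₂, h1, h2, h3, h4, h5, h6, s₁, hs₁, s₂, hs₂, h7, h8, h9⟩ :=
      (hG m hm o W hW _ _ rfl rfl).2 hmv
    have hlift : ∀ s ∈ Algebra.adjoin K (Y : Set S), ∃ σ ∈ Λ o W, ψ σ = s := by
      intro s hs
      induction hs using Algebra.adjoin_induction with
      | mem y hy =>
        refine ⟨yl y, mem_truncLattice_of_coeffs (hc0 o) (hcW o W hW) (fun l hl =>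
          hcg o W hW l ?_) ?_, Function.surjInv_eq hψ y⟩
        · simp only [G₀, Finset.mem_union, Finset.mem_biUnion]
          exact Or.inl (Or.inl (Or.inr ⟨y, hy, hl⟩))
        · rw [← hψπ, Function.surjInv_eq hψ y]
          exact hY y hy
      | algebraMap k =>
        refine ⟨algebraMap K _ k, ?_, ψ.commutes k⟩
        rw [IsScalarTower.algebraMap_apply K L (TruncPoly L (Fin r) M)]
        exact algebraMap_mem_truncLattice (hc0 o) (hW.algebraMap_mem k)
      | add y z _ _ hy hz =>
        obtain ⟨σ, hσ, rfl⟩ := hy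
        obtain ⟨τ, hτ, rfl⟩ := hz
        exact ⟨σ + τ, add_mem hσ hτ, map_add _ _ _⟩
      | mul y z _ _ hy hz =>
        obtain ⟨σ, hσ, rfl⟩ := hy
        obtain ⟨τ, hτ, rfl⟩ := hz
        exact ⟨σ * τ, mul_mem hσ hτ, map_mul _ _ _⟩
    obtain ⟨σ₁, hσ₁, rfl⟩ := hlift s₁ hs₁
    obtain ⟨σ₂, hσ₂, rfl⟩ := hlift s₂ hs₂
    rw [hψπ] at h7 h8
    obtain ⟨τ₁, hτ₁, ht₁⟩ := exists_inv_truncLattice (hc0 o) hσ₁ h7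
    obtain ⟨τ₂, hτ₂, ht₂⟩ := exists_inv_truncLattice (hc0 o) hσ₂ h8
    refine ⟨e₁, e₂, h1, h2, h3, h4, h5, h6, σ₁, hσ₁, σ₂, hσ₂, τ₁, hτ₁, τ₂, hτ₂, ht₁, ht₂, ?_⟩
    rw [RingHom.mem_ker, map_sub, map_mul, map_mul, hψA, hψB, h9, sub_self]

end

end InvHyp

namespace InvHyp

section GoodFamilies

variable {K : Type*} [Field K] {F : Type*} [Field F] [Algebra K F]

variable (K) in
/-- `v` dominates the chart of some member of the family `g`, and the residues of `k` members in
that chart are algebraically independent. -/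
def GoodFam {κ : Type*} (k : ℕ) (g : κ → F) (v : ValuationSubring F) : Prop :=
  ∃ i, g i ≠ 0 ∧ (∀ j, g j / g i ∈ v) ∧ ∃ s : Fin k → κ, ResIndep K v fun l => g (s l) / g i

lemma ResIndep.injective {ι : Type*} {v : ValuationSubring F} {r : ι → F} (h : ResIndep K v r) :
    Function.Injective r := by
  intro a b hab
  by_contra hne
  have h1 := h (MvPolynomial.X a - MvPolynomial.X b) (by
    rw [sub_ne_zero]
    exact fun h => hne (MvPolynomial.X_injective h))
  simp [hab] at h1

lemma ResIndep.ne_one {ι : Type*} {v : ValuationSubring F} {r : ι → F} (h : ResIndep K v r)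
    (a : ι) : r a ≠ 1 := by
  intro hab
  have h1 := h (MvPolynomial.X a - 1) (by
    rw [sub_ne_zero]
    intro h
    have := congrArg MvPolynomial.totalDegree h
    rw [MvPolynomial.totalDegree_X, MvPolynomial.totalDegree_one] at this
    exact one_ne_zero this)
  simp [hab] at h1

lemma GoodFam.prod {κ κ' : Type*} [Finite κ'] {k : ℕ} {g : κ → F} {v : ValuationSubring F}
    (h : GoodFam K k g v) {g' : κ' → F} (hg' : ∃ i, g' i ≠ 0) :
    GoodFam K k (fun a : κ × κ' => g a.1 * g' a.2) v := by
  obtain ⟨i, hi, hiv, s, hs⟩ := h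
  obtain ⟨i₁, hi₁⟩ := hg'
  have : Nonempty κ' := ⟨i₁⟩
  obtain ⟨i', hi'⟩ := Finite.exists_max fun i => v.valuation (g' i)
  have h0 : g' i' ≠ 0 := by
    intro h0
    have := hi' i₁
    rw [h0, map_zero, le_zero_iff, map_eq_zero] at this
    exact hi₁ this
  refine ⟨(i, i'), mul_ne_zero hi h0, fun a => ?_, fun l => (s l, i'), ?_⟩
  · rw [mul_div_mul_comm]
    refine v.mul_mem _ _ (hiv _) ?_
    rw [← v.valuation_le_one_iff, map_div₀]
    exact div_le_one_of_le₀ (hi' _) zero_le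
  · simpa only [mul_div_mul_right _ _ h0] using hs

lemma GoodFam.drop [Infinite K] {κ : Type*} [Finite κ] {g : Option κ → F} (h0 : g none ≠ 0)
    (hg : ¬AlgebraicIndependent K fun k => g (some k) / g none) :
    ∃ w : κ → K, ∀ k v, (∀ a, algebraMap K F a ∈ v) → GoodFam K k g v →
      GoodFam K k (fun j => g (some j) - algebraMap K F (w j) * g none) v := by
  rw [algebraicIndependent_iff] at hg
  push Not at hg
  obtain ⟨p, hp, hp0⟩ := hg
  obtain ⟨w, hw⟩ : ∃ w, MvPolynomial.eval w p ≠ 0 := by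
    by_contra! h
    exact hp0 (MvPolynomial.funext fun w => by rw [h w, map_zero])
  refine ⟨w, fun k v hK h => ?_⟩
  obtain ⟨i, hi, hiv, s, hs⟩ := h
  set g' : κ → F := fun j => g (some j) - algebraMap K F (w j) * g none with hg'
  have hne : ∃ j, g' j ≠ 0 := by
    by_contra! hz
    have h1 : (fun k => g (some k) / g none) = fun k => algebraMap K F (w k) := by
      funext k
      rw [div_eq_iff h0]
      exact sub_eq_zero.1 (hz k)
    rw [h1] at hp
    have h2 : MvPolynomial.aeval (fun k => algebraMap K F (w k)) p =
        algebraMap K F (MvPolynomial.eval w p) := by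
      rw [← MvPolynomial.coe_aeval_eq_eval]
      exact MvPolynomial.aeval_algebraMap_apply F w p
    rw [h2, map_eq_zero] at hp
    exact hw hp
  obtain ⟨i₁, hi₁⟩ := hne
  have : Nonempty κ := ⟨i₁⟩
  obtain ⟨i', hi'⟩ := Finite.exists_max fun i => v.valuation (g' i)
  have hi0 : g' i' ≠ 0 := by
    intro h0
    have := hi' i₁
    rw [h0, map_zero, le_zero_iff, map_eq_zero] at this
    exact hi₁ this
  have hτv : ∀ j, g' j / g' i' ∈ v := fun j => by
    rw [← v.valuation_le_one_iff, map_div₀]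
    exact div_le_one_of_le₀ (hi' _) zero_le
  set τ : κ → F := fun j => g' j / g' i' with hτ
  have hmem : ∀ W : ValuationSubring F, (∀ a, algebraMap K F a ∈ W) → (∀ j, τ j ∈ W) →
      ∀ z ∈ Algebra.adjoin K (Set.range τ), z ∈ W := by
    intro W hK hW z hz
    rw [Algebra.adjoin_range_eq_range_aeval] at hz
    obtain ⟨p, rfl⟩ := hz
    exact aeval_mem hK hW p
  have hz : IsIntegral (Algebra.adjoin K (Set.range τ)) (g none / g' i') := by
    refine isIntegral_of_forall_valuationSubring fun W hW => ?_
    have hKW : ∀ a, algebraMap K F a ∈ W := fun a =>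
      hW (algebraMap K (Algebra.adjoin K (Set.range τ)) a)
    by_contra hzW
    have hz1 : W.valuation (g' i' / g none) < 1 := by
      rw [← W.valuation_le_one_iff, not_le, map_div₀] at hzW
      rw [map_div₀, ← inv_div]
      exact inv_lt_one_of_one_lt₀ hzW
    have hy : ∀ j, g (some j) / g none = τ j * (g' i' / g none) + algebraMap K F (w j) := by
      intro j
      have : τ j * (g' i' / g none) = g' j / g none := by
        simp only [hτ]
        field_simp
      rw [this]
      simp only [hg']
      field_simp
      ring
    have hy1 : ∀ j, W.valuation (τ j * (g' i' / g none)) < 1 := by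
      intro j
      rw [map_mul, mul_comm]
      refine mul_lt_one_of_lt_of_le hz1 ?_
      rw [W.valuation_le_one_iff]
      exact hW ⟨τ j, Algebra.subset_adjoin ⟨j, rfl⟩⟩
    obtain ⟨κ', _, _, res, hres, hresK⟩ := exists_residue_algebra hKW
    have hyW : ∀ j, g (some j) / g none ∈ W := fun j => by
      rw [hy]
      exact W.add_mem _ _ (W.valuation_le_one_iff _ |>.1 (hy1 j).le) (hKW _)
    have h1 := residue_aeval hKW hresK hyW p
    have h2 : ∀ j, res ⟨g (some j) / g none, hyW j⟩ = algebraMap K κ' (w j) := by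
      intro j
      have : (⟨g (some j) / g none, hyW j⟩ : W) =
          ⟨τ j * (g' i' / g none), W.valuation_le_one_iff _ |>.1 (hy1 j).le⟩ +
            ⟨algebraMap K F (w j), hKW _⟩ := Subtype.ext (hy j)
      rw [this, map_add, hresK, (hres _).2 (hy1 j), zero_add]
    have h3 : (⟨_, aeval_mem hKW hyW p⟩ : W) = 0 := Subtype.ext hp
    have h4 : MvPolynomial.aeval (fun k => algebraMap K κ' (w k)) p =
        algebraMap K κ' (MvPolynomial.eval w p) := by
      rw [← MvPolynomial.coe_aeval_eq_eval]
      exact MvPolynomial.aeval_algebraMap_apply κ' w p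
    rw [h3, map_zero, funext h2, h4, eq_comm, map_eq_zero] at h1
    exact hw h1
  have hmemv := hmem v hK hτv
  have hσi : ∀ o, IsIntegral (Algebra.adjoin K (Set.range τ)) (g o / g' i') := by
    rintro (_ | j)
    · exact hz
    · have : g (some j) / g' i' = τ j + algebraMap K F (w j) * (g none / g' i') := by
        simp only [hτ, hg']
        field_simp
        ring
      rw [this]
      refine IsIntegral.add ?_ (IsIntegral.mul ?_ hz)
      · exact isIntegral_algebraMap (R := Algebra.adjoin K (Set.range τ))
          (x := ⟨τ j, Algebra.subset_adjoin ⟨j, rfl⟩⟩)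
      · exact isIntegral_algebraMap (R := Algebra.adjoin K (Set.range τ))
          (x := algebraMap K (Algebra.adjoin K (Set.range τ)) (w j))
  have hσv : ∀ o, g o / g' i' ∈ v := fun o =>
    v.mem_of_isIntegral' (D := Algebra.adjoin K (Set.range τ)) (fun d => hmemv d d.2) (hσi o)
  have hu : v.valuation (g i / g' i') = 1 := by
    refine valuation_eq_one_of_mem_of_inv_mem (div_ne_zero hi hi0) (hσv i) ?_
    rw [inv_div, hg']
    simp only [sub_div, mul_div_assoc]
    exact sub_mem (hiv _) (v.mul_mem _ _ (hK _) (hiv _))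
  obtain ⟨s₁, -, hs₁'⟩ := ResIndep.exchange hK hσv hs fun a => by
    refine ⟨g i / g' i', Algebra.subset_adjoin ⟨i, rfl⟩, hu, ?_⟩
    have : g i / g' i' * (g (s a) / g i) = g (s a) / g' i' := by
      field_simp
    rw [this]
    exact isIntegral_algebraMap
      (R := Algebra.adjoin K (Set.range fun o => g o / g' i'))
      (x := ⟨g (s a) / g' i', Algebra.subset_adjoin ⟨s a, rfl⟩⟩)
  obtain ⟨s₂, -, hs₂'⟩ := ResIndep.exchange hK hτv hs₁' fun a =>
    ⟨1, one_mem _, map_one _, by rw [one_mul]; exact hσi _⟩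
  exact ⟨i', hi0, hτv, s₂, hs₂'⟩

lemma GoodFam.comp_equiv {κ κ' : Type*} {k : ℕ} {g : κ → F} {v : ValuationSubring F}
    (h : GoodFam K k g v) (e : κ' ≃ κ) : GoodFam K k (g ∘ e) v := by
  obtain ⟨i, hi, hiv, s, hs⟩ := h
  refine ⟨e.symm i, by simpa using hi, fun j => by simpa using hiv _, fun l => e.symm (s l), ?_⟩
  simpa using hs

lemma GoodFam.lt_card {κ : Type*} [Finite κ] {k : ℕ} {g : κ → F} {v : ValuationSubring F}
    (h : GoodFam K k g v) : k < Nat.card κ := by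
  classical
  obtain ⟨i, hi, hiv, s, hs⟩ := h
  have := Fintype.ofFinite κ
  have h1 : Function.Injective (fun o : Option (Fin k) => o.elim i s) := by
    rintro (_ | a) (_ | b) hab
    · rfl
    · exact absurd (show g (s b) / g i = 1 by rw [← show i = s b from hab, div_self hi])
        (hs.ne_one b)
    · exact absurd (show g (s a) / g i = 1 by rw [show s a = i from hab, div_self hi])
        (hs.ne_one a)
    · refine congrArg some (hs.injective ?_)
      rw [show s a = s b from hab]
  have h2 := Nat.card_le_card_of_injective _ h1
  simp only [Nat.card_eq_fintype_card, Fintype.card_option, Fintype.card_fin] at h2 ⊢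
  omega

lemma GoodFam.exists_chartGood {κ : Type*} [Finite κ] [DecidableEq κ] {k : ℕ} {g : κ → F}
    {v : ValuationSubring F} (h : GoodFam K k g v) (i : κ) (hi : g i ≠ 0)
    (hk : Nat.card κ = k + 2) :
    ∃ o, ChartGood K (pchart (fun j : {j // j ≠ i} => g j / g i) o) v := by
  have := Fintype.ofFinite κ
  have hcard : Nat.card (Fin k) + 1 = Nat.card {j // j ≠ i} := by
    rw [Nat.card_eq_fintype_card] at hk
    simp only [Nat.card_eq_fintype_card, Fintype.card_fin, ne_eq, Fintype.card_subtype_compl,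
      Fintype.card_unique]
    omega
  obtain ⟨i', hi', hiv, s, hs⟩ := h
  have hsi : ∀ l, s l ≠ i' := fun l hl => hs.ne_one l (by rw [hl, div_self hi'])
  have hsinj : Function.Injective s := fun a b hab => hs.injective (by rw [hab])
  by_cases hii : i' = i
  · subst hii
    refine ⟨none, chartGood_of_injective (by simpa using fun j _ => hiv j) hcard
      (s := fun l => ⟨s l, hsi l⟩) ?_ ?_⟩
    · intro a b hab
      exact hsinj (congrArg Subtype.val hab)
    · simpa [Function.comp_def] using hs
  · let e : {j // j ≠ i} → κ := fun j => Equiv.swap i i' j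
    have he : ∀ j, pchart (fun j : {j // j ≠ i} => g j / g i) (some ⟨i', hii⟩) j
        = g (e j) / g i' := by
      intro j
      by_cases hj : j = ⟨i', hii⟩
      · subst hj
        simp [e, pchart_some_self]
      · rw [pchart_some_of_ne _ hj]
        have : e j = j := Equiv.swap_apply_of_ne_of_ne j.2 fun h => hj (Subtype.ext h)
        rw [this]
        field_simp
    have hs' : ∀ l, Equiv.swap i i' (s l) ≠ i := fun l h => hsi l (by
      rw [Equiv.swap_apply_eq_iff, Equiv.swap_apply_left] at h
      exact h)
    refine ⟨some ⟨i', hii⟩, chartGood_of_injective (fun j => by rw [he]; exact hiv _) hcard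
      (s := fun l => ⟨Equiv.swap i i' (s l), hs' l⟩) ?_ ?_⟩
    · intro a b hab
      exact hsinj ((Equiv.swap i i').injective (congrArg Subtype.val hab))
    · have : (pchart (fun j : {j // j ≠ i} => g j / g i) (some ⟨i', hii⟩) ∘
          fun l => ⟨Equiv.swap i i' (s l), hs' l⟩) = fun l => g (s l) / g i' := by
        funext l
        simp [he, e]
      rw [this]
      exact hs

/-- A family with enough independent ratios can be shrunk, by projections from general points, to
the homogeneous coordinates given by a transcendence basis. -/
lemma GoodFam.exists_basis [Infinite K] {n : ℕ} {x₀ : Fin (n + 1) → F}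
    (hx₀ : IsTranscendenceBasis K x₀) {κ : Type*} [Finite κ] (g : κ → F)
    (hg : GoodFam K (n + 1) g ⊤) : ∃ (ι : Type) (_ : Fintype ι) (_ : DecidableEq ι)
      (x : ι → F), IsTranscendenceBasis K x ∧ Nonempty ι ∧
        ∀ v, (∀ a, algebraMap K F a ∈ v) → GoodFam K n g v → ∃ o, ChartGood K (pchart x o) v := by
  classical
  obtain ⟨N, e⟩ := Finite.exists_equiv_fin κ
  obtain ⟨e⟩ := e
  suffices H : ∀ N (g : Fin N → F), GoodFam K (n + 1) g ⊤ →
      ∃ (ι : Type) (_ : Fintype ι) (_ : DecidableEq ι)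
      (x : ι → F), IsTranscendenceBasis K x ∧ Nonempty ι ∧
        ∀ v, (∀ a, algebraMap K F a ∈ v) → GoodFam K n g v →
          ∃ o, ChartGood K (pchart x o) v by
    obtain ⟨ι, i1, i2, x, h1, h2, h3⟩ := H N (g ∘ e.symm) (hg.comp_equiv _)
    exact ⟨ι, i1, i2, x, h1, h2, fun v hv h => h3 v hv (h.comp_equiv _)⟩
  clear! κ
  intro N
  induction N with
  | zero =>
    intro g hg
    have := hg.lt_card
    simp at this
  | succ N ih =>
    intro g hg
    have hcard := hg.lt_card
    obtain ⟨i, hi, -⟩ := id hg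
    rw [Nat.card_fin] at hcard
    by_cases hind : AlgebraicIndependent K fun j : {j // j ≠ i} => g j / g i
    · have hc : Nat.card {j // j ≠ i} = N := by
        simp [Nat.card_eq_fintype_card, Fintype.card_subtype_compl]
      have hb : IsTranscendenceBasis K fun j : {j // j ≠ i} => g j / g i := by
        refine hind.isTranscendenceBasis_of_lift_trdeg_le_of_finite ?_
        rw [← hx₀.lift_cardinalMk_eq_trdeg]
        rw [Cardinal.mk_fin, ← Nat.cast_card, hc]
        simp only [Cardinal.lift_natCast, Nat.cast_le]
        omega
      have hN : N = n + 1 := by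
        have := hb.lift_cardinalMk_eq_trdeg
        rw [← hx₀.lift_cardinalMk_eq_trdeg, Cardinal.mk_fin, ← Nat.cast_card, hc] at this
        simpa only [Cardinal.lift_natCast, Nat.cast_inj] using this
      refine ⟨_, inferInstance, inferInstance, _, hb, ?_, fun v hv h =>
        h.exists_chartGood i hi (by rw [Nat.card_fin, hN])⟩
      rw [← Finite.card_pos_iff, hc, hN]
      omega
    · let e := Equiv.optionSubtypeNe i
      obtain ⟨w, hw⟩ := GoodFam.drop (g := g ∘ e) (by simpa [e] using hi) (by simpa [e] using hind)
      have hc : Fintype.card {j // j ≠ i} = N := by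
        simp [Fintype.card_subtype_compl]
      let e' := (Fintype.equivFinOfCardEq hc).symm
      obtain ⟨ι, i1, i2, x, h1, h2, h3⟩ := ih _
        ((hw _ ⊤ (fun _ => trivial) (hg.comp_equiv e)).comp_equiv e')
      exact ⟨ι, i1, i2, x, h1, h2, fun v hv h =>
        h3 v hv ((hw _ v hv (h.comp_equiv e)).comp_equiv e')⟩

end GoodFamilies

end InvHyp

namespace InvHyp

section AdaptedBasis

variable {K : Type*} [Field K] {F : Type*} [Field F] [Algebra K F]

lemma resIndep_comap {L : Type*} [Field L] [Algebra K L] (φ : F →ₐ[K] L) {W : ValuationSubring L}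
    {ι : Type*} {r : ι → F} :
    ResIndep K (W.comap (φ : F →+* L)) r ↔ ResIndep K W (φ ∘ r) := by
  have key : ∀ z : F, (W.comap (φ : F →+* L)).valuation z = 1 ↔ W.valuation (φ z) = 1 := by
    intro z
    by_cases hz : z = 0
    · simp [hz]
    have hz' : φ z ≠ 0 := by simpa using hz
    constructor
    · intro h
      refine valuation_eq_one_of_mem_of_inv_mem hz' ?_ ?_
      · have : z ∈ W.comap (φ : F →+* L) := (ValuationSubring.valuation_le_one_iff _ _).1 h.le
        exact this
      · have : z⁻¹ ∈ W.comap (φ : F →+* L) := by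
          rw [← ValuationSubring.valuation_le_one_iff, map_inv₀, h, inv_one]
        rw [← map_inv₀]
        exact this
    · intro h
      refine valuation_eq_one_of_mem_of_inv_mem hz ?_ ?_
      · change φ z ∈ W
        exact (ValuationSubring.valuation_le_one_iff _ _).1 h.le
      · change (φ : F →+* L) z⁻¹ ∈ W
        rw [← ValuationSubring.valuation_le_one_iff, map_inv₀, map_inv₀]
        change (W.valuation (φ z))⁻¹ ≤ 1
        rw [h, inv_one]
  refine forall₂_congr fun p _ => ?_
  have h : φ (MvPolynomial.aeval r p) = MvPolynomial.aeval (φ ∘ r) p :=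
    MvPolynomial.comp_aeval_apply r φ p
  rw [key, h]

/-- Almost all valuation rings that are good for the charts of `t` contract to valuation rings that
are good for a given transcendence basis. -/
lemma finite_not_chartGood_comap [CharZero K] {L : Type*} [Field L] [Algebra K L]
    [Algebra.EssFiniteType K L] {ι' : Type*} [Finite ι'] [DecidableEq ι'] {t : ι' → L}
    (ht : IsTranscendenceBasis K t) {n : ℕ} {x : Fin (n + 1) → F}
    (hx : IsTranscendenceBasis K x) (φ : F →ₐ[K] L) :
    {W | (∃ o, ChartGood K (pchart t o) W) ∧
      ¬ChartGood K x (W.comap (φ : F →+* L))}.Finite := by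
  classical
  have hφx : AlgebraicIndependent K (φ ∘ x) := hx.1.map' φ.toRingHom.injective
  obtain ⟨B, hxB, hB⟩ := exists_isTranscendenceBasis_superset hφx.coe_range
  have hcard : Nat.card B = Nat.card ι' := by
    have h1 := hB.lift_cardinalMk_eq_trdeg
    have h2 := ht.lift_cardinalMk_eq_trdeg
    have h3 := congrArg Cardinal.toNat h1
    have h4 := congrArg Cardinal.toNat h2
    simp only [Cardinal.toNat_lift] at h3 h4
    exact h3.trans h4.symm
  have hBfin : Finite B := by
    have h1 := hB.lift_cardinalMk_eq_trdeg
    rw [← Cardinal.mk_lt_aleph0_iff]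
    have h2 := ht.lift_cardinalMk_eq_trdeg
    have h5 : Cardinal.mk ι' < Cardinal.aleph0 := Cardinal.mk_lt_aleph0
    rw [← Cardinal.lift_lt_aleph0, h2, Cardinal.lift_lt_aleph0, ← Cardinal.lift_lt_aleph0,
      ← h1, Cardinal.lift_lt_aleph0] at h5
    exact h5
  have hne : Nonempty ι' := by
    rw [← Finite.card_pos_iff, ← hcard, Finite.card_pos_iff]
    exact ⟨⟨_, hxB ⟨0, rfl⟩⟩⟩
  have := Fintype.ofFinite ι'
  have := Fintype.ofFinite B
  obtain ⟨d, hd, hd0, hdint⟩ := exists_common_denominator hB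
    (Finset.univ.image fun a : Option ι' × ι' => pchart t a.1 a.2)
  let E : Finset L := insert d (Finset.univ.image ((↑) : B → L))
  have hE0 : ∀ e ∈ E, e ≠ 0 := by
    intro e he
    rcases Finset.mem_insert.1 he with rfl | he
    · exact hd0
    · obtain ⟨b, -, rfl⟩ := Finset.mem_image.1 he
      exact hB.1.ne_zero b
  refine Set.Finite.subset (Set.Finite.biUnion E.finite_toSet fun e he =>
    Set.finite_iUnion fun o => finite_chartGood (isTranscendenceBasis_pchart ht o) (hE0 e he)) ?_
  rintro W ⟨⟨o, hW⟩, hWx⟩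
  by_contra hcon
  simp only [Set.mem_iUnion, Set.mem_ofPred_eq, not_exists, not_and, not_not] at hcon
  have hE1 : ∀ e ∈ E, W.valuation e = 1 := fun e he => hcon e he o hW
  have hK := hW.algebraMap_mem
  have hBW : ∀ b : B, (b : L) ∈ W := fun b => by
    rw [← W.valuation_le_one_iff]
    exact (hE1 _ (Finset.mem_insert_of_mem (Finset.mem_image_of_mem _ (Finset.mem_univ b)))).le
  obtain ⟨hτ, j, hj⟩ := id hW
  obtain ⟨s, hsi, hs⟩ := ResIndep.exchange hK hBW hj fun a =>
    ⟨d, hd, hE1 d (Finset.mem_insert_self _ _),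
      hdint _ (Finset.mem_image.2 ⟨(o, a), Finset.mem_univ _, rfl⟩)⟩
  have hGB : ChartGood K ((↑) : B → L) W := by
    refine chartGood_of_injective hBW ?_ hsi hs
    rw [hcard]
    simp only [ne_eq, Nat.card_eq_fintype_card, Fintype.card_subtype_compl, Fintype.card_unique]
    have : 0 < Fintype.card ι' := Fintype.card_pos
    omega
  apply hWx
  obtain ⟨b, hb⟩ := hGB.2
  have hxi : Function.Injective (φ ∘ x) := hφx.injective
  have hxm : ∀ i, φ (x i) ∈ B := fun i => hxB ⟨i, rfl⟩
  obtain ⟨i₀, hi₀⟩ : ∃ i₀, ∀ i, i ≠ i₀ → (⟨φ (x i), hxm i⟩ : B) ≠ b := by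
    by_cases h : ∃ i₀, (⟨φ (x i₀), hxm i₀⟩ : B) = b
    · obtain ⟨i₀, rfl⟩ := h
      exact ⟨i₀, fun i hi h => hi (hxi (congrArg Subtype.val h))⟩
    · push Not at h
      exact ⟨0, fun i _ => h i⟩
  refine ⟨fun i => hBW ⟨_, hxm i⟩, i₀, ?_⟩
  rw [resIndep_comap]
  exact resIndep_comp hb (s := fun i : {i // i ≠ i₀} => ⟨⟨φ (x i), hxm i⟩, hi₀ i i.2⟩)
    fun i i' h => Subtype.ext (hxi (congrArg Subtype.val (congrArg Subtype.val h)))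

lemma algebraicIndependent_of_residue {L : Type*} [Field L] [Algebra F L] {v : ValuationSubring F}
    {W : ValuationSubring L} {f : v →+* W} (hf : ∀ z, (f z : L) = algebraMap F L z) {k₀ κ : Type*}
    [Field k₀] [Field κ] [Algebra k₀ κ] {res₀ : v →+* k₀} {res : W →+* κ}
    (hres : ∀ z, res (f z) = algebraMap k₀ κ (res₀ z)) {α : Type*} (a : α → W)
    (ha : AlgebraicIndependent k₀ fun i => res (a i)) :
    AlgebraicIndependent F fun i => (a i : L) := by
  rw [algebraicIndependent_iff]
  intro p hp
  by_contra hp0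
  obtain ⟨m, hm, hmax⟩ := p.support.exists_max_image (fun m => v.valuation (p.coeff m))
    (MvPolynomial.support_nonempty.2 hp0)
  have hc : p.coeff m ≠ 0 := MvPolynomial.mem_support_iff.1 hm
  obtain ⟨c, hcm⟩ : ∃ c, c = p.coeff m := ⟨_, rfl⟩
  have hq : ∀ l, p.coeff l / c ∈ v := by
    intro l
    rw [hcm]
    by_cases hl : l ∈ p.support
    · rw [← v.valuation_le_one_iff, map_div₀]
      exact div_le_one_of_le₀ (hmax l hl) zero_le
    · rw [MvPolynomial.notMem_support_iff.1 hl, zero_div]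
      exact v.zero_mem
  let q : MvPolynomial α v := ∑ l ∈ p.support, MvPolynomial.monomial l ⟨_, hq l⟩
  have h1 : MvPolynomial.map v.subtype q = MvPolynomial.C c⁻¹ * p := by
    conv_rhs => rw [p.as_sum, Finset.mul_sum]
    rw [map_sum]
    refine Finset.sum_congr rfl fun l _ => ?_
    rw [MvPolynomial.map_monomial, MvPolynomial.C_mul_monomial]
    congr 1
    exact div_eq_inv_mul (p.coeff l) c
  have h2 : MvPolynomial.eval₂ f a q = 0 := by
    apply Subtype.ext
    have h3 : ((MvPolynomial.eval₂ f a q : W) : L) =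
        MvPolynomial.aeval (fun i => (a i : L)) (MvPolynomial.map v.subtype q) := by
      rw [MvPolynomial.aeval_def, MvPolynomial.eval₂_map]
      change W.subtype _ = _
      rw [MvPolynomial.eval₂_comp_left]
      congr 1
      ext z
      exact hf z
    rw [h3, h1, map_mul, hp, mul_zero]
    rfl
  have h4 : MvPolynomial.aeval (fun i => res (a i)) (MvPolynomial.map res₀ q) = 0 := by
    rw [MvPolynomial.aeval_def, MvPolynomial.eval₂_map]
    have h5 := congrArg res h2
    rw [map_zero, MvPolynomial.eval₂_comp_left] at h5
    rw [← h5]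
    congr 1
    ext z
    exact (hres z).symm
  have h6 := (algebraicIndependent_iff.1 ha) _ h4
  have h7 := congrArg (MvPolynomial.coeff m) h6
  have h8 : q.coeff m = 1 := by
    apply Subtype.ext
    have := congrArg (MvPolynomial.coeff m) h1
    rw [MvPolynomial.coeff_map, MvPolynomial.coeff_C_mul, hcm, inv_mul_cancel₀ hc] at this
    exact this
  rw [MvPolynomial.coeff_map, h8, map_one, MvPolynomial.coeff_zero] at h7
  exact one_ne_zero h7

/-- A valuation ring with large residue field contracts to one with large residue field. -/
lemma exists_resIndep_comap {L : Type*} [Field L] [Algebra K L]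
    {ι' : Type*} [Finite ι'] {t : ι' → L}
    (ht : IsTranscendenceBasis K t) {n : ℕ} {x : Fin (n + 1) → F}
    (hx : IsTranscendenceBasis K x) (φ : F →ₐ[K] L) {W : ValuationSubring L}
    (hW : ChartGood K t W) :
    ∃ r : Fin n → F, ResIndep K (W.comap (φ : F →+* L)) r := by
  have hK := hW.algebraMap_mem
  have hK₀ : ∀ a, algebraMap K F a ∈ W.comap (φ : F →+* L) := fun a => by
    rw [ValuationSubring.mem_comap]
    change φ _ ∈ W
    rw [φ.commutes]
    exact hK a
  set v := W.comap (φ : F →+* L) with hv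
  let θ : K →+* W := (algebraMap K L).codRestrict W.toSubring hK
  let θ₀ : K →+* v := (algebraMap K F).codRestrict v.toSubring hK₀
  let f : v →+* W := ((φ : F →+* L).comp v.subtype).codRestrict W.toSubring fun z => z.2
  have hfloc : IsLocalHom f := by
    constructor
    intro z hz
    have hz0 : (z : F) ≠ 0 := by
      intro h
      have h1 : f z = 0 := Subtype.ext (by
        change φ z = 0
        rw [h, map_zero])
      rw [h1] at hz
      exact not_isUnit_zero hz
    obtain ⟨u, hu⟩ := hz.exists_right_inv
    have h1 : φ z * (u : L) = 1 := congrArg Subtype.val hu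
    have h2 : (z : F)⁻¹ ∈ v := by
      change φ _ ∈ W
      rw [map_inv₀, ← eq_inv_of_mul_eq_one_right h1]
      exact u.2
    exact IsUnit.of_mul_eq_one ⟨_, h2⟩ (Subtype.ext (mul_inv_cancel₀ hz0))
  let k₀ := IsLocalRing.ResidueField v
  let κ := IsLocalRing.ResidueField W
  let : Algebra K k₀ := ((IsLocalRing.residue v).comp θ₀).toAlgebra
  let : Algebra K κ := ((IsLocalRing.residue W).comp θ).toAlgebra
  let : Algebra k₀ κ := (IsLocalRing.ResidueField.map f).toAlgebra
  let : Algebra F L := (φ : F →+* L).toAlgebra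
  have : IsScalarTower K F L := IsScalarTower.of_algebraMap_eq fun a => (φ.commutes a).symm
  have : IsScalarTower K k₀ κ := IsScalarTower.of_algebraMap_eq fun a => by
    change IsLocalRing.residue W (θ a) = IsLocalRing.residue W (f (θ₀ a))
    congr 1
    exact Subtype.ext (φ.commutes a).symm
  have e1 := lift_trdeg_add_eq K F L
  have e2 := lift_trdeg_add_eq K k₀ κ
  have e3 : Algebra.trdeg k₀ κ ≤ Algebra.trdeg F L := by
    obtain ⟨B, hB⟩ := exists_isTranscendenceBasis k₀ κ
    choose a ha using fun b : B => IsLocalRing.residue_surjective (b : κ)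
    rw [← hB.cardinalMk_eq_trdeg]
    refine (algebraicIndependent_of_residue (f := f) (res₀ := IsLocalRing.residue v)
      (res := IsLocalRing.residue W) (fun _ => rfl) (fun _ => rfl) a ?_).cardinalMk_le_trdeg
    have : (fun i => IsLocalRing.residue W (a i)) = ((↑) : B → κ) := funext ha
    rw [this]
    exact hB.1
  have e4 : ((n + 1 : ℕ) : Cardinal) = Algebra.trdeg K F := by
    have := hx.lift_cardinalMk_eq_trdeg
    simpa using this
  have e5 : ((Nat.card ι' : ℕ) : Cardinal) = Algebra.trdeg K L := by
    have := ht.lift_cardinalMk_eq_trdeg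
    rw [← Nat.cast_card, Cardinal.lift_natCast] at this
    apply Cardinal.lift_injective
    rw [Cardinal.lift_natCast, this]
  have hres : ∀ w : W, IsLocalRing.residue W w = 0 ↔ W.valuation w < 1 := fun w => by
    rw [IsLocalRing.residue_eq_zero_iff, ← ValuationSubring.valuation_lt_one_iff]
  have hres₀ : ∀ w : v, IsLocalRing.residue v w = 0 ↔ v.valuation w < 1 := fun w => by
    rw [IsLocalRing.residue_eq_zero_iff, ← ValuationSubring.valuation_lt_one_iff]
  have e6 : ((Nat.card ι' : ℕ) : Cardinal) ≤ Algebra.trdeg K κ + 1 := by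
    obtain ⟨hτ, j, hj⟩ := id hW
    rw [resIndep_iff (r := fun l : {l // l ≠ j} => t l) hK hres (fun _ => rfl) fun l => hτ l] at hj
    have h1 := hj.lift_cardinalMk_le_trdeg
    rw [← Nat.cast_card, Cardinal.lift_natCast, Cardinal.nat_le_lift_iff] at h1
    have := Fintype.ofFinite ι'
    have h2 : Nat.card ι' ≤ Nat.card {l // l ≠ j} + 1 := by
      classical
      simp only [ne_eq, Nat.card_eq_fintype_card, Fintype.card_subtype_compl,
        Fintype.card_unique]
      omega
    calc ((Nat.card ι' : ℕ) : Cardinal) ≤ ((Nat.card {l // l ≠ j} + 1 : ℕ) : Cardinal) := by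
          exact_mod_cast h2
      _ ≤ _ := by
        rw [Nat.cast_add, Nat.cast_one]
        gcongr
  have e7 : (n : Cardinal) ≤ Algebra.trdeg K k₀ := by
    by_contra! hlt
    obtain ⟨m, hm⟩ := Cardinal.lt_aleph0.1 (hlt.trans Cardinal.natCast_lt_aleph0)
    have hfin : Algebra.trdeg F L < Cardinal.aleph0 := by
      have h1 : Cardinal.lift (Algebra.trdeg K L) < Cardinal.aleph0 := by
        rw [← e5, Cardinal.lift_natCast]
        exact Cardinal.natCast_lt_aleph0
      rw [← e1, Cardinal.add_lt_aleph0_iff, Cardinal.lift_lt_aleph0, Cardinal.lift_lt_aleph0] at h1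
      exact h1.2
    obtain ⟨b, hb⟩ := Cardinal.lt_aleph0.1 hfin
    obtain ⟨c, hc⟩ := Cardinal.lt_aleph0.1 (e3.trans_lt hfin)
    rw [hb, hc, Nat.cast_le] at e3
    rw [hm, Nat.cast_lt] at hlt
    rw [← e4, ← e5, hb] at e1
    rw [hm, hc] at e2
    simp only [Cardinal.lift_natCast, ← Nat.cast_add, Nat.cast_inj] at e1
    have e9 : Cardinal.lift (Algebra.trdeg K κ) < Cardinal.aleph0 := by
      rw [← e2, Cardinal.lift_natCast, Cardinal.lift_natCast, ← Nat.cast_add]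
      exact Cardinal.natCast_lt_aleph0
    rw [Cardinal.lift_lt_aleph0] at e9
    obtain ⟨d, hd⟩ := Cardinal.lt_aleph0.1 e9
    have e8 := congrArg Cardinal.toNat e2
    rw [hd] at e8 e6
    rw [Cardinal.lift_natCast, Cardinal.lift_natCast, ← Nat.cast_add, Cardinal.lift_natCast,
      Cardinal.toNat_natCast, Cardinal.toNat_natCast] at e8
    norm_cast at e6
    omega
  obtain ⟨B, hB⟩ := exists_isTranscendenceBasis K k₀
  rw [← hB.cardinalMk_eq_trdeg] at e7
  obtain ⟨s⟩ : Nonempty (Fin n ↪ B) := by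
    rw [← Cardinal.lift_mk_le', Cardinal.mk_fin, Cardinal.lift_natCast]
    simpa using e7
  choose a ha using fun b : B => IsLocalRing.residue_surjective (b : k₀)
  refine ⟨fun i => a (s i), ?_⟩
  rw [resIndep_iff hK₀ hres₀ (fun _ => rfl) fun l => (a (s l)).2]
  have : (fun i => IsLocalRing.residue v ⟨(a (s i) : F), (a (s i)).2⟩) = ((↑) : B → k₀) ∘ s :=
    funext fun i => ha (s i)
  rw [this]
  exact hB.1.comp s s.injective

lemma ChartGood.goodFam_cons {n : ℕ} {x : Fin (n + 1) → F} {v : ValuationSubring F}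
    (h : ChartGood K x v) : GoodFam K n (fun o : Option (Fin (n + 1)) => o.elim 1 x) v := by
  obtain ⟨hx, j, hj⟩ := h
  refine ⟨none, one_ne_zero, ?_, fun l => some (j.succAbove l), ?_⟩
  · rintro (_ | l)
    · simp
    · simpa using hx l
  · simpa using! resIndep_comp hj (s := fun l => ⟨j.succAbove l, Fin.succAbove_ne j l⟩)
      fun a b hab => Fin.succAbove_right_injective (congrArg Subtype.val hab)

lemma exists_goodFam {V : Set (ValuationSubring F)} (hV : V.Finite) {n : ℕ}
    (h : ∀ v ∈ V, ∃ r : Fin n → F, ResIndep K v r) {κ₀ : Type} [Finite κ₀] (g₀ : κ₀ → F)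
    (hg₀ : ∃ i, g₀ i ≠ 0) :
    ∃ (κ : Type) (_ : Finite κ) (g : κ → F), (∃ i, g i ≠ 0) ∧ (∀ v ∈ V, GoodFam K n g v) ∧
      ∀ k v, GoodFam K k g₀ v → GoodFam K k g v := by
  induction V, hV using Set.Finite.induction_on with
  | empty => exact ⟨κ₀, inferInstance, g₀, hg₀, by simp, fun _ _ h => h⟩
  | @insert v V hv hV ih =>
    obtain ⟨κ, _, g, hg, h1, h2⟩ := ih fun v' hv' => h v' (Set.mem_insert_of_mem _ hv')
    obtain ⟨r, hr⟩ := h v (Set.mem_insert _ _)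
    have hr' : GoodFam K n (fun o : Option (Fin n) => o.elim 1 r) v := by
      refine ⟨none, one_ne_zero, ?_, some, by simpa using hr⟩
      rintro (_ | l)
      · simp
      · have := hr (MvPolynomial.X l) (MvPolynomial.X_ne_zero l)
        rw [MvPolynomial.aeval_X] at this
        simpa using (v.valuation_le_one_iff _).1 this.le
    have hne : ∃ o : Option (Fin n), o.elim 1 r ≠ 0 := ⟨none, one_ne_zero⟩
    refine ⟨κ × Option (Fin n), inferInstance, fun a => g a.1 * a.2.elim 1 r, ?_, ?_, ?_⟩
    · obtain ⟨i, hi⟩ := hg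
      exact ⟨(i, none), by simpa using hi⟩
    · rintro v' (rfl | hv')
      · have := (hr'.prod hg).comp_equiv (Equiv.prodComm κ (Option (Fin n)))
        simpa [Function.comp_def, mul_comm] using this
      · exact (h1 v' hv').prod hne
    · intro k v' h'
      exact (h2 k v' h').prod hne

/-- For two embeddings of `F` in `L` there is a transcendence basis of `F` such that every valuation
ring that is good for the charts of `t` contracts to valuation rings good for its charts. -/
theorem exists_adapted_basis [CharZero K] {L : Type*} [Field L] [Algebra K L]
    [Algebra.EssFiniteType K L] {ι' : Type*} [Finite ι'] [DecidableEq ι'] {t : ι' → L}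
    (ht : IsTranscendenceBasis K t) {n : ℕ} {x₀ : Fin (n + 1) → F}
    (hx₀ : IsTranscendenceBasis K x₀) (φ₁ φ₂ : F →ₐ[K] L) :
    ∃ (ι : Type) (_ : Fintype ι) (_ : DecidableEq ι) (x : ι → F), IsTranscendenceBasis K x ∧
      Nonempty ι ∧ ∀ o W, ChartGood K (pchart t o) W →
        (∃ o₁, ChartGood K (pchart x o₁) (W.comap (φ₁ : F →+* L))) ∧
        ∃ o₂, ChartGood K (pchart x o₂) (W.comap (φ₂ : F →+* L)) := by
  have : Infinite K := CharZero.infinite K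
  let B : (F →ₐ[K] L) → Set (ValuationSubring L) := fun φ =>
    {W | (∃ o, ChartGood K (pchart t o) W) ∧ ¬ChartGood K x₀ (W.comap (φ : F →+* L))}
  have hB : ∀ φ, (B φ).Finite := fun φ => finite_not_chartGood_comap ht hx₀ φ
  let C : (F →ₐ[K] L) → Set (ValuationSubring F) := fun φ =>
    (fun W => W.comap (φ : F →+* L)) '' B φ
  have hC : ∀ φ, ∀ v ∈ C φ, ∃ r : Fin n → F, ResIndep K v r := by
    rintro φ _ ⟨W, ⟨⟨o, hW⟩, -⟩, rfl⟩
    exact exists_resIndep_comap (isTranscendenceBasis_pchart ht o) hx₀ φ hW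
  obtain ⟨κ, _, g, -, h1, h2⟩ := exists_goodFam (K := K) (((hB φ₁).image _).union ((hB φ₂).image _))
    (fun v hv => hv.elim (hC φ₁ v) (hC φ₂ v))
    (fun o : Option (Fin (n + 1)) => o.elim 1 x₀) ⟨none, one_ne_zero⟩
  have htop : GoodFam K (n + 1) (fun o : Option (Fin (n + 1)) => o.elim 1 x₀) ⊤ := by
    refine ⟨none, one_ne_zero, fun _ => trivial, some, fun p hp => ?_⟩
    have h3 : MvPolynomial.aeval x₀ p ≠ 0 := fun h => hp ((algebraicIndependent_iff.1 hx₀.1) p h)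
    refine valuation_eq_one_of_mem_of_inv_mem ?_ trivial trivial
    simpa using h3
  obtain ⟨ι, i1, i2, x, hx, hne, h3⟩ := GoodFam.exists_basis hx₀ g (h2 _ _ htop)
  refine ⟨ι, i1, i2, x, hx, hne, fun o W hW => ?_⟩
  have key : ∀ φ : F →ₐ[K] L, (∀ v ∈ C φ, GoodFam K n g v) →
      ∃ o, ChartGood K (pchart x o) (W.comap (φ : F →+* L)) := by
    intro φ hφ
    refine h3 _ (fun a => ?_) ?_
    · change φ _ ∈ W
      rw [φ.commutes]
      exact hW.algebraMap_mem a
    · by_cases hg : ChartGood K x₀ (W.comap (φ : F →+* L))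
      · exact h2 _ _ hg.goodFam_cons
      · exact hφ _ ⟨W, ⟨⟨o, hW⟩, hg⟩, rfl⟩
  exact ⟨key φ₁ fun v hv => h1 v (Or.inl hv), key φ₂ fun v hv => h1 v (Or.inr hv)⟩

end AdaptedBasis

end InvHyp

namespace InvHyp

lemma _root_.HeightOnePrime.exists_mul_pow_mem {B : Type*} [CommRing B] {P : Ideal B}
    (hP : HeightOnePrime P) {a w : B} (ha0 : a ≠ 0) (hw : w ∈ P) :
    ∃ s ∉ P, ∃ n : ℕ, s * w ^ n ∈ Ideal.span {a} := by
  by_contra! hc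
  have := hP.1
  let M : Submonoid B := P.primeCompl ⊔ Submonoid.powers w
  have hM : Disjoint ((Ideal.span {a} : Ideal B) : Set B) (M : Set B) := by
    rw [Set.disjoint_left]
    rintro z hz hzM
    obtain ⟨s, hs, _, ⟨n, rfl⟩, rfl⟩ := Submonoid.mem_sup.1 hzM
    exact hc s hs n hz
  obtain ⟨Q, hQ, haQ, hQM⟩ := Ideal.exists_le_prime_disjoint _ M hM
  have hwQ : w ∉ Q := fun h => Set.disjoint_left.1 hQM h
    (Submonoid.mem_sup_right (Submonoid.mem_powers w))
  have hQP : Q ≤ P := fun z hz => by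
    by_contra hzP
    exact Set.disjoint_left.1 hQM hz (Submonoid.mem_sup_left hzP)
  have := hP.2.2 Q hQ (lt_of_le_of_ne hQP fun h => hwQ (h ▸ hw))
  rw [this, Ideal.span_le, Set.singleton_subset_iff] at haQ
  exact ha0 haQ

lemma exists_dominating {B : Type*} [CommRing B] {F : Type*} [Field F] [Algebra B F]
    (P : Ideal B) [P.IsPrime] (hinj : Function.Injective (algebraMap B F)) :
    ∃ v : ValuationSubring F, (∀ b : B, algebraMap B F b ∈ v) ∧
      ∀ b : B, v.valuation (algebraMap B F b) < 1 ↔ b ∈ P := by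
  have hu : ∀ y : P.primeCompl, IsUnit (algebraMap B F y) := fun y => by
    refine IsUnit.mk0 _ fun h => y.2 ?_
    rw [hinj (h.trans (map_zero _).symm)]
    exact zero_mem _
  let f : Localization.AtPrime P →+* F := IsLocalization.lift (M := P.primeCompl) hu
  obtain ⟨v, hv, hloc⟩ := IsLocalRing.exists_factor_valuationRing f
  have hf : ∀ b, f (algebraMap B _ b) = algebraMap B F b := fun b => IsLocalization.lift_eq hu b
  have hmem : ∀ b : B, algebraMap B F b ∈ v := fun b => hf b ▸ hv _
  refine ⟨v, hmem, fun b => ⟨fun h => ?_, fun h => ?_⟩⟩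
  · by_contra hb
    have h1 : IsUnit (f.codRestrict _ hv (algebraMap B _ b)) :=
      (IsLocalization.map_units (Localization.AtPrime P) (⟨b, hb⟩ : P.primeCompl)).map _
    have h2 := (v.valuation_eq_one_iff _).1 h1
    rw [← hf] at h
    exact h.ne h2
  · by_contra hc
    have h1 : v.valuation (algebraMap B F b) = 1 :=
      le_antisymm ((v.valuation_le_one_iff _).2 (hmem b)) (not_lt.1 hc)
    have h2 : IsUnit (f.codRestrict _ hv (algebraMap B _ b)) := by
      refine (v.valuation_eq_one_iff _).2 ?_
      change v.valuation (f _) = 1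
      rw [hf, h1]
    have h3 := hloc.map_nonunit _ h2
    rw [IsLocalization.AtPrime.isUnit_to_map_iff _ P] at h3
    exact h3 h

end InvHyp

namespace InvHyp

/-- The fractions of `B` whose denominator avoids `P`. -/
def fracSubring {B : Type*} [CommRing B] {F : Type*} [Field F] [Algebra B F] (P : Ideal B)
    [P.IsPrime] : Subring F where
  carrier := {z | ∃ n m, m ∉ P ∧ z * algebraMap B F m = algebraMap B F n}
  mul_mem' := by
    rintro z w ⟨n, m, hm, h⟩ ⟨n', m', hm', h'⟩
    refine ⟨n * n', m * m', fun hc => (‹P.IsPrime›.mem_or_mem hc).elim hm hm', ?_⟩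
    rw [map_mul, map_mul, ← h, ← h']; ring
  one_mem' := ⟨1, 1, fun h => ‹P.IsPrime›.ne_top ((Ideal.eq_top_iff_one _).2 h), by simp⟩
  add_mem' := by
    rintro z w ⟨n, m, hm, h⟩ ⟨n', m', hm', h'⟩
    refine ⟨n * m' + n' * m, m * m', fun hc => (‹P.IsPrime›.mem_or_mem hc).elim hm hm', ?_⟩
    rw [map_add, map_mul, map_mul, map_mul, ← h, ← h']; ring
  zero_mem' := ⟨0, 1, fun h => ‹P.IsPrime›.ne_top ((Ideal.eq_top_iff_one _).2 h), by simp⟩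
  neg_mem' := by
    rintro z ⟨n, m, hm, h⟩
    exact ⟨-n, m, hm, by rw [map_neg, ← h]; ring⟩

lemma mem_fracSubring {B : Type*} [CommRing B] {F : Type*} [Field F] [Algebra B F] {P : Ideal B}
    [P.IsPrime] {z : F} : z ∈ (fracSubring P : Subring F) ↔
      ∃ n m, m ∉ P ∧ z * algebraMap B F m = algebraMap B F n := Iff.rfl

section

variable {F : Type*} [Field F] {B : Type*} [CommRing B] [Algebra B F]

/-- Transfer of height one primes between birational rings. -/
lemma center_eq_of_le {P : Ideal B} (hP : HeightOnePrime P) {v : ValuationSubring F}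
    (hv : ∀ b : B, algebraMap B F b ∈ v) (hvP : ∀ b : B, v.valuation (algebraMap B F b) < 1 ↔ b ∈ P)
    {B₀ : Type*} [CommRing B₀] [Algebra B₀ F] (hinj : Function.Injective (algebraMap B₀ F))
    (h₀ : ∀ z : B₀, algebraMap B₀ F z ∈ v)
    (hfrac : ∀ z : B₀, ∃ n m, m ∉ P ∧ algebraMap B₀ F z * algebraMap B F m = algebraMap B F n)
    {d : B₀} (hd : v.valuation (algebraMap B₀ F d) = 1)
    (hB : ∀ b : B, ∃ (k : ℕ) (z : B₀), algebraMap B₀ F (d ^ k) * algebraMap B F b = algebraMap B₀ F z)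
    {Q : Ideal B₀} (hQ : Q.IsPrime) (hQ0 : Q ≠ ⊥) (hle : Q ≤ center v h₀) : Q = center v h₀ := by
  refine le_antisymm hle fun z hz => ?_
  obtain ⟨q, hq, hq0⟩ := Submodule.exists_mem_ne_zero_of_ne_bot hQ0
  have hone : ∀ m, m ∉ P → v.valuation (algebraMap B F m) = 1 := fun m hm =>
    le_antisymm ((v.valuation_le_one_iff _).2 (hv m)) (not_lt.1 fun h => hm ((hvP m).1 h))
  obtain ⟨n₁, m₁, hm₁, h₁⟩ := hfrac q
  obtain ⟨n₂, m₂, hm₂, h₂⟩ := hfrac z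
  have hne : ∀ m, m ∉ P → algebraMap B F m ≠ 0 := fun m hm h => by
    have := hone m hm
    simp [h] at this
  have hn₁ : n₁ ≠ 0 := fun h => by
    rw [h, map_zero, mul_eq_zero] at h₁
    exact h₁.elim (fun h => hq0 (hinj (h.trans (map_zero _).symm))) (hne _ hm₁)
  have hn₂ : n₂ ∈ P := by
    rw [← hvP, ← h₂, map_mul, hone _ hm₂, mul_one]
    exact (mem_center v h₀ z).1 hz
  obtain ⟨s, hs, k, hk⟩ := hP.exists_mul_pow_mem hn₁ hn₂
  obtain ⟨u, hu⟩ := Ideal.mem_span_singleton'.1 hk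
  obtain ⟨k₁, z₁, hz₁⟩ := hB (s * m₂ ^ k)
  obtain ⟨k₂, z₂, hz₂⟩ := hB (u * m₁)
  have hz₁Q : z₁ ∉ Q := fun h => by
    have h3 := (mem_center v h₀ z₁).1 (hle h)
    rw [← hz₁] at h3
    simp only [map_mul, map_pow, hd, hone _ hm₂, hone _ hs, one_pow, mul_one] at h3
    exact h3.ne rfl
  have hdQ : d ∉ Q := fun h => ((mem_center v h₀ d).1 (hle h)).ne hd
  have key : z₁ * d ^ k₂ * z ^ k = q * (z₂ * d ^ k₁) := by
    apply hinj
    have h3 : algebraMap B F s * algebraMap B F n₂ ^ k = algebraMap B F u * algebraMap B F n₁ := by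
      rw [← map_pow, ← map_mul, ← hu, map_mul]
    rw [← h₁, ← h₂] at h3
    rw [map_mul, map_mul, map_mul, map_mul, map_pow, ← hz₁, ← hz₂]
    simp only [map_mul, map_pow]
    linear_combination (algebraMap B₀ F d ^ k₁ * algebraMap B₀ F d ^ k₂) * h3
  have h6 : z₁ * d ^ k₂ * z ^ k ∈ Q := key ▸ Ideal.mul_mem_right _ _ hq
  rcases hQ.mem_or_mem h6 with h7 | h7
  · rcases hQ.mem_or_mem h7 with h8 | h8
    · exact (hz₁Q h8).elim
    · exact (hdQ (hQ.mem_of_pow_mem _ h8)).elim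
  · exact hQ.mem_of_pow_mem _ h7
end
end InvHyp

namespace InvHyp

/-- Going down for integral extensions of factorial rings, in height one. -/
lemma exists_prime_comap_eq_span {A B : Type*} [CommRing A] [IsDomain A]
    [UniqueFactorizationMonoid A] [CommRing B] [IsDomain B] [Algebra A B]
    [Algebra.IsIntegral A B] (hinj : Function.Injective (algebraMap A B)) {P : Ideal B} [P.IsPrime] (hne : P ≠ ⊥)
    (h : ∀ Q : Ideal B, Q.IsPrime → Q ≠ ⊥ → Q ≤ P → Q = P) :
    ∃ f, Prime f ∧ ∀ a, algebraMap A B a ∈ P ↔ f ∣ a := by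
  have := (faithfulSMul_iff_algebraMap_injective A B).2 hinj
  let 𝔭 : Ideal A := P.under A
  have h𝔭 : 𝔭.IsPrime := Ideal.IsPrime.under A P
  have h𝔭0 : 𝔭 ≠ ⊥ := fun h0 => hne (Ideal.eq_bot_of_comap_eq_bot h0)
  obtain ⟨f, hf𝔭, hf⟩ := h𝔭.exists_mem_prime_of_ne_bot h𝔭0
  have hfp : (Ideal.span {f}).IsPrime := (Ideal.span_singleton_prime hf.ne_zero).2 hf
  refine ⟨f, hf, fun a => ?_⟩
  rw [← Ideal.mem_span_singleton]
  suffices Ideal.span {f} = 𝔭 by rw [this]; rfl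
  by_contra hc
  have hlt : Ideal.span {f} < 𝔭 :=
    lt_of_le_of_ne ((Ideal.span_singleton_le_iff_mem _).2 hf𝔭) hc
  have : P.LiesOver 𝔭 := ⟨rfl⟩
  obtain ⟨Q, hQ, hQp, hQf⟩ := Ideal.exists_ideal_lt_liesOver_of_lt P hlt
  refine hQ.ne (h Q hQp (fun h0 => hf.ne_zero ?_) hQ.le)
  have h2 : f ∈ Q.under A := hQf.over ▸ Ideal.mem_span_singleton_self f
  rw [h0] at h2
  have h3 : algebraMap A B f = 0 := h2
  exact hinj (h3.trans (map_zero _).symm)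

section

variable {K : Type*} [Field K] {F : Type*} [Field F] [Algebra K F]
  {ι : Type*} {x : ι → F}

lemma _root_.MvPolynomial.rename_eq_zero_of_dvd {j : ι} {h : MvPolynomial ι K}
    (hj : MvPolynomial.pderiv j h ≠ 0) {p : MvPolynomial {l // l ≠ j} K}
    (hp : h ∣ MvPolynomial.rename (↑) p) : p = 0 := by
  classical
  by_contra hp0
  obtain ⟨q, hq⟩ := hp
  have hr0 : MvPolynomial.rename (Subtype.val : {l // l ≠ j} → ι) p ≠ 0 := fun h0 =>
    hp0 (MvPolynomial.rename_injective _ Subtype.val_injective (h0.trans (map_zero _).symm))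
  have h1 : MvPolynomial.degreeOf j (MvPolynomial.rename (Subtype.val : {l // l ≠ j} → ι) p) = 0 := by
    rw [MvPolynomial.degreeOf_eq_sup, ← Nat.le_zero]
    refine Finset.sup_le fun m hm => Nat.le_zero.2 ?_
    rw [MvPolynomial.support_rename_of_injective Subtype.val_injective, Finset.mem_image] at hm
    obtain ⟨m', -, rfl⟩ := hm
    exact Finsupp.mapDomain_of_notMem_range _ _ (by simp)
  rw [hq, MvPolynomial.degreeOf_mul_eq (left_ne_zero_of_mul (hq ▸ hr0))
    (right_ne_zero_of_mul (hq ▸ hr0))] at h1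
  refine hj ?_
  ext m
  rw [MvPolynomial.coeff_pderiv, MvPolynomial.coeff_zero]
  by_contra hc
  have h2 := (MvPolynomial.monomial_le_degreeOf j
    (MvPolynomial.mem_support_iff.2 (left_ne_zero_of_mul hc))).trans
    (Nat.eq_zero_of_add_eq_zero_right h1).le
  simp at h2

open Algebra in
lemma chartGood_of_center [CharZero K] (hx : IsTranscendenceBasis K x) {v : ValuationSubring F}
    (hK : ∀ a : K, algebraMap K F a ∈ v) (hxv : ∀ i, x i ∈ v) (B₀ : Subalgebra (adjoin K (Set.range x)) F)
    [Algebra.IsIntegral (adjoin K (Set.range x)) B₀] (h₀ : ∀ z : B₀, algebraMap B₀ F z ∈ v)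
    (hne : center v h₀ ≠ ⊥)
    (h : ∀ Q : Ideal B₀, Q.IsPrime → Q ≠ ⊥ → Q ≤ center v h₀ → Q = center v h₀) :
    ChartGood K x v := by
  let A := adjoin K (Set.range x)
  let e : MvPolynomial ι K ≃ₐ[K] A := hx.1.aevalEquiv
  have he : ∀ p, ((e p : A) : F) = MvPolynomial.aeval x p := fun p => by
    exact hx.1.algebraMap_aevalEquiv p
  have : UniqueFactorizationMonoid A := e.toMulEquiv.uniqueFactorizationMonoid inferInstance
  obtain ⟨f, hf, hfP⟩ := exists_prime_comap_eq_span (A := A) (B := B₀)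
    (fun a b hab => Subtype.ext (congrArg (Subtype.val : B₀ → F) hab)) hne h
  obtain ⟨g, rfl⟩ := e.surjective f
  have hg : Irreducible g := (MulEquiv.irreducible_iff e.toMulEquiv).1 hf.irreducible
  obtain ⟨j, hj⟩ := exists_pderiv_not_dvd hg
  have hpv : ∀ p, v.valuation (MvPolynomial.aeval x p) < 1 → g ∣ p := by
    intro p hp
    have h2 := (hfP (e p)).1 <| (mem_center v h₀ _).2 (by
      change v.valuation ((e p : A) : F) < 1
      rwa [he])
    exact (map_dvd_iff e).1 h2
  refine ⟨hxv, j, fun p hp0 => ?_⟩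
  by_contra hc
  have hlt := lt_of_le_of_ne
    ((v.valuation_le_one_iff _).2 (aeval_mem hK (fun l : {l // l ≠ j} => hxv l.1) p)) hc
  have h3 : MvPolynomial.aeval (fun l : {l // l ≠ j} => x l) p =
      MvPolynomial.aeval x (MvPolynomial.rename (↑) p) := (MvPolynomial.aeval_rename _ _ _).symm
  rw [h3] at hlt
  exact hp0 (MvPolynomial.rename_eq_zero_of_dvd (fun h0 => hj (h0 ▸ dvd_zero _)) (hpv _ hlt))

end
end InvHyp

namespace InvHyp

section

variable {K : Type*} [Field K] [CharZero K] {F : Type*} [Field F] [Algebra K F]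
  {ι : Type*} [Finite ι] {x : ι → F} {B : Type*} [CommRing B] [IsDomain B] [Algebra K B]
  [Algebra.FiniteType K B] [Algebra B F] [IsFractionRing B F] [IsScalarTower K B F]

open Algebra in
/-- Almost every height one prime is the centre of a chart-good valuation ring. -/
lemma exists_chartGood_center (hx : IsTranscendenceBasis K x) :
    ∃ b : B, b ≠ 0 ∧ ∀ P : Ideal B, HeightOnePrime P → b ∉ P →
      ∃ v : ValuationSubring F, ChartGood K x v ∧ (∀ b : B, algebraMap B F b ∈ v) ∧
        ∀ b : B, v.valuation (algebraMap B F b) < 1 ↔ b ∈ P := by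
  classical
  have := Fintype.ofFinite ι
  have hinj := IsFractionRing.injective B F
  obtain ⟨gB, hgB⟩ := (FiniteType.out : (⊤ : Subalgebra K B).FG)
  obtain ⟨d, hd, hd0, hint⟩ := exists_common_denominator hx (gB.image (algebraMap B F))
  have hfr : ∀ z : F, ∃ n m : B, m ≠ 0 ∧ z * algebraMap B F m = algebraMap B F n := fun z => by
    obtain ⟨n, m, hm, h⟩ := IsFractionRing.div_surjective (A := B) z
    have hm0 := nonZeroDivisors.ne_zero hm
    refine ⟨n, m, hm0, ?_⟩
    rw [← h, div_mul_cancel₀]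
    exact fun h0 => hm0 (hinj (h0.trans (map_zero _).symm))
  choose nu de hde hnd using hfr
  have hnd0 : nu d ≠ 0 := fun h0 => by
    have := hnd d
    rw [h0, map_zero, mul_eq_zero] at this
    exact this.elim hd0 fun h => hde d (hinj (h.trans (map_zero _).symm))
  refine ⟨(∏ i, de (x i)) * (nu d * de d), mul_ne_zero (Finset.prod_ne_zero_iff.2 fun i _ => hde _)
    (mul_ne_zero hnd0 (hde d)), fun P hP hbP => ?_⟩
  have hPp := hP.1
  have hdeP : ∀ i, de (x i) ∉ P := fun i h => hbP (P.mul_mem_right _ (P.mem_of_dvd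
    (Finset.dvd_prod_of_mem _ (Finset.mem_univ i)) h))
  have hndP : nu d ∉ P := fun h => hbP (P.mul_mem_left _ (P.mul_mem_right _ h))
  have hddP : de d ∉ P := fun h => hbP (P.mul_mem_left _ (P.mul_mem_left _ h))
  obtain ⟨v, hv, hvP⟩ := exists_dominating (F := F) P hinj
  have hone : ∀ m, m ∉ P → v.valuation (algebraMap B F m) = 1 := fun m hm =>
    le_antisymm ((v.valuation_le_one_iff _).2 (hv m)) (not_lt.1 fun h => hm ((hvP m).1 h))
  have hKv : ∀ a : K, algebraMap K F a ∈ v := fun a => by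
    rw [IsScalarTower.algebraMap_apply K B F]; exact hv _
  let A := adjoin K (Set.range x)
  let T : Subring F := fracSubring P
  have hTv : ∀ z ∈ T, z ∈ v := by
    rintro z ⟨n, m, hm, h⟩
    rw [← v.valuation_le_one_iff, ← mul_one (v.valuation z), ← hone m hm, ← map_mul, h,
      hone m hm, v.valuation_le_one_iff]
    exact hv n
  have hBT : ∀ b : B, algebraMap B F b ∈ T := fun b =>
    ⟨b, 1, fun h => hPp.ne_top ((Ideal.eq_top_iff_one _).2 h), by simp⟩
  have hKT : ∀ a : K, algebraMap K F a ∈ T := fun a => by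
    rw [IsScalarTower.algebraMap_apply K B F]; exact hBT _
  have hAT : ∀ a ∈ A, a ∈ T := fun a ha => by
    induction ha using adjoin_induction with
    | mem z hz =>
      obtain ⟨i, rfl⟩ := hz
      exact ⟨_, _, hdeP i, hnd _⟩
    | algebraMap r => exact hKT r
    | add y z _ _ hy hz => exact add_mem hy hz
    | mul y z _ _ hy hz => exact mul_mem hy hz
  let B₀ : Subalgebra A F := adjoin A ((gB.image fun g => d * algebraMap B F g : Finset F) : Set F)
  have hB₀ : Algebra.IsIntegral A B₀ := by
    refine Algebra.IsIntegral.adjoin fun z hz => ?_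
    obtain ⟨g, hg, rfl⟩ := Finset.mem_image.1 (Finset.mem_coe.1 hz)
    exact hint _ (Finset.mem_image_of_mem _ hg)
  have hB₀T : ∀ z ∈ B₀, z ∈ T := fun z hz => by
    induction hz using adjoin_induction with
    | mem z hz =>
      obtain ⟨g, hg, rfl⟩ := Finset.mem_image.1 (Finset.mem_coe.1 hz)
      exact mul_mem (hAT d hd) (hBT g)
    | algebraMap r => exact hAT r r.2
    | add y z _ _ hy hz => exact add_mem hy hz
    | mul y z _ _ hy hz => exact mul_mem hy hz
  have h₀ : ∀ z : B₀, algebraMap B₀ F z ∈ v := fun z => hTv _ (hB₀T z z.2)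
  let d₀ : B₀ := algebraMap A B₀ ⟨d, hd⟩
  have hd₀ : algebraMap B₀ F d₀ = d := rfl
  have hd1 : v.valuation (algebraMap B₀ F d₀) = 1 := by
    rw [hd₀, ← hone _ hndP, ← hnd, map_mul, hone _ hddP, mul_one]
  have hBd : ∀ b : B, ∃ (k : ℕ) (z : B₀), algebraMap B₀ F (d₀ ^ k) * algebraMap B F b =
      algebraMap B₀ F z := fun b => by
    have hb : b ∈ adjoin K (gB : Set B) := hgB ▸ mem_top
    induction hb using adjoin_induction with
    | mem g hg =>
      refine ⟨1, ⟨d * algebraMap B F g, subset_adjoin ?_⟩, ?_⟩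
      · exact Finset.mem_coe.2 (Finset.mem_image_of_mem (fun g => d * algebraMap B F g) hg)
      · rw [pow_one, hd₀]; rfl
    | algebraMap r =>
      refine ⟨0, algebraMap A B₀ (algebraMap K A r), ?_⟩
      rw [pow_zero, map_one, one_mul, ← IsScalarTower.algebraMap_apply K B F]; rfl
    | add y z _ _ hy hz =>
      obtain ⟨k, y', hy⟩ := hy
      obtain ⟨l, z', hz⟩ := hz
      refine ⟨k + l, d₀ ^ l * y' + d₀ ^ k * z', ?_⟩
      simp only [map_add, map_mul, ← hy, ← hz, map_pow]; ring
    | mul y z _ _ hy hz =>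
      obtain ⟨k, y', hy⟩ := hy
      obtain ⟨l, z', hz⟩ := hz
      refine ⟨k + l, y' * z', ?_⟩
      simp only [map_mul, ← hy, ← hz, map_pow]; ring
  have hinj₀ : Function.Injective (algebraMap B₀ F) := Subtype.val_injective
  refine ⟨v, chartGood_of_center hx hKv (fun i => hTv _ ⟨_, _, hdeP i, hnd _⟩) B₀ h₀ ?_
    fun Q hQ hQ0 hle => center_eq_of_le hP hv hvP hinj₀ h₀ (fun z => hB₀T z z.2) hd1 hBd hQ hQ0 hle,
    hv, hvP⟩
  intro h0
  obtain ⟨p, hp, hp0⟩ := Submodule.exists_mem_ne_zero_of_ne_bot hP.2.1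
  obtain ⟨k, z, hz⟩ := hBd p
  have hzc : z ∈ center v h₀ := by
    rw [mem_center, ← hz, map_mul, map_pow, map_pow, hd1, one_pow, one_mul]
    exact (hvP p).2 hp
  rw [h0, Ideal.mem_bot] at hzc
  rw [hzc, map_zero, mul_eq_zero, map_pow, hd₀] at hz
  exact hz.elim (pow_ne_zero _ hd0) fun h => hp0 (hinj (h.trans (map_zero _).symm))

end
end InvHyp

namespace InvHyp

section

variable {K : Type*} [Field K] [CharZero K] {F : Type*} [Field F] [Algebra K F]
  [Algebra.EssFiniteType K F] {ι : Type*} [Finite ι] {x : ι → F} {B : Type*} [CommRing B]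
  [Algebra B F]

lemma finite_chartGood_finset (hx : IsTranscendenceBasis K x) (E : Finset F) (hE : ∀ e ∈ E, e ≠ 0) :
    {v : ValuationSubring F | ChartGood K x v ∧ ∃ e ∈ E, v.valuation e ≠ 1}.Finite := by
  refine (E.finite_toSet.biUnion fun e he => finite_chartGood hx (hE e he)).subset ?_
  rintro v ⟨hv, e, he, h⟩
  exact Set.mem_biUnion he ⟨hv, h⟩

/-- A ring is locally birational to almost all chart-good valuation rings. -/
lemma finite_chartGood_not_frac [IsDomain B] [Algebra K B]
    [Algebra.FiniteType K B] [IsFractionRing B F] [IsScalarTower K B F]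
    (hx : IsTranscendenceBasis K x) :
    {v : ValuationSubring F | ChartGood K x v ∧ ¬ ((∀ b : B, algebraMap B F b ∈ v) ∧
      ∀ z ∈ v, ∃ a s : B, v.valuation (algebraMap B F s) = 1 ∧
        z * algebraMap B F s = algebraMap B F a)}.Finite := by
  classical
  have hinj := IsFractionRing.injective B F
  obtain ⟨gB, hgB⟩ := (Algebra.FiniteType.out : (⊤ : Subalgebra K B).FG)
  obtain ⟨G', hG'⟩ := chart_generated hx
  have hfr : ∀ z : F, ∃ n m : B, m ≠ 0 ∧ z * algebraMap B F m = algebraMap B F n := fun z => by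
    obtain ⟨n, m, hm, h⟩ := IsFractionRing.div_surjective (A := B) z
    have hm0 := nonZeroDivisors.ne_zero hm
    refine ⟨n, m, hm0, ?_⟩
    rw [← h, div_mul_cancel₀]
    exact fun h0 => hm0 (hinj (h0.trans (map_zero _).symm))
  choose nu de hde hnd using hfr
  refine (finite_chartGood_finset hx
    ((gB.image (algebraMap B F) ∪ G'.image fun g => algebraMap B F (de g)).erase 0)
    fun e he => (Finset.mem_erase.1 he).1).subset ?_
  rintro v ⟨hv, h⟩
  refine ⟨hv, ?_⟩
  by_contra! hc
  refine h ?_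
  have hB : ∀ b : B, algebraMap B F b ∈ v := fun b => by
    have hb : b ∈ Algebra.adjoin K (gB : Set B) := hgB ▸ Algebra.mem_top
    induction hb using Algebra.adjoin_induction with
    | mem g hg =>
      by_cases hg0 : algebraMap B F g = 0
      · rw [hg0]; exact zero_mem _
      refine (v.valuation_le_one_iff _).1 (hc _ (Finset.mem_erase.2 ⟨hg0, ?_⟩)).le
      exact Finset.mem_union_left _ (Finset.mem_image_of_mem _ hg)
    | algebraMap r =>
      rw [← IsScalarTower.algebraMap_apply K B F]; exact hv.algebraMap_mem r
    | add y z _ _ hy hz => rw [map_add]; exact add_mem hy hz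
    | mul y z _ _ hy hz => rw [map_mul]; exact mul_mem hy hz
  refine ⟨hB, fun z hz => ?_⟩
  obtain ⟨G, hGG, hG, hgen⟩ := hG' v hv
  refine exists_frac_of_generated (K := K) (algebraMap B F) (fun a => ⟨algebraMap K B a, ?_⟩) hgen
    (fun g hg => ⟨nu g, de g, hc _ (Finset.mem_erase.2 ⟨?_, ?_⟩), hnd g⟩) hz
  · rw [← IsScalarTower.algebraMap_apply K B F]
  · exact fun h0 => hde g (hinj (h0.trans (map_zero _).symm))
  · exact Finset.mem_union_right _ (Finset.mem_image_of_mem _ (hGG hg))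

lemma eq_center_of_le [DecidableEq ι] (hx : IsTranscendenceBasis K x) {v : ValuationSubring F}
    (hv : ChartGood K x v) (hD : ∀ j, ∀ w ∈ v, pd hx j w ∈ v)
    (hB : ∀ b : B, algebraMap B F b ∈ v)
    (hfrac : ∀ z ∈ v, ∃ a s : B, v.valuation (algebraMap B F s) = 1 ∧
        z * algebraMap B F s = algebraMap B F a) (hinj : Function.Injective (algebraMap B F))
    {P : Ideal B} (hP : P.IsPrime) (hP0 : P ≠ ⊥) (hle : P ≤ center v hB) : P = center v hB := by
  classical
  have hvT : ∀ z ∈ v, z ∈ (fracSubring P : Subring F) := fun z hz => by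
    obtain ⟨a, s, hs, h⟩ := hfrac z hz
    exact ⟨a, s, fun hc => ((mem_center v hB s).1 (hle hc)).ne hs, h⟩
  have hPT : ∀ b ∈ P, b ≠ 0 → (algebraMap B F b)⁻¹ ∉ (fracSubring P : Subring F) := by
    rintro b hb hb0 ⟨n, m, hm, h⟩
    refine hm ?_
    have h1 : algebraMap B F b ≠ 0 := fun h0 => hb0 (hinj (h0.trans (map_zero _).symm))
    have : m = b * n := hinj (by rw [map_mul, ← h, mul_inv_cancel_left₀ h1])
    exact this ▸ P.mul_mem_right _ hb
  obtain ⟨u, hu, hu0⟩ := Submodule.exists_mem_ne_zero_of_ne_bot hP0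
  have huF : algebraMap B F u ≠ 0 := fun h0 => hu0 (hinj (h0.trans (map_zero _).symm))
  obtain ⟨d, hd, hd0, hint⟩ := exists_common_denominator_good hx {(algebraMap B F u)⁻¹}
  have hdu := hvT _ (hint _ (Finset.mem_singleton_self _) v hv)
  have hdT : d⁻¹ ∉ (fracSubring P : Subring F) := fun hc => hPT u hu hu0 (by
    have := mul_mem hc hdu
    rwa [inv_mul_cancel_left₀ hd0] at this)
  rw [Algebra.adjoin_range_eq_range_aeval] at hd
  obtain ⟨p, rfl⟩ := hd
  change MvPolynomial.aeval x p ≠ 0 at hd0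
  change (MvPolynomial.aeval x p)⁻¹ ∉ _ at hdT
  have hv1 : v ≠ ⊤ := fun h => hdT (hvT _ (h ▸ ValuationSubring.mem_top _))
  obtain ⟨h, hh, hhv⟩ := exists_irreducible_of_ne_top hx hv hv1
  have hp0 : p ≠ 0 := fun h0 => hd0 (by rw [h0, map_zero])
  obtain ⟨k, w, hw, hpw⟩ := WfDvdMonoid.max_power_factor hp0 hh
  have hw1 : v.valuation (MvPolynomial.aeval x w) = 1 :=
    le_antisymm ((v.valuation_le_one_iff _).2 (hv.aeval_mem w))
      (not_lt.1 fun hc => hw ((hhv w).1 hc))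
  have hwT : (MvPolynomial.aeval x w)⁻¹ ∈ (fracSubring P : Subring F) := hvT _ (by
    rw [← v.valuation_le_one_iff, map_inv₀, hw1, inv_one])
  have hhT : (MvPolynomial.aeval x h)⁻¹ ∉ (fracSubring P : Subring F) := fun hc => hdT (by
    rw [hpw, map_mul, map_pow, mul_inv, ← inv_pow]
    exact mul_mem (pow_mem hc _) hwT)
  refine le_antisymm hle fun b hb => ?_
  by_contra hbP
  have hb0 : algebraMap B F b ≠ 0 := fun h0 => hbP (by
    rw [hinj (h0.trans (map_zero _).symm)]; exact zero_mem _)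
  have h1 := hvT _ (div_mem_of_derivation_mem hx hD hh hhv ((mem_center v hB b).1 hb))
  have h2 : (algebraMap B F b)⁻¹ ∈ (fracSubring P : Subring F) :=
    ⟨1, b, hbP, by rw [inv_mul_cancel₀ hb0, map_one]⟩
  refine hhT ?_
  have := mul_mem h1 h2
  rwa [div_eq_mul_inv, mul_right_comm, mul_inv_cancel₀ hb0, one_mul] at this

end
end InvHyp

namespace InvHyp

open Classical in
/-- The indicator of the elements of `N` whose centre is a component of `V(I)`. -/
noncomputable def compInd {V B : Type*} [CommRing B] (N : Set V) (cen : V → Ideal B) (I : Ideal B)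
    (v : V) : ℤ :=
  if v ∈ N ∧ cen v ∈ I.minimalPrimes then 1 else 0

lemma compInd_eq_one {V B : Type*} [CommRing B] {N : Set V} {cen : V → Ideal B} {I : Ideal B}
    {v : V} : compInd N cen I v = 1 ↔ v ∈ N ∧ cen v ∈ I.minimalPrimes := by
  rw [compInd]
  split_ifs with h
  · exact ⟨fun _ => h, fun _ => rfl⟩
  · exact ⟨fun h0 => absurd h0 (by norm_num), fun h' => absurd h' h⟩

lemma compInd_ne_zero {V B : Type*} [CommRing B] {N : Set V} {cen : V → Ideal B} {I : Ideal B}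
    {v : V} : compInd N cen I v ≠ 0 ↔ v ∈ N ∧ cen v ∈ I.minimalPrimes := by
  rw [compInd]
  split_ifs with h
  · exact ⟨fun _ => h, fun _ => one_ne_zero⟩
  · exact ⟨fun h0 => absurd rfl h0, fun h' => absurd h' h⟩

lemma compInd_eq_zero {V B : Type*} [CommRing B] {N : Set V} {cen : V → Ideal B} {I : Ideal B}
    {v : V} : compInd N cen I v = 0 ↔ ¬ (v ∈ N ∧ cen v ∈ I.minimalPrimes) :=
  not_iff_not.1 (compInd_ne_zero.trans (not_not).symm)

lemma eq_of_minimalPrimes_eq {B : Type*} [CommRing B] {I J : Ideal B} (hI : I.IsRadical)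
    (hJ : J.IsRadical) (h : I.minimalPrimes = J.minimalPrimes) : I = J := by
  rw [← hI.radical, ← hJ.radical, ← Ideal.sInf_minimalPrimes, ← Ideal.sInf_minimalPrimes, h]

lemma infinite_biUnion_minimalPrimes {B : Type*} [CommRing B] {𝓘 : Set (Ideal B)}
    (h𝓘 : 𝓘.Infinite) (hyp : ∀ I ∈ 𝓘, IsHypersurfaceIdeal I) :
    (⋃ I ∈ 𝓘, I.minimalPrimes).Infinite := by
  intro hfin
  refine h𝓘 (Set.Finite.of_finite_image (f := Ideal.minimalPrimes)
    (hfin.finite_subsets.subset ?_) fun I hI J hJ h =>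
      eq_of_minimalPrimes_eq (hyp I hI).1 (hyp J hJ).1 h)
  rintro _ ⟨I, hI, rfl⟩
  exact Set.subset_biUnion_of_mem (u := Ideal.minimalPrimes) hI

lemma exists_finsupp_family {V B : Type*} [CommRing B] [IsNoetherianRing B] (N : Set V)
    (cen : V → Ideal B) (hinj : Set.InjOn cen N)
    (hex : {P | HeightOnePrime P ∧ ∀ v ∈ N, cen v ≠ P}.Finite) {𝓘 : Set (Ideal B)}
    (h𝓘 : 𝓘.Infinite) (hyp : ∀ I ∈ 𝓘, IsHypersurfaceIdeal I) {A : Set V} (hA : A.Finite) :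
    ∃ G : Set (V →₀ ℤ), (⋃ m ∈ G, (m.support : Set V)).Infinite ∧
      ∀ m ∈ G, ∃ I ∈ 𝓘, ∃ J ∈ 𝓘, (∀ v, m v = compInd N cen I v - compInd N cen J v) ∧
        ∀ v ∈ A, m v = 0 := by
  classical
  obtain ⟨T, hT⟩ : ∃ T : Set V, {I ∈ 𝓘 | {v ∈ A | compInd N cen I v = 1} = T}.Infinite := by
    by_contra! hc
    refine h𝓘 ((hA.finite_subsets.biUnion fun T _ => hc T).subset fun I hI => ?_)
    exact Set.mem_biUnion (x := {v ∈ A | compInd N cen I v = 1}) (Set.sep_subset _ _) ⟨hI, rfl⟩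
  obtain ⟨J, hJ, hJT⟩ := hT.nonempty
  have hfin : ∀ I : Ideal B, (Function.support (compInd N cen I)).Finite := fun I => by
    refine Set.Finite.of_finite_image (f := cen)
      ((Ideal.finite_minimalPrimes_of_isNoetherianRing B I).subset ?_) fun v hv w hw h =>
        hinj (compInd_ne_zero.1 hv).1 (compInd_ne_zero.1 hw).1 h
    rintro _ ⟨v, hv, rfl⟩
    exact (compInd_ne_zero.1 hv).2
  let c : Ideal B → V →₀ ℤ := fun I => Finsupp.ofSupportFinite _ (hfin I)
  have hc : ∀ I v, c I v = compInd N cen I v := fun I v => rfl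
  refine ⟨(fun I => c I - c J) '' {I ∈ 𝓘 | {v ∈ A | compInd N cen I v = 1} = T}, ?_, ?_⟩
  · intro hf
    refine infinite_biUnion_minimalPrimes hT (fun I hI => hyp I hI.1)
      ((((hf.image cen).union hex).union
        (Ideal.finite_minimalPrimes_of_isNoetherianRing B J)).subset fun P hP => ?_)
    obtain ⟨I, hI, hPI⟩ := Set.mem_iUnion₂.1 hP
    by_cases hPJ : P ∈ J.minimalPrimes
    · exact Or.inr hPJ
    by_cases hPN : ∀ v ∈ N, cen v ≠ P
    · exact Or.inl (Or.inr ⟨(hyp I hI.1).2.2 P hPI, hPN⟩)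
    push Not at hPN
    obtain ⟨v, hv, rfl⟩ := hPN
    refine Or.inl (Or.inl ⟨v, Set.mem_biUnion (Set.mem_image_of_mem _ hI) ?_, rfl⟩)
    rw [Finset.mem_coe, Finsupp.mem_support_iff, Finsupp.sub_apply, hc, hc,
      compInd_eq_one.2 ⟨hv, hPI⟩, compInd_eq_zero.2 fun h => hPJ h.2]
    norm_num
  · rintro _ ⟨I, ⟨hI, hIT⟩, rfl⟩
    refine ⟨I, hI, J, hJ, fun v => rfl, fun v hv => ?_⟩
    have h1 : compInd N cen I v = 1 ↔ compInd N cen J v = 1 := by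
      have := (hIT.trans hJT.symm)
      constructor
      · exact fun h => (this.subset ⟨hv, h⟩ : v ∈ {v ∈ A | compInd N cen J v = 1}).2
      · exact fun h => (this.superset ⟨hv, h⟩ : v ∈ {v ∈ A | compInd N cen I v = 1}).2
    change compInd N cen I v - compInd N cen J v = 0
    rw [compInd_eq_one, compInd_eq_one] at h1
    unfold compInd
    simp only [h1, sub_self]

lemma _root_.Ideal.exists_mul_pow_mem_of_mem_minimalPrimes {B : Type*} [CommRing B] {I P : Ideal B}
    (hP : P ∈ I.minimalPrimes) {w : B} (hw : w ∈ P) : ∃ s ∉ P, ∃ n : ℕ, s * w ^ n ∈ I := by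
  by_contra! hc
  have := hP.1.1
  let M : Submonoid B := P.primeCompl ⊔ Submonoid.powers w
  have hM : Disjoint (I : Set B) (M : Set B) := by
    rw [Set.disjoint_left]
    rintro z hz hzM
    obtain ⟨s, hs, _, ⟨n, rfl⟩, rfl⟩ := Submonoid.mem_sup.1 hzM
    exact hc s hs n hz
  obtain ⟨Q, hQ, hIQ, hQM⟩ := Ideal.exists_le_prime_disjoint _ M hM
  have hwQ : w ∉ Q := fun h => Set.disjoint_left.1 hQM h
    (Submonoid.mem_sup_right (Submonoid.mem_powers w))
  have hQP : Q ≤ P := fun z hz => by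
    by_contra hzP
    exact Set.disjoint_left.1 hQM hz (Submonoid.mem_sup_left hzP)
  exact hwQ (hP.2 ⟨hQ, hIQ⟩ hQP hw)

/-- A local equation of `V(I)` at a component with a good valuation ring. -/
lemma exists_local_equation {B : Type*} [CommRing B] [IsNoetherianRing B] {F : Type*} [Field F]
    [Algebra B F] (hinj : Function.Injective (algebraMap B F)) {v : ValuationSubring F}
    (hB : ∀ b : B, algebraMap B F b ∈ v)
    (hfrac : ∀ z ∈ v, ∃ a s : B, v.valuation (algebraMap B F s) = 1 ∧
      z * algebraMap B F s = algebraMap B F a)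
    {h : F} (hh0 : h ≠ 0) (hh1 : v.valuation h < 1) (hh : ∀ b, v.valuation b < 1 → b / h ∈ v)
    {I : Ideal B} (hI : I.IsRadical) (hP : center v hB ∈ I.minimalPrimes) :
    ∃ e ∈ I, algebraMap B F e ≠ 0 ∧ algebraMap B F e / h ∈ v ∧ h / algebraMap B F e ∈ v ∧
      ∃ s, v.valuation (algebraMap B F s) = 1 ∧ ∀ g ∈ I, e ∣ s * g := by
  classical
  obtain ⟨a, s, hs, has⟩ := hfrac h ((v.valuation_le_one_iff _).1 hh1.le)
  have ha : a ∈ center v hB := by rw [mem_center, ← has, map_mul, hs, mul_one]; exact hh1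
  obtain ⟨t, ht, n, htn⟩ := Ideal.exists_mul_pow_mem_of_mem_minimalPrimes hP ha
  have ht1 : v.valuation (algebraMap B F t) = 1 :=
    le_antisymm ((v.valuation_le_one_iff _).2 (hB t))
      (not_lt.1 fun hc => ht ((mem_center v hB t).2 hc))
  have htI : t * a ∈ I := hI ⟨n + 1, by
    have : (t * a) ^ (n + 1) = t ^ n * a * (t * a ^ n) := by ring
    rw [this]; exact I.mul_mem_left _ htn⟩
  have hv : v.valuation (algebraMap B F (t * a)) = v.valuation h := by
    rw [map_mul, map_mul, ht1, one_mul, ← has, map_mul, hs, mul_one]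
  have hne : algebraMap B F (t * a) ≠ 0 := fun h0 => by
    rw [h0, map_zero, eq_comm, map_eq_zero] at hv; exact hh0 hv
  have hvne : v.valuation h ≠ 0 := by simpa using hh0
  have hquot : algebraMap B F (t * a) / h ∈ v := by
    rw [← v.valuation_le_one_iff, map_div₀, hv, div_self hvne]
  have hquot' : h / algebraMap B F (t * a) ∈ v := by
    rw [← v.valuation_le_one_iff, map_div₀, hv, div_self hvne]
  refine ⟨t * a, htI, hne, hquot, hquot', ?_⟩
  have key : ∀ g ∈ I, ∃ s, v.valuation (algebraMap B F s) = 1 ∧ t * a ∣ s * g := fun g hg => by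
    have hgv : algebraMap B F g / algebraMap B F (t * a) ∈ v := by
      have h1 := mul_mem (hh _ ((mem_center v hB g).1 (hP.1.2 hg))) hquot'
      rwa [div_mul_div_cancel₀ hh0] at h1
    obtain ⟨b, s', hs', hb⟩ := hfrac _ hgv
    refine ⟨s', hs', b, hinj ?_⟩
    rw [map_mul _ (t * a), ← hb, map_mul]
    field_simp
  obtain ⟨E, hE⟩ := (isNoetherian_def.1 ‹IsNoetherianRing B› I : I.FG)
  have hsub : ∀ g ∈ E, g ∈ I := fun g hg => hE ▸ Submodule.subset_span hg
  choose! σ hσ hσd using key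
  refine ⟨∏ g ∈ E, σ g, ?_, fun g hg => ?_⟩
  · rw [map_prod, map_prod]
    exact Finset.prod_eq_one fun g hg => hσ g (hsub g hg)
  · rw [← hE] at hg
    induction hg using Submodule.span_induction with
    | mem g hg =>
      exact (hσd g (hsub g hg)).trans (mul_dvd_mul_right (Finset.dvd_prod_of_mem _ hg) _)
    | zero => simp
    | add y z _ _ hy hz => rw [mul_add]; exact dvd_add hy hz
    | smul c y _ hy => rw [smul_eq_mul, mul_left_comm]; exact hy.mul_left _

end InvHyp

namespace InvHyp

section LogData

set_option linter.unusedSectionVars false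

variable {K : Type*} [Field K] [CharZero K] {F : Type*} [Field F] [Algebra K F]
  {ι : Type*} [Fintype ι] [DecidableEq ι] {x : ι → F}

/-- The valuation ring `v` is stable under the partial derivations and is locally birational
to `B`. -/
structure Adapted (hx : IsTranscendenceBasis K x) (B : Type*) [CommRing B] [Algebra B F]
    (v : ValuationSubring F) : Prop where
  good : ChartGood K x v
  stable : ∀ j, ∀ w ∈ v, pd hx j w ∈ v
  mem : ∀ b : B, algebraMap B F b ∈ v
  frac : ∀ z ∈ v, ∃ a s : B, v.valuation (algebraMap B F s) = 1 ∧
    z * algebraMap B F s = algebraMap B F a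

lemma finite_not_adapted [Algebra.EssFiniteType K F] (hx : IsTranscendenceBasis K x)
    (B : Type*) [CommRing B] [IsDomain B] [Algebra K B] [Algebra.FiniteType K B] [Algebra B F]
    [IsFractionRing B F] [IsScalarTower K B F] :
    {v : ValuationSubring F | ChartGood K x v ∧ ¬ Adapted hx B v}.Finite := by
  obtain ⟨c, hc0, hc⟩ := exists_derivation_bound hx ∅ fun j => pd hx j
  refine ((finite_chartGood hx hc0).union (finite_chartGood_not_frac (B := B) hx)).subset ?_
  rintro v ⟨hv, hva⟩
  by_contra h
  rw [Set.mem_union, not_or] at h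
  have h1 : v.valuation c = 1 := by by_contra h1; exact h.1 ⟨hv, h1⟩
  have h2 := not_not.1 fun h2 => h.2 ⟨hv, h2⟩
  refine hva ⟨hv, fun j w hw => ?_, h2.1, h2.2⟩
  have := (hc v hv).2.2 j w hw
  rwa [← v.valuation_le_one_iff, map_mul, h1, one_mul, v.valuation_le_one_iff] at this

lemma Adapted.eq_center [Algebra.EssFiniteType K F] {hx : IsTranscendenceBasis K x}
    {B : Type*} [CommRing B] [Algebra B F] {v : ValuationSubring F} (h : Adapted hx B v)
    (hinj : Function.Injective (algebraMap B F)) {P : Ideal B} (hP : P.IsPrime) (hP0 : P ≠ ⊥)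
    (hle : P ≤ center v h.mem) : P = center v h.mem :=
  eq_center_of_le hx h.good h.stable h.mem h.frac hinj hP hP0 hle

open Classical in
/-- The centre of `v` on `B`, or the unit ideal if there is none. -/
noncomputable def cenv (B : Type*) [CommRing B] [Algebra B F] (v : ValuationSubring F) : Ideal B :=
  if h : ∀ b, algebraMap B F b ∈ v then center v h else ⊤

lemma cenv_eq {B : Type*} [CommRing B] [Algebra B F] {v : ValuationSubring F}
    (h : ∀ b : B, algebraMap B F b ∈ v) : cenv B v = center v h := dif_pos h

lemma Adapted.cenv_injOn {hx : IsTranscendenceBasis K x} {B : Type*} [CommRing B] [Algebra B F]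
    {N : Set (ValuationSubring F)} (hN : ∀ v ∈ N, Adapted hx B v) : Set.InjOn (cenv B) N := by
  intro v hv w hw h
  have key : ∀ {v w : ValuationSubring F}, Adapted hx B v → Adapted hx B w →
      cenv B v = cenv B w → v ≤ w := fun {v w} hv hw h =>
    le_of_frac (algebraMap B F) hw.mem hv.frac fun r hr => by
      rw [← mem_center w hw.mem, ← cenv_eq hw.mem, ← h, cenv_eq hv.mem, mem_center] at hr
      exact hr
  exact le_antisymm (key (hN v hv) (hN w hw) h) (key (hN w hw) (hN v hv) h.symm)

lemma finite_heightOnePrime_mem {B : Type*} [CommRing B] [IsNoetherianRing B] {b : B} (hb : b ≠ 0) :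
    {P : Ideal B | HeightOnePrime P ∧ b ∈ P}.Finite := by
  refine (Ideal.finite_minimalPrimes_of_isNoetherianRing B (Ideal.span {b})).subset ?_
  rintro P ⟨hP, hbP⟩
  refine ⟨⟨hP.1, (Ideal.span_singleton_le_iff_mem _).2 hbP⟩, fun Q hQ hQP => ?_⟩
  by_contra hPQ
  have := hP.2.2 Q hQ.1 (lt_of_le_not_ge hQP hPQ)
  rw [this, Ideal.span_singleton_le_iff_mem, Ideal.mem_bot] at hQ
  exact hb hQ.2

/-- Local equations, and logarithmic forms with prescribed residues, at almost all of the
chart-good valuation rings. -/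
structure LogData (hx : IsTranscendenceBasis K x) (B : Type*) [CommRing B] [Algebra B F] where
  q : Option ι → F
  N : Set (ValuationSubring F)
  H : ValuationSubring F → F
  ω : ValuationSubring F → ι → F
  q_ne : ∀ o, q o ≠ 0
  finite_compl : {v | (∃ o, ChartGood K (pchart x o) v) ∧ v ≠ ⊤ ∧ v ∉ N}.Finite
  q_spec : ∀ o v, ChartGood K (pchart x o) v → q o ∈ v ∧
    (∀ j, x j * q o ∈ v) ∧ ∀ j, ∀ w ∈ v, q o * pd hx j w ∈ v
  q_val : ∀ v ∈ N, v.valuation (q none) = 1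
  adapted : ∀ v ∈ N, Adapted hx B v
  H_ne : ∀ v ∈ N, H v ≠ 0
  H_lt : ∀ v ∈ N, v.valuation (H v) < 1
  H_div : ∀ v ∈ N, ∀ b, v.valuation b < 1 → b / H v ∈ v
  pd_H : ∀ v ∈ N, ∃ j, pd hx j (H v) / H v ∉ v
  ω_pole : ∀ v ∈ N, ∀ o, ChartGood K (pchart x o) v → ∀ j,
    q o * (ω v j - pd hx j (H v) / H v) ∈ v
  ω_mem : ∀ v ∈ N, ∀ o v', ChartGood K (pchart x o) v' → v' ≠ v → ∀ j, q o * ω v j ∈ v'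

lemma mem_of_valuation_eq_one {v : ValuationSubring F} {c z : F} (hc : v.valuation c = 1) :
    c * z ∈ v ↔ z ∈ v := by
  rw [← v.valuation_le_one_iff, map_mul, hc, one_mul, v.valuation_le_one_iff]

lemma exists_logData [Algebra.EssFiniteType K F] (hx : IsTranscendenceBasis K x)
    (B : Type*) [CommRing B] [IsDomain B] [Algebra K B] [Algebra.FiniteType K B] [Algebra B F]
    [IsFractionRing B F] [IsScalarTower K B F] : Nonempty (LogData hx B) := by
  obtain ⟨q, N, H, ω, hq0, hfin, hq, hN⟩ := exists_log_forms hx ∅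
  refine ⟨⟨q, {v ∈ N | v.valuation (q none) = 1 ∧ Adapted hx B v}, H, ω, hq0, ?_,
    fun o v hv => ⟨(hq o v hv).1, (hq o v hv).2.2⟩, fun v hv => hv.2.1, fun v hv => hv.2.2,
    fun v hv => (hN v hv.1).2.2.1, fun v hv => (hN v hv.1).2.1, fun v hv => (hN v hv.1).2.2.2.1,
    fun v hv => ?_, fun v hv => (hN v hv.1).2.2.2.2.2.1, fun v hv => (hN v hv.1).2.2.2.2.2.2⟩⟩
  · refine (hfin.union ((finite_chartGood hx (hq0 none)).union
      (finite_not_adapted hx B))).subset ?_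
    rintro v ⟨ho, hv, hvN⟩
    by_cases h : v ∈ N
    · have hg := (hN v h).1
      by_cases hq1 : v.valuation (q none) = 1
      · exact Or.inr (Or.inr ⟨hg, fun ha => hvN ⟨h, hq1, ha⟩⟩)
      · exact Or.inr (Or.inl ⟨hg, hq1⟩)
    · exact Or.inl ⟨ho, hv, h⟩
  · obtain ⟨j, hj⟩ := (hN v hv.1).2.2.2.2.1
    exact ⟨j, fun h => hj ((mem_of_valuation_eq_one hv.2.1).2 h)⟩

lemma LogData.ne_top {hx : IsTranscendenceBasis K x} {B : Type*} [CommRing B] [Algebra B F]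
    (E : LogData hx B) {v : ValuationSubring F} (hv : v ∈ E.N) : v ≠ ⊤ := by
  rintro rfl
  refine (E.H_lt _ hv).ne (valuation_eq_one_of_mem_of_inv_mem (E.H_ne _ hv) ?_ ?_) <;>
    exact ValuationSubring.mem_top _

lemma LogData.finite_heightOnePrime [Algebra.EssFiniteType K F] {hx : IsTranscendenceBasis K x}
    {B : Type*} [CommRing B] [IsDomain B] [Algebra K B] [Algebra.FiniteType K B] [Algebra B F]
    [IsFractionRing B F] [IsScalarTower K B F] (E : LogData hx B) :
    {P : Ideal B | HeightOnePrime P ∧ ∀ v ∈ E.N, cenv B v ≠ P}.Finite := by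
  have : IsNoetherianRing B := Algebra.FiniteType.isNoetherianRing K B
  obtain ⟨b, hb, h⟩ := exists_chartGood_center (B := B) hx
  refine ((finite_heightOnePrime_mem hb).union (E.finite_compl.image (cenv B))).subset ?_
  rintro P ⟨hP, hPN⟩
  by_cases hbP : b ∈ P
  · exact Or.inl ⟨hP, hbP⟩
  obtain ⟨v, hv, hvB, hvP⟩ := h P hP hbP
  have hcen : cenv B v = P := by
    ext z; rw [cenv_eq hvB, mem_center, hvP]
  refine Or.inr ⟨v, ⟨⟨none, hv⟩, ?_, fun hvN => hPN v hvN hcen⟩, hcen⟩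
  rintro rfl
  obtain ⟨p, hp, hp0⟩ := Submodule.exists_mem_ne_zero_of_ne_bot hP.2.1
  refine ((hvP p).2 hp).ne (valuation_eq_one_of_mem_of_inv_mem
    (fun h0 => hp0 (IsFractionRing.injective B F (by rw [h0, map_zero]))) ?_ ?_) <;>
    exact ValuationSubring.mem_top _

end LogData

/-- A finite nonempty transcendence basis. -/
lemma exists_fin_transcendenceBasis {K F : Type*} [Field K] [Field F] [Algebra K F]
    [Algebra.EssFiniteType K F] {z : F} (hz : Transcendental K z) :
    ∃ (n : ℕ) (x : Fin (n + 1) → F), IsTranscendenceBasis K x := by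
  obtain ⟨s, hs⟩ := exists_isTranscendenceBasis K F
  have hfin : Finite s := finite_of_isTranscendenceBasis hs
  obtain ⟨m, ⟨e⟩⟩ := Finite.exists_equiv_fin s
  have : Nonempty s := hs.nonempty_iff_transcendental.2 ⟨z, hz⟩
  obtain ⟨n, rfl⟩ : ∃ n, m = n + 1 := Nat.exists_eq_succ_of_ne_zero fun h => by
    subst h; exact (e (Classical.arbitrary s)).elim0
  exact ⟨n, _, hs.comp_equiv e.symm⟩

end InvHyp

namespace InvHyp

section

variable {K : Type*} [Field K] [CharZero K] {F L : Type*} [Field F] [Algebra K F] [Field L]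
  [Algebra K L] [Algebra.EssFiniteType K L] {ι' : Type*} [Finite ι'] [DecidableEq ι']
  {t : ι' → L}

lemma finite_comap_eq (ht : IsTranscendenceBasis K t) (φ : F →ₐ[K] L) {v : ValuationSubring F}
    (hv : v ≠ ⊤) :
    {W : ValuationSubring L | (∃ o, ChartGood K (pchart t o) W) ∧
      W.comap (φ : F →+* L) = v}.Finite := by
  obtain ⟨e, he⟩ : ∃ e, e ∉ v := by
    by_contra! h
    exact hv (top_le_iff.1 fun z _ => h z)
  have he0 : φ e ≠ 0 := (map_ne_zero φ).2 fun h => he (h ▸ zero_mem v)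
  refine (Set.finite_iUnion fun o =>
    finite_chartGood (isTranscendenceBasis_pchart ht o) he0).subset ?_
  rintro W ⟨⟨o, ho⟩, rfl⟩
  exact Set.mem_iUnion.2 ⟨o, ho, fun h => he ((W.valuation_le_one_iff _).1 h.le)⟩

lemma finite_comap_mem (ht : IsTranscendenceBasis K t) (φ : F →ₐ[K] L)
    {V : Set (ValuationSubring F)} (hV : V.Finite) (hV' : ⊤ ∉ V) :
    {W : ValuationSubring L | (∃ o, ChartGood K (pchart t o) W) ∧
      W.comap (φ : F →+* L) ∈ V}.Finite := by
  refine (hV.biUnion fun v hv => finite_comap_eq ht φ fun h => hV' (h ▸ hv)).subset ?_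
  rintro W ⟨hW, hWV⟩
  exact Set.mem_biUnion hWV ⟨hW, rfl⟩

variable [Nonempty ι'] [Algebra.EssFiniteType K F] {S : Type*} [CommRing S] [Algebra K S]
  {B : Type*} [CommRing B] [IsDomain B] [Algebra K B] [Algebra.FiniteType K B] [Algebra B F]
  [IsFractionRing B F] [IsScalarTower K B F]

/-- Hypersurfaces whose pullbacks to an infinitesimal thickening agree locally yield an invariant
function. -/
theorem exists_invariant_of_local (ht : IsTranscendenceBasis K t) {n : ℕ} {x₀ : Fin (n + 1) → F}
    (hx₀ : IsTranscendenceBasis K x₀) (π : S →ₐ[K] L) (hπ : Function.Surjective π)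
    (hfg : (RingHom.ker π).FG) {M : ℕ} (hM : RingHom.ker π ^ (M + 1) = ⊥) (Φ₁ Φ₂ : F →ₐ[K] S)
    (Y : Finset S) {𝓘 : Set (Ideal B)} (h𝓘 : 𝓘.Infinite) (hyp : ∀ I ∈ 𝓘, IsHypersurfaceIdeal I)
    (hloc : ∀ (ι : Type) [Fintype ι] [DecidableEq ι] (x : ι → F) (hx : IsTranscendenceBasis K x)
      (E : LogData hx B), ∃ Z : Set (ValuationSubring L), Z.Finite ∧
        ∀ o W, ChartGood K (pchart t o) W → W ∉ Z → (∀ y ∈ Y, π y ∈ W) ∧ ∀ v₁ v₂,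
          v₁ = W.comap (π.comp Φ₁ : F →+* L) → v₂ = W.comap (π.comp Φ₂ : F →+* L) →
          (v₁ ≠ ⊤ → v₁ ∈ E.N) → (v₂ ≠ ⊤ → v₂ ∈ E.N) → ∀ I ∈ 𝓘,
            (v₁ ∈ E.N ∧ cenv B v₁ ∈ I.minimalPrimes ↔ v₂ ∈ E.N ∧ cenv B v₂ ∈ I.minimalPrimes) ∧
            (v₁ ∈ E.N ∧ cenv B v₁ ∈ I.minimalPrimes → v₂ ∈ E.N ∧ cenv B v₂ ∈ I.minimalPrimes →
              ∃ e₁ e₂ : F, e₁ ≠ 0 ∧ e₂ ≠ 0 ∧ e₁ / E.H v₁ ∈ v₁ ∧ E.H v₁ / e₁ ∈ v₁ ∧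
                e₂ / E.H v₂ ∈ v₂ ∧ E.H v₂ / e₂ ∈ v₂ ∧ ∃ s₁ ∈ Algebra.adjoin K (Y : Set S),
                ∃ s₂ ∈ Algebra.adjoin K (Y : Set S), W.valuation (π s₁) = 1 ∧
                  W.valuation (π s₂) = 1 ∧ s₂ * Φ₁ e₁ = s₁ * Φ₂ e₂)) :
    ∃ g : F, g ∉ Set.range (algebraMap K F) ∧ Φ₁ g = Φ₂ g := by
  classical
  have : IsNoetherianRing B := Algebra.FiniteType.isNoetherianRing K B
  obtain ⟨ι, _, _, x, hx, _, hgood⟩ := exists_adapted_basis ht hx₀ (π.comp Φ₁) (π.comp Φ₂)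
  obtain ⟨E⟩ := exists_logData hx B
  obtain ⟨Z, hZ, hloc⟩ := hloc ι x hx E
  let V : Set (ValuationSubring F) :=
    {v | (∃ o, ChartGood K (pchart x o) v) ∧ v ≠ ⊤ ∧ v ∉ E.N}
  let Z' := Z ∪ ({W | (∃ o, ChartGood K (pchart t o) W) ∧ W.comap (π.comp Φ₁ : F →+* L) ∈ V} ∪
    {W | (∃ o, ChartGood K (pchart t o) W) ∧ W.comap (π.comp Φ₂ : F →+* L) ∈ V})
  have hZ' : Z'.Finite := hZ.union ((finite_comap_mem ht _ E.finite_compl fun h => h.2.1 rfl).union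
    (finite_comap_mem ht _ E.finite_compl fun h => h.2.1 rfl))
  obtain ⟨G, hGinf, hG⟩ := exists_finsupp_family E.N (cenv B) (Adapted.cenv_injOn E.adapted)
    E.finite_heightOnePrime h𝓘 hyp ((hZ'.image fun W => W.comap (π.comp Φ₁ : F →+* L)).union
      (hZ'.image fun W => W.comap (π.comp Φ₂ : F →+* L)))
  refine exists_invariant_of_thickening hx ht E.q_ne E.q_spec (N := E.N) (H := E.H) (ω := E.ω)
    (fun v hv => ⟨(E.adapted v hv).good, E.H_ne v hv, ?_, E.ω_pole v hv, E.ω_mem v hv⟩) π hπ hfg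
    hM Φ₁ Φ₂ Y hgood (G := G) ?_ hGinf ?_
  · obtain ⟨j, hj⟩ := E.pd_H v hv
    exact ⟨j, fun h => hj ((mem_of_valuation_eq_one (E.q_val v hv)).1 h)⟩
  · intro m hm v hv
    obtain ⟨I, -, J, -, h, -⟩ := hG m hm
    by_contra hvN
    rw [Finsupp.mem_support_iff, h, compInd_eq_zero.2 fun h => hvN h.1,
      compInd_eq_zero.2 fun h => hvN h.1] at hv
    exact hv rfl
  · intro m hm o W hW v₁ v₂ h₁ h₂
    obtain ⟨I, hI, J, hJ, h, hA⟩ := hG m hm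
    by_cases hWZ : W ∈ Z'
    · have e₁ : m v₁ = 0 := hA _ (Or.inl (h₁ ▸ Set.mem_image_of_mem _ hWZ))
      have e₂ : m v₂ = 0 := hA _ (Or.inr (h₂ ▸ Set.mem_image_of_mem _ hWZ))
      exact ⟨e₁.trans e₂.symm, fun h0 => absurd e₁ h0⟩
    · obtain ⟨hY, hl⟩ := hloc o W hW fun h => hWZ (Or.inl h)
      have hv₁ : v₁ ≠ ⊤ → v₁ ∈ E.N := fun htop => by
        by_contra hN
        exact hWZ (Or.inr (Or.inl ⟨⟨o, hW⟩, h₁ ▸ ⟨h₁ ▸ (hgood o W hW).1, htop, hN⟩⟩))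
      have hv₂ : v₂ ≠ ⊤ → v₂ ∈ E.N := fun htop => by
        by_contra hN
        exact hWZ (Or.inr (Or.inr ⟨⟨o, hW⟩, h₂ ▸ ⟨h₂ ▸ (hgood o W hW).2, htop, hN⟩⟩))
      have hl' := hl v₁ v₂ h₁ h₂ hv₁ hv₂
      have hc : ∀ I ∈ 𝓘, compInd E.N (cenv B) I v₁ = compInd E.N (cenv B) I v₂ := fun I hI => by
        unfold compInd
        simp only [(hl' I hI).1]
      refine ⟨by rw [h, h, hc I hI, hc J hJ], fun h0 => ⟨hY, ?_⟩⟩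
      have key : ∀ I ∈ 𝓘, compInd E.N (cenv B) I v₁ ≠ 0 → _ := fun I hI h1 =>
        (hl' I hI).2 (compInd_ne_zero.1 h1) ((hl' I hI).1.1 (compInd_ne_zero.1 h1))
      by_cases hI0 : compInd E.N (cenv B) I v₁ = 0
      · refine key J hJ fun hJ0 => h0 ?_
        rw [h, hI0, hJ0, sub_zero]
      · exact key I hI hI0

end

end InvHyp

namespace InvHyp

lemma valuation_comap_lt_one {F L : Type*} [Field F] [Field L] (φ : F →+* L)
    (W : ValuationSubring L) (z : F) : (W.comap φ).valuation z < 1 ↔ W.valuation (φ z) < 1 := by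
  by_cases hz : z = 0
  · simp [hz]
  rw [← not_le, ← not_le, not_iff_not, ← inv_le_one₀ (by simpa [zero_lt_iff] using hz),
    ← map_inv₀, ValuationSubring.valuation_le_one_iff,
    ← inv_le_one₀ (by simpa [zero_lt_iff] using hz), ← map_inv₀,
    ValuationSubring.valuation_le_one_iff, ← map_inv₀]
  rfl

lemma valuation_comap_eq_one {F L : Type*} [Field F] [Field L] (φ : F →+* L)
    (W : ValuationSubring L) (z : F) : (W.comap φ).valuation z = 1 ↔ W.valuation (φ z) = 1 := by
  have h : (W.comap φ).valuation z ≤ 1 ↔ W.valuation (φ z) ≤ 1 := by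
    rw [ValuationSubring.valuation_le_one_iff, ValuationSubring.valuation_le_one_iff]
    rfl
  rw [eq_iff_le_not_lt, eq_iff_le_not_lt, valuation_comap_lt_one, h]

section

set_option linter.unusedSectionVars false

variable {K : Type*} [Field K] [CharZero K] {F L : Type*} [Field F] [Algebra K F] [Field L]
  [Algebra K L] [Algebra.EssFiniteType K L] {ι' : Type*} [Finite ι'] [DecidableEq ι']
  {t : ι' → L}

lemma finite_chartGood_notMem (ht : IsTranscendenceBasis K t) (Y : Finset L) :
    {W : ValuationSubring L | (∃ o, ChartGood K (pchart t o) W) ∧ ∃ y ∈ Y, y ∉ W}.Finite := by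
  classical
  refine (Set.finite_iUnion fun o => finite_chartGood_finset (isTranscendenceBasis_pchart ht o)
    (Y.erase 0) fun e he => (Finset.mem_erase.1 he).1).subset ?_
  rintro W ⟨⟨o, ho⟩, y, hy, hyW⟩
  exact Set.mem_iUnion.2 ⟨o, ho, y, Finset.mem_erase.2 ⟨fun h => hyW (h ▸ zero_mem W), hy⟩,
    fun h => hyW ((W.valuation_le_one_iff _).1 h.le)⟩

lemma ChartGood.map_mem {W : ValuationSubring L} {o : Option ι'}
    (hW : ChartGood K (pchart t o) W) {S : Type*} [CommRing S] [Algebra K S] (ψ : S →ₐ[K] L)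
    {Y : Finset S} (hY : Algebra.adjoin K (Y : Set S) = ⊤) (h : ∀ y ∈ Y, ψ y ∈ W) (s : S) :
    ψ s ∈ W := by
  have hs : s ∈ Algebra.adjoin K (Y : Set S) := hY ▸ Algebra.mem_top
  induction hs using Algebra.adjoin_induction with
  | mem y hy => exact h y hy
  | algebraMap k => rw [AlgHom.commutes]; exact hW.algebraMap_mem k
  | add a b _ _ ha hb => rw [map_add]; exact add_mem ha hb
  | mul a b _ _ ha hb => rw [map_mul]; exact mul_mem ha hb

variable [Nonempty ι'] [Algebra.EssFiniteType K F]
  {B : Type*} [CommRing B] [IsDomain B] [Algebra K B] [Algebra.FiniteType K B] [Algebra B F]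
  [IsFractionRing B F] [IsScalarTower K B F]
  {S Q : Type*} [CommRing S] [Algebra K S] [Algebra.FiniteType K S] [CommRing Q] [Algebra K Q]

lemma mem_minimalPrimes_of_map_eq {ι : Type*} [Fintype ι] [DecidableEq ι] {x : ι → F}
    {hx : IsTranscendenceBasis K x} (E : LogData hx B) {f₁ f₂ : B →ₐ[K] S} {ψ : S →ₐ[K] L}
    {φ₁ φ₂ : F →ₐ[K] L} (h₁ : ∀ b, φ₁ (algebraMap B F b) = ψ (f₁ b))
    (h₂ : ∀ b, φ₂ (algebraMap B F b) = ψ (f₂ b)) {I : Ideal B} (hI : IsHypersurfaceIdeal I)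
    (hmap : I.map f₁ = I.map f₂) {W : ValuationSubring L} (hW : ∀ s, ψ s ∈ W)
    {v₁ v₂ : ValuationSubring F} (hv₁ : v₁ = W.comap (φ₁ : F →+* L))
    (hv₂ : v₂ = W.comap (φ₂ : F →+* L)) (hN : v₂ ≠ ⊤ → v₂ ∈ E.N)
    (h : v₁ ∈ E.N ∧ cenv B v₁ ∈ I.minimalPrimes) :
    v₂ ∈ E.N ∧ cenv B v₂ ∈ I.minimalPrimes := by
  let alg : Algebra S L := (ψ : S →+* L).toAlgebra
  let c : Ideal S := center W hW
  have hc : ∀ s, s ∈ c ↔ W.valuation (ψ s) < 1 := mem_center W hW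
  have hv : ∀ b, f₂ b ∈ c ↔ v₂.valuation (algebraMap B F b) < 1 := fun b => by
    rw [hc, hv₂, valuation_comap_lt_one]
    change _ ↔ W.valuation (φ₂ _) < 1
    rw [h₂]
  have hle : I ≤ c.comap f₂ := by
    rw [← Ideal.map_le_iff_le_comap, ← hmap, Ideal.map_le_iff_le_comap]
    intro b hb
    have := h.2.1.2 hb
    rw [cenv_eq (E.adapted v₁ h.1).mem, mem_center, hv₁, valuation_comap_lt_one] at this
    change W.valuation (φ₁ _) < 1 at this
    rw [h₁] at this
    exact (hc _).2 this
  have : c.IsPrime := center_isPrime W hW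
  obtain ⟨P, hP, hPle⟩ := Ideal.exists_minimalPrimes_le hle
  have hP1 := hI.2.2 P hP
  obtain ⟨p, hp, hp0⟩ := Submodule.exists_mem_ne_zero_of_ne_bot hP1.2.1
  have hvN : v₂ ∈ E.N := hN fun htop => by
    refine ((hv p).1 (hPle hp)).ne (valuation_eq_one_of_mem_of_inv_mem
      (fun h0 => hp0 (IsFractionRing.injective B F (by rw [h0, map_zero]))) ?_ ?_) <;>
    exact htop ▸ ValuationSubring.mem_top _
  have ha := E.adapted v₂ hvN
  have := ha.eq_center (IsFractionRing.injective B F) hP1.1 hP1.2.1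
    fun b hb => (mem_center v₂ ha.mem b).2 ((hv b).1 (hPle hb))
  exact ⟨hvN, by rwa [cenv_eq ha.mem, ← this]⟩

/-- Hypersurfaces with the same scheme-theoretic inverse images yield an invariant function. -/
theorem exists_invariant_of_map_eq (ht : IsTranscendenceBasis K t) {n : ℕ}
    {x₀ : Fin (n + 1) → F} (hx₀ : IsTranscendenceBasis K x₀) (π : Q →ₐ[K] L)
    (hπ : Function.Surjective π) (hfg : (RingHom.ker π).FG) {M : ℕ}
    (hM : RingHom.ker π ^ (M + 1) = ⊥) (j : S →ₐ[K] Q) (f₁ f₂ : B →ₐ[K] S) (Φ₁ Φ₂ : F →ₐ[K] Q)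
    (h₁ : ∀ b, Φ₁ (algebraMap B F b) = j (f₁ b)) (h₂ : ∀ b, Φ₂ (algebraMap B F b) = j (f₂ b))
    {𝓘 : Set (Ideal B)} (h𝓘 : 𝓘.Infinite) (hyp : ∀ I ∈ 𝓘, IsHypersurfaceIdeal I)
    (hmap : ∀ I ∈ 𝓘, I.map f₁ = I.map f₂) :
    ∃ g : F, g ∉ Set.range (algebraMap K F) ∧ Φ₁ g = Φ₂ g := by
  classical
  have : IsNoetherianRing B := Algebra.FiniteType.isNoetherianRing K B
  obtain ⟨Y, hY⟩ := (Algebra.FiniteType.out : (⊤ : Subalgebra K S).FG)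
  have hYQ : ∀ s, j s ∈ Algebra.adjoin K ((Y.image j : Finset Q) : Set Q) := fun s => by
    rw [Finset.coe_image, ← AlgHom.map_adjoin, hY]
    exact ⟨s, Algebra.mem_top, rfl⟩
  refine exists_invariant_of_local ht hx₀ π hπ hfg hM Φ₁ Φ₂ (Y.image j) h𝓘 hyp
    fun ι _ _ x hx E => ⟨_, finite_chartGood_notMem ht ((Y.image j).image π),
      fun o W hW hWZ => ?_⟩
  have hYW : ∀ y ∈ Y.image j, π y ∈ W := fun y hy => by
    by_contra hyW
    exact hWZ ⟨⟨o, hW⟩, π y, Finset.mem_image_of_mem _ hy, hyW⟩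
  have hSW : ∀ s, π.comp j s ∈ W := hW.map_mem (π.comp j) hY fun y hy =>
    hYW _ (Finset.mem_image_of_mem _ hy)
  have h₁' : ∀ b, π.comp Φ₁ (algebraMap B F b) = π.comp j (f₁ b) := fun b => congrArg π (h₁ b)
  have h₂' : ∀ b, π.comp Φ₂ (algebraMap B F b) = π.comp j (f₂ b) := fun b => congrArg π (h₂ b)
  refine ⟨hYW, fun v₁ v₂ hv₁ hv₂ hN₁ hN₂ I hI => ⟨⟨mem_minimalPrimes_of_map_eq E h₁' h₂' (hyp I hI)
    (hmap I hI) hSW hv₁ hv₂ hN₂, mem_minimalPrimes_of_map_eq E h₂' h₁' (hyp I hI)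
    (hmap I hI).symm hSW hv₂ hv₁ hN₁⟩, fun hm₁ hm₂ => ?_⟩⟩
  have hinj := IsFractionRing.injective B F
  have key : ∀ v ∈ E.N, cenv B v ∈ I.minimalPrimes → _ := fun v hv hm =>
    exists_local_equation hinj (E.adapted v hv).mem (E.adapted v hv).frac (E.H_ne v hv)
      (E.H_lt v hv) (E.H_div v hv) (hyp I hI).1 (cenv_eq (E.adapted v hv).mem ▸ hm)
  obtain ⟨e₁, he₁, h10, h11, h12, s₁, hs₁, hd₁⟩ := key v₁ hm₁.1 hm₁.2
  obtain ⟨e₂, he₂, h20, h21, h22, s₂, hs₂, hd₂⟩ := key v₂ hm₂.1 hm₂.2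
  have hdvd : ∀ (f f' : B →ₐ[K] S), I.map f ≤ I.map f' → ∀ (e e' s : B), e' ∈ I →
      (∀ g ∈ I, e ∣ s * g) → f' e ∣ f' s * f e' := by
    intro f f' hff e e' s he' hd
    have hmem : f e' ∈ I.map f' := hff (Ideal.mem_map_of_mem f he')
    have hle : I.map f' ≤ (Submodule.comap (LinearMap.mulLeft S (f' s)) (Ideal.span {f' e}) : Ideal S) := by
      refine Ideal.map_le_iff_le_comap.2 fun g hg => ?_
      change f' s * f' g ∈ Ideal.span {f' e}
      rw [Ideal.mem_span_singleton, ← map_mul]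
      exact map_dvd f' (hd g hg)
    exact Ideal.mem_span_singleton.1 (hle hmem)
  obtain ⟨τ, hτ⟩ := hdvd f₁ f₂ (hmap I hI).le e₂ e₁ s₂ he₁ hd₂
  obtain ⟨σ, hσ⟩ := hdvd f₂ f₁ (hmap I hI).ge e₁ e₂ s₁ he₂ hd₁
  have hval : ∀ s : S, W.valuation (π.comp j s) ≤ 1 := fun s => (W.valuation_le_one_iff _).2 (hSW s)
  have hs₁' : W.valuation (π.comp j (f₁ s₁)) = 1 := by
    rw [← h₁']; exact (valuation_comap_eq_one _ W _).1 (hv₁ ▸ hs₁)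
  have hs₂' : W.valuation (π.comp j (f₂ s₂)) = 1 := by
    rw [← h₂']; exact (valuation_comap_eq_one _ W _).1 (hv₂ ▸ hs₂)
  have hf₂ : π.comp j (f₂ e₂) ≠ 0 := by rw [← h₂']; exact (map_ne_zero _).2 h20
  have hprod : π.comp j τ * π.comp j σ = π.comp j (f₁ s₁) * π.comp j (f₂ s₂) := by
    refine mul_right_cancel₀ hf₂ ?_
    have e1 := congrArg (π.comp j) hτ
    have e2 := congrArg (π.comp j) hσ
    rw [map_mul, map_mul] at e1 e2
    linear_combination -(π.comp j σ) * e1 - π.comp j (f₂ s₂) * e2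
  have hτ1 : W.valuation (π.comp j τ) = 1 := by
    have h3 := congrArg W.valuation hprod
    rw [map_mul, map_mul, hs₁', hs₂', mul_one] at h3
    refine le_antisymm (hval τ) (not_lt.1 fun hlt => ?_)
    exact (mul_lt_one_of_lt_of_le hlt (hval σ)).ne h3
  refine ⟨algebraMap B F e₁, algebraMap B F e₂, h10, h20, h11, h12, h21, h22, j τ, hYQ τ,
    j (f₂ s₂), hYQ _, hτ1, hs₂', ?_⟩
  rw [h₁, h₂, ← map_mul, ← map_mul, hτ, mul_comm]

end

end InvHyp

namespace InvHyp

lemma _root_.Ideal.IsPrime.exists_le_of_sInf_le {S : Type*} [CommRing S] {c : Ideal S}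
    (hc : c.IsPrime) {T : Set (Ideal S)} (hT : T.Finite) (h : sInf T ≤ c) : ∃ Q ∈ T, Q ≤ c := by
  have h' : hT.toFinset.inf id ≤ c := by
    rw [Finset.inf_id_eq_sInf, hT.coe_toFinset]
    exact h
  obtain ⟨Q, hQ, hQc⟩ := hc.inf_le'.1 h'
  exact ⟨Q, hT.mem_toFinset.1 hQ, hQc⟩

section

set_option linter.unusedSectionVars false

variable {K : Type*} [Field K] [CharZero K] {F L : Type*} [Field F] [Algebra K F] [Field L]
  [Algebra K L] [Algebra.EssFiniteType K F] [Algebra.EssFiniteType K L]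
  {ι ι' : Type*} [Fintype ι] [DecidableEq ι] [Fintype ι'] [DecidableEq ι']
  {x : ι → F} {t : ι' → L}
  {B : Type*} [CommRing B] [IsDomain B] [Algebra K B] [Algebra.FiniteType K B] [Algebra B F]
  [IsFractionRing B F] [IsScalarTower K B F]
  {S : Type*} [CommRing S] [IsDomain S] [Algebra K S] [Algebra.FiniteType K S] [Algebra S L]
  [IsFractionRing S L] [IsScalarTower K S L]

lemma mem_minimalPrimes_of_properTransform_eq {hx : IsTranscendenceBasis K x}
    {ht : IsTranscendenceBasis K t} (E : LogData hx B) {f₁ f₂ : B →ₐ[K] S} {φ₁ φ₂ : F →ₐ[K] L}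
    (h₁ : ∀ b, φ₁ (algebraMap B F b) = algebraMap S L (f₁ b))
    (h₂ : ∀ b, φ₂ (algebraMap B F b) = algebraMap S L (f₂ b)) {I : Ideal B}
    (hI : IsHypersurfaceIdeal I)
    (hpt : properTransform (f₁ : B →+* S) I = properTransform (f₂ : B →+* S) I)
    {W : ValuationSubring L} (hW : Adapted ht S W)
    {v₁ v₂ : ValuationSubring F} (hv₁ : v₁ = W.comap (φ₁ : F →+* L))
    (hv₂ : v₂ = W.comap (φ₂ : F →+* L)) (hN : v₂ ≠ ⊤ → v₂ ∈ E.N)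
    (h : v₁ ∈ E.N ∧ cenv B v₁ ∈ I.minimalPrimes) :
    v₂ ∈ E.N ∧ cenv B v₂ ∈ I.minimalPrimes := by
  have : IsNoetherianRing S := Algebra.FiniteType.isNoetherianRing K S
  have hinj := IsFractionRing.injective B F
  have hinjS := IsFractionRing.injective S L
  let c : Ideal S := center W hW.mem
  have hcp : c.IsPrime := center_isPrime W hW.mem
  have hcv : ∀ {f : B →ₐ[K] S} {φ : F →ₐ[K] L} {v : ValuationSubring F},
      (∀ b, φ (algebraMap B F b) = algebraMap S L (f b)) → v = W.comap (φ : F →+* L) →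
      ∀ b, f b ∈ c ↔ v.valuation (algebraMap B F b) < 1 := by
    rintro f φ v hf rfl b
    rw [valuation_comap_lt_one, mem_center, ← hf]
    rfl
  have hf : ∀ {f : B →ₐ[K] S} {φ : F →ₐ[K] L},
      (∀ b, φ (algebraMap B F b) = algebraMap S L (f b)) → Function.Injective f := by
    intro f φ hf a b hab
    exact hinj (φ.injective (show φ _ = φ _ by rw [hf, hf, hab]))
  have hI0 : ∃ i ∈ I, i ≠ 0 := by
    by_contra! h0
    refine (hI.2.2 _ h.2).2.1 (le_bot_iff.1 (h.2.2 ⟨Ideal.isPrime_bot, ?_⟩ bot_le))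
    exact fun i hi => h0 i hi
  obtain ⟨i, hi, hi0⟩ := hI0
  have hne : ∀ {f : B →ₐ[K] S}, Function.Injective f → ∀ {Q : Ideal S}, I.map (f : B →+* S) ≤ Q →
      Q ≠ ⊥ := by
    rintro f hf Q hQ rfl
    exact hi0 (hf ((hQ (Ideal.mem_map_of_mem _ hi) : f i = 0).trans (map_zero f).symm))
  have hc₁ : c.comap (f₁ : B →+* S) = cenv B v₁ := by
    ext b
    rw [cenv_eq (E.adapted v₁ h.1).mem, mem_center, ← hcv h₁ hv₁]
    rfl
  have hcT : c ∈ {Q : Ideal S | Q ∈ (I.map (f₁ : B →+* S)).minimalPrimes ∧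
      Q.comap (f₁ : B →+* S) ∈ I.minimalPrimes} := by
    refine ⟨⟨⟨hcp, ?_⟩, fun Q hQ hQc => ?_⟩, hc₁ ▸ h.2⟩
    · rw [Ideal.map_le_iff_le_comap, hc₁]
      exact h.2.1.2
    · exact (hW.eq_center hinjS hQ.1 (hne (hf h₁) hQ.2) hQc).ge
  have hle : properTransform (f₂ : B →+* S) I ≤ c := hpt ▸ sInf_le hcT
  obtain ⟨Q, ⟨hQ, hQI⟩, hQc⟩ := hcp.exists_le_of_sInf_le
    ((Ideal.finite_minimalPrimes_of_isNoetherianRing S _).subset fun Q hQ => hQ.1) hle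
  have hQe : Q = c := hW.eq_center hinjS hQ.1.1 (hne (hf h₂) hQ.1.2) hQc
  rw [hQe] at hQI
  obtain ⟨p, hp, hp0⟩ := Submodule.exists_mem_ne_zero_of_ne_bot (hI.2.2 _ hQI).2.1
  have hvN : v₂ ∈ E.N := hN fun htop => by
    refine ((hcv h₂ hv₂ p).1 hp).ne (valuation_eq_one_of_mem_of_inv_mem
      (fun h0 => hp0 (hinj (by rw [h0, map_zero]))) ?_ ?_) <;>
    exact htop ▸ ValuationSubring.mem_top _
  refine ⟨hvN, ?_⟩
  convert hQI
  ext b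
  rw [cenv_eq (E.adapted v₂ hvN).mem, mem_center, ← hcv h₂ hv₂]
  rfl

/-- Almost all valuation rings are unramified over the base. -/
lemma exists_unramified {hx : IsTranscendenceBasis K x} {ht : IsTranscendenceBasis K t}
    (E : LogData hx B) {φ : F →ₐ[K] L} {W : ValuationSubring L} (hW : Adapted ht S W)
    {D : ι → Derivation K L L} (hD : ∀ j g, D j (φ g) = φ (pd hx j g))
    (hDW : ∀ j, ∀ w ∈ W, D j w ∈ W) {h : MvPolynomial ι' K} (hh : Irreducible h)
    (hhW : ∀ p, W.valuation (MvPolynomial.aeval t p) < 1 ↔ h ∣ p)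
    {v : ValuationSubring F} (hv : v = W.comap (φ : F →+* L)) (hN : v ∈ E.N) :
    W.valuation (φ (E.H v) / MvPolynomial.aeval t h) = 1 := by
  have hWlt : ∀ z, v.valuation z < 1 ↔ W.valuation (φ z) < 1 := fun z => by
    rw [hv, valuation_comap_lt_one]; rfl
  set T := MvPolynomial.aeval t h with hT
  have hT1 : W.valuation T < 1 := (hhW h).2 dvd_rfl
  have hT0 : T ≠ 0 := fun h0 => hh.ne_zero (ht.1 (h0.trans (map_zero _).symm))
  have hu : φ (E.H v) / T ∈ W := div_mem_of_derivation_mem ht hW.stable hh hhW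
    ((hWlt _).1 (E.H_lt v hN))
  obtain ⟨j, hj⟩ := E.pd_H v hN
  by_contra hne
  have hlt : W.valuation (φ (E.H v) / T) < 1 :=
    lt_of_le_of_ne ((W.valuation_le_one_iff _).2 hu) hne
  refine hj (E.H_div v hN _ ((hWlt _).2 ?_))
  have he : φ (pd hx j (E.H v)) =
      φ (E.H v) / T * D j T + T * D j (φ (E.H v) / T) := by
    rw [← hD, ← smul_eq_mul, ← smul_eq_mul, ← Derivation.leibniz, div_mul_cancel₀ _ hT0]
  have hTW : T ∈ W := (W.valuation_le_one_iff _).1 hT1.le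
  rw [he]
  refine W.valuation.map_add_lt ?_ ?_ <;> rw [map_mul]
  · exact mul_lt_one_of_lt_of_le hlt ((W.valuation_le_one_iff _).2 (hDW j _ hTW))
  · exact mul_lt_one_of_lt_of_le hT1 ((W.valuation_le_one_iff _).2 (hDW j _ hu))

/-- Hypersurfaces with the same proper transforms yield an invariant function. -/
theorem exists_invariant_of_properTransform_eq [Nonempty ι'] (ht : IsTranscendenceBasis K t)
    {n : ℕ} {x₀ : Fin (n + 1) → F} (hx₀ : IsTranscendenceBasis K x₀) (f₁ f₂ : B →ₐ[K] S)
    (φ₁ φ₂ : F →ₐ[K] L) (h₁ : ∀ b, φ₁ (algebraMap B F b) = algebraMap S L (f₁ b))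
    (h₂ : ∀ b, φ₂ (algebraMap B F b) = algebraMap S L (f₂ b)) {𝓘 : Set (Ideal B)}
    (h𝓘 : 𝓘.Infinite) (hyp : ∀ I ∈ 𝓘, IsHypersurfaceIdeal I)
    (hpt : ∀ I ∈ 𝓘, properTransform (f₁ : B →+* S) I = properTransform (f₂ : B →+* S) I) :
    ∃ g : F, g ∉ Set.range (algebraMap K F) ∧ φ₁ g = φ₂ g := by
  classical
  obtain ⟨Y, hY⟩ := (Algebra.FiniteType.out : (⊤ : Subalgebra K S).FG)
  let j : S →ₐ[K] L := IsScalarTower.toAlgHom K S L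
  have hYQ : ∀ s, j s ∈ Algebra.adjoin K ((Y.image j : Finset L) : Set L) := fun s => by
    rw [Finset.coe_image, ← AlgHom.map_adjoin, hY]
    exact ⟨s, Algebra.mem_top, rfl⟩
  have hker : RingHom.ker (AlgHom.id K L) = ⊥ :=
    (RingHom.injective_iff_ker_eq_bot (AlgHom.id K L : L →+* L)).1 fun _ _ h => h
  have hto : ∀ o, IsTranscendenceBasis K (pchart t o) := isTranscendenceBasis_pchart ht
  refine exists_invariant_of_local ht hx₀ (AlgHom.id K L) Function.surjective_id
    (hker ▸ Submodule.fg_bot) (M := 0) (by rw [hker, zero_add, pow_one]) φ₁ φ₂ (Y.image j) h𝓘 hyp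
    fun ι _ _ x hx E => ?_
  choose D₁ hD₁ using exists_pd_extension hx φ₁
  choose D₂ hD₂ using exists_pd_extension hx φ₂
  choose c hc0 hc using fun o => exists_derivation_bound (hto o) ∅ (Sum.elim D₁ D₂)
  refine ⟨_, Set.finite_iUnion fun o => (finite_not_adapted (hto o) S).union
    (finite_chartGood (hto o) (hc0 o)), fun o W hW hWZ => ?_⟩
  simp only [Set.mem_iUnion, Set.mem_union, not_exists, not_or] at hWZ
  obtain ⟨hWa, hWc⟩ := hWZ o
  replace hWa : Adapted (hto o) S W := by by_contra h; exact hWa ⟨hW, h⟩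
  replace hWc : W.valuation (c o) = 1 := by by_contra h; exact hWc ⟨hW, h⟩
  have hDW : ∀ k, ∀ w ∈ W, Sum.elim D₁ D₂ k w ∈ W := fun k w hw =>
    (mem_of_valuation_eq_one hWc).1 ((hc o W hW).2.2 k w hw)
  refine ⟨fun y hy => ?_, fun v₁ v₂ hv₁ hv₂ hN₁ hN₂ I hI =>
    ⟨⟨mem_minimalPrimes_of_properTransform_eq E h₁ h₂ (hyp I hI) (hpt I hI) hWa hv₁ hv₂ hN₂,
    mem_minimalPrimes_of_properTransform_eq E h₂ h₁ (hyp I hI) (hpt I hI).symm hWa hv₂ hv₁ hN₁⟩,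
    fun hm₁ hm₂ => ?_⟩⟩
  · obtain ⟨s, -, rfl⟩ := Finset.mem_image.1 hy
    exact hWa.mem s
  change v₁ = W.comap (φ₁ : F →+* L) at hv₁
  change v₂ = W.comap (φ₂ : F →+* L) at hv₂
  have hWtop : W ≠ ⊤ := by
    rintro rfl
    exact E.ne_top hm₁.1 (hv₁.trans (top_le_iff.1 fun z _ => ValuationSubring.mem_top (φ₁ z)))
  obtain ⟨h, hh, hhW⟩ := exists_irreducible_of_ne_top (hto o) hW hWtop
  have hu₁ := exists_unramified E hWa hD₁ (fun j => hDW (Sum.inl j)) hh hhW hv₁ hm₁.1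
  have hu₂ := exists_unramified E hWa hD₂ (fun j => hDW (Sum.inr j)) hh hhW hv₂ hm₂.1
  set T := MvPolynomial.aeval (pchart t o) h with hT
  have hT0 : T ≠ 0 := fun h0 => hh.ne_zero ((hto o).1 (h0.trans (map_zero _).symm))
  have hH₁ := E.H_ne _ hm₁.1
  have hH₂ := E.H_ne _ hm₂.1
  have hφ₂ : φ₂ (E.H v₂) ≠ 0 := (map_ne_zero _).2 hH₂
  have hquot : W.valuation (φ₁ (E.H v₁) / φ₂ (E.H v₂)) = 1 := by
    rw [← div_div_div_cancel_right₀ hT0, map_div₀, hu₁, hu₂, div_one]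
  obtain ⟨a, s, hs, has⟩ := hWa.frac _ ((W.valuation_le_one_iff _).1 hquot.le)
  have ha : W.valuation (algebraMap S L a) = 1 := by rw [← has, map_mul, hquot, hs, one_mul]
  refine ⟨E.H v₁, E.H v₂, hH₁, hH₂, ?_, ?_, ?_, ?_, j a, hYQ a, j s, hYQ s, ha, hs, ?_⟩
  · rw [div_self hH₁]; exact one_mem _
  · rw [div_self hH₁]; exact one_mem _
  · rw [div_self hH₂]; exact one_mem _
  · rw [div_self hH₂]; exact one_mem _
  · change algebraMap S L s * φ₁ (E.H v₁) = algebraMap S L a * φ₂ (E.H v₂)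
    rw [← has]
    field_simp

end

end InvHyp

namespace InvHyp

section

variable {K : Type*} [Field K] [IsAlgClosed K]

lemma mem_range_algebraMap_of_isAlgebraic {L : Type*} [Field L] [Algebra K L] {g : L}
    (hg : IsAlgebraic K g) : g ∈ Set.range (algebraMap K L) :=
  minpoly.mem_range_of_degree_eq_one K g
    (IsAlgClosed.degree_eq_one_of_irreducible K (minpoly.irreducible hg.isIntegral))

lemma exists_transcendental_of_isHypersurfaceIdeal {B F : Type*} [CommRing B] [IsDomain B]
    [Algebra K B] [Field F] [Algebra B F] [IsFractionRing B F] [Algebra K F] [IsScalarTower K B F]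
    {I : Ideal B} (hI : IsHypersurfaceIdeal I) :
    ∃ p : B, Transcendental K (algebraMap B F p) := by
  obtain ⟨m, hm, hIm⟩ := Ideal.exists_le_maximal I hI.2.1
  obtain ⟨P, hP, -⟩ := Ideal.exists_minimalPrimes_le (J := m) hIm
  have hP1 := hI.2.2 P hP
  obtain ⟨p, hp, hp0⟩ := Submodule.exists_mem_ne_zero_of_ne_bot hP1.2.1
  refine ⟨p, fun halg => ?_⟩
  obtain ⟨c, hc⟩ := mem_range_algebraMap_of_isAlgebraic halg
  rw [IsScalarTower.algebraMap_apply K B F] at hc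
  have hc' : algebraMap K B c = p := IsFractionRing.injective B F hc
  have hc0 : c ≠ 0 := by
    rintro rfl
    exact hp0 (by rw [← hc', map_zero])
  exact hP1.1.ne_top (Ideal.eq_top_of_isUnit_mem _ hp
    (hc' ▸ (isUnit_iff_ne_zero.2 hc0).map (algebraMap K B)))

variable [CharZero K] {B : Type*} [CommRing B] [IsDomain B] [Algebra K B] [Algebra.FiniteType K B]
  {S : Type*} [CommRing S] [Algebra K S] [Algebra.FiniteType K S]

/-- Hypersurfaces with the same scheme-theoretic inverse images yield an invariant fraction. -/
theorem exists_invariant_fraction_of_map_eq (hS : (nilradical S).IsPrime) (f₁ f₂ : B →ₐ[K] S)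
    (hf₁ : ∀ b, b ≠ 0 → f₁ b ∉ nilradical S) (hf₂ : ∀ b, b ≠ 0 → f₂ b ∉ nilradical S)
    {𝓘 : Set (Ideal B)} (h𝓘 : 𝓘.Infinite) (hyp : ∀ I ∈ 𝓘, IsHypersurfaceIdeal I)
    (hmap : ∀ I ∈ 𝓘, I.map f₁ = I.map f₂) :
    ∃ a b : B, b ≠ 0 ∧ (∀ c : K, a ≠ algebraMap K B c * b) ∧
      ∃ u : S, u ∉ nilradical S ∧ u * (f₁ a * f₂ b - f₂ a * f₁ b) = 0 := by
  classical
  let F := FractionRing B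
  let Q := Localization.AtPrime (nilradical S)
  let L := (nilradical S).ResidueField
  let j : S →ₐ[K] Q := IsScalarTower.toAlgHom K S Q
  let π : Q →ₐ[K] L := IsScalarTower.toAlgHom K Q L
  have hπ : Function.Surjective π := IsLocalRing.residue_surjective
  have : IsNoetherianRing S := Algebra.FiniteType.isNoetherianRing K S
  have : IsNoetherianRing Q := IsLocalization.isNoetherianRing (nilradical S).primeCompl Q this
  have hker : RingHom.ker π = IsLocalRing.maximalIdeal Q := IsLocalRing.ker_residue
  have hnil : RingHom.ker π ≤ nilradical Q := by
    rw [hker, ← Localization.AtPrime.map_eq_maximalIdeal, Ideal.map_le_iff_le_comap]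
    intro s hs
    exact (mem_nilradical.1 hs).map (algebraMap S Q)
  obtain ⟨N, hN⟩ := IsNoetherianRing.isNilpotent_nilradical Q
  have hM : RingHom.ker π ^ (N + 1) = ⊥ := by
    refine le_bot_iff.1 ((Ideal.pow_right_mono hnil _).trans ?_)
    rw [pow_succ, hN]
    simp
  have hu : ∀ f : B →ₐ[K] S, (∀ b, b ≠ 0 → f b ∉ nilradical S) →
      ∃ Φ : F →ₐ[K] Q, ∀ b, Φ (algebraMap B F b) = j (f b) := fun f hf => by
    have h : ∀ b : nonZeroDivisors B, IsUnit ((j.comp f) b) := fun b =>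
      IsLocalization.map_units Q (⟨f b, hf b (nonZeroDivisors.coe_ne_zero b)⟩ :
        (nilradical S).primeCompl)
    exact ⟨IsLocalization.liftAlgHom (M := nonZeroDivisors B) (S := F) h, fun b =>
      IsLocalization.lift_eq _ _⟩
  obtain ⟨Φ₁, h₁⟩ := hu f₁ hf₁
  obtain ⟨Φ₂, h₂⟩ := hu f₂ hf₂
  have hF : Algebra.EssFiniteType K F := by
    have := Algebra.EssFiniteType.of_isLocalization F (nonZeroDivisors B)
    exact Algebra.EssFiniteType.comp K B F
  have hL : Algebra.EssFiniteType K L := Algebra.EssFiniteType.comp K S L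
  obtain ⟨I, hI⟩ := h𝓘.nonempty
  obtain ⟨p, hp⟩ := exists_transcendental_of_isHypersurfaceIdeal (K := K) (F := F) (hyp I hI)
  obtain ⟨n, x₀, hx₀⟩ := exists_fin_transcendenceBasis hp
  have hpL : Transcendental K ((π.comp Φ₁) (algebraMap B F p)) := fun h =>
    hp ((isAlgebraic_algHom_iff (π.comp Φ₁) (π.comp Φ₁).toRingHom.injective).1 h)
  obtain ⟨m, t, ht⟩ := exists_fin_transcendenceBasis hpL
  obtain ⟨g, hgK, hg⟩ := exists_invariant_of_map_eq (B := B) (S := S) ht hx₀ π hπ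
    (isNoetherian_def.1 inferInstance _) hM j f₁ f₂ Φ₁ Φ₂ h₁ h₂ h𝓘 hyp hmap
  obtain ⟨a, b, hb, rfl⟩ := IsFractionRing.div_surjective (A := B) g
  have hb0 := nonZeroDivisors.ne_zero hb
  have hbF : algebraMap B F b ≠ 0 := fun h => hb0 (IsFractionRing.injective B F (by rw [h, map_zero]))
  refine ⟨a, b, hb0, fun c hc => hgK ⟨c, ?_⟩, ?_⟩
  · rw [hc, map_mul, ← IsScalarTower.algebraMap_apply, mul_div_cancel_right₀ _ hbF]
  · have e₁ : Φ₁ (algebraMap B F a / algebraMap B F b) * j (f₁ b) = j (f₁ a) := by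
      rw [← h₁, ← h₁, ← map_mul, div_mul_cancel₀ _ hbF]
    have e₂ : Φ₂ (algebraMap B F a / algebraMap B F b) * j (f₂ b) = j (f₂ a) := by
      rw [← h₂, ← h₂, ← map_mul, div_mul_cancel₀ _ hbF]
    have e : algebraMap S Q (f₁ a * f₂ b) = algebraMap S Q (f₂ a * f₁ b) := by
      change j _ = j _
      rw [map_mul, map_mul, ← e₁, ← e₂, hg]
      ring
    obtain ⟨u, hu⟩ := (IsLocalization.eq_iff_exists (nilradical S).primeCompl Q).1 e
    exact ⟨u, u.2, by rw [mul_sub, hu, sub_self]⟩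

/-- Hypersurfaces with the same proper transforms yield an invariant fraction. -/
theorem exists_invariant_fraction_of_properTransform_eq [IsDomain S] (f₁ f₂ : B →ₐ[K] S)
    (hf₁ : Function.Injective f₁) (hf₂ : Function.Injective f₂) {𝓘 : Set (Ideal B)}
    (h𝓘 : 𝓘.Infinite) (hyp : ∀ I ∈ 𝓘, IsHypersurfaceIdeal I)
    (hpt : ∀ I ∈ 𝓘, properTransform (f₁ : B →+* S) I = properTransform (f₂ : B →+* S) I) :
    ∃ a b : B, b ≠ 0 ∧ (∀ c : K, a ≠ algebraMap K B c * b) ∧ f₁ a * f₂ b = f₂ a * f₁ b := by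
  classical
  let F := FractionRing B
  let L := FractionRing S
  let j : S →ₐ[K] L := IsScalarTower.toAlgHom K S L
  have hj : Function.Injective j := IsFractionRing.injective S L
  have hu : ∀ f : B →ₐ[K] S, Function.Injective f →
      ∃ Φ : F →ₐ[K] L, ∀ b, Φ (algebraMap B F b) = j (f b) := fun f hf => by
    have h : Function.Injective (j.comp f) := hj.comp hf
    exact ⟨IsFractionRing.liftAlgHom (A := B) (K := F) h,
      fun b => IsFractionRing.lift_algebraMap (g := (j.comp f).toRingHom) h b⟩
  obtain ⟨Φ₁, h₁⟩ := hu f₁ hf₁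
  obtain ⟨Φ₂, h₂⟩ := hu f₂ hf₂
  have hF : Algebra.EssFiniteType K F := by
    have := Algebra.EssFiniteType.of_isLocalization F (nonZeroDivisors B)
    exact Algebra.EssFiniteType.comp K B F
  have hL : Algebra.EssFiniteType K L := by
    have := Algebra.EssFiniteType.of_isLocalization L (nonZeroDivisors S)
    exact Algebra.EssFiniteType.comp K S L
  obtain ⟨I, hI⟩ := h𝓘.nonempty
  obtain ⟨p, hp⟩ := exists_transcendental_of_isHypersurfaceIdeal (K := K) (F := F) (hyp I hI)
  obtain ⟨n, x₀, hx₀⟩ := exists_fin_transcendenceBasis hp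
  have hpL : Transcendental K (Φ₁ (algebraMap B F p)) := fun h =>
    hp ((isAlgebraic_algHom_iff Φ₁ Φ₁.toRingHom.injective).1 h)
  obtain ⟨m, t, ht⟩ := exists_fin_transcendenceBasis hpL
  obtain ⟨g, hgK, hg⟩ := exists_invariant_of_properTransform_eq (B := B) (S := S) ht hx₀
    f₁ f₂ Φ₁ Φ₂ h₁ h₂ h𝓘 hyp hpt
  obtain ⟨a, b, hb, rfl⟩ := IsFractionRing.div_surjective (A := B) g
  have hb0 := nonZeroDivisors.ne_zero hb
  have hbF : algebraMap B F b ≠ 0 := fun h => hb0 (IsFractionRing.injective B F (by rw [h, map_zero]))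
  refine ⟨a, b, hb0, fun c hc => hgK ⟨c, ?_⟩, hj ?_⟩
  · rw [hc, map_mul, ← IsScalarTower.algebraMap_apply, mul_div_cancel_right₀ _ hbF]
  · have e₁ : Φ₁ (algebraMap B F a / algebraMap B F b) * j (f₁ b) = j (f₁ a) := by
      rw [← h₁, ← h₁, ← map_mul, div_mul_cancel₀ _ hbF]
    have e₂ : Φ₂ (algebraMap B F a / algebraMap B F b) * j (f₂ b) = j (f₂ a) := by
      rw [← h₂, ← h₂, ← map_mul, div_mul_cancel₀ _ hbF]
    rw [map_mul, map_mul, ← e₁, ← e₂, hg]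
    ring

end

end InvHyp

namespace InvHyp

section

variable {K : Type*} [Field K] [IsAlgClosed K] [CharZero K]
  {R : Type*} [CommRing R] [IsDomain R] [Algebra K R] [Algebra.FiniteType K R]
  {S : Type*} [CommRing S] [Algebra K S] [Algebra.FiniteType K S]

lemma algebraMap_mem_nilradical_iff {S T : Type*} [CommRing S] [CommRing T] [Algebra S T]
    (hS : (nilradical S).IsPrime) {s : S} [IsLocalization.Away s T] (hs : s ∉ nilradical S)
    {a : S} : algebraMap S T a ∈ nilradical T ↔ a ∈ nilradical S := by
  refine ⟨fun ⟨n, hn⟩ => ?_, fun h => (mem_nilradical.1 h).map (algebraMap S T)⟩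
  replace hn : algebraMap S T (a ^ n) = 0 := by rwa [map_pow]
  obtain ⟨⟨_, k, rfl⟩, hk⟩ := (IsLocalization.map_eq_zero_iff (Submonoid.powers s) T _).1 hn
  have h : s ^ k * a ^ n ∈ nilradical S := by
    change s ^ k * a ^ n = 0 at hk
    rw [hk]
    exact zero_mem _
  exact (hS.mem_or_mem h).elim (fun h => absurd (hS.mem_of_pow_mem _ h) hs) (hS.mem_of_pow_mem _)

lemma isPrime_nilradical_away {S T : Type*} [CommRing S] [CommRing T] [Algebra S T]
    (hS : (nilradical S).IsPrime) {s : S} [IsLocalization.Away s T] (hs : s ∉ nilradical S) :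
    (nilradical T).IsPrime := by
  refine ⟨fun h => ?_, fun {x y} hxy => ?_⟩
  · refine hS.ne_top ((Ideal.eq_top_iff_one _).2 ((algebraMap_mem_nilradical_iff hS hs (T := T)).1 ?_))
    rw [h]
    exact Submodule.mem_top
  · obtain ⟨⟨a, m⟩, ha⟩ := IsLocalization.surj (Submonoid.powers s) x
    obtain ⟨⟨b, n⟩, hb⟩ := IsLocalization.surj (Submonoid.powers s) y
    have hab : algebraMap S T (a * b) ∈ nilradical T := by
      rw [map_mul, ← ha, ← hb, mul_mul_mul_comm]
      exact Ideal.mul_mem_right _ _ hxy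
    rcases hS.mem_or_mem ((algebraMap_mem_nilradical_iff hS hs).1 hab) with h | h
    · left
      have := (algebraMap_mem_nilradical_iff hS hs (T := T)).2 h
      rwa [← ha, Ideal.mul_unit_mem_iff_mem _ (IsLocalization.map_units T m)] at this
    · right
      have := (algebraMap_mem_nilradical_iff hS hs (T := T)).2 h
      rwa [← hb, Ideal.mul_unit_mem_iff_mem _ (IsLocalization.map_units T n)] at this

/-- Condition (1) implies condition (2). -/
theorem exists_fraction_of_infinite_map_eq (hS : (nilradical S).IsPrime) (f₁ f₂ : R →ₐ[K] S)
    (hf₁ : ∀ b, b ≠ 0 → f₁ b ∉ nilradical S) (hf₂ : ∀ b, b ≠ 0 → f₂ b ∉ nilradical S)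
    {r : R} (hr : r ≠ 0) {s : S} (hs : s ∉ nilradical S)
    {F₁ F₂ : Localization.Away r →+* Localization.Away s}
    (h₁ : F₁.comp (algebraMap R (Localization.Away r))
      = (algebraMap S (Localization.Away s)).comp (f₁ : R →+* S))
    (h₂ : F₂.comp (algebraMap R (Localization.Away r))
      = (algebraMap S (Localization.Away s)).comp (f₂ : R →+* S))
    (hinf : {I : Ideal (Localization.Away r) |
      IsHypersurfaceIdeal I ∧ I.map F₁ = I.map F₂}.Infinite) :
    ∃ a b : R, b ≠ 0 ∧ (∀ c : K, a ≠ algebraMap K R c * b) ∧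
      ∃ u : S, u ∉ nilradical S ∧ u * (f₁ a * f₂ b - f₂ a * f₁ b) = 0 := by
  let B := Localization.Away r
  let T := Localization.Away s
  have hle : Submonoid.powers r ≤ nonZeroDivisors R :=
    powers_le_nonZeroDivisors_of_noZeroDivisors hr
  have : IsDomain B := IsLocalization.isDomain_localization hle
  have hinj : Function.Injective (algebraMap R B) := IsLocalization.injective B hle
  have : Algebra.FiniteType K B := inferInstanceAs (Algebra.FiniteType K (Localization.Away r))
  have : Algebra.FiniteType K T := inferInstanceAs (Algebra.FiniteType K (Localization.Away s))
  have h₁' : ∀ x, F₁ (algebraMap R B x) = algebraMap S T (f₁ x) := RingHom.congr_fun h₁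
  have h₂' : ∀ x, F₂ (algebraMap R B x) = algebraMap S T (f₂ x) := RingHom.congr_fun h₂
  have hcomm : ∀ (f : R →ₐ[K] S) (F : B →+* T), (∀ x, F (algebraMap R B x) = algebraMap S T (f x)) →
      ∀ c : K, F (algebraMap K B c) = algebraMap K T c := fun f F hF c => by
    rw [IsScalarTower.algebraMap_apply K R B, hF, AlgHom.commutes, ← IsScalarTower.algebraMap_apply]
  let G₁ : B →ₐ[K] T := { F₁ with commutes' := hcomm f₁ F₁ h₁' }
  let G₂ : B →ₐ[K] T := { F₂ with commutes' := hcomm f₂ F₂ h₂' }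
  have hnil : ∀ (f : R →ₐ[K] S) (F : B →+* T), (∀ b, b ≠ 0 → f b ∉ nilradical S) →
      (∀ x, F (algebraMap R B x) = algebraMap S T (f x)) →
      ∀ b, b ≠ 0 → F b ∉ nilradical T := fun f F hf hF b hb hFb => by
    obtain ⟨⟨x, m⟩, hx⟩ := IsLocalization.surj (Submonoid.powers r) b
    have hx0 : x ≠ 0 := by
      rintro rfl
      rw [map_zero] at hx
      exact hb (((IsLocalization.map_units B m).mul_left_eq_zero).1 hx)
    refine hf x hx0 ((algebraMap_mem_nilradical_iff hS hs (T := T)).1 ?_)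
    rw [← hF, ← hx, map_mul]
    exact Ideal.mul_mem_right _ _ hFb
  obtain ⟨a', b', hb', hab', u', hu', he⟩ := exists_invariant_fraction_of_map_eq
    (isPrime_nilradical_away hS hs) G₁ G₂ (hnil f₁ F₁ hf₁ h₁') (hnil f₂ F₂ hf₂ h₂') hinf
    (fun I hI => hI.1) (fun I hI => hI.2)
  obtain ⟨⟨a, m⟩, ha⟩ := IsLocalization.surj (Submonoid.powers r) a'
  obtain ⟨⟨b, n⟩, hb⟩ := IsLocalization.surj (Submonoid.powers r) b'
  obtain ⟨⟨u, k⟩, hu⟩ := IsLocalization.surj (Submonoid.powers s) u'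
  have ha2 : algebraMap R B (a * n) = a' * algebraMap R B (m * n) := by
    rw [map_mul, map_mul, ← ha, mul_assoc]
  have hb2 : algebraMap R B (b * m) = b' * algebraMap R B (m * n) := by
    rw [map_mul, map_mul, ← hb, mul_assoc, mul_comm (algebraMap R B n)]
  have hmn : algebraMap R B (m * n) ≠ 0 := by
    rw [map_mul]
    exact ((IsLocalization.map_units B m).mul (IsLocalization.map_units B n)).ne_zero
  have hzero : algebraMap S T (u * (f₁ (a * n) * f₂ (b * m) - f₂ (a * n) * f₁ (b * m))) = 0 := by
    rw [map_mul, map_sub, map_mul (algebraMap S T) (f₁ (a * n)),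
      map_mul (algebraMap S T) (f₂ (a * n)), ← h₁', ← h₁', ← h₂', ← h₂', ha2, hb2, ← hu]
    change u' * (F₁ a' * F₂ b' - F₂ a' * F₁ b') = 0 at he
    simp only [map_mul F₁ a', map_mul F₁ b', map_mul F₂ a', map_mul F₂ b']
    linear_combination (algebraMap S T k * F₁ (algebraMap R B (m * n)) *
      F₂ (algebraMap R B (m * n))) * he
  obtain ⟨⟨_, l, rfl⟩, hl⟩ := (IsLocalization.map_eq_zero_iff (Submonoid.powers s) T _).1 hzero
  refine ⟨a * n, b * m, fun h => ?_, fun c hc => hab' c (mul_right_cancel₀ hmn ?_), s ^ l * u,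
    fun h => ?_, by rw [mul_assoc]; exact hl⟩
  · rw [h, map_zero] at hb2
    exact mul_ne_zero hb' hmn hb2.symm
  · rw [← ha2, mul_assoc, ← hb2, hc, map_mul, ← IsScalarTower.algebraMap_apply]
  · rcases hS.mem_or_mem h with h | h
    · exact hs (hS.mem_of_pow_mem _ h)
    · have := (algebraMap_mem_nilradical_iff hS hs (T := T)).2 h
      rw [← hu, Ideal.mul_unit_mem_iff_mem _ (IsLocalization.map_units T k)] at this
      exact hu' this

end

end InvHyp

namespace InvHyp

/-- Generic smoothness in characteristic zero. -/
lemma exists_smooth_away (A S : Type*) [CommRing A] [IsDomain A] [IsNoetherianRing A] [CharZero A]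
    [CommRing S] [IsDomain S] [Algebra A S] [Algebra.FiniteType A S] [FaithfulSMul A S] :
    ∃ f : S, f ≠ 0 ∧ Algebra.Smooth A (Localization.Away f) := by
  have : Algebra.FinitePresentation A S := Algebra.FinitePresentation.of_finiteType.1 inferInstance
  have : IsLocalization.AtPrime (FractionRing S) (⊥ : Ideal S) := by
    have h : (⊥ : Ideal S).primeCompl = nonZeroDivisors S := by
      ext x
      simp [Ideal.primeCompl]
    rw [IsLocalization.AtPrime, h]
    infer_instance
  have : CharZero (FractionRing A) :=
    charZero_of_injective_algebraMap (IsFractionRing.injective A (FractionRing A))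
  have : Algebra.FormallySmooth A (FractionRing A) :=
    Algebra.FormallySmooth.of_isLocalization (nonZeroDivisors A)
  let _ : Algebra (FractionRing A) (FractionRing S) := FractionRing.liftAlgebra A (FractionRing S)
  have : IsScalarTower A (FractionRing A) (FractionRing S) :=
    FractionRing.isScalarTower_liftAlgebra A (FractionRing S)
  have : Algebra.EssFiniteType S (FractionRing S) := .of_isLocalization _ (nonZeroDivisors S)
  have : Algebra.EssFiniteType A (FractionRing S) := .comp A S (FractionRing S)
  have : Algebra.EssFiniteType (FractionRing A) (FractionRing S) := .of_comp A _ _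
  have : Algebra.FormallySmooth (FractionRing A) (FractionRing S) :=
    Algebra.FormallySmooth.of_perfectField
  have : Algebra.FormallySmooth A (FractionRing S) := .comp A (FractionRing A) (FractionRing S)
  have : Algebra.IsSmoothAt A (⊥ : Ideal S) :=
    (Algebra.FormallySmooth.iff_of_equiv ((IsLocalization.algEquiv (⊥ : Ideal S).primeCompl
      (FractionRing S) (Localization.AtPrime (⊥ : Ideal S))).restrictScalars A)).1 inferInstance
  obtain ⟨f, hf, h⟩ := Algebra.IsSmoothAt.exists_notMem_smooth A (⊥ : Ideal S)
  exact ⟨f, hf, h⟩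

open Polynomial in
/-- A smooth algebra over a field is reduced. -/
lemma isReduced_of_smooth (k S : Type*) [Field k] [CommRing S] [Algebra k S] [Algebra.Smooth k S] :
    IsReduced S := by
  refine ⟨fun n hn => ?_⟩
  have hint : IsIntegral S (n ⊗ₜ[k] (X : k[X])) := by
    obtain ⟨m, hm⟩ := hn
    refine ⟨X ^ (m + 1), monic_X_pow _, ?_⟩
    rw [eval₂_pow, eval₂_X, Algebra.TensorProduct.tmul_pow, pow_succ, hm]
    simp
  obtain ⟨t, ht⟩ := (TensorProduct.toIntegralClosure_bijective_of_smooth (R := k) (S := S)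
    (B := k[X])).2 ⟨_, hint⟩
  have hcl : ∀ p : k[X], IsIntegral k p → p.coeff 1 = 0 := fun p hp => by
    obtain ⟨q, hq, hqp⟩ := hp
    replace hqp : q.comp p = 0 := hqp
    have hdeg := natDegree_comp (p := q) (q := p)
    rw [hqp, natDegree_zero, eq_comm, mul_eq_zero] at hdeg
    refine coeff_eq_zero_of_natDegree_lt ((hdeg.resolve_left fun h => ?_).trans_lt one_pos)
    rw [hq.natDegree_eq_zero.1 h, one_comp] at hqp
    exact one_ne_zero hqp
  let ψ : TensorProduct k S k[X] →ₗ[k] S :=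
    TensorProduct.lift (LinearMap.mk₂ k (fun s p => p.coeff 1 • s) (fun _ _ _ => smul_add _ _ _)
      (fun _ _ _ => smul_comm _ _ _) (fun _ _ _ => by rw [coeff_add, add_smul])
      (fun _ _ _ => by rw [coeff_smul, smul_assoc]))
  have h0 : ∀ t : TensorProduct k S (integralClosure k k[X]),
      ψ (TensorProduct.toIntegralClosure k S k[X] t) = 0 := fun t => by
    induction t with
    | zero => simp
    | add x y hx hy => simp [hx, hy]
    | tmul s p =>
      change p.1.coeff 1 • s = 0
      rw [hcl _ p.2, zero_smul]
  have := h0 t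
  rw [ht] at this
  simpa [ψ] using this

end InvHyp

namespace InvHyp

lemma heightOnePrime_of_mem_minimalPrimes_span {B : Type*} [CommRing B] [IsDomain B]
    [IsNoetherianRing B] {x : B} (hx : x ≠ 0) {P : Ideal B}
    (hP : P ∈ (Ideal.span {x}).minimalPrimes) : HeightOnePrime P := by
  have hPp := hP.1.1
  have hxP : x ∈ P := hP.1.2 (Ideal.mem_span_singleton_self x)
  refine ⟨hPp, fun h => hx (by rw [h] at hxP; exact hxP), fun Q hQ hQP => ?_⟩
  have h1 := Ideal.height_le_iff.1
    (Ideal.height_le_one_of_isPrincipal_of_mem_minimalPrimes (Ideal.span {x}) P hP) Q hQ hQP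
  exact Ideal.height_eq_zero_iff_eq_bot.1 (Order.lt_one_iff.1 h1)

section

variable {K : Type*} [Field K] [IsAlgClosed K]
  {B : Type*} [CommRing B] [IsDomain B] [Algebra K B] [Algebra.FiniteType K B]

lemma infinite_not_isUnit_sub {g : B} (hg : ∀ c : K, g ≠ algebraMap K B c) :
    {c : K | ¬IsUnit (g - algebraMap K B c)}.Infinite := by
  intro hfin
  let h : B := ∏ c ∈ hfin.toFinset, (g - algebraMap K B c)
  have hh : h ≠ 0 := Finset.prod_ne_zero_iff.2 fun c _ => sub_ne_zero.2 (hg c)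
  have : Nontrivial (Localization.Away h) :=
    (IsLocalization.injective (Localization.Away h)
      (powers_le_nonZeroDivisors_of_noZeroDivisors hh)).nontrivial
  obtain ⟨m, hm⟩ := Ideal.exists_maximal (Localization.Away h)
  let _ : Field (Localization.Away h ⧸ m) := Ideal.Quotient.field m
  have : Algebra.FiniteType B (Localization.Away h) := IsLocalization.finiteType_of_monoid_fg
    (Submonoid.powers h) _
  have : Algebra.FiniteType K (Localization.Away h) := .trans (S := B) inferInstance inferInstance
  have : Module.Finite K (Localization.Away h ⧸ m) :=
    finite_of_finite_type_of_isJacobsonRing K (Localization.Away h ⧸ m)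
  obtain ⟨c, hc⟩ := mem_range_algebraMap_of_isAlgebraic (Algebra.IsAlgebraic.isAlgebraic (R := K)
    (Ideal.Quotient.mk m (algebraMap B (Localization.Away h) g)))
  have hcm : algebraMap B (Localization.Away h) (g - algebraMap K B c) ∈ m := by
    rw [map_sub, ← IsScalarTower.algebraMap_apply, ← Ideal.Quotient.eq_zero_iff_mem, map_sub,
      ← hc, sub_eq_zero]
    rfl
  refine hm.ne_top (Ideal.eq_top_of_isUnit_mem _ hcm ?_)
  by_cases hu : IsUnit (g - algebraMap K B c)
  · exact hu.map _
  · exact isUnit_of_dvd_unit (map_dvd _ (Finset.dvd_prod_of_mem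
      (fun c => g - algebraMap K B c) (hfin.mem_toFinset.2 hu)))
      (IsLocalization.Away.algebraMap_isUnit h)

open Polynomial in
lemma exists_away_isRadical_span_sub [CharZero K] {g : B} (hg : ∀ c : K, g ≠ algebraMap K B c) :
    ∃ f : B, f ≠ 0 ∧ ∀ c : K, (Ideal.span {algebraMap B (Localization.Away f)
      (g - algebraMap K B c)}).IsRadical := by
  let _ : Algebra K[X] B := (aeval (R := K) g).toAlgebra
  have hst : IsScalarTower K K[X] B := .of_algebraMap_eq fun c => ((aeval (R := K) g).commutes c).symm
  have : Algebra.FiniteType K[X] B := .of_restrictScalars_finiteType K _ _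
  have htr : Transcendental K g := fun h => by
    obtain ⟨c, hc⟩ := mem_range_algebraMap_of_isAlgebraic (h.algebraMap (A := FractionRing B))
    rw [IsScalarTower.algebraMap_apply K B] at hc
    exact hg c (IsFractionRing.injective B (FractionRing B) hc).symm
  have : FaithfulSMul K[X] B := (faithfulSMul_iff_algebraMap_injective _ _).2
    (transcendental_iff_injective.1 htr)
  obtain ⟨f, hf, hsm⟩ := exists_smooth_away K[X] B
  refine ⟨f, hf, fun c => ?_⟩
  have hmax : (Ideal.span {X - C c}).IsMaximal :=
    PrincipalIdealRing.isMaximal_of_irreducible (irreducible_X_sub_C c)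
  let _ : Field (K[X] ⧸ Ideal.span {X - C c}) := Ideal.Quotient.field _
  have hred := isReduced_of_smooth (K[X] ⧸ Ideal.span {X - C c})
    (TensorProduct K[X] (K[X] ⧸ Ideal.span {X - C c}) (Localization.Away f))
  have e := Algebra.TensorProduct.quotIdealMapEquivQuotTensor (Localization.Away f)
    (Ideal.span {X - C c})
  have hred' := isReduced_of_injective e e.injective
  have hI : Ideal.span {algebraMap B (Localization.Away f) (g - algebraMap K B c)} =
      (Ideal.span {X - C c}).map (algebraMap K[X] (Localization.Away f)) := by
    rw [Ideal.map_span, Set.image_singleton, IsScalarTower.algebraMap_apply K[X] B]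
    congr 3
    change _ = aeval g (X - C c)
    simp
  rw [hI]
  exact (Ideal.isRadical_iff_quotient_reduced _).2 hred'

end

end InvHyp

namespace InvHyp

lemma finiteType_away (K : Type*) [CommRing K] {R : Type*} [CommRing R] [Algebra K R]
    [Algebra.FiniteType K R] (x : R) : Algebra.FiniteType K (Localization.Away x) :=
  .trans (S := R) inferInstance (IsLocalization.finiteType_of_monoid_fg (Submonoid.powers x) _)

lemma away_mul_ne {K : Type*} [CommRing K] {R : Type*} [CommRing R] [IsDomain R] [Algebra K R]
    {a b r : R} (hr : r ≠ 0) (hab : ∀ c : K, a ≠ algebraMap K R c * b)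
    {g : Localization.Away r}
    (hg : g * algebraMap R (Localization.Away r) b = algebraMap R (Localization.Away r) a)
    (c : K) : g ≠ algebraMap K (Localization.Away r) c := by
  rintro rfl
  rw [IsScalarTower.algebraMap_apply K R, ← map_mul] at hg
  exact hab c (IsLocalization.injective (Localization.Away r)
    (powers_le_nonZeroDivisors_of_noZeroDivisors hr) hg).symm

lemma exists_away_fraction {R : Type*} [CommRing R] {a b r : R} (hbr : b ∣ r) :
    ∃ g : Localization.Away r,
    g * algebraMap R (Localization.Away r) b = algebraMap R (Localization.Away r) a := by
  obtain ⟨v, hv⟩ := isUnit_of_dvd_unit (map_dvd (algebraMap R (Localization.Away r)) hbr)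
    (IsLocalization.Away.algebraMap_isUnit r)
  exact ⟨algebraMap R _ a * ↑v⁻¹, by rw [← hv, mul_assoc, Units.inv_mul, mul_one]⟩

lemma isDomain_away {R : Type*} [CommRing R] [IsDomain R] {r : R} (hr : r ≠ 0) : IsDomain (Localization.Away r) :=
  IsLocalization.isDomain_localization (powers_le_nonZeroDivisors_of_noZeroDivisors hr)

section

variable {K : Type*} [Field K] [IsAlgClosed K]
  {R : Type*} [CommRing R] [IsDomain R] [Algebra K R] [Algebra.FiniteType K R]

lemma exists_away_mul_isRadical_span_sub [CharZero K] {a b : R} (hb : b ≠ 0)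
    (hab : ∀ c : K, a ≠ algebraMap K R c * b) :
    ∃ x : R, x ≠ 0 ∧ ∃ g : Localization.Away (b * x),
      g * algebraMap R (Localization.Away (b * x)) b = algebraMap R (Localization.Away (b * x)) a ∧
      ∀ c : K, (Ideal.span {g - algebraMap K (Localization.Away (b * x)) c}).IsRadical := by
  have := isDomain_away hb
  have := finiteType_away K b
  obtain ⟨g, hg⟩ := exists_away_fraction (a := a) (dvd_refl b)
  obtain ⟨f, hf, hrad⟩ := exists_away_isRadical_span_sub (away_mul_ne hb hab hg)
  have hass := IsLocalization.Away.associated_sec_fst b f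
  set x := (IsLocalization.Away.sec b f).1
  have hx : x ≠ 0 := fun h => hf (by rwa [h, map_zero, Associated.comm, associated_zero_iff_eq_zero]
    at hass)
  have : IsLocalization.Away (b * x) (Localization.Away f) :=
    IsLocalization.Away.mul_of_associated b x f hass
  let e : Localization.Away f ≃ₐ[R] Localization.Away (b * x) :=
    IsLocalization.algEquiv (Submonoid.powers (b * x)) _ _
  refine ⟨x, hx, e (algebraMap _ _ g), ?_, fun c => ?_⟩
  · rw [← e.commutes, ← map_mul, IsScalarTower.algebraMap_apply R (Localization.Away b)
      (Localization.Away f), ← map_mul, hg, ← e.commutes, ← IsScalarTower.algebraMap_apply]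
  · have h := (hrad c).comap (e.symm : Localization.Away (b * x) →+* Localization.Away f)
    convert h using 1
    have := Ideal.map_comap_of_equiv (I := Ideal.span {algebraMap (Localization.Away b)
      (Localization.Away f) (g - algebraMap K _ c)}) e.toRingEquiv
    refine Eq.trans ?_ this
    rw [Ideal.map_span, Set.image_singleton]
    congr 2
    have hc := (e.restrictScalars K).commutes c
    change e _ = _ at hc
    change _ = e _
    rw [map_sub, map_sub, ← hc, ← IsScalarTower.algebraMap_apply]

theorem exists_infinite_map_eq_of_fraction [CharZero K] {S : Type*} [CommRing S] [Algebra K S]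
    (hS : (nilradical S).IsPrime) (f₁ f₂ : R →ₐ[K] S)
    (hf₁ : ∀ b, b ≠ 0 → f₁ b ∉ nilradical S) (hf₂ : ∀ b, b ≠ 0 → f₂ b ∉ nilradical S)
    {a b : R} (hb : b ≠ 0) (hab : ∀ c : K, a ≠ algebraMap K R c * b) {u : S}
    (hu : u ∉ nilradical S) (hu0 : u * (f₁ a * f₂ b - f₂ a * f₁ b) = 0) :
    ∃ (r : R), r ≠ 0 ∧ ∃ (s : S), s ∉ nilradical S ∧
        ∃ (F₁ F₂ : Localization.Away r →+* Localization.Away s),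
          F₁.comp (algebraMap R (Localization.Away r))
              = (algebraMap S (Localization.Away s)).comp (f₁ : R →+* S) ∧
          F₂.comp (algebraMap R (Localization.Away r))
              = (algebraMap S (Localization.Away s)).comp (f₂ : R →+* S) ∧
          {I : Ideal (Localization.Away r) |
            IsHypersurfaceIdeal I ∧ I.map F₁ = I.map F₂}.Infinite := by
  obtain ⟨x, hx, g, hg, hrad⟩ := exists_away_mul_isRadical_span_sub hb hab
  have hr := mul_ne_zero hb hx
  have hbr : b ∣ b * x := dvd_mul_right b x
  generalize b * x = r at *
  have := isDomain_away hr
  have := finiteType_away K r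
  have : IsNoetherianRing (Localization.Away r) := Algebra.FiniteType.isNoetherianRing K _
  have hgc := away_mul_ne hr hab hg
  have hs : u * f₁ r * f₂ r ∉ nilradical S := fun h => (hS.mem_or_mem h).elim
    (fun h => (hS.mem_or_mem h).elim hu (hf₁ r hr)) (hf₂ r hr)
  generalize hs' : u * f₁ r * f₂ r = s at hs
  have hα : ∀ t, t ∣ s → IsUnit (algebraMap S (Localization.Away s) t) := fun t ht =>
    isUnit_of_dvd_unit (map_dvd _ ht) (IsLocalization.Away.algebraMap_isUnit s)
  have hr₁ : f₁ r ∣ s := hs' ▸ (dvd_mul_left _ _).mul_right _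
  have hr₂ : f₂ r ∣ s := hs' ▸ dvd_mul_left _ _
  have hb₁ := hα _ ((map_dvd f₁ hbr).trans hr₁)
  have hb₂ := hα _ ((map_dvd f₂ hbr).trans hr₂)
  have hu' := hα u (hs' ▸ (dvd_mul_right _ _).mul_right _)
  let F₁ : Localization.Away r →+* Localization.Away s := IsLocalization.Away.lift r
    (g := (algebraMap S (Localization.Away s)).comp (f₁ : R →+* S)) (hα _ hr₁)
  let F₂ : Localization.Away r →+* Localization.Away s := IsLocalization.Away.lift r
    (g := (algebraMap S (Localization.Away s)).comp (f₂ : R →+* S)) (hα _ hr₂)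
  have h₁ : ∀ y, F₁ (algebraMap R _ y) = algebraMap S _ (f₁ y) :=
    IsLocalization.Away.lift_eq r (hα _ hr₁)
  have h₂ : ∀ y, F₂ (algebraMap R _ y) = algebraMap S _ (f₂ y) :=
    IsLocalization.Away.lift_eq r (hα _ hr₂)
  refine ⟨r, hr, s, hs, F₁, F₂, RingHom.ext h₁, RingHom.ext h₂, ?_⟩
  have hFg : F₁ g = F₂ g := by
    have e₁ := congrArg F₁ hg
    have e₂ := congrArg F₂ hg
    have e₀ := congrArg (algebraMap S (Localization.Away s)) hu0
    rw [map_mul, map_zero, hu'.mul_right_eq_zero, map_sub, map_mul, map_mul] at e₀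
    rw [map_mul, h₁, h₁] at e₁
    rw [map_mul, h₂, h₂] at e₂
    refine (hb₁.mul hb₂).mul_right_cancel ?_
    linear_combination algebraMap S (Localization.Away s) (f₂ b) * e₁ -
      algebraMap S (Localization.Away s) (f₁ b) * e₂ + e₀
  refine ((infinite_not_isUnit_sub hgc).image (f := fun c =>
    Ideal.span {g - algebraMap K (Localization.Away r) c}) ?_).mono ?_
  · intro c hc c' _ h
    by_contra hcc
    have h1 : g - algebraMap K (Localization.Away r) c' ∈
        Ideal.span {g - algebraMap K (Localization.Away r) c} :=
      (congrArg (g - algebraMap K (Localization.Away r) c' ∈ ·) h).mpr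
        (Ideal.mem_span_singleton_self _)
    refine hc (Ideal.span_singleton_eq_top.1 (Ideal.eq_top_of_isUnit_mem _ (sub_mem h1
      (Ideal.mem_span_singleton_self _)) ?_))
    rw [sub_sub_sub_cancel_left, ← map_sub]
    exact (isUnit_iff_ne_zero.2 (sub_ne_zero.2 hcc)).map _
  · rintro _ ⟨c, hc, rfl⟩
    refine ⟨⟨hrad c, fun h => hc (Ideal.span_singleton_eq_top.1 h), fun P hP =>
      heightOnePrime_of_mem_minimalPrimes_span (sub_ne_zero.2 (hgc c)) hP⟩, ?_⟩
    have hc : F₁ (algebraMap K _ c) = F₂ (algebraMap K _ c) := by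
      rw [IsScalarTower.algebraMap_apply K R, h₁, h₂, f₁.commutes, f₂.commutes]
    rw [Ideal.map_span, Ideal.map_span, Set.image_singleton, Set.image_singleton, map_sub, map_sub,
      hFg, hc]

end

end InvHyp

namespace InvHyp

lemma minimalPrimes_sInf {B : Type*} [CommRing B] {T : Set (Ideal B)} (hT : T.Finite)
    (hP : ∀ P ∈ T, HeightOnePrime P) : (sInf T).minimalPrimes = T := by
  ext p
  refine ⟨fun hp => ?_, fun hp => ⟨⟨(hP p hp).1, sInf_le hp⟩, fun c hc hcp => ?_⟩⟩
  · obtain ⟨Q, hQ, hQp⟩ := hp.1.1.exists_le_of_sInf_le hT hp.1.2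
    exact le_antisymm hQp (hp.2 ⟨(hP Q hQ).1, sInf_le hQ⟩ hQp) ▸ hQ
  · obtain ⟨Q, hQ, hQc⟩ := hc.1.exists_le_of_sInf_le hT hc.2
    by_contra h
    exact (hP Q hQ).2.1 ((hP p hp).2.2 Q (hP Q hQ).1 ((hQc.trans hcp).lt_of_not_ge
      fun h' => h (h'.trans hQc)))

lemma isHypersurfaceIdeal_sInf {B : Type*} [CommRing B] {T : Set (Ideal B)} (hT : T.Finite)
    (hP : ∀ P ∈ T, HeightOnePrime P) (hne : T.Nonempty) : IsHypersurfaceIdeal (sInf T) := by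
  obtain ⟨P, hPT⟩ := hne
  refine ⟨fun x ⟨n, hx⟩ => ?_, fun h => ?_, (minimalPrimes_sInf hT hP).symm ▸ hP⟩
  · rw [Submodule.mem_sInf] at hx ⊢
    exact fun Q hQ => (hP Q hQ).1.mem_of_pow_mem n (hx Q hQ)
  · exact (hP P hPT).1.ne_top (top_le_iff.1 (h ▸ sInf_le hPT))

lemma subsingleton_sub_mem {K : Type*} [Field K] {R S : Type*} [CommRing R] [CommRing S]
    [Algebra K R] [Algebra K S] (f : R →ₐ[K] S) (a b : R) {Q : Ideal S} (hQ : Q.IsPrime) :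
    {c : K | f (a - algebraMap K R c * b) ∈ Q ∧ f b ∉ Q}.Subsingleton := by
  rintro c ⟨hc, hb⟩ c' ⟨hc', -⟩
  by_contra h
  have h1 := sub_mem hc' hc
  rw [← map_sub, sub_sub_sub_cancel_left, ← sub_mul, map_mul, ← map_sub, f.commutes] at h1
  refine (hQ.mem_or_mem h1).elim (fun h2 => hQ.ne_top (Ideal.eq_top_of_isUnit_mem _ h2 ?_)) hb
  exact (isUnit_iff_ne_zero.2 (sub_ne_zero.2 h)).map _

section

variable {K : Type*} [Field K] {R : Type*} [CommRing R] [Algebra K R]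
  {S : Type*} [CommRing S] [IsDomain S] [Algebra K S] [Algebra.FiniteType K S]

lemma exists_heightOnePrime_comap [CharZero K] [IsDomain R] [Algebra.FiniteType K R]
    (f : R →ₐ[K] S) (hf : Function.Injective f) :
    ∃ t : S, t ≠ 0 ∧ ∀ Q : Ideal S, HeightOnePrime Q → t ∉ Q →
      Q.comap (f : R →+* S) ≠ ⊥ → HeightOnePrime (Q.comap (f : R →+* S)) := by
  let _ : Algebra R S := (f : R →+* S).toAlgebra
  have : IsScalarTower K R S := .of_algebraMap_eq fun c => (f.commutes c).symm
  have : Algebra.FiniteType R S := .of_restrictScalars_finiteType K _ _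
  have : FaithfulSMul R S := (faithfulSMul_iff_algebraMap_injective _ _).2 hf
  have : IsNoetherianRing R := Algebra.FiniteType.isNoetherianRing K _
  have : CharZero R := charZero_of_injective_algebraMap (algebraMap K R).injective
  obtain ⟨t, ht, hsm⟩ := exists_smooth_away R S
  refine ⟨t, ht, fun Q hQ htQ hQ0 => ⟨hQ.1.comap _, hQ0, fun p hp hpQ => ?_⟩⟩
  have := hQ.1
  have hdis : Disjoint (Submonoid.powers t : Set S) (Q : Set S) := by
    rw [Set.disjoint_left]
    rintro _ ⟨n, rfl⟩ h
    exact htQ (hQ.1.mem_of_pow_mem n h)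
  have hQ'p := IsLocalization.isPrime_of_isPrime_disjoint (Submonoid.powers t)
    (Localization.Away t) Q hQ.1 hdis
  have hQ' : (Q.map (algebraMap S (Localization.Away t))).comap
      (algebraMap S (Localization.Away t)) = Q :=
    IsLocalization.under_map_of_isPrime_disjoint (Submonoid.powers t) _ hQ.1 hdis
  set Q' := Q.map (algebraMap S (Localization.Away t))
  have hlt : p < Q'.under R := by
    rwa [Ideal.under, IsScalarTower.algebraMap_eq R S, ← Ideal.comap_comap, hQ']
  have : Module.Flat R (Localization.Away t) := inferInstance
  have : Q'.LiesOver (Q'.under R) := ⟨rfl⟩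
  obtain ⟨P', hP'Q, hP', hP'p⟩ := Ideal.exists_ideal_lt_liesOver_of_lt Q' hlt
  have hlt' : P'.comap (algebraMap S (Localization.Away t)) < Q := by
    refine lt_of_le_not_ge (hQ' ▸ Ideal.comap_mono hP'Q.le) fun h => hP'Q.not_ge ?_
    exact Ideal.map_le_iff_le_comap.2 h
  have h0 := hQ.2.2 _ (hP'.comap _) hlt'
  rw [hP'p.over, Ideal.under, IsScalarTower.algebraMap_eq R S, ← Ideal.comap_comap, h0]
  exact Ideal.comap_bot_of_injective _ hf

/-- The prime divisors of the fibre over `c` of the rational function `a / b`. -/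
def fibrePrimes (a b : R) (c : K) : Set (Ideal R) :=
  {P | HeightOnePrime P ∧ a - algebraMap K R c * b ∈ P ∧ b ∉ P}

lemma infinite_fibrePrimes_nonempty [IsAlgClosed K] [IsDomain R] [Algebra.FiniteType K R]
    {a b : R} (hb : b ≠ 0)
    (hab : ∀ c : K, a ≠ algebraMap K R c * b) : {c : K | (fibrePrimes a b c).Nonempty}.Infinite := by
  have := isDomain_away hb
  have := finiteType_away K b
  have : IsNoetherianRing R := Algebra.FiniteType.isNoetherianRing K _
  obtain ⟨g, hg⟩ := exists_away_fraction (a := a) (dvd_refl b)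
  refine (infinite_not_isUnit_sub (away_mul_ne hb hab hg)).mono fun c hc => ?_
  obtain ⟨m, hm, hgm⟩ := exists_max_ideal_of_mem_nonunits hc
  have hmp := hm.isPrime.comap (algebraMap R (Localization.Away b))
  have hle : Ideal.span {a - algebraMap K R c * b} ≤
      m.comap (algebraMap R (Localization.Away b)) := by
    rw [Ideal.span_singleton_le_iff_mem, Ideal.mem_comap, map_sub, map_mul, ← hg, ← sub_mul,
      ← IsScalarTower.algebraMap_apply]
    exact Ideal.mul_mem_right _ _ hgm
  obtain ⟨P, hP, hPm⟩ := Ideal.exists_minimalPrimes_le hle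
  refine ⟨P, heightOnePrime_of_mem_minimalPrimes_span (sub_ne_zero.2 (hab c)) hP,
    hP.1.2 (Ideal.mem_span_singleton_self _), fun h => hm.ne_top
      (Ideal.eq_top_of_isUnit_mem _ (hPm h) (IsLocalization.Away.algebraMap_isUnit b))⟩

lemma mem_minimalPrimes_map_of_fraction {f₁ f₂ : R →ₐ[K] S} (hf₁ : Function.Injective f₁)
    (hf₂ : Function.Injective f₂) {a b : R} {c : K} (hc : a ≠ algebraMap K R c * b)
    (h : f₁ a * f₂ b = f₂ a * f₁ b)
    (hfin : (fibrePrimes a b c).Finite)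
    (hgood : ∀ Q : Ideal S, HeightOnePrime Q → f₁ (a - algebraMap K R c * b) ∈ Q → f₁ b ∉ Q →
      f₂ b ∉ Q ∧ (Q.comap (f₂ : R →+* S) ≠ ⊥ → HeightOnePrime (Q.comap (f₂ : R →+* S))))
    {Q : Ideal S} (hQ : Q ∈ ((sInf (fibrePrimes a b c)).map (f₁ : R →+* S)).minimalPrimes)
    (hQ₁ : Q.comap (f₁ : R →+* S) ∈ fibrePrimes a b c) :
    Q ∈ ((sInf (fibrePrimes a b c)).map (f₂ : R →+* S)).minimalPrimes ∧
      Q.comap (f₂ : R →+* S) ∈ fibrePrimes a b c := by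
  have : IsNoetherianRing S := Algebra.FiniteType.isNoetherianRing K _
  have hQp := hQ.1.1
  have hx := sub_ne_zero.2 hc
  have hQm : Q ∈ (Ideal.span {f₁ (a - algebraMap K R c * b)}).minimalPrimes := by
    refine ⟨⟨hQp, (Ideal.span_singleton_le_iff_mem _).2 hQ₁.2.1⟩, fun Q' hQ' hle => ?_⟩
    refine hQ.2 ⟨hQ'.1, Ideal.map_le_iff_le_comap.2 ((sInf_le hQ₁).trans ?_)⟩ hle
    have hmem : a - algebraMap K R c * b ∈ Q'.comap (f₁ : R →+* S) :=
      (Ideal.span_singleton_le_iff_mem Q').1 hQ'.2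
    by_contra hlt
    have h0 := hQ₁.1.2.2 _ (hQ'.1.comap _) (lt_of_le_not_ge (Ideal.comap_mono hle) hlt)
    rw [h0] at hmem
    exact hx hmem
  have hQ1 := heightOnePrime_of_mem_minimalPrimes_span
    ((map_ne_zero_iff f₁ hf₁).2 hx) hQm
  obtain ⟨hb₂, hcomap⟩ := hgood Q hQ1 hQ₁.2.1 hQ₁.2.2
  have hx₂ : f₂ (a - algebraMap K R c * b) ∈ Q := by
    refine (hQp.mem_or_mem (?_ : f₂ (a - algebraMap K R c * b) * f₁ b ∈ Q)).resolve_right hQ₁.2.2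
    have : f₂ (a - algebraMap K R c * b) * f₁ b = f₁ (a - algebraMap K R c * b) * f₂ b := by
      simp only [map_sub, map_mul, AlgHom.commutes]
      linear_combination -h
    rw [this]
    exact Ideal.mul_mem_right _ _ hQ₁.2.1
  have hQ₂ : Q.comap (f₂ : R →+* S) ∈ fibrePrimes a b c := by
    refine ⟨hcomap fun h0 => hx ?_, hx₂, hb₂⟩
    exact h0.le (show _ ∈ Q.comap (f₂ : R →+* S) from hx₂)
  refine ⟨⟨⟨hQp, Ideal.map_le_iff_le_comap.2 (sInf_le hQ₂)⟩, fun Q' hQ' hle => ?_⟩, hQ₂⟩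
  by_contra hlt
  have h0 := hQ1.2.2 Q' hQ'.1 (lt_of_le_not_ge hle hlt)
  have h1 := Ideal.map_le_iff_le_comap.1 hQ'.2
  obtain ⟨P, hP, hP0⟩ := hQ'.1.comap (f₂ : R →+* S) |>.exists_le_of_sInf_le hfin h1
  rw [h0, Ideal.comap_bot_of_injective (f₂ : R →+* S) hf₂, le_bot_iff] at hP0
  exact hP.1.2.1 hP0

theorem infinite_properTransform_eq_of_fraction [IsAlgClosed K] [CharZero K] [IsDomain R]
    [Algebra.FiniteType K R] {f₁ f₂ : R →ₐ[K] S}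
    (hf₁ : Function.Injective f₁) (hf₂ : Function.Injective f₂) {a b : R} (hb : b ≠ 0)
    (hab : ∀ c : K, a ≠ algebraMap K R c * b) (h : f₁ a * f₂ b = f₂ a * f₁ b) :
    {I : Ideal R | IsHypersurfaceIdeal I ∧
      properTransform (f₁ : R →+* S) I = properTransform (f₂ : R →+* S) I}.Infinite := by
  have : IsNoetherianRing R := Algebra.FiniteType.isNoetherianRing K _
  have : IsNoetherianRing S := Algebra.FiniteType.isNoetherianRing K _
  obtain ⟨t₁, ht₁, hc₁⟩ := exists_heightOnePrime_comap f₁ hf₁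
  obtain ⟨t₂, ht₂, hc₂⟩ := exists_heightOnePrime_comap f₂ hf₂
  have hfin : ∀ c, (fibrePrimes a b c).Finite := fun c =>
    (finite_heightOnePrime_mem (sub_ne_zero.2 (hab c))).subset fun P hP => ⟨hP.1, hP.2.1⟩
  have hE := finite_heightOnePrime_mem (mul_ne_zero (mul_ne_zero ((map_ne_zero_iff f₁ hf₁).2 hb)
    ((map_ne_zero_iff f₂ hf₂).2 hb)) (mul_ne_zero ht₁ ht₂))
  have hbad := hE.biUnion fun Q hQ => (subsingleton_sub_mem f₁ a b hQ.1.1).finite.union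
    (subsingleton_sub_mem f₂ a b hQ.1.1).finite
  refine (((infinite_fibrePrimes_nonempty hb hab).sdiff hbad).image
    (f := fun c => sInf (fibrePrimes a b c)) ?_).mono ?_
  · rintro c ⟨⟨P, hP⟩, -⟩ c' - hcc
    have h1 := congrArg Ideal.minimalPrimes hcc
    rw [minimalPrimes_sInf (hfin c) fun P hP => hP.1,
      minimalPrimes_sInf (hfin c') fun P hP => hP.1] at h1
    exact subsingleton_sub_mem (AlgHom.id K R) a b hP.1.1 hP.2 (h1 ▸ hP).2
  · rintro _ ⟨c, ⟨hne, hc⟩, rfl⟩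
    refine ⟨isHypersurfaceIdeal_sInf (hfin c) (fun P hP => hP.1) hne, ?_⟩
    simp only [Set.mem_iUnion, not_exists] at hc
    simp only [properTransform, minimalPrimes_sInf (hfin c) fun P hP => hP.1]
    congr 1
    ext Q
    refine ⟨fun hQ => mem_minimalPrimes_map_of_fraction hf₁ hf₂ (hab c) h (hfin c)
      (fun Q hQ hm hn => ?_) hQ.1 hQ.2, fun hQ => mem_minimalPrimes_map_of_fraction hf₂ hf₁ (hab c)
        h.symm (hfin c) (fun Q hQ hm hn => ?_) hQ.1 hQ.2⟩
    · have hQE := fun hmem => hc Q ⟨hQ, hmem⟩ (Or.inl ⟨hm, hn⟩)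
      exact ⟨fun h => hQE (Ideal.mul_mem_right _ _ (Ideal.mul_mem_left _ _ h)),
        hc₂ Q hQ fun h => hQE (Ideal.mul_mem_left _ _ (Ideal.mul_mem_left _ _ h))⟩
    · have hQE := fun hmem => hc Q ⟨hQ, hmem⟩ (Or.inr ⟨hm, hn⟩)
      exact ⟨fun h => hQE (Ideal.mul_mem_right _ _ (Ideal.mul_mem_right _ _ h)),
        hc₁ Q hQ fun h => hQE (Ideal.mul_mem_left _ _ (Ideal.mul_mem_right _ _ h))⟩

end

end InvHyp

namespace InvHyp
lemma notMem_nilradical_of_injective {R S : Type*} [CommRing R] [CommRing S] {f : R →+* S}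
    (h : Function.Injective ((Ideal.Quotient.mk (nilradical S)).comp f)) {b : R} (hb : b ≠ 0) :
    f b ∉ nilradical S := fun hm => hb (h (by
  rw [map_zero, RingHom.comp_apply, Ideal.Quotient.eq_zero_iff_mem.2 hm]))
end InvHyp
/-- **Theorem 1.1.**  (1) ↔ (2), and if `Z` is reduced also (2) ↔ (3). -/
theorem invariant_hypersurfaces_main
    (K : Type*) [Field K] [IsAlgClosed K] [CharZero K]
    (R : Type*) [CommRing R] [IsDomain R] [Algebra K R] [Algebra.FiniteType K R]
    (S : Type*) [CommRing S] [Nontrivial S] [Algebra K S] [Algebra.FiniteType K S]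
    -- `Z` is irreducible
    (hZirr : (nilradical S).IsPrime)
    (f₁ f₂ : R →ₐ[K] S)
    -- the restrictions of `φ₁, φ₂` to `Z_red` are dominant
    (hdom₁ : Function.Injective ((Ideal.Quotient.mk (nilradical S)).comp (f₁ : R →+* S)))
    (hdom₂ : Function.Injective ((Ideal.Quotient.mk (nilradical S)).comp (f₂ : R →+* S))) :
    -- (1) ↔ (2):
    ((∃ (r : R), r ≠ 0 ∧ ∃ (s : S), s ∉ nilradical S ∧
        ∃ (F₁ F₂ : Localization.Away r →+* Localization.Away s),
          F₁.comp (algebraMap R (Localization.Away r))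
              = (algebraMap S (Localization.Away s)).comp (f₁ : R →+* S) ∧
          F₂.comp (algebraMap R (Localization.Away r))
              = (algebraMap S (Localization.Away s)).comp (f₂ : R →+* S) ∧
          {I : Ideal (Localization.Away r) |
            IsHypersurfaceIdeal I ∧ I.map F₁ = I.map F₂}.Infinite)
      ↔
      (∃ a b : R, b ≠ 0 ∧ (∀ c : K, a ≠ algebraMap K R c * b) ∧
        ∃ u : S, u ∉ nilradical S ∧ u * (f₁ a * f₂ b - f₂ a * f₁ b) = 0))
    ∧
    -- if `Z` is reduced, (2) ↔ (3):
    (nilradical S = ⊥ →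
      ((∃ a b : R, b ≠ 0 ∧ (∀ c : K, a ≠ algebraMap K R c * b) ∧
          ∃ u : S, u ∉ nilradical S ∧ u * (f₁ a * f₂ b - f₂ a * f₁ b) = 0)
        ↔
       {I : Ideal R | IsHypersurfaceIdeal I ∧
          properTransform (f₁ : R →+* S) I = properTransform (f₂ : R →+* S) I}.Infinite)) := by
  
  have hf₁ : ∀ b, b ≠ 0 → f₁ b ∉ nilradical S :=
    fun _ => InvHyp.notMem_nilradical_of_injective hdom₁
  have hf₂ : ∀ b, b ≠ 0 → f₂ b ∉ nilradical S :=
    fun _ => InvHyp.notMem_nilradical_of_injective hdom₂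
  refine ⟨⟨?_, ?_⟩, fun hred => ?_⟩
  · rintro ⟨r, hr, s, hs, F₁, F₂, h₁, h₂, hinf⟩
    exact InvHyp.exists_fraction_of_infinite_map_eq hZirr f₁ f₂ hf₁ hf₂ hr hs h₁ h₂ hinf
  · rintro ⟨a, b, hb, hab, u, hu, hu0⟩
    exact InvHyp.exists_infinite_map_eq_of_fraction hZirr f₁ f₂ hf₁ hf₂ hb hab hu hu0
  have : (⊥ : Ideal S).IsPrime := hred ▸ hZirr
  have : IsDomain S := IsDomain.of_bot_isPrime S
  have hi₁ : Function.Injective f₁ := (injective_iff_map_eq_zero f₁).2 fun b h => by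
    by_contra hb
    exact hf₁ b hb (h ▸ zero_mem _)
  have hi₂ : Function.Injective f₂ := (injective_iff_map_eq_zero f₂).2 fun b h => by
    by_contra hb
    exact hf₂ b hb (h ▸ zero_mem _)
  constructor
  · rintro ⟨a, b, hb, hab, u, hu, hu0⟩
    have hu' : u ≠ 0 := fun h => hu (h ▸ zero_mem _)
    exact InvHyp.infinite_properTransform_eq_of_fraction hi₁ hi₂ hb hab
      (sub_eq_zero.1 ((mul_eq_zero.1 hu0).resolve_left hu'))
  · intro hinf
    obtain ⟨a, b, hb, hab, h⟩ := InvHyp.exists_invariant_fraction_of_properTransform_eq f₁ f₂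
      hi₁ hi₂ hinf (fun I hI => hI.1) fun I hI => hI.2
    exact ⟨a, b, hb, hab, 1, fun h1 => one_ne_zero (α := S) (by rwa [hred] at h1),
      by rw [one_mul, sub_eq_zero, h]⟩
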